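/- For every ε > 0 there exist c = c(ε) > 0 and x₀ = x₀(ε) such that for all x ≥ x₀ one has ∏_{p < x}(1 + 1/p)^{-1} · ∑_{n ∈ S_{<x}} Δ(n)/n ≥ c · (Log₂ x)^{1+η−ε}. -/

import Mathlib

open Filter Topology
open scoped Classical

noncomputable def LLog (x : ℝ) : ℝ := max 1 (Real.log x)
noncomputable def LLog2 (x : ℝ) : ℝ := LLog (LLog x)
noncomputable def LLog3 (x : ℝ) : ℝ := LLog (LLog2 x)

/-- `Δ^{(v)}(n)`: the maximal number of divisors of `n` in an interval `(e^u, e^{u+v}]`. -/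
noncomputable def DeltaV (v : ℝ) (n : ℕ) : ℕ :=
  ⨆ u : ℝ, (n.divisors.filter fun d => Real.exp u < (d : ℝ) ∧ (d : ℝ) ≤ Real.exp (u + v)).card

/-- The Erdős–Hooley Delta function. -/
noncomputable def Delta (n : ℕ) : ℕ := DeltaV 1 n

/-- `S_{[y,x)}`: squarefree positive integers all of whose prime factors `p` satisfy `y ≤ p < x`. -/
def Sset (y x : ℝ) : Set ℕ :=
  {n | 0 < n ∧ Squarefree n ∧ ∀ p ∈ n.primeFactors, y ≤ (p : ℝ) ∧ (p : ℝ) < x}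

/-- `∏_{y ≤ p < x} (1 + 1/p)⁻¹`, product over primes. -/
noncomputable def primeProd (y x : ℝ) : ℝ :=
  ∏ᶠ p ∈ {p : ℕ | p.Prime ∧ y ≤ (p : ℝ) ∧ (p : ℝ) < x}, ((1 : ℝ) + 1 / p)⁻¹

/-- number of distinct prime factors -/
def omegaN (n : ℕ) : ℕ := n.primeFactors.card

/-- number of divisors -/
def tauN (n : ℕ) : ℕ := n.divisors.card

/-- `n_{<y}`: the largest divisor of `n` (squarefree) composed of primes `< y`. -/
noncomputable def nsmall (n : ℕ) (y : ℝ) : ℕ :=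
  ∏ p ∈ n.primeFactors.filter (fun p : ℕ => (p : ℝ) < y), p

def Yset (α x : ℝ) : Set ℝ :=
  {y | 0 < y ∧ |LLog2 y - α * LLog2 x| ≤ Real.sqrt (LLog2 x) ∧ ∃ m : ℤ, LLog2 y = m * Real.log 2}

def Uset (α x : ℝ) : Set ℤ :=
  {u | |(u : ℝ) - (Real.log 4 - 1) / Real.log 2 * (α * LLog2 x)| ≤ Real.sqrt (LLog2 x)}

noncomputable def Qfun (t : ℝ) : ℝ := t * Real.log t - t + 1


open Filter Topology
open scoped Classical
namespace FKT

section Entropy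
variable {X : Type*} [Fintype X]

/-- probability of the class of `x` -/
noncomputable def cp (p : X → ℝ) (r : X → X → Prop) (x : X) : ℝ :=
  ∑ x', if r x x' then p x' else 0

/-- entropy of the quotient law -/
noncomputable def ent (p : X → ℝ) (r : X → X → Prop) : ℝ :=
  -∑ x, p x * Real.log (cp p r x)

lemma cp_nonneg {p : X → ℝ} (hp : ∀ x, 0 ≤ p x) (r) (x : X) : 0 ≤ cp p r x := by
  unfold cp; exact Finset.sum_nonneg (fun i _ => by split_ifs <;> simp [hp])

lemma le_cp {p : X → ℝ} (hp : ∀ x, 0 ≤ p x) {r : X → X → Prop} {x y : X} (h : r x y) :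
    p y ≤ cp p r x := by
  unfold cp
  have := Finset.single_le_sum (f := fun x' => if r x x' then p x' else 0)
    (fun i _ => by split_ifs <;> simp [hp]) (Finset.mem_univ y)
  simpa [h] using this

lemma cp_le_one {p : X → ℝ} (hp : ∀ x, 0 ≤ p x) (h1 : ∑ x, p x = 1) (r) (x : X) :
    cp p r x ≤ 1 := by
  rw [← h1]; unfold cp
  exact Finset.sum_le_sum (fun i _ => by split_ifs <;> simp [hp])

lemma cp_mono {p : X → ℝ} (hp : ∀ x, 0 ≤ p x) {r r' : X → X → Prop} (x : X)
    (h : ∀ y, r x y → r' x y) : cp p r x ≤ cp p r' x := by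
  unfold cp
  refine Finset.sum_le_sum (fun i _ => ?_)
  by_cases h1 : r x i
  · simp [h1, h i h1]
  · simp only [h1, if_false]; split_ifs <;> simp [hp]

lemma cp_congr {p : X → ℝ} {r : X → X → Prop} (hr : Equivalence r) {x y : X} (h : r x y) :
    cp p r x = cp p r y := by
  unfold cp
  refine Finset.sum_congr rfl (fun i _ => ?_)
  have : r x i ↔ r y i := ⟨fun h1 => hr.trans (hr.symm h) h1, fun h1 => hr.trans h h1⟩
  simp [this]

lemma ent_nonneg {p : X → ℝ} (hp : ∀ x, 0 ≤ p x) (h1 : ∑ x, p x = 1) (r) : 0 ≤ ent p r := by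
  unfold ent
  rw [neg_nonneg]
  refine Finset.sum_nonpos (fun x _ => ?_)
  exact mul_nonpos_of_nonneg_of_nonpos (hp x)
    (Real.log_nonpos (cp_nonneg hp r x) (cp_le_one hp h1 r x))

lemma ent_submod {p : X → ℝ} (hp : ∀ x, 0 ≤ p x) (h1 : ∑ x, p x = 1)
    {u v i j : X → X → Prop} (hu : Equivalence u) (hv : Equivalence v)
    (hi : ∀ x y, i x y ↔ u x y ∧ v x y) (hj : Equivalence j)
    (huj : ∀ x y, u x y → j x y) (hvj : ∀ x y, v x y → j x y) :
    ent p i + ent p j ≤ ent p u + ent p v := by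
  have key : ∑ x, p x * (cp p u x * cp p v x / (cp p i x * cp p j x)) ≤ 1 := by
    have e1 : ∀ x, p x * (cp p u x * cp p v x / (cp p i x * cp p j x)) =
        ∑ y, ∑ z, (if u x y ∧ v x z then p x / cp p i x * (p y * p z / cp p j y) else 0) := by
      intro x
      have : ∀ y z, (if u x y ∧ v x z then p x / cp p i x * (p y * p z / cp p j y) else 0)
          = p x / cp p i x / cp p j x * ((if u x y then p y else 0) * (if v x z then p z else 0)) := by
        intro y z
        by_cases h : u x y
        · by_cases h' : v x z
          · simp only [h, h', and_self, if_true]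
            rw [cp_congr hj (huj _ _ h)]; field_simp
          · simp [h']
        · simp [h]
      simp_rw [this, ← Finset.mul_sum]
      rw [← Finset.sum_mul]
      unfold cp
      field_simp
    simp_rw [e1]
    rw [Finset.sum_comm]
    have e2 : ∀ y, ∑ x, ∑ z, (if u x y ∧ v x z then p x / cp p i x * (p y * p z / cp p j y) else 0)
        ≤ p y := by
      intro y
      rw [Finset.sum_comm]
      have e3 : ∀ z, ∑ x, (if u x y ∧ v x z then p x / cp p i x * (p y * p z / cp p j y) else 0)
          ≤ (p y / cp p j y) * (if j y z then p z else 0) := by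
        intro z
        by_cases hne : ∃ x0, u x0 y ∧ v x0 z
        · obtain ⟨x0, h01, h02⟩ := hne
          have hjyz : j y z := hj.trans (hj.symm (huj _ _ h01)) (hvj _ _ h02)
          have e4 : ∀ x, (if u x y ∧ v x z then p x / cp p i x * (p y * p z / cp p j y) else 0)
             = (p y * p z / cp p j y / cp p i x0) * (if i x0 x then p x else 0) := by
            intro x
            have hiff : (u x y ∧ v x z) ↔ i x0 x := by
              rw [hi]
              constructor
              · rintro ⟨a, b⟩; exact ⟨hu.trans h01 (hu.symm a), hv.trans h02 (hv.symm b)⟩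
              · rintro ⟨a, b⟩; exact ⟨hu.trans (hu.symm a) h01, hv.trans (hv.symm b) h02⟩
            by_cases h : i x0 x
            · have hie : Equivalence i := by
                refine ⟨fun x => (hi _ _).2 ⟨hu.refl _, hv.refl _⟩, fun h => ?_, fun h h' => ?_⟩
                · rw [hi] at h ⊢; exact ⟨hu.symm h.1, hv.symm h.2⟩
                · rw [hi] at h h' ⊢; exact ⟨hu.trans h.1 h'.1, hv.trans h.2 h'.2⟩
              simp only [hiff, h, if_true]
              rw [cp_congr hie h]; field_simp
            · simp only [hiff, h, if_false, mul_zero]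
          simp_rw [e4]
          rw [← Finset.mul_sum]
          change _ * cp p i x0 ≤ _
          simp only [hjyz, if_true]
          rcases (cp_nonneg hp i x0).eq_or_lt with h | h
          · rw [← h, mul_zero]
            exact mul_nonneg (div_nonneg (hp y) (cp_nonneg hp j y)) (hp z)
          · rw [div_mul_cancel₀ _ h.ne']; apply le_of_eq; ring
        · rw [Finset.sum_eq_zero]
          · refine mul_nonneg (div_nonneg (hp y) (cp_nonneg hp j y)) ?_
            split_ifs <;> simp [hp]
          · intro x _
            rw [if_neg (fun h => hne ⟨x, h⟩)]
      refine (Finset.sum_le_sum (fun z _ => e3 z)).trans ?_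
      rw [← Finset.mul_sum]
      change _ * cp p j y ≤ _
      rcases (cp_nonneg hp j y).eq_or_lt with h | h
      · rw [← h, mul_zero]; exact hp y
      · rw [div_mul_cancel₀ _ h.ne']
    exact (Finset.sum_le_sum (fun y _ => e2 y)).trans h1.le
  have hmain : ∀ x, p x * Real.log (cp p u x) + p x * Real.log (cp p v x)
      - p x * Real.log (cp p i x) - p x * Real.log (cp p j x)
      ≤ p x * (cp p u x * cp p v x / (cp p i x * cp p j x)) - p x := by
    intro x
    rcases (hp x).eq_or_lt with h | h
    · rw [← h]; simp
    · have hu' : 0 < cp p u x := h.trans_le (le_cp hp (hu.refl x))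
      have hv' : 0 < cp p v x := h.trans_le (le_cp hp (hv.refl x))
      have hi' : 0 < cp p i x := h.trans_le (le_cp hp ((hi _ _).2 ⟨hu.refl x, hv.refl x⟩))
      have hj' : 0 < cp p j x := h.trans_le (le_cp hp (hj.refl x))
      have := Real.log_le_sub_one_of_pos (x := cp p u x * cp p v x / (cp p i x * cp p j x))
        (by positivity)
      rw [Real.log_div (by positivity) (by positivity), Real.log_mul hu'.ne' hv'.ne',
        Real.log_mul hi'.ne' hj'.ne'] at this
      nlinarith
  have := Finset.sum_le_sum (fun x (_ : x ∈ Finset.univ) => hmain x)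
  simp only [Finset.sum_sub_distrib, Finset.sum_add_distrib] at this
  unfold ent
  linarith

end Entropy
end FKT

open Filter Topology
open scoped Classical
namespace FKT

/-- real vector of a sign pattern -/
noncomputable def vecE {Y : Type*} (e : Y → SignType) : Y → ℝ := fun q => ((e q : ℤ) : ℝ)

/-- congruence modulo a subspace via a vector map -/
def relV {X V : Type*} [AddCommGroup V] [Module ℝ V] (f : X → V) (U : Submodule ℝ V)
    (x y : X) : Prop := f y - f x ∈ U

lemma relV_equiv {X V : Type*} [AddCommGroup V] [Module ℝ V] (f : X → V) (U : Submodule ℝ V) :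
    Equivalence (relV f U) := by
  refine ⟨fun x => by simp [relV], fun h => ?_, fun h h' => ?_⟩
  · unfold relV at *; rw [← neg_sub]; exact U.neg_mem h
  · unfold relV at *
    have := U.add_mem h' h
    simpa using this

lemma ent_equiv {X : Type*} [Fintype X] (b : X ≃ X) (p p' : X → ℝ) (r r' : X → X → Prop)
    (hp : ∀ x, p' (b x) = p x) (hr : ∀ x y, r' (b x) (b y) ↔ r x y) : ent p' r' = ent p r := by
  unfold ent
  congr 1
  rw [← Equiv.sum_comp b]
  refine Finset.sum_congr rfl (fun x _ => ?_)
  rw [hp]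
  congr 2
  unfold cp
  rw [← Equiv.sum_comp b]
  simp [hp, hr]

section Sym
variable {S Y : Type*} [Fintype S] [Fintype Y] [DecidableEq Y]

/-- averaged entropy modulo `U` -/
noncomputable def HU (P : S → ℝ) (ν : S → (Y → SignType) → ℝ) (U : Submodule ℝ (Y → ℝ)) : ℝ :=
  ∑ s, P s * ent (ν s) (relV vecE U)

lemma HU_submod {P : S → ℝ} {ν : S → (Y → SignType) → ℝ} (hP : ∀ s, 0 ≤ P s)
    (hν : ∀ s e, 0 ≤ ν s e) (hν1 : ∀ s, ∑ e, ν s e = 1) (U V : Submodule ℝ (Y → ℝ)) :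
    HU P ν (U ⊓ V) + HU P ν (U ⊔ V) ≤ HU P ν U + HU P ν V := by
  unfold HU
  rw [← Finset.sum_add_distrib, ← Finset.sum_add_distrib]
  refine Finset.sum_le_sum (fun s _ => ?_)
  rw [← mul_add, ← mul_add]
  refine mul_le_mul_of_nonneg_left ?_ (hP s)
  refine ent_submod (hν s) (hν1 s) (relV_equiv _ _) (relV_equiv _ _) ?_ (relV_equiv _ _) ?_ ?_
  · intro x y; simp [relV, Submodule.mem_inf]
  · intro x y h; exact (le_sup_left : U ≤ U ⊔ V) h
  · intro x y h; exact (le_sup_right : V ≤ U ⊔ V) h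

lemma HU_map {P : S → ℝ} {ν : S → (Y → SignType) → ℝ} (L : (Y → ℝ) ≃ₗ[ℝ] (Y → ℝ))
    (b : (Y → SignType) ≃ (Y → SignType)) (φ : S ≃ S) (hL : ∀ e, vecE (b e) = L (vecE e))
    (hφ : ∀ s, P (φ s) = P s) (hν : ∀ s e, ν (φ s) (b e) = ν s e) (U : Submodule ℝ (Y → ℝ)) :
    HU P ν (U.map (L : (Y → ℝ) →ₗ[ℝ] (Y → ℝ))) = HU P ν U := by
  unfold HU
  rw [← Equiv.sum_comp φ]
  refine Finset.sum_congr rfl (fun s _ => ?_)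
  rw [hφ, ent_equiv b (ν s) (ν (φ s)) (relV vecE U) _ (hν s)]
  intro x y
  unfold relV
  rw [hL, hL, ← map_sub]
  constructor
  · rintro ⟨z, hz, hz'⟩
    have : z = vecE y - vecE x := L.injective hz'
    rwa [← this]
  · intro h; exact ⟨_, h, rfl⟩

lemma exists_min_of_finite_range {α : Type*} [Nonempty α] (f : α → ℝ) (h : (Set.range f).Finite) :
    ∃ a, ∀ b, f a ≤ f b := by
  obtain ⟨m, ⟨a, rfl⟩, hm⟩ := Set.exists_min_image (Set.range f) id h (Set.range_nonempty f)
  exact ⟨a, fun b => hm (f b) ⟨b, rfl⟩⟩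

lemma HU_range (P : S → ℝ) (ν : S → (Y → SignType) → ℝ) (η : ℝ) :
    (Set.range (fun U : Submodule ℝ (Y → ℝ) =>
      HU P ν U - η * ((Fintype.card Y : ℝ) - Module.finrank ℝ U))).Finite := by
  have : (Set.range (fun x : ((Y → SignType) → (Y → SignType) → Prop) × Fin (Fintype.card Y + 1) =>
    (∑ s, P s * ent (ν s) x.1) - η * ((Fintype.card Y : ℝ) - (x.2 : ℕ)))).Finite := Set.finite_range _
  refine this.subset ?_
  rintro _ ⟨U, rfl⟩
  have h : Module.finrank ℝ U ≤ Fintype.card Y := by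
    have := Submodule.finrank_le U; simpa using this
  exact ⟨(relV vecE U, ⟨Module.finrank ℝ U, by omega⟩), rfl⟩

theorem entropy_sym {P : S → ℝ} {ν : S → (Y → SignType) → ℝ} [Nonempty Y] (hP : ∀ s, 0 ≤ P s)
    (hν : ∀ s e, 0 ≤ ν s e) (hν1 : ∀ s, ∑ e, ν s e = 1)
    (hflip : ∀ q0 : Y, ∃ φ : S ≃ S, (∀ s, P (φ s) = P s) ∧
      ∀ s e, ν (φ s) (fun q => if q = q0 then - e q else e q) = ν s e)
    (htrans : ∀ q q' : Y, ∃ τ : Y ≃ Y, τ q = q' ∧ ∃ φ : S ≃ S, (∀ s, P (φ s) = P s) ∧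
      ∀ s e, ν (φ s) (fun q => e (τ q)) = ν s e)
    (η : ℝ) (hη : HU P ν ⊥ = η * Fintype.card Y) (U : Submodule ℝ (Y → ℝ)) :
    η * ((Fintype.card Y : ℝ) - Module.finrank ℝ U) ≤ HU P ν U := by
  set f : Submodule ℝ (Y → ℝ) → ℝ := fun U =>
      HU P ν U - η * ((Fintype.card Y : ℝ) - Module.finrank ℝ U) with hf
  have hsub : ∀ U V, f (U ⊓ V) + f (U ⊔ V) ≤ f U + f V := by
    intro U V
    have h1 := HU_submod hP hν hν1 U V
    have h2 : (Module.finrank ℝ ↥(U ⊔ V) : ℝ) + Module.finrank ℝ ↥(U ⊓ V) =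
      Module.finrank ℝ U + Module.finrank ℝ V := by
      exact_mod_cast Submodule.finrank_sup_add_finrank_inf_eq U V
    simp only [hf]
    have h3 : Module.finrank ℝ ↥(U ⊔ V) = (Module.finrank ℝ U : ℝ) + Module.finrank ℝ V -
      Module.finrank ℝ ↥(U ⊓ V) := by linarith
    rw [h3]; nlinarith
  obtain ⟨U0, hU0⟩ := exists_min_of_finite_range f (HU_range P ν η)
  -- minimiser of maximal dimension
  have hex : ∃ n, ∃ U, (∀ V, f U ≤ f V) ∧ Fintype.card Y - Module.finrank ℝ U = n := ⟨_, U0, hU0, rfl⟩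
  obtain ⟨W, hW, hWn⟩ := Nat.find_spec hex
  have hWmax : ∀ V, (∀ V', f V ≤ f V') → Module.finrank ℝ V ≤ Module.finrank ℝ W := by
    intro V hV
    have h1 := Nat.find_min' hex ⟨V, hV, rfl⟩
    have h2 : Module.finrank ℝ W ≤ Fintype.card Y := by
      have := Submodule.finrank_le W; simpa using this
    have h3 : Module.finrank ℝ V ≤ Fintype.card Y := by
      have := Submodule.finrank_le V; simpa using this
    omega
  have hinv : ∀ (L : (Y → ℝ) ≃ₗ[ℝ] (Y → ℝ)), (∀ U, HU P ν (U.map (L : (Y → ℝ) →ₗ[ℝ] (Y → ℝ))) = HU P ν U) →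
      ∀ x ∈ W, L x ∈ W := by
    intro L hL x hx
    set V := W.map (L : (Y → ℝ) →ₗ[ℝ] (Y → ℝ)) with hV
    have hVf : f V = f W := by
      simp only [hf, hV]
      rw [hL]
      congr 3
      exact_mod_cast LinearEquiv.finrank_map_eq L W
    have h1 : ∀ V', f (W ⊔ V) ≤ f V' := by
      intro V'
      have := hsub W V
      have h2 := hW (W ⊓ V)
      have h3 := hW V'
      linarith
    have h2 := hWmax _ h1
    have h3 : W = W ⊔ V := Submodule.eq_of_le_of_finrank_le le_sup_left h2
    rw [h3]
    exact (le_sup_right : V ≤ W ⊔ V) ⟨x, hx, rfl⟩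
  -- sign flips
  have hflipW : ∀ q0, ∀ x ∈ W, (fun q => if q = q0 then - x q else x q) ∈ W := by
    intro q0
    obtain ⟨φ, h1, h2⟩ := hflip q0
    let L : (Y → ℝ) ≃ₗ[ℝ] (Y → ℝ) := LinearEquiv.ofInvolutive
      { toFun := fun x q => if q = q0 then - x q else x q
        map_add' := by intro x y; ext q; simp only [Pi.add_apply]; split_ifs <;> ring
        map_smul' := by intro x y; ext q; simp }
      (by intro x; ext q; simp only [LinearMap.coe_mk, AddHom.coe_mk]; split_ifs <;> simp)
    let b : (Y → SignType) ≃ (Y → SignType) := 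
      (Function.Involutive.toPerm (fun e q => if q = q0 then - e q else e q)
        (by intro x; ext q; dsimp only; split_ifs <;> simp))
    refine hinv L (HU_map L b φ ?_ h1 h2)
    intro e
    ext q
    change (((if q = q0 then - e q else e q : SignType) : ℤ) : ℝ) =
      if q = q0 then -(((e q : SignType) : ℤ) : ℝ) else (((e q : SignType) : ℤ) : ℝ)
    split_ifs
    · cases e q <;> simp
    · rfl
  have htransW : ∀ q q', ∃ τ : Y ≃ Y, τ q = q' ∧ ∀ x ∈ W, (fun q => x (τ q)) ∈ W := by
    intro q q'
    obtain ⟨τ, h0, φ, h1, h2⟩ := htrans q q'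
    refine ⟨τ, h0, ?_⟩
    refine hinv (LinearEquiv.funCongrLeft ℝ ℝ τ) (HU_map _ (Equiv.arrowCongr τ.symm (Equiv.refl _)) φ ?_ h1 ?_)
    · intro e; ext q; simp [vecE, LinearEquiv.funCongrLeft, Equiv.arrowCongr]
    · intro s e; rw [← h2 s e]; congr 1
  have hcoord : ∀ x ∈ W, ∀ q, x q ≠ 0 → (Pi.single q 1 : Y → ℝ) ∈ W := by
    intro x hx q hq
    have h1 := W.sub_mem hx (hflipW q x hx)
    have h2 : (Pi.single q 1 : Y → ℝ) = (2 * x q)⁻¹ • (x - fun q' => if q' = q then - x q' else x q') := by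
      ext q'
      by_cases h : q' = q
      · subst h; simp; field_simp; ring
      · simp [h]
    rw [h2]; exact W.smul_mem _ h1
  have hW0 : f W = 0 := by
    by_cases hbot : W = ⊥
    · simp only [hf]; rw [hbot, hη]; simp
    · have htop : W = ⊤ := by
        obtain ⟨x, hx, hx0⟩ := (Submodule.ne_bot_iff W).1 hbot
        obtain ⟨q, hq⟩ := Function.ne_iff.1 hx0
        have hs := hcoord x hx q hq
        have hall : ∀ q', (Pi.single q' 1 : Y → ℝ) ∈ W := by
          intro q'
          obtain ⟨τ, h0, h1⟩ := htransW q' q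
          have h2 := h1 _ hs
          refine hcoord _ h2 q' ?_
          simp [h0]
        rw [eq_top_iff]
        intro y _
        rw [← Finset.univ_sum_single y]
        refine W.sum_mem (fun q' _ => ?_)
        have : (Pi.single q' (y q') : Y → ℝ) = (y q') • (Pi.single q' 1 : Y → ℝ) := by
          rw [← Pi.single_smul]; simp
        rw [this]
        exact W.smul_mem _ (hall q')
      simp only [hf]; rw [htop]
      have : HU P ν ⊤ = 0 := by
        unfold HU
        refine Finset.sum_eq_zero (fun s _ => ?_)
        have : ent (ν s) (relV vecE (⊤ : Submodule ℝ (Y → ℝ))) = 0 := by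
          unfold ent cp; simp [relV, hν1]
        rw [this, mul_zero]
      rw [this]; simp
  have := hW U
  rw [hW0] at this
  simp only [hf] at this
  linarith
end Sym
end FKT

open Filter Topology
open scoped Classical
namespace FKT

abbrev Cl (k : ℕ) := Fin k → Bool
abbrev St (k : ℕ) := Cl k → Bool
abbrev Sg (k : ℕ) := Cl k → SignType

/-- prepend a bit -/
def cns {k : ℕ} (b : Bool) (q : Cl k) : Cl (k+1) := Fin.cons b q

lemma cns_inj {k : ℕ} {b b' : Bool} {q q' : Cl k} (h : cns b q = cns b' q') : b = b' ∧ q = q' := by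
  unfold cns at h
  exact Fin.cons_inj.1 h

lemma cns_surj {k : ℕ} (v : Cl (k+1)) : ∃ b q, v = cns b q :=
  ⟨v 0, Fin.tail v, (Fin.cons_self_tail v).symm⟩

def cnsEquiv (k : ℕ) : Bool × Cl k ≃ Cl (k+1) where
  toFun x := cns x.1 x.2
  invFun v := (v 0, Fin.tail v)
  left_inv x := by simp [cns]
  right_inv v := by simp [cns]

/-- allowed moves -/
def alw {k : ℕ} (s : St (k+1)) (e : Sg k) : Prop :=
  ∀ q, (e q = 1 → s (cns false q) = true) ∧ (e q = -1 → s (cns true q) = true)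

noncomputable def kept {k : ℕ} (s : St (k+1)) (e : Sg k) : St k :=
  fun q => s (cns false q) && s (cns true q) && decide (e q = 0)

noncomputable def Fg (ρ : ℝ) : ℕ → (k : ℕ) → St k → ℝ
  | 0, _, s => ∏ q, if s q then 2 else 1
  | _+1, 0, _ => 1
  | d+1, k+1, s => ∑ e : Sg k, if alw s e then (Fg ρ d k (kept s e)) ^ ρ else 0

noncomputable def nu (ρ : ℝ) (d k : ℕ) (s : St (k+1)) (e : Sg k) : ℝ :=
  if alw s e then (Fg ρ d k (kept s e)) ^ ρ / Fg ρ (d+1) (k+1) s else 0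

noncomputable def AL (ρ : ℝ) (D : ℕ) : ℕ → (k : ℕ) → St k → ℝ
  | 0, _, s => if s = (fun _ => true) then 1 else 0
  | i+1, k, s' => ∑ s : St (k+1), AL ρ D i (k+1) s *
      ∑ e : Sg k, if kept s e = s' then nu ρ (D - i) k s e else 0

lemma alw_zero {k : ℕ} (s : St (k+1)) : alw s (fun _ => 0) := by
  intro q; simp

lemma one_le_Fg {ρ : ℝ} (hρ : 0 < ρ) : ∀ d k s, 1 ≤ Fg ρ d k s
  | 0, k, s => by
    unfold Fg
    calc (1:ℝ) = ∏ q : Cl k, (1:ℝ) := by simp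
      _ ≤ _ := Finset.prod_le_prod (fun _ _ => zero_le_one) (fun q _ => by split_ifs <;> norm_num)
  | d+1, 0, s => by unfold Fg; exact le_rfl
  | d+1, k+1, s => by
    unfold Fg
    have h : (1:ℝ) ≤ (Fg ρ d k (kept s (fun _ => 0))) ^ ρ :=
      Real.one_le_rpow (one_le_Fg hρ d k _) hρ.le
    have := Finset.single_le_sum (f := fun e : Sg k => if alw s e then (Fg ρ d k (kept s e)) ^ ρ else 0)
      (fun e _ => by
        split_ifs
        · exact Real.rpow_nonneg (zero_le_one.trans (one_le_Fg hρ d k _)) _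
        · exact le_rfl) (Finset.mem_univ (fun _ => 0))
    rw [if_pos (alw_zero s)] at this
    exact h.trans this

lemma Fg_pos {ρ : ℝ} (hρ : 0 < ρ) (d k s) : 0 < Fg ρ d k s :=
  zero_lt_one.trans_le (one_le_Fg hρ d k s)

lemma nu_nonneg {ρ : ℝ} (hρ : 0 < ρ) (d k s e) : 0 ≤ nu ρ d k s e := by
  unfold nu; split_ifs
  · exact div_nonneg (Real.rpow_nonneg (Fg_pos hρ _ _ _).le _) (Fg_pos hρ _ _ _).le
  · exact le_rfl

lemma nu_sum {ρ : ℝ} (hρ : 0 < ρ) (d k s) : ∑ e, nu ρ d k s e = 1 := by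
  have h : ∀ e, nu ρ d k s e = (if alw s e then (Fg ρ d k (kept s e)) ^ ρ else 0) / Fg ρ (d+1) (k+1) s := by
    intro e; unfold nu; split_ifs <;> simp
  simp_rw [h]
  rw [← Finset.sum_div]
  change Fg ρ (d+1) (k+1) s / _ = 1
  exact div_self (Fg_pos hρ _ _ _).ne'

lemma AL_nonneg {ρ : ℝ} (hρ : 0 < ρ) (D : ℕ) : ∀ i k s, 0 ≤ AL ρ D i k s
  | 0, k, s => by unfold AL; split_ifs <;> norm_num
  | i+1, k, s => by
    unfold AL
    refine Finset.sum_nonneg (fun s _ => mul_nonneg (AL_nonneg hρ D i _ _) (Finset.sum_nonneg (fun e _ => ?_)))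
    split_ifs
    · exact nu_nonneg hρ _ _ _ _
    · exact le_rfl

/-- step formula for expectations -/
lemma AL_step (ρ : ℝ) (D i k : ℕ) (φ : St k → ℝ) :
    ∑ s', AL ρ D (i+1) k s' * φ s' =
      ∑ s, AL ρ D i (k+1) s * ∑ e, nu ρ (D - i) k s e * φ (kept s e) := by
  have h : ∀ s', AL ρ D (i+1) k s' * φ s' = ∑ s, AL ρ D i (k+1) s *
      ∑ e : Sg k, if kept s e = s' then nu ρ (D - i) k s e * φ (kept s e) else 0 := by
    intro s'
    rw [AL, Finset.sum_mul]
    refine Finset.sum_congr rfl (fun s _ => ?_)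
    rw [mul_assoc, Finset.sum_mul]
    congr 1
    refine Finset.sum_congr rfl (fun e _ => ?_)
    split_ifs with h
    · rw [h]
    · simp
  simp_rw [h]
  rw [Finset.sum_comm]
  refine Finset.sum_congr rfl (fun s _ => ?_)
  rw [← Finset.mul_sum, Finset.sum_comm]
  congr 1
  refine Finset.sum_congr rfl (fun e _ => ?_)
  simp

lemma AL_sum {ρ : ℝ} (hρ : 0 < ρ) (D : ℕ) : ∀ i k, ∑ s, AL ρ D i k s = 1
  | 0, k => by simp [AL]
  | i+1, k => by
    have := AL_step ρ D i k (fun _ => 1)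
    simp only [mul_one, nu_sum hρ] at this
    rw [this, AL_sum hρ D i]

/-! halving on the last coordinate -/

def hlf {X : Type*} {k : ℕ} (b : Bool) (s : Cl (k+1) → X) : Cl k → X :=
  fun q => s (Fin.snoc (α := fun _ => Bool) q b)

def hlfEquiv (X : Type*) (k : ℕ) : (Cl (k+1) → X) ≃ (Cl k → X) × (Cl k → X) where
  toFun s := (hlf false s, hlf true s)
  invFun x v := bif v (Fin.last k) then x.2 (Fin.init v) else x.1 (Fin.init v)
  left_inv s := by
    ext v
    have h : Fin.snoc (α := fun _ => Bool) (Fin.init v) (v (Fin.last k)) = v := Fin.snoc_init_self v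
    cases hv : v (Fin.last k) <;> (rw [hv] at h; simp [hlf, h, hv])
  right_inv x := by
    ext v <;> simp [hlf]

lemma cns_snoc {k : ℕ} (b b' : Bool) (q : Cl k) :
    cns b (Fin.snoc (α := fun _ => Bool) q b' : Cl (k+1)) = Fin.snoc (α := fun _ => Bool) (cns b q) b' := by
  unfold cns
  exact Fin.cons_snoc_eq_snoc_cons (β := Bool) b q b'

lemma snoc_surj {k : ℕ} (v : Cl (k+1)) : ∃ q b, v = Fin.snoc (α := fun _ => Bool) q b :=
  ⟨Fin.init v, v (Fin.last k), (Fin.snoc_init_self v).symm⟩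

lemma hlf_kept {k : ℕ} (b : Bool) (s : St (k+2)) (e : Sg (k+1)) :
    hlf b (kept s e) = kept (hlf b s) (hlf b e) := by
  ext q; simp only [hlf, kept, cns_snoc]; congr

lemma alw_hlf {k : ℕ} (s : St (k+2)) (e : Sg (k+1)) :
    alw s e ↔ alw (hlf false s) (hlf false e) ∧ alw (hlf true s) (hlf true e) := by
  unfold alw
  constructor
  · intro h
    exact ⟨fun q => by simpa [hlf, cns_snoc] using h (Fin.snoc (α := fun _ => Bool) q false),
      fun q => by simpa [hlf, cns_snoc] using h (Fin.snoc (α := fun _ => Bool) q true)⟩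
  · rintro ⟨h0, h1⟩ v
    obtain ⟨q, b, rfl⟩ := snoc_surj v
    cases b
    · simpa [hlf, cns_snoc] using h0 q
    · simpa [hlf, cns_snoc] using h1 q

lemma sum_hlf {X : Type*} [Fintype X] {k : ℕ} (f : (Cl k → X) → (Cl k → X) → ℝ) :
    ∑ s : Cl (k+1) → X, f (hlf false s) (hlf true s) = ∑ s0, ∑ s1, f s0 s1 := by
  rw [← Fintype.sum_prod_type', ← Equiv.sum_comp (hlfEquiv X k)]
  rfl

lemma sum_hlf' {X : Type*} [Fintype X] {k : ℕ} (g : (Cl (k+1) → X) → ℝ) (f : (Cl k → X) → (Cl k → X) → ℝ)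
    (h : ∀ s, g s = f (hlf false s) (hlf true s)) :
    ∑ s : Cl (k+1) → X, g s = ∑ s0, ∑ s1, f s0 s1 := by
  rw [← sum_hlf f]
  exact Finset.sum_congr rfl (fun s _ => h s)

lemma prod_snoc {k : ℕ} (g : Cl (k+1) → ℝ) :
    ∏ v, g v = (∏ q, g (Fin.snoc (α := fun _ => Bool) q false)) * ∏ q, g (Fin.snoc (α := fun _ => Bool) q true) := by
  have h : ∏ v, g v = ∏ x : Bool × Cl k, g (Fin.snoc (α := fun _ => Bool) x.2 x.1) := by
    symm
    refine Fintype.prod_equiv (Fin.snocEquiv (fun _ => Bool)) _ _ (fun x => ?_)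
    rfl
  rw [h, Fintype.prod_prod_type]
  simp [mul_comm]

lemma Fg_hlf {ρ : ℝ} (hρ : 0 < ρ) : ∀ d k, d ≤ k → ∀ s : St (k+1),
    Fg ρ d (k+1) s = Fg ρ d k (hlf false s) * Fg ρ d k (hlf true s)
  | 0, k, _, s => by
    simp only [Fg]
    exact prod_snoc (fun q => if s q then (2:ℝ) else 1)
  | d+1, 0, h, s => by omega
  | d+1, k+1, h, s => by
    have h1 : ∀ e : Sg (k+1), (if alw s e then (Fg ρ d (k+1) (kept s e)) ^ ρ else 0) =
        (fun e0 e1 : Sg k => (if alw (hlf false s) e0 then (Fg ρ d k (kept (hlf false s) e0)) ^ ρ else 0) *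
        (if alw (hlf true s) e1 then (Fg ρ d k (kept (hlf true s) e1)) ^ ρ else 0)) (hlf false e) (hlf true e) := by
      intro e
      by_cases h0 : alw (hlf false s) (hlf false e)
      · by_cases h1 : alw (hlf true s) (hlf true e)
        · rw [if_pos ((alw_hlf s e).2 ⟨h0, h1⟩)]
          simp only [if_pos h0, if_pos h1]
          rw [Fg_hlf hρ d k (by omega), hlf_kept, hlf_kept,
            Real.mul_rpow (Fg_pos hρ _ _ _).le (Fg_pos hρ _ _ _).le]
        · rw [if_neg (fun hh => h1 ((alw_hlf s e).1 hh).2)]; simp [h1]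
      · rw [if_neg (fun hh => h0 ((alw_hlf s e).1 hh).1)]; simp [h0]
    rw [Fg, sum_hlf' _ (fun e0 e1 : Sg k => (if alw (hlf false s) e0 then (Fg ρ d k (kept (hlf false s) e0)) ^ ρ else 0) * (if alw (hlf true s) e1 then (Fg ρ d k (kept (hlf true s) e1)) ^ ρ else 0)) h1, ← Finset.sum_mul_sum]
    simp only [Fg]

lemma nu_hlf {ρ : ℝ} (hρ : 0 < ρ) (d k) (h : d ≤ k) (s : St (k+2)) (e : Sg (k+1)) :
    nu ρ d (k+1) s e = nu ρ d k (hlf false s) (hlf false e) * nu ρ d k (hlf true s) (hlf true e) := by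
  unfold nu
  by_cases h0 : alw (hlf false s) (hlf false e)
  · by_cases h1 : alw (hlf true s) (hlf true e)
    · rw [if_pos ((alw_hlf s e).2 ⟨h0, h1⟩)]
      simp only [if_pos h0, if_pos h1]
      rw [Fg_hlf hρ d k (by omega), hlf_kept, hlf_kept, Fg_hlf hρ (d+1) (k+1) (by omega),
        Real.mul_rpow (Fg_pos hρ _ _ _).le (Fg_pos hρ _ _ _).le]
      field_simp
    · rw [if_neg (fun hh => h1 ((alw_hlf s e).1 hh).2)]; simp [h1]
  · rw [if_neg (fun hh => h0 ((alw_hlf s e).1 hh).1)]; simp [h0]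

lemma hlf_ext {X : Type*} {k : ℕ} {s s' : Cl (k+1) → X} :
    s = s' ↔ hlf false s = hlf false s' ∧ hlf true s = hlf true s' := by
  constructor
  · rintro rfl; simp
  · rintro ⟨h, h'⟩; exact (hlfEquiv X k).injective (Prod.ext h h')

lemma AL_hlf {ρ : ℝ} (hρ : 0 < ρ) (D : ℕ) : ∀ i k, i ≤ D + 1 → D + 1 ≤ k + i → ∀ s : St (k+1),
    AL ρ D i (k+1) s = AL ρ D i k (hlf false s) * AL ρ D i k (hlf true s)
  | 0, k, _, _, s => by
    unfold AL
    have : s = (fun _ => true) ↔ hlf false s = (fun _ => true) ∧ hlf true s = (fun _ => true) := by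
      rw [hlf_ext]; rfl
    simp only [this]
    by_cases h : hlf false s = (fun _ => true) <;> by_cases h' : hlf true s = (fun _ => true) <;>
      simp [h, h']
  | i+1, k, hi, hk, s' => by
    have h1 : ∀ s : St (k+2), AL ρ D i (k+2) s *
        ∑ e : Sg (k+1), (if kept s e = s' then nu ρ (D - i) (k+1) s e else 0) =
      (fun s0 s1 : St (k+1) => (AL ρ D i (k+1) s0 * ∑ e : Sg k, if kept s0 e = hlf false s' then nu ρ (D - i) k s0 e else 0) *
      (AL ρ D i (k+1) s1 * ∑ e : Sg k, if kept s1 e = hlf true s' then nu ρ (D - i) k s1 e else 0)) (hlf false s) (hlf true s) := by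
      intro s
      rw [AL_hlf hρ D i (k+1) (by omega) (by omega)]
      have h2 : ∀ e : Sg (k+1), (if kept s e = s' then nu ρ (D - i) (k+1) s e else 0) =
        (fun e0 e1 : Sg k => (if kept (hlf false s) e0 = hlf false s' then nu ρ (D - i) k (hlf false s) e0 else 0) *
          (if kept (hlf true s) e1 = hlf true s' then nu ρ (D - i) k (hlf true s) e1 else 0)) (hlf false e) (hlf true e) := by
        intro e
        have : kept s e = s' ↔ kept (hlf false s) (hlf false e) = hlf false s' ∧
            kept (hlf true s) (hlf true e) = hlf true s' := by
          rw [hlf_ext, hlf_kept, hlf_kept]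
        simp only [this]
        rw [nu_hlf hρ _ _ (by omega)]
        by_cases h : kept (hlf false s) (hlf false e) = hlf false s' <;>
        by_cases h' : kept (hlf true s) (hlf true e) = hlf true s' <;> simp [h, h']
      rw [sum_hlf' _ (fun e0 e1 : Sg k => (if kept (hlf false s) e0 = hlf false s' then nu ρ (D - i) k (hlf false s) e0 else 0) * (if kept (hlf true s) e1 = hlf true s' then nu ρ (D - i) k (hlf true s) e1 else 0)) h2, ← Finset.sum_mul_sum]
      ring
    rw [AL, sum_hlf' _ (fun s0 s1 : St (k+1) => (AL ρ D i (k+1) s0 * ∑ e : Sg k, if kept s0 e = hlf false s' then nu ρ (D - i) k s0 e else 0) * (AL ρ D i (k+1) s1 * ∑ e : Sg k, if kept s1 e = hlf true s' then nu ρ (D - i) k s1 e else 0)) h1, ← Finset.sum_mul_sum]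
    simp only [AL]

/-- expected log partition function -/
noncomputable def mm (ρ : ℝ) (D i k : ℕ) : ℝ :=
  ∑ s, AL ρ D i k s * Real.log (Fg ρ (D + 1 - i) k s)

lemma mm_succ {ρ : ℝ} (hρ : 0 < ρ) (D i k : ℕ) (hi : i ≤ D + 1) (hk : D + 1 ≤ k + i) :
    mm ρ D i (k+1) = 2 * mm ρ D i k := by
  unfold mm
  have h1 : ∀ s : St (k+1), AL ρ D i (k+1) s * Real.log (Fg ρ (D + 1 - i) (k+1) s) =
    (fun s0 s1 => (AL ρ D i k s0 * Real.log (Fg ρ (D + 1 - i) k s0)) * AL ρ D i k s1 +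
      AL ρ D i k s0 * (AL ρ D i k s1 * Real.log (Fg ρ (D + 1 - i) k s1))) (hlf false s) (hlf true s) := by
    intro s
    rw [AL_hlf hρ D i k hi hk, Fg_hlf hρ _ _ (by omega), Real.log_mul (Fg_pos hρ _ _ _).ne' (Fg_pos hρ _ _ _).ne']
    ring
  rw [sum_hlf' _ (fun s0 s1 => (AL ρ D i k s0 * Real.log (Fg ρ (D + 1 - i) k s0)) * AL ρ D i k s1 + AL ρ D i k s0 * (AL ρ D i k s1 * Real.log (Fg ρ (D + 1 - i) k s1))) h1]
  simp only [Finset.sum_add_distrib]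
  rw [← Finset.sum_mul_sum, ← Finset.sum_mul_sum, AL_sum hρ]
  ring

noncomputable def mi (ρ : ℝ) (D i : ℕ) : ℝ := mm ρ D i (D + 1 - i) / 2 ^ (D + 1 - i)

lemma mm_eq {ρ : ℝ} (hρ : 0 < ρ) (D i k : ℕ) (hi : i ≤ D + 1) (hk : D + 1 ≤ k + i) :
    mm ρ D i k = 2 ^ k * mi ρ D i := by
  obtain ⟨t, rfl⟩ : ∃ t, k = (D + 1 - i) + t := ⟨k + i - (D + 1), by omega⟩
  induction t with
  | zero => unfold mi; simp; field_simp
  | succ t ih =>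
    rw [← add_assoc, mm_succ hρ _ _ _ hi (by omega), ih (by omega)]
    ring

end FKT

open Filter Topology
open scoped Classical
namespace FKT

/-- full state -/
def fl (k : ℕ) : St k := fun _ => true

lemma kept_fl_zero (k : ℕ) : kept (fl (k+1)) (fun _ => 0) = fl k := by
  ext q; simp [kept, fl]

lemma kept_ne_fl {k : ℕ} {s : St (k+1)} {e : Sg k} (h : s ≠ fl (k+1) ∨ e ≠ fun _ => 0) :
    kept s e ≠ fl k := by
  intro hk
  have hq : ∀ q, s (cns false q) = true ∧ s (cns true q) = true ∧ e q = 0 := by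
    intro q
    have := congrFun hk q
    simp only [kept, fl, Bool.and_eq_true, decide_eq_true_eq] at this
    exact ⟨this.1.1, this.1.2, this.2⟩
  rcases h with h | h
  · apply h; funext v
    obtain ⟨b, q, rfl⟩ := cns_surj v
    cases b
    · exact (hq q).1
    · exact (hq q).2.1
  · exact h (funext fun q => (hq q).2.2)

lemma prod_cns {k : ℕ} (g : Cl (k+1) → ℝ) :
    ∏ v, g v = (∏ q, g (cns false q)) * ∏ q, g (cns true q) := by
  rw [← Equiv.prod_comp (cnsEquiv k), Fintype.prod_prod_type]
  simp [cnsEquiv, mul_comm]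

lemma sg0_cases (f : Sg 0 → ℝ) : ∑ e, f e = f (fun _ => 0) + f (fun _ => -1) + f (fun _ => 1) := by
  rw [← Equiv.sum_comp (Equiv.funUnique (Cl 0) SignType).symm]
  rw [show (Finset.univ : Finset SignType) = {0, -1, 1} from rfl]
  rw [Finset.sum_insert (by decide), Finset.sum_pair (by decide), ← add_assoc]
  rfl

lemma Fg_ne_fl (ρ : ℝ) : ∀ d (s : St (d+1)), s ≠ fl (d+1) → Fg ρ (d+1) (d+1) s = Fg ρ d (d+1) s
  | 0, s, hs => by
    have h1 : ∀ e : Sg 0, Fg ρ 0 0 (kept s e) = 1 := by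
      intro e
      have h := kept_ne_fl (e := e) (Or.inl hs)
      have h2 : ∀ q, kept s e q = false := by
        intro q0
        by_contra hc
        apply h
        funext q
        rw [Subsingleton.elim q q0]
        exact Bool.eq_true_of_not_eq_false hc
      unfold Fg
      exact Finset.prod_eq_one (fun q _ => by rw [h2]; rfl)
    have e1 : Fg ρ 1 1 s = ∑ e : Sg 0, if alw s e then (Fg ρ 0 0 (kept s e)) ^ ρ else 0 := by rw [Fg]
    change Fg ρ 1 1 s = _
    rw [e1, sg0_cases]
    simp only [h1, Real.one_rpow]
    obtain ⟨z, hz⟩ : ∃ z : Cl 0, ∀ q : Cl 0, q = z := ⟨Fin.elim0, fun q => Subsingleton.elim _ _⟩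
    have hp : ∀ g : Cl 0 → ℝ, ∏ q, g q = g z := by
      intro g
      rw [Fintype.prod_eq_single z (fun q hq => absurd (hz q) hq)]
    rw [Fg, prod_cns, if_pos (alw_zero s), hp, hp]
    have hA : alw s (fun _ => (-1:SignType)) ↔ s (cns true z) = true := by
      unfold alw
      exact ⟨fun h => (h z).2 rfl, fun h q => ⟨fun h' => absurd h' (by simp; try decide), fun _ => by rw [hz q]; exact h⟩⟩
    have hB : alw s (fun _ => (1:SignType)) ↔ s (cns false z) = true := by
      unfold alw
      exact ⟨fun h => (h z).1 rfl, fun h q => ⟨fun _ => by rw [hz q]; exact h, fun h' => absurd h' (by simp; try decide)⟩⟩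
    have hn : ¬ (s (cns false z) = true ∧ s (cns true z) = true) := by
      rintro ⟨ha, hb⟩
      apply hs; funext v
      obtain ⟨b, q, rfl⟩ := cns_surj v
      rw [hz q]
      cases b
      · exact ha
      · exact hb
    simp only [hA, hB]
    clear hA hB e1 h1 hp hs
    generalize s (cns false z) = u at *
    generalize s (cns true z) = v at *
    cases u <;> cases v <;> simp_all
    all_goals norm_num
  | d+1, s, hs => by
    rw [Fg, Fg]
    refine Finset.sum_congr rfl (fun e _ => ?_)
    rw [Fg_ne_fl ρ d _ (kept_ne_fl (Or.inl hs))]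

lemma hlf_fl (k b) : hlf b (fl (k+1)) = fl k := rfl

lemma Fg_fl_rec {ρ : ℝ} (hρ : 0 < ρ) (d : ℕ) :
    Fg ρ (d+2) (d+2) (fl (d+2)) = Fg ρ (d+1) (d+1) (fl (d+1)) ^ 2 + Fg ρ (d+1) (d+1) (fl (d+1)) ^ ρ
      - Fg ρ d d (fl d) ^ (2 * ρ) := by
  have hY : Fg ρ (d+1) (d+2) (fl (d+2)) = Fg ρ (d+1) (d+1) (fl (d+1)) ^ 2 := by
    rw [Fg_hlf hρ _ _ le_rfl, hlf_fl, hlf_fl, sq]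
  have hY2 : Fg ρ d (d+1) (fl (d+1)) ^ ρ = Fg ρ d d (fl d) ^ (2 * ρ) := by
    rw [Fg_hlf hρ _ _ le_rfl, hlf_fl, hlf_fl, ← sq, Real.rpow_mul (Fg_pos hρ _ _ _).le]
    norm_num
  rw [← hY, ← hY2]
  have e1 : Fg ρ (d+2) (d+2) (fl (d+2)) = ∑ e : Sg (d+1), if alw (fl (d+2)) e then (Fg ρ (d+1) (d+1) (kept (fl (d+2)) e)) ^ ρ else 0 := by
    rw [Fg]
  have e2 : Fg ρ (d+1) (d+2) (fl (d+2)) = ∑ e : Sg (d+1), if alw (fl (d+2)) e then (Fg ρ d (d+1) (kept (fl (d+2)) e)) ^ ρ else 0 := by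
    rw [Fg]
  rw [e1, e2, ← Finset.add_sum_erase _ _ (Finset.mem_univ (fun _ => (0:SignType))),
    ← Finset.add_sum_erase _ (fun e => if alw (fl (d+2)) e then (Fg ρ d (d+1) (kept (fl (d+2)) e)) ^ ρ else 0)
      (Finset.mem_univ (fun _ => (0:SignType)))]
  rw [if_pos (alw_zero _), if_pos (alw_zero _), kept_fl_zero]
  rw [Finset.sum_congr rfl (g := fun e => if alw (fl (d+2)) e then (Fg ρ d (d+1) (kept (fl (d+2)) e)) ^ ρ else 0)
    (fun e he => by rw [Fg_ne_fl ρ d _ (kept_ne_fl (Or.inr (Finset.ne_of_mem_erase he)))])]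
  ring

lemma Fg_fl_zero (ρ : ℝ) : Fg ρ 0 0 (fl 0) = 2 := by
  simp [Fg, fl]

lemma Fg_fl_one (ρ : ℝ) : Fg ρ 1 1 (fl 1) = 2 + 2 ^ ρ := by
  rw [Fg, sg0_cases]
  have h : ∀ e : Sg 0, alw (fl 1) e := by intro e q; simp [fl]
  simp only [h, if_true]
  rw [kept_fl_zero, Fg_fl_zero]
  simp [Fg, kept]
  ring

lemma Fg_fl_eq {ρ : ℝ} (hρ : 0 < ρ) (a : ℕ → ℝ) (ha1 : a 1 = 2) (ha2 : a 2 = 2 + (2:ℝ) ^ ρ)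
    (harec : ∀ j : ℕ, 3 ≤ j → a j = a (j-1) ^ 2 + a (j-1) ^ ρ - a (j-2) ^ (2*ρ)) :
    ∀ d, Fg ρ d d (fl d) = a (d+1)
  | 0 => by rw [Fg_fl_zero, ha1]
  | 1 => by rw [Fg_fl_one, ha2]
  | d+2 => by
    rw [Fg_fl_rec hρ, Fg_fl_eq hρ a ha1 ha2 harec d, Fg_fl_eq hρ a ha1 ha2 harec (d+1),
      harec (d+2+1) (by omega)]
    rfl

end FKT

open Filter Topology
open scoped Classical
namespace FKT

lemma relV_bot {Y : Type*} (e e' : Y → SignType) : relV vecE (⊥ : Submodule ℝ (Y → ℝ)) e e' ↔ e = e' := by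
  unfold relV
  rw [Submodule.mem_bot, sub_eq_zero]
  constructor
  · intro h
    funext q
    have := congrFun h q
    unfold vecE at this
    have h2 : ((e' q : ℤ)) = (e q : ℤ) := by exact_mod_cast this
    revert h2
    generalize e q = u; generalize e' q = v
    revert u v; decide
  · rintro rfl; rfl

lemma ent_bot {Y : Type*} [Fintype Y] [DecidableEq Y] (p : (Y → SignType) → ℝ) :
    ent p (relV vecE (⊥ : Submodule ℝ (Y → ℝ))) = -∑ e, p e * Real.log (p e) := by
  unfold ent cp
  simp only [relV_bot]
  simp

lemma ent_nu {ρ : ℝ} (hρ : 0 < ρ) (d k : ℕ) (s : St (k+1)) :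
    ent (nu ρ d k s) (relV vecE (⊥ : Submodule ℝ (Cl k → ℝ))) =
      Real.log (Fg ρ (d+1) (k+1) s) - ρ * ∑ e, nu ρ d k s e * Real.log (Fg ρ d k (kept s e)) := by
  rw [ent_bot]
  have h : ∀ e, nu ρ d k s e * Real.log (nu ρ d k s e) =
      ρ * (nu ρ d k s e * Real.log (Fg ρ d k (kept s e))) - nu ρ d k s e * Real.log (Fg ρ (d+1) (k+1) s) := by
    intro e
    by_cases ha : alw s e
    · have h1 : nu ρ d k s e = (Fg ρ d k (kept s e)) ^ ρ / Fg ρ (d+1) (k+1) s := by unfold nu; rw [if_pos ha]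
      have h2 : Real.log (nu ρ d k s e) = ρ * Real.log (Fg ρ d k (kept s e)) - Real.log (Fg ρ (d+1) (k+1) s) := by
        rw [h1, Real.log_div (Real.rpow_pos_of_pos (Fg_pos hρ _ _ _) _).ne' (Fg_pos hρ _ _ _).ne',
          Real.log_rpow (Fg_pos hρ _ _ _)]
      rw [h2]; ring
    · have h1 : nu ρ d k s e = 0 := by unfold nu; rw [if_neg ha]
      rw [h1]; simp
  simp_rw [h]
  rw [Finset.sum_sub_distrib, ← Finset.sum_mul, nu_sum hρ, ← Finset.mul_sum]
  ring

noncomputable def et (ρ : ℝ) (D i : ℕ) : ℝ := 2 * mi ρ D i - ρ * mi ρ D (i+1)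

lemma HU_bot {ρ : ℝ} (hρ : 0 < ρ) (D i k : ℕ) (hi : i ≤ D) (hk : D ≤ k + i) :
    HU (AL ρ D i (k+1)) (nu ρ (D - i) k) ⊥ = et ρ D i * 2 ^ k := by
  unfold HU
  simp_rw [ent_nu hρ, mul_sub, Finset.sum_sub_distrib]
  have h1 : ∑ s, AL ρ D i (k+1) s * Real.log (Fg ρ (D - i + 1) (k+1) s) = mm ρ D i (k+1) := by
    unfold mm; rw [show D - i + 1 = D + 1 - i by omega]
  have h2 : ∑ s, AL ρ D i (k+1) s * (ρ * ∑ e, nu ρ (D-i) k s e * Real.log (Fg ρ (D-i) k (kept s e))) =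
      ρ * mm ρ D (i+1) k := by
    unfold mm
    rw [AL_step, Finset.mul_sum]
    refine Finset.sum_congr rfl (fun s _ => ?_)
    rw [show D + 1 - (i+1) = D - i by omega]
    ring
  rw [h1, h2, mm_eq hρ _ _ _ (by omega) (by omega), mm_eq hρ _ _ _ (by omega) (by omega)]
  unfold et
  ring

/-- swap the values 0 and σ at q -/
def swAt {k : ℕ} (q : Cl k) (σ : SignType) : Sg k ≃ Sg k :=
  Function.Involutive.toPerm (fun e => Function.update e q (Equiv.swap 0 σ (e q))) (by
    intro e; simp)

lemma swAt_same {k : ℕ} (q : Cl k) (σ : SignType) (e : Sg k) : swAt q σ e q = Equiv.swap 0 σ (e q) := by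
  change Function.update e q (Equiv.swap 0 σ (e q)) q = _
  simp

lemma swAt_ne {k : ℕ} {q q' : Cl k} (h : q' ≠ q) (σ : SignType) (e : Sg k) : swAt q σ e q' = e q' := by
  change Function.update e q (Equiv.swap 0 σ (e q)) q' = _
  simp [h]

noncomputable def wt (ρ : ℝ) (d k : ℕ) (s : St (k+1)) (e : Sg k) : ℝ :=
  if alw s e then (Fg ρ d k (kept s e)) ^ ρ else 0

lemma wt_nonneg {ρ : ℝ} (hρ : 0 < ρ) (d k s e) : 0 ≤ wt ρ d k s e := by
  unfold wt; split_ifs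
  · exact Real.rpow_nonneg (Fg_pos hρ _ _ _).le _
  · exact le_rfl

lemma Fg_eq_wt (ρ : ℝ) (d k : ℕ) (s : St (k+1)) : Fg ρ (d+1) (k+1) s = ∑ e, wt ρ d k s e := by
  rw [Fg]; rfl

lemma nu_eq_wt (ρ : ℝ) (d k : ℕ) (s : St (k+1)) (e) : nu ρ d k s e = wt ρ d k s e / Fg ρ (d+1) (k+1) s := by
  unfold nu wt; split_ifs <;> simp

def sgb (b : Bool) : SignType := if b then -1 else 1

lemma alw_iff {k : ℕ} (s : St (k+1)) (e : Sg k) : alw s e ↔ ∀ b q, e q = sgb b → s (cns b q) = true := by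
  unfold alw sgb
  constructor
  · intro h b q
    cases b
    · simpa using (h q).1
    · simpa using (h q).2
  · intro h q
    exact ⟨by simpa using h false q, by simpa using h true q⟩

lemma kept_iff {k : ℕ} (s : St (k+1)) (e : Sg k) (q) :
    kept s e q = true ↔ s (cns false q) = true ∧ s (cns true q) = true ∧ e q = 0 := by
  simp [kept, and_assoc]

lemma kept_iff' {k : ℕ} (s : St (k+1)) (e : Sg k) (q) :
    kept s e q = true ↔ (∀ b, s (cns b q) = true) ∧ e q = 0 := by
  rw [kept_iff, Bool.forall_bool, and_assoc]

lemma bool_ext {a b : Bool} (h : a = true ↔ b = true) : a = b := by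
  cases a <;> cases b <;> simp_all

lemma sgb_ne_zero (b) : sgb b ≠ 0 := by cases b <;> decide

lemma eight_rpow {ρ : ℝ} (hρ1 : ρ < 1/3) : (8:ℝ) ^ ρ ≤ 2 := by
  have : (8:ℝ) ^ ρ ≤ 8 ^ ((1:ℝ)/3) := Real.rpow_le_rpow_of_exponent_le (by norm_num) hρ1.le
  refine this.trans_eq ?_
  rw [show (8:ℝ) = 2 ^ (3:ℝ) by norm_num, ← Real.rpow_mul (by norm_num)]; norm_num

lemma Fg_update {ρ : ℝ} (hρ : 0 < ρ) (hρ1 : ρ < 1/3) : ∀ d k (s : St k) (v : Cl k),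
    Fg ρ d k s ≤ 8 * Fg ρ d k (Function.update s v false)
  | 0, k, s, v => by
    simp only [Fg]
    rw [← Finset.mul_prod_erase _ _ (Finset.mem_univ v), ← Finset.mul_prod_erase _
      (fun q => if Function.update s v false q then (2:ℝ) else 1) (Finset.mem_univ v)]
    rw [Finset.prod_congr rfl (g := fun q => if s q then (2:ℝ) else 1) (s₁ := Finset.univ.erase v)
      (f := fun q => if Function.update s v false q then (2:ℝ) else 1) (fun q hq => by
        simp [Finset.ne_of_mem_erase hq])]
    have hp : 0 ≤ ∏ q ∈ Finset.univ.erase v, (if s q then (2:ℝ) else 1) :=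
      Finset.prod_nonneg (fun q _ => by split_ifs <;> norm_num)
    rw [← mul_assoc]
    refine mul_le_mul_of_nonneg_right ?_ hp
    simp; split_ifs <;> norm_num
  | d+1, 0, s, v => by simp only [Fg]; norm_num
  | d+1, k+1, s, v => by
    obtain ⟨b, q, rfl⟩ := cns_surj v
    set s' := Function.update s (cns b q) false with hs'
    rw [Fg_eq_wt, Fg_eq_wt]
    have hs'1 : s' (cns b q) = false := by simp [s']
    have hs'2 : ∀ b' q', (b', q') ≠ (b, q) → s' (cns b' q') = s (cns b' q') := by
      intro b' q' h
      simp only [s']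
      rw [Function.update_of_ne]
      intro hc; exact h (Prod.ext (cns_inj hc).1 (cns_inj hc).2)
    have hkq : ∀ e, kept s' e q = false := by
      intro e
      by_contra hc
      have := (kept_iff' _ _ _).1 (Bool.eq_true_of_not_eq_false hc)
      rw [this.1 b] at hs'1; cases hs'1
    have hkq' : ∀ e q', q' ≠ q → kept s' e q' = kept s e q' := by
      intro e q' h
      apply bool_ext
      rw [kept_iff', kept_iff']
      refine and_congr_left fun _ => forall_congr' fun b' => ?_
      rw [hs'2 b' q' (by simp [h])]
    have key : ∀ e, wt ρ d k s e ≤ 2 * wt ρ d k s' e +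
        (if e q = sgb b then wt ρ d k s' (swAt q (sgb b) e) else 0) := by
      intro e
      by_cases ha : alw s e
      swap
      · have : wt ρ d k s e = 0 := by unfold wt; rw [if_neg ha]
        rw [this]
        refine add_nonneg (mul_nonneg (by norm_num) (wt_nonneg hρ _ _ _ _)) ?_
        split_ifs
        · exact wt_nonneg hρ _ _ _ _
        · exact le_rfl
      have ha' := (alw_iff _ _).1 ha
      by_cases hb : e q = sgb b
      · rw [if_pos hb]
        have h0 : swAt q (sgb b) e q = 0 := by rw [swAt_same, hb]; simp
        have h1 : alw s' (swAt q (sgb b) e) := by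
          rw [alw_iff]
          intro b' q' h
          have hne : q' ≠ q := by
            rintro rfl
            rw [h0] at h; exact sgb_ne_zero _ h.symm
          rw [hs'2 b' q' (by simp [hne])]
          rw [swAt_ne hne] at h
          exact ha' b' q' h
        have h2 : kept s' (swAt q (sgb b) e) = kept s e := by
          funext q'
          by_cases hne : q' = q
          · subst hne
            rw [hkq]
            symm
            by_contra hc
            have := (kept_iff' _ _ _).1 (Bool.eq_true_of_not_eq_false hc)
            rw [hb] at this
            exact sgb_ne_zero _ this.2
          · rw [hkq' _ _ hne]
            apply bool_ext
            rw [kept_iff', kept_iff', swAt_ne hne]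
        have h3 : wt ρ d k s e = wt ρ d k s' (swAt q (sgb b) e) := by
          unfold wt; rw [if_pos ha, if_pos h1, h2]
        rw [h3]
        have := wt_nonneg hρ d k s' e
        linarith
      · rw [if_neg hb, add_zero]
        have h1 : alw s' e := by
          rw [alw_iff]
          intro b' q' h
          rw [hs'2 b' q' (by
            intro hc; rw [Prod.mk.injEq] at hc; rw [hc.1, hc.2] at h; exact hb h)]
          exact ha' b' q' h
        have h2 : kept s' e = Function.update (kept s e) q false := by
          funext q'
          by_cases hne : q' = q
          · subst hne; simp [hkq]
          · simp [hne, hkq' e q' hne]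
        unfold wt
        rw [if_pos ha, if_pos h1, h2]
        calc (Fg ρ d k (kept s e)) ^ ρ ≤ (8 * Fg ρ d k (Function.update (kept s e) q false)) ^ ρ :=
              Real.rpow_le_rpow (Fg_pos hρ _ _ _).le (Fg_update hρ hρ1 d k _ q) hρ.le
          _ = 8 ^ ρ * (Fg ρ d k (Function.update (kept s e) q false)) ^ ρ :=
              Real.mul_rpow (by norm_num) (Fg_pos hρ _ _ _).le
          _ ≤ _ := mul_le_mul_of_nonneg_right (eight_rpow hρ1) (Real.rpow_nonneg (Fg_pos hρ _ _ _).le _)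
    have hsum : ∑ e, (if e q = sgb b then wt ρ d k s' (swAt q (sgb b) e) else 0) ≤ ∑ e, wt ρ d k s' e := by
      rw [← Equiv.sum_comp (swAt q (sgb b)) (wt ρ d k s')]
      refine Finset.sum_le_sum (fun e _ => ?_)
      split_ifs
      · exact le_rfl
      · exact wt_nonneg hρ _ _ _ _
    have h5 := Finset.sum_le_sum (fun e (_ : e ∈ Finset.univ) => key e)
    rw [Finset.sum_add_distrib, ← Finset.mul_sum] at h5
    have h6 : 0 ≤ ∑ e, wt ρ d k s' e := Finset.sum_nonneg (fun e _ => wt_nonneg hρ _ _ _ _)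
    linarith

lemma nu_kept_le {ρ : ℝ} (hρ : 0 < ρ) (hρ1 : ρ < 1/3) (d k) (s : St (k+1)) (q : Cl k) :
    ∑ e, nu ρ d k s e * (if kept s e q then 1 else 0) ≤ 1/2 := by
  have key : ∀ e, wt ρ d k s e * (if kept s e q then 1 else 0) ≤
      (if e q = 0 then wt ρ d k s (swAt q 1 e) else 0) + (if e q = 0 then wt ρ d k s (swAt q (-1) e) else 0) := by
    intro e
    by_cases hk : kept s e q = true
    swap
    · rw [if_neg hk, mul_zero]
      have h1 := wt_nonneg hρ d k s (swAt q 1 e)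
      have h2 := wt_nonneg hρ d k s (swAt q (-1) e)
      split_ifs <;> linarith
    obtain ⟨hs, he⟩ := (kept_iff' _ _ _).1 hk
    rw [if_pos hk, if_pos he, if_pos he, mul_one]
    by_cases ha : alw s e
    swap
    · have : wt ρ d k s e = 0 := by unfold wt; rw [if_neg ha]
      have h1 := wt_nonneg hρ d k s (swAt q 1 e)
      have h2 := wt_nonneg hρ d k s (swAt q (-1) e)
      linarith
    have aux : ∀ σ : SignType, σ ≠ 0 → wt ρ d k s e ≤ 2 * wt ρ d k s (swAt q σ e) := by
      intro σ hσ
      have h1 : alw s (swAt q σ e) := by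
        rw [alw_iff]
        intro b' q' h
        by_cases hne : q' = q
        · rw [hne]; exact hs b'
        · rw [swAt_ne hne] at h
          exact (alw_iff _ _).1 ha b' q' h
      have h2 : kept s (swAt q σ e) = Function.update (kept s e) q false := by
        funext q'
        by_cases hne : q' = q
        · subst hne
          simp only [Function.update_self]
          by_contra hc
          have := ((kept_iff' _ _ _).1 (Bool.eq_true_of_not_eq_false hc)).2
          rw [swAt_same, he] at this
          simp at this
          exact hσ this
        · rw [Function.update_of_ne hne]
          apply bool_ext
          rw [kept_iff', kept_iff', swAt_ne hne]
      unfold wt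
      rw [if_pos ha, if_pos h1, h2]
      calc (Fg ρ d k (kept s e)) ^ ρ ≤ (8 * Fg ρ d k (Function.update (kept s e) q false)) ^ ρ :=
            Real.rpow_le_rpow (Fg_pos hρ _ _ _).le (Fg_update hρ hρ1 d k _ q) hρ.le
        _ = 8 ^ ρ * (Fg ρ d k (Function.update (kept s e) q false)) ^ ρ :=
            Real.mul_rpow (by norm_num) (Fg_pos hρ _ _ _).le
        _ ≤ _ := mul_le_mul_of_nonneg_right (eight_rpow hρ1) (Real.rpow_nonneg (Fg_pos hρ _ _ _).le _)
    have h1 := aux 1 (by decide)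
    have h2 := aux (-1) (by decide)
    linarith
  have hsum : ∀ σ : SignType, σ ≠ 0 → ∑ e, (if e q = 0 then wt ρ d k s (swAt q σ e) else 0) =
      ∑ e, if e q = σ then wt ρ d k s e else 0 := by
    intro σ hσ
    rw [← Equiv.sum_comp (swAt q σ) (fun e => if e q = σ then wt ρ d k s e else 0)]
    refine Finset.sum_congr rfl (fun e _ => ?_)
    have : swAt q σ e q = σ ↔ e q = 0 := by
      rw [swAt_same]
      rw [Equiv.swap_apply_eq_iff]; simp
    simp only [this]
  have htot : ∑ e, wt ρ d k s e * (if kept s e q then 1 else 0) + (∑ e, (if e q = 1 then wt ρ d k s e else 0) +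
     ∑ e, if e q = -1 then wt ρ d k s e else 0) ≤ ∑ e, wt ρ d k s e := by
    rw [← Finset.sum_add_distrib, ← Finset.sum_add_distrib]
    refine Finset.sum_le_sum (fun e _ => ?_)
    have h1 := wt_nonneg hρ d k s e
    by_cases hk : kept s e q = true
    · have he := ((kept_iff' _ _ _).1 hk).2
      rw [if_pos hk, if_neg (by rw [he]; decide), if_neg (by rw [he]; decide)]
      linarith
    · rw [if_neg hk]
      rcases SignType.trichotomy (e q) with h | h | h <;> simp [h] <;> exact h1
  have h5 := Finset.sum_le_sum (fun e (_ : e ∈ Finset.univ) => key e)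
  rw [Finset.sum_add_distrib, hsum 1 (by decide), hsum (-1) (by decide)] at h5
  have h6 : ∑ e, nu ρ d k s e * (if kept s e q then 1 else 0) =
      (∑ e, wt ρ d k s e * (if kept s e q then 1 else 0)) / Fg ρ (d+1) (k+1) s := by
    rw [Finset.sum_div]
    refine Finset.sum_congr rfl (fun e _ => ?_)
    rw [nu_eq_wt]; ring
  rw [h6, div_le_iff₀ (Fg_pos hρ _ _ _), Fg_eq_wt]
  linarith

lemma AL_half {ρ : ℝ} (hρ : 0 < ρ) (hρ1 : ρ < 1/3) (D i k : ℕ) (q : Cl k) :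
    ∑ s, AL ρ D (i+1) k s * (if s q then 1 else 0) ≤ 1/2 := by
  rw [AL_step]
  calc _ ≤ ∑ s, AL ρ D i (k+1) s * (1/2) :=
        Finset.sum_le_sum (fun s _ => mul_le_mul_of_nonneg_left (nu_kept_le hρ hρ1 _ _ _ _) (AL_nonneg hρ _ _ _ _))
    _ = 1/2 := by rw [← Finset.sum_mul, AL_sum hρ, one_mul]

end FKT

open Filter Topology
open scoped Classical
namespace FKT

def ssz {k : ℕ} (s : St k) : ℕ := (Finset.univ.filter (fun v => s v = true)).card

lemma alw_card {k : ℕ} (s : St (k+1)) : (Finset.univ.filter (fun e : Sg k => alw s e)).card ≤ 2 ^ ssz s := by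
  unfold ssz
  rw [← Finset.card_powerset]
  refine Finset.card_le_card_of_injOn
    (fun e => Finset.univ.filter (fun v : Cl (k+1) => e (Fin.tail v) = sgb (v 0))) ?_ ?_
  · intro e he
    have ha := (alw_iff _ _).1 (Finset.mem_filter.1 he).2
    simp only [Finset.coe_powerset, Set.mem_preimage, Set.mem_powerset_iff]
    intro v hv
    have hv := (Finset.mem_filter.1 hv).2
    refine Finset.mem_coe.2 (Finset.mem_filter.2 ⟨Finset.mem_univ _, ?_⟩)
    have := ha _ _ hv
    rwa [cns, Fin.cons_self_tail] at this
  · intro e _ e' _ h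
    funext q
    have h1 : ∀ b, e q = sgb b ↔ e' q = sgb b := by
      intro b
      have := Finset.ext_iff.1 h (cns b q)
      simpa [cns] using this
    have h0 := h1 false
    have h2 := h1 true
    revert h0 h2
    generalize e q = u; generalize e' q = v
    revert u v; decide

lemma entropy_le {X : Type*} [Fintype X] (p : X → ℝ) (hp : ∀ x, 0 ≤ p x) (h1 : ∑ x, p x = 1)
    (A : Finset X) (hA : ∀ x, x ∉ A → p x = 0) (N : ℝ) (hN : 0 < N) (hc : (A.card : ℝ) ≤ N) :
    -∑ x, p x * Real.log (p x) ≤ Real.log N := by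
  have key : ∀ x, -(p x * Real.log (p x)) ≤ p x * Real.log N + ((if x ∈ A then 1 / N else 0) - p x) := by
    intro x
    rcases (hp x).eq_or_lt with h | h
    · rw [← h]; simp; split_ifs <;> positivity
    · have hx : x ∈ A := by by_contra hc; rw [hA x hc] at h; exact lt_irrefl _ h
      rw [if_pos hx]
      have := Real.log_le_sub_one_of_pos (x := 1 / (p x * N)) (by positivity)
      rw [Real.log_div one_ne_zero (by positivity), Real.log_one, Real.log_mul h.ne' hN.ne'] at this
      have h2 := mul_le_mul_of_nonneg_left this h.le
      have h3 : p x * (1 / (p x * N) - 1) = 1 / N - p x := by field_simp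
      rw [h3] at h2
      linarith
  have := Finset.sum_le_sum (fun x (_ : x ∈ Finset.univ) => key x)
  rw [Finset.sum_neg_distrib, Finset.sum_add_distrib, ← Finset.sum_mul, h1, Finset.sum_sub_distrib, h1] at this
  have h4 : ∑ x, (if x ∈ A then 1 / N else 0) = A.card / N := by
    rw [Finset.sum_ite_mem]; simp; ring
  rw [h4] at this
  have h5 : (A.card : ℝ) / N ≤ 1 := (div_le_one hN).2 hc
  linarith

lemma et_nonneg {ρ : ℝ} (hρ : 0 < ρ) (D i : ℕ) (hi : i ≤ D) : 0 ≤ et ρ D i := by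
  have h := HU_bot hρ D i (D - i) hi (by omega)
  have h2 : 0 ≤ HU (AL ρ D i (D-i+1)) (nu ρ (D - i) (D-i)) ⊥ :=
    Finset.sum_nonneg (fun s _ => mul_nonneg (AL_nonneg hρ _ _ _ _)
      (ent_nonneg (nu_nonneg hρ _ _ _) (nu_sum hρ _ _ _) _))
  rw [h] at h2
  exact nonneg_of_mul_nonneg_left h2 (by positivity)

lemma et_le {ρ : ℝ} (hρ : 0 < ρ) (hρ1 : ρ < 1/3) (D i : ℕ) (hi : i + 1 ≤ D) : et ρ D (i+1) ≤ Real.log 2 := by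
  have h := HU_bot hρ D (i+1) (D - (i+1)) hi (by omega)
  set k := D - (i+1)
  have h2 : HU (AL ρ D (i+1) (k+1)) (nu ρ k k) ⊥ ≤ Real.log 2 * 2 ^ k := by
    unfold HU
    calc _ ≤ ∑ s, AL ρ D (i+1) (k+1) s * ((∑ v, if s v then 1 else 0) * Real.log 2) := by
          refine Finset.sum_le_sum (fun s _ => mul_le_mul_of_nonneg_left ?_ (AL_nonneg hρ _ _ _ _))
          rw [ent_bot]
          have := entropy_le (nu ρ k k s) (nu_nonneg hρ _ _ _) (nu_sum hρ _ _ _)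
            (Finset.univ.filter (fun e : Sg k => alw s e)) (fun e he => by
              unfold nu; rw [if_neg]; intro ha; exact he (Finset.mem_filter.2 ⟨Finset.mem_univ _, ha⟩))
            (2 ^ ssz s) (by positivity) (by exact_mod_cast alw_card s)
          refine this.trans_eq ?_
          rw [Real.log_pow]
          congr 1
          simp [ssz]
      _ = Real.log 2 * ∑ v, ∑ s, AL ρ D (i+1) (k+1) s * (if s v then 1 else 0) := by
          rw [Finset.sum_comm, Finset.mul_sum]
          refine Finset.sum_congr rfl (fun s _ => ?_)
          rw [← Finset.mul_sum]; ring
      _ ≤ Real.log 2 * ∑ v : Cl (k+1), (1/2 : ℝ) := by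
          refine mul_le_mul_of_nonneg_left (Finset.sum_le_sum (fun v _ => AL_half hρ hρ1 _ _ _ _)) (Real.log_nonneg (by norm_num))
      _ = _ := by
          simp [pow_succ]
  rw [h] at h2
  exact le_of_mul_le_mul_right h2 (by positivity)

lemma mi_last {ρ : ℝ} (hρ : 0 < ρ) (D : ℕ) : mi ρ D (D+1) ≤ Real.log 2 := by
  have e : mi ρ D (D+1) = ∑ s, AL ρ D (D+1) 0 s * Real.log (Fg ρ 0 0 s) := by
    unfold mi
    have : D + 1 - (D + 1) = 0 := by omega
    rw [this, pow_zero, div_one]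
    unfold mm
    rw [this]
  rw [e]
  calc _ ≤ ∑ s, AL ρ D (D+1) 0 s * Real.log 2 := by
        refine Finset.sum_le_sum (fun s _ => mul_le_mul_of_nonneg_left ?_ (AL_nonneg hρ _ _ _ _))
        refine Real.log_le_log (Fg_pos hρ _ _ _) ?_
        simp only [Fg]
        rw [Fintype.prod_unique]
        split_ifs <;> norm_num
    _ = _ := by rw [← Finset.sum_mul, AL_sum hρ, one_mul]

lemma mi_zero (ρ : ℝ) (D : ℕ) : mi ρ D 0 = Real.log (Fg ρ (D+1) (D+1) (fl (D+1))) / 2 ^ (D+1) := by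
  unfold mi mm
  simp [AL]
  rfl

lemma et_tele (ρ : ℝ) (D : ℕ) : ∀ n, ∑ i ∈ Finset.range n, (ρ/2)^i * et ρ D i = 2 * mi ρ D 0 - 2 * (ρ/2)^n * mi ρ D n
  | 0 => by simp
  | n+1 => by
    rw [Finset.sum_range_succ, et_tele ρ D n, et]
    ring

lemma et_sum {ρ : ℝ} (hρ : 0 < ρ) (D : ℕ) (a : ℕ → ℝ) (ha1 : a 1 = 2) (ha2 : a 2 = 2 + (2:ℝ) ^ ρ)
    (harec : ∀ j : ℕ, 3 ≤ j → a j = a (j-1) ^ 2 + a (j-1) ^ ρ - a (j-2) ^ (2*ρ)) :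
    Real.log (a (D+2)) / 2 ^ D - 2 * (ρ/2)^(D+1) * Real.log 2 ≤ ∑ i ∈ Finset.range (D+1), (ρ/2)^i * et ρ D i := by
  rw [et_tele, mi_zero, Fg_fl_eq hρ a ha1 ha2 harec (D+1)]
  have h : 2 * (ρ/2)^(D+1) * mi ρ D (D+1) ≤ 2 * (ρ/2)^(D+1) * Real.log 2 :=
    mul_le_mul_of_nonneg_left (mi_last hρ D) (by positivity)
  have h2 : 2 * (Real.log (a (D+1+1)) / 2 ^ (D+1)) = Real.log (a (D+2)) / 2 ^ D := by
    rw [pow_succ]; field_simp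
  rw [h2]; linarith

end FKT

open Filter Topology
open scoped Classical
namespace FKT

/-- lift of a permutation with fibrewise flips -/
def lf {k : ℕ} (f : Cl k → Bool) (π : Cl k ≃ Cl k) : Cl (k+1) ≃ Cl (k+1) where
  toFun v := cns (xor (v 0) (f (Fin.tail v))) (π (Fin.tail v))
  invFun v := cns (xor (v 0) (f (π.symm (Fin.tail v)))) (π.symm (Fin.tail v))
  left_inv v := by
    simp [cns]
  right_inv v := by
    simp [cns]

lemma lf_cns {k : ℕ} (f : Cl k → Bool) (π : Cl k ≃ Cl k) (b q) :
    lf f π (cns b q) = cns (xor b (f q)) (π q) := by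
  simp [lf, cns]

def flE {k : ℕ} (f : Cl k → Bool) (π : Cl k ≃ Cl k) (e : Sg k) : Sg k :=
  fun q => if f q = true then - e (π q) else e (π q)

def flEquiv {k : ℕ} (f : Cl k → Bool) (π : Cl k ≃ Cl k) : Sg k ≃ Sg k where
  toFun := flE f π
  invFun e := fun q => if f (π.symm q) = true then - e (π.symm q) else e (π.symm q)
  left_inv e := by
    funext q; simp only [flE]; split_ifs <;> simp
  right_inv e := by
    funext q; simp only [flE]; split_ifs <;> simp_all

def InvF (ρ : ℝ) (d k : ℕ) (π : Cl k ≃ Cl k) : Prop := ∀ s : St k, Fg ρ d k (fun q => s (π q)) = Fg ρ d k s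

lemma flE_sgb {k : ℕ} (f : Cl k → Bool) (π : Cl k ≃ Cl k) (e : Sg k) (b q) :
    flE f π e q = sgb b ↔ e (π q) = sgb (xor b (f q)) := by
  unfold flE
  generalize f q = u; generalize e (π q) = w
  revert u w b; decide

lemma flE_zero {k : ℕ} (f : Cl k → Bool) (π : Cl k ≃ Cl k) (e : Sg k) (q) :
    flE f π e q = 0 ↔ e (π q) = 0 := by
  unfold flE
  generalize f q = u; generalize e (π q) = w
  revert u w; decide

lemma alw_flE {k : ℕ} (f : Cl k → Bool) (π : Cl k ≃ Cl k) (s : St (k+1)) (e : Sg k) :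
    alw (fun v => s (lf f π v)) (flE f π e) ↔ alw s e := by
  rw [alw_iff, alw_iff]
  simp only [flE_sgb, lf_cns]
  constructor
  · intro h b q hq
    have := h (xor b (f (π.symm q))) (π.symm q)
    simp at this
    exact this hq
  · intro h b q hq
    exact h _ _ hq

lemma kept_flE {k : ℕ} (f : Cl k → Bool) (π : Cl k ≃ Cl k) (s : St (k+1)) (e : Sg k) :
    kept (fun v => s (lf f π v)) (flE f π e) = fun q => kept s e (π q) := by
  funext q
  apply bool_ext
  rw [kept_iff', kept_iff', flE_zero]
  refine and_congr_left fun _ => ?_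
  simp only [lf_cns]
  constructor
  · intro h b
    have := h (xor b (f q)); simpa using this
  · intro h b; exact h _

lemma wt_flE {ρ : ℝ} {d k : ℕ} (f : Cl k → Bool) {π : Cl k ≃ Cl k} (h : InvF ρ d k π) (s : St (k+1)) (e : Sg k) :
    wt ρ d k (fun v => s (lf f π v)) (flE f π e) = wt ρ d k s e := by
  unfold wt
  simp only [alw_flE, kept_flE, h (kept s e)]

lemma InvF_lift {ρ : ℝ} {d k : ℕ} (f : Cl k → Bool) {π : Cl k ≃ Cl k} (h : InvF ρ d k π) :
    InvF ρ (d+1) (k+1) (lf f π) := by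
  intro s
  rw [Fg_eq_wt, Fg_eq_wt, ← Equiv.sum_comp (flEquiv f π)]
  exact Finset.sum_congr rfl (fun e _ => wt_flE f h s e)

lemma nu_flE {ρ : ℝ} {d k : ℕ} (f : Cl k → Bool) {π : Cl k ≃ Cl k} (h : InvF ρ d k π) (s : St (k+1)) (e : Sg k) :
    nu ρ d k (fun v => s (lf f π v)) (flE f π e) = nu ρ d k s e := by
  rw [nu_eq_wt, nu_eq_wt, wt_flE f h, InvF_lift f h s]

def stE {k : ℕ} (σ : Cl k ≃ Cl k) : St k ≃ St k where
  toFun s v := s (σ v)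
  invFun s v := s (σ.symm v)
  left_inv s := by simp
  right_inv s := by simp

lemma AL_inv {ρ : ℝ} {D : ℕ} : ∀ i k (σ : Cl k ≃ Cl k), i ≤ D + 1 → InvF ρ (D + 1 - i) k σ → ∀ s,
    AL ρ D i k (fun v => s (σ v)) = AL ρ D i k s
  | 0, k, σ, _, _, s => by
    unfold AL
    have : ((fun v => s (σ v)) = fun _ => true) ↔ s = fun _ => true := by
      constructor
      · intro h; funext v
        have := congrFun h (σ.symm v); simpa using this
      · rintro rfl; rfl
    simp only [this]
  | i+1, k, σ, hi, hσ, s' => by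
    have hd : D + 1 - (i+1) = D - i := by omega
    rw [hd] at hσ
    have hl := InvF_lift (fun _ => false) hσ
    rw [AL, AL, ← Equiv.sum_comp (stE (lf (fun _ => false) σ))]
    refine Finset.sum_congr rfl (fun s _ => ?_)
    have h1 : AL ρ D i (k+1) (stE (lf (fun _ => false) σ) s) = AL ρ D i (k+1) s :=
      AL_inv i (k+1) (lf (fun _ => false) σ) (by omega) (by rw [show D + 1 - i = D - i + 1 by omega]; exact hl) s
    rw [h1, ← Equiv.sum_comp (flEquiv (fun _ => false) σ)]
    congr 1
    refine Finset.sum_congr rfl (fun e _ => ?_)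
    have h2 : nu ρ (D-i) k (stE (lf (fun _ => false) σ) s) (flEquiv (fun _ => false) σ e) = nu ρ (D-i) k s e :=
      nu_flE _ hσ s e
    have h3 : kept (stE (lf (fun _ => false) σ) s) (flEquiv (fun _ => false) σ e) = fun q => kept s e (σ q) :=
      kept_flE _ _ s e
    rw [h2, h3]
    have h4 : ((fun q => kept s e (σ q)) = fun v => s' (σ v)) ↔ kept s e = s' := by
      constructor
      · intro h; funext v
        have := congrFun h (σ.symm v); simpa using this
      · rintro rfl; rfl
    simp only [h4]

/-- translation -/
def xT {k : ℕ} (c : Cl k) : Cl k ≃ Cl k :=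
  Function.Involutive.toPerm (fun q j => xor (q j) (c j)) (by intro q; funext j; simp)

lemma xT_apply {k : ℕ} (c q : Cl k) (j) : xT c q j = xor (q j) (c j) := rfl

lemma InvF_xT (ρ : ℝ) : ∀ d k (c : Cl k), InvF ρ d k (xT c)
  | 0, k, c => by
    intro s; simp only [Fg]
    exact Equiv.prod_comp (xT c) (fun q => if s q = true then (2:ℝ) else 1)
  | d+1, 0, c => by intro s; simp only [Fg]
  | d+1, k+1, c => by
    have h : xT c = lf (fun _ => c 0) (xT (Fin.tail c)) := by
      ext v j
      refine Fin.cases ?_ (fun j => ?_) j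
      · simp [lf, cns, xT_apply]
      · simp [lf, cns, xT_apply, Fin.tail]
    rw [h]
    exact InvF_lift _ (InvF_xT ρ d k _)

lemma InvF_refl (ρ : ℝ) (d k) : InvF ρ d k (Equiv.refl _) := fun _ => rfl

theorem gibbs_codim {ρ : ℝ} (hρ : 0 < ρ) (D i k : ℕ) (hi : i ≤ D) (hk : D ≤ k + i)
    (U : Submodule ℝ (Cl k → ℝ)) :
    et ρ D i * ((2:ℝ) ^ k - Module.finrank ℝ U) ≤ HU (AL ρ D i (k+1)) (nu ρ (D - i) k) U := by
  have hcard : (Fintype.card (Cl k) : ℝ) = 2 ^ k := by simp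
  rw [← hcard]
  refine entropy_sym (AL_nonneg hρ _ _ _) (nu_nonneg hρ _ _) (nu_sum hρ _ _) ?_ ?_ _ ?_ U
  · intro q0
    refine ⟨stE (lf (fun q => decide (q = q0)) (Equiv.refl _)), fun s => ?_, fun s e => ?_⟩
    · refine AL_inv i (k+1) _ (by omega) ?_ s
      rw [show D + 1 - i = D - i + 1 by omega]
      exact InvF_lift _ (InvF_refl _ _ _)
    · have := nu_flE (d := D - i) (fun q => decide (q = q0)) (InvF_refl ρ (D-i) k) s e
      rw [← this]
      congr 1
      funext q
      simp [flE]
  · intro q q'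
    refine ⟨xT (fun j => xor (q j) (q' j)), ?_, stE (lf (fun _ => false) (xT (fun j => xor (q j) (q' j)))), fun s => ?_, fun s e => ?_⟩
    · funext j; simp [xT_apply]
    · refine AL_inv i (k+1) _ (by omega) ?_ s
      rw [show D + 1 - i = D - i + 1 by omega]
      exact InvF_lift _ (InvF_xT _ _ _ _)
    · have := nu_flE (d := D - i) (fun _ => false) (InvF_xT ρ (D-i) k (fun j => xor (q j) (q' j))) s e
      rw [← this]
      congr 1
  · rw [HU_bot hρ D i k hi hk, hcard]

end FKT

open Filter Topology
open scoped Classical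
namespace FKT

lemma geom_diff (x y : ℝ) (hx : 0 < x) (hxy : x < y) (hy : y < 1) (n : ℕ) :
    ∑ i ∈ Finset.range n, (y^i - x^i) ≤ (y - x) / ((1-y)*(1-x)) := by
  rw [Finset.sum_sub_distrib]
  have h1 : ∀ n, ∑ i ∈ Finset.range n, (y^i - x^i) ≤ (y - x) / ((1-y)*(1-x)) := by
    intro n
    have hs : Summable (fun i : ℕ => y^i - x^i) :=
      (summable_geometric_of_lt_one (hx.trans hxy).le hy).sub (summable_geometric_of_lt_one hx.le (hxy.trans hy))
    have := hs.sum_le_tsum (Finset.range n) (fun i _ => sub_nonneg.2 (pow_le_pow_left₀ hx.le hxy.le i))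
    refine this.trans_eq ?_
    rw [Summable.tsum_sub (summable_geometric_of_lt_one (hx.trans hxy).le hy) (summable_geometric_of_lt_one hx.le (hxy.trans hy)),
      tsum_geometric_of_lt_one (hx.trans hxy).le hy, tsum_geometric_of_lt_one hx.le (hxy.trans hy)]
    have : 1 - y ≠ 0 := by linarith
    have : 1 - x ≠ 0 := by linarith
    field_simp; ring
  have := h1 n
  rwa [Finset.sum_sub_distrib] at this

theorem numeric (ρ : ℝ) (hρ0 : 0 < ρ) (hρ1 : ρ < 1/3)
    (a : ℕ → ℝ) (ha1 : a 1 = 2) (ha2 : a 2 = 2 + (2:ℝ) ^ ρ)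
    (harec : ∀ j : ℕ, 3 ≤ j → a j = a (j-1) ^ 2 + a (j-1) ^ ρ - a (j-2) ^ (2*ρ))
    (hlim : Filter.Tendsto (fun j : ℕ => (2:ℝ) ^ ((j:ℝ) - 2) / Real.log (a j))
      Filter.atTop (nhds (1 - ρ/2))) (x : ℝ) (hx0 : 0 < x) (hx : x < ρ/2) :
    ∃ D : ℕ, ∃ δ : ℝ, 0 < δ ∧ 1 + δ ≤ (1 - x) * ∑ i ∈ Finset.range (D+1), x^i * et ρ D i := by
  set y := ρ/2 with hy
  have hy1 : y < 1 := by rw [hy]; linarith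
  have hl2 : Real.log 2 < 1 := by have := Real.log_two_lt_d9; linarith
  set δ := (1 - Real.log 2) * (y - x) / (2 * (1 - y)) with hδ
  have hδ0 : 0 < δ := by
    rw [hδ]; apply div_pos (mul_pos (by linarith) (by linarith)) (by linarith)
  have ht : Tendsto (fun D : ℕ => Real.log (a (D+2)) / 2 ^ D - 2 * y^(D+1) * Real.log 2) atTop (nhds ((1-y)⁻¹ - 2 * 0 * Real.log 2)) := by
    refine Tendsto.sub ?_ ?_
    · have h1 := (hlim.comp (tendsto_add_atTop_nat 2)).inv₀ (by linarith : (1:ℝ) - y ≠ 0)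
      refine h1.congr (fun D => ?_)
      simp only [Function.comp, inv_div]
      congr 1
      push_cast
      rw [add_sub_cancel_right, Real.rpow_natCast]
    · refine Tendsto.mul_const _ (Tendsto.const_mul _ ?_)
      exact (tendsto_pow_atTop_nhds_zero_of_lt_one (by rw [hy]; linarith) hy1).comp (tendsto_add_atTop_nat 1)
  simp only [mul_zero, zero_mul, sub_zero] at ht
  have hev := ht.eventually (lt_mem_nhds (show (1-y)⁻¹ - δ < (1-y)⁻¹ by linarith))
  obtain ⟨D, hD⟩ := hev.exists
  refine ⟨D, δ, hδ0, ?_⟩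
  have hs := et_sum hρ0 D a ha1 ha2 harec
  rw [← hy] at hs
  have h1 : ∑ i ∈ Finset.range (D+1), y^i * et ρ D i - ∑ i ∈ Finset.range (D+1), x^i * et ρ D i ≤
      Real.log 2 * ((y - x) / ((1-y)*(1-x))) := by
    rw [← Finset.sum_sub_distrib]
    calc _ ≤ ∑ i ∈ Finset.range (D+1), Real.log 2 * (y^i - x^i) := by
          refine Finset.sum_le_sum (fun i hi => ?_)
          rw [← sub_mul, mul_comm]
          rcases i with _ | i
          · simp
          · refine mul_le_mul_of_nonneg_right (et_le hρ0 hρ1 D i (by simpa using Finset.mem_range.1 hi)) ?_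
            exact sub_nonneg.2 (pow_le_pow_left₀ hx0.le hx.le _)
      _ ≤ _ := by
          rw [← Finset.mul_sum]
          exact mul_le_mul_of_nonneg_left (geom_diff x y hx0 hx hy1 _) (Real.log_nonneg (by norm_num))
  have h2 : (1-y)⁻¹ - δ - Real.log 2 * ((y - x) / ((1-y)*(1-x))) ≤ ∑ i ∈ Finset.range (D+1), x^i * et ρ D i := by linarith
  have h3 : (0:ℝ) < 1 - x := by linarith
  have h4 : (0:ℝ) < 1 - y := by linarith
  have h5 := mul_le_mul_of_nonneg_left h2 h3.le
  refine le_trans ?_ h5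
  have h6 : (1 - x) * ((1-y)⁻¹ - δ - Real.log 2 * ((y - x) / ((1-y)*(1-x)))) =
     1 + 2 * δ - (1 - x) * δ := by
    rw [hδ]; field_simp; ring
  rw [h6]
  nlinarith
end FKT

open Filter Topology
open scoped Classical
namespace FKT

/-! Collision part -/

theorem sum_cons {α : Type} [Fintype α] {n : ℕ} (f : (Fin (n+1) → α) → ℝ) :
    ∑ a, f a = ∑ x, ∑ a : Fin n → α, f (Fin.cons x a) := by
  rw [← (Fin.consEquiv (fun _ : Fin (n+1) => α)).sum_comp, Fintype.sum_prod_type]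
  rfl

noncomputable def wp {α : Type} (w : ℕ → α → ℝ) (t n : ℕ) (a : Fin n → α) : ℝ :=
  ∏ i : Fin n, w (t + (i : ℕ)) (a i)

theorem wp_cons {α : Type} (w : ℕ → α → ℝ) (t n : ℕ) (x : α) (a : Fin n → α) :
    wp w t (n+1) (Fin.cons x a : Fin (n+1) → α) = w t x * wp w (t+1) n a := by
  unfold wp
  rw [Fin.prod_univ_succ]
  simp only [Fin.cons_zero, Fin.cons_succ, Fin.val_zero, add_zero, Fin.val_succ]
  congr 1
  apply Finset.prod_congr rfl
  intro i _
  congr 1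
  ring

theorem wp_zero {α : Type} (w : ℕ → α → ℝ) (t : ℕ) (a : Fin 0 → α) : wp w t 0 a = 1 := by
  simp [wp]

theorem wp_nonneg {α : Type} {w : ℕ → α → ℝ} (hw : ∀ c x, 0 ≤ w c x) (t n : ℕ) (a : Fin n → α) :
    0 ≤ wp w t n a := Finset.prod_nonneg fun _ _ => hw _ _

theorem wp_sum_le {α : Type} [Fintype α] {w : ℕ → α → ℝ} (hw : ∀ c x, 0 ≤ w c x)
    (h1 : ∀ c, ∑ x, w c x ≤ 1) (n : ℕ) : ∀ t, ∑ a, wp w t n a ≤ 1 := by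
  induction n with
  | zero => intro t; simp [wp]
  | succ n ih =>
    intro t
    rw [sum_cons]
    simp only [wp_cons]
    simp only [← Finset.mul_sum]
    rw [← Finset.sum_mul]
    exact mul_le_one₀ (h1 t) (Finset.sum_nonneg fun a _ => wp_nonneg hw _ _ _) (ih _)

theorem wp_sum {α : Type} [Fintype α] {w : ℕ → α → ℝ}
    (h1 : ∀ c, ∑ x, w c x = 1) (n : ℕ) : ∀ t, ∑ a, wp w t n a = 1 := by
  induction n with
  | zero => intro t; simp [wp]
  | succ n ih =>
    intro t
    rw [sum_cons]
    simp only [wp_cons, ← Finset.mul_sum]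
    rw [← Finset.sum_mul, ih, h1, one_mul]

theorem rpow_sum_le' {ι : Type} (s : Finset ι) (f : ι → ℝ) (hf : ∀ i ∈ s, 0 ≤ f i) {θ : ℝ}
    (h0 : 0 < θ) (h1 : θ ≤ 1) : (∑ i ∈ s, f i) ^ θ ≤ ∑ i ∈ s, f i ^ θ := by
  induction s using Finset.induction_on with
  | empty => simp [Real.zero_rpow h0.ne']
  | insert i s hi ih =>
    rw [Finset.sum_insert hi, Finset.sum_insert hi]
    have h2 : 0 ≤ ∑ i ∈ s, f i := Finset.sum_nonneg fun j hj => hf j (Finset.mem_insert_of_mem hj)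
    have h3 := ih fun j hj => hf j (Finset.mem_insert_of_mem hj)
    have := Real.rpow_add_le_add_rpow (hf i (Finset.mem_insert_self _ _)) h2 h0.le h1
    linarith

/-- concavity: sub-probability Jensen for `t ^ θ`. -/
theorem jensen_rpow {ι : Type} [Fintype ι] (w f : ι → ℝ) (hw : ∀ i, 0 ≤ w i) (hw1 : ∑ i, w i ≤ 1)
    (hf : ∀ i, 0 ≤ f i) {θ : ℝ} (h0 : 0 < θ) (h1 : θ ≤ 1) :
    ∑ i, w i * f i ^ θ ≤ (∑ i, w i * f i) ^ θ := by
  have hc := (Real.concaveOn_rpow h0.le h1)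
  let w' : Option ι → ℝ := fun o => o.elim (1 - ∑ i, w i) w
  let f' : Option ι → ℝ := fun o => o.elim 0 f
  have := hc.le_map_sum (t := Finset.univ) (w := w') (p := f') ?_ ?_ ?_
  · simpa [Fintype.sum_option, w', f', Real.zero_rpow h0.ne'] using this
  · intro o _; cases o with
    | none => simp [w', hw1]
    | some i => simp [w', hw i]
  · simp [Fintype.sum_option, w']
  · intro o _; cases o with
    | none => simp [f']
    | some i => simp [f', hf i]

section AC
variable {X : Type} [NormedAddCommGroup X] [NormedSpace ℝ X] [FiniteDimensional ℝ X]

noncomputable def fr (U : Submodule ℝ X) : ℕ := Module.finrank ℝ U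

noncomputable def sp {n : ℕ} (Δ : Fin n → X) : Submodule ℝ X := Submodule.span ℝ (Set.range Δ)

theorem sp_cons {n : ℕ} (d : X) (Δ : Fin n → X) :
    sp (Fin.cons d Δ : Fin (n+1) → X) = Submodule.span ℝ {d} ⊔ sp Δ := by
  unfold sp
  rw [Fin.range_cons, Submodule.span_insert]

noncomputable def Zt (a : ℝ) : (n : ℕ) → (Fin n → X) → ℝ
  | 0, _ => 1
  | n+1, Δ => Real.exp (-a * fr (sp (Fin.tail Δ))) * Zt a n (Fin.tail Δ)

theorem Zt_nonneg (a : ℝ) : ∀ (n : ℕ) (Δ : Fin n → X), 0 ≤ Zt a n Δ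
  | 0, _ => by simp [Zt]
  | n+1, Δ => by rw [Zt]; exact mul_nonneg (Real.exp_nonneg _) (Zt_nonneg a n _)

theorem Zt_cons (a : ℝ) {n : ℕ} (d : X) (Δ : Fin n → X) :
    Zt a (n+1) (Fin.cons d Δ : Fin (n+1) → X) = Real.exp (-a * fr (sp Δ)) * Zt a n Δ := by
  rw [Zt, Fin.tail_cons]

/-- uniform functionals -/
def FunBd (𝒟 : Set X) (Λ : ℝ) : Prop :=
  ∀ n (Δ : Fin n → X), (∀ i, Δ i ∈ 𝒟) → ∀ d ∈ 𝒟, d ∉ sp Δ →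
    ∃ φ : X →ₗ[ℝ] ℝ, (∀ i, φ (Δ i) = 0) ∧ φ d = 1 ∧ ∀ v, ‖v‖ ≤ 1 → |φ v| ≤ Λ

theorem exists_funBd (𝒟 : Set X) (h𝒟 : 𝒟.Finite) : ∃ Λ, 0 ≤ Λ ∧ FunBd 𝒟 Λ := by
  have key : ∀ (q : 𝒟.powerset × 𝒟), ∃ Λ : ℝ, 0 ≤ Λ ∧
      ((q.2 : X) ∉ Submodule.span ℝ (q.1 : Set X) →
      ∃ φ : X →ₗ[ℝ] ℝ, (∀ v ∈ (q.1 : Set X), φ v = 0) ∧ φ q.2 = 1 ∧ ∀ v, ‖v‖ ≤ 1 → |φ v| ≤ Λ) := by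
    intro q
    by_cases h : (q.2 : X) ∈ Submodule.span ℝ (q.1 : Set X)
    · exact ⟨0, le_rfl, fun h' => absurd h h'⟩
    obtain ⟨φ, hφ, hφ0⟩ := Submodule.exists_dual_map_eq_bot_of_notMem h inferInstance
    let ψ : X →ₗ[ℝ] ℝ := (φ q.2)⁻¹ • φ
    refine ⟨‖LinearMap.toContinuousLinearMap ψ‖, norm_nonneg _, fun _ => ⟨ψ, ?_, ?_, ?_⟩⟩
    · intro v hv
      have : φ v ∈ (Submodule.span ℝ (q.1 : Set X)).map φ :=
        ⟨v, Submodule.subset_span hv, rfl⟩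
      rw [hφ0] at this
      simp only [Submodule.mem_bot] at this
      simp [ψ, this]
    · simp [ψ, inv_mul_cancel₀ hφ]
    · intro v hv
      have := (LinearMap.toContinuousLinearMap ψ).le_opNorm v
      rw [Real.norm_eq_abs] at this
      calc |ψ v| ≤ _ := this
        _ ≤ _ := mul_le_of_le_one_right (norm_nonneg _) hv
  choose Λ hΛ0 hΛ using key
  have : Finite (𝒟.powerset × 𝒟) := by
    have h1 : Finite 𝒟.powerset := h𝒟.finite_subsets
    have h2 : Finite 𝒟 := h𝒟
    infer_instance
  have := Fintype.ofFinite (𝒟.powerset × 𝒟)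
  refine ⟨∑ q, Λ q, Finset.sum_nonneg fun q _ => hΛ0 q, ?_⟩
  intro n Δ hΔ d hd hn
  obtain ⟨φ, h1, h2, h3⟩ := hΛ (⟨Set.range Δ, by rintro _ ⟨i, rfl⟩; exact hΔ i⟩, ⟨d, hd⟩) hn
  refine ⟨φ, fun i => h1 _ ⟨i, rfl⟩, h2, fun v hv => (h3 v hv).trans ?_⟩
  exact Finset.single_le_sum (f := Λ) (fun q _ => hΛ0 q) (Finset.mem_univ _)

theorem AC {J : Type} [Fintype J] (u : ℕ → J → ℝ) (y : J → ℝ) (a C2 Λ : ℝ)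
    (hu : ∀ c x, 0 ≤ u c x) (hu1 : ∀ c, ∑ x, u c x ≤ 1) (hC : 1 ≤ C2)
    (hball : ∀ c z, ∑ x, (if |y x - z| ≤ Λ then u c x else 0) ≤ C2 * Real.exp (-a * c))
    (𝒟 : Set X) (hΛ : FunBd 𝒟 Λ) (n : ℕ) :
    ∀ t (Δ : Fin n → X), (∀ i, Δ i ∈ 𝒟) → ∀ z : X,
    ∑ p, wp u t n p * (if ‖z + ∑ i, y (p i) • Δ i‖ ≤ 1 then 1 else 0)
      ≤ C2 ^ fr (sp Δ) * Real.exp (-a * t * fr (sp Δ)) * Zt a n Δ := by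
  induction n with
  | zero =>
    intro t Δ _ z
    have : fr (sp Δ) = 0 := by
      unfold sp fr
      rw [Set.range_eq_empty]; simp
    rw [this]
    simp [wp, Zt]
    split_ifs <;> norm_num
  | succ n ih =>
    intro t Δ hΔ z
    obtain ⟨d, Δ', rfl⟩ : ∃ d Δ', Δ = Fin.cons d Δ' := ⟨Δ 0, Fin.tail Δ, (Fin.cons_self_tail Δ).symm⟩
    have hd : d ∈ 𝒟 := by simpa using hΔ 0
    have hΔ' : ∀ i, Δ' i ∈ 𝒟 := fun i => by simpa using hΔ i.succ
    rw [sum_cons]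
    have e1 : ∀ (x : J) (p : Fin n → J), wp u t (n+1) (Fin.cons x p : Fin (n+1) → J) *
        (if ‖z + ∑ i, y ((Fin.cons x p : Fin (n+1) → J) i) • (Fin.cons d Δ' : Fin (n+1) → X) i‖ ≤ 1
          then (1:ℝ) else 0) =
        u t x * (wp u (t+1) n p * (if ‖(z + y x • d) + ∑ i, y (p i) • Δ' i‖ ≤ 1 then 1 else 0)) := by
      intro x p
      rw [wp_cons, Fin.sum_univ_succ]
      simp only [Fin.cons_zero, Fin.cons_succ]
      rw [add_assoc, mul_assoc]
    simp only [e1, ← Finset.mul_sum]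
    set B := C2 ^ fr (sp Δ') * Real.exp (-a * ((t+1 : ℕ):ℝ) * fr (sp Δ')) * Zt a n Δ' with hB
    have hB0 : 0 ≤ B := by
      have := Zt_nonneg a n Δ'
      positivity
    rw [Zt_cons, sp_cons]
    by_cases hmem : d ∈ sp Δ'
    · have e2 : Submodule.span ℝ {d} ⊔ sp Δ' = sp Δ' := by
        rw [sup_eq_right, Submodule.span_singleton_le_iff_mem]; exact hmem
      rw [e2]
      calc _ ≤ ∑ x, u t x * B := Finset.sum_le_sum fun x _ =>
            mul_le_mul_of_nonneg_left (ih (t+1) Δ' hΔ' _) (hu _ _)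
        _ ≤ B := by
            rw [← Finset.sum_mul]; exact mul_le_of_le_one_left hB0 (hu1 t)
        _ = _ := by
            rw [hB]
            have : Real.exp (-a * ((t+1 : ℕ):ℝ) * fr (sp Δ')) =
              Real.exp (-a * t * fr (sp Δ')) * Real.exp (-a * fr (sp Δ')) := by
              rw [← Real.exp_add]; congr 1; push_cast; ring
            rw [this]; ring
    · obtain ⟨φ, h1, h2, h3⟩ := hΛ n Δ' hΔ' d hd hmem
      have hfr : fr (Submodule.span ℝ {d} ⊔ sp Δ') = fr (sp Δ') + 1 := by
        unfold fr
        have hd0 : d ≠ 0 := fun h => hmem (h ▸ Submodule.zero_mem _)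
        have hinf : Submodule.span ℝ {d} ⊓ sp Δ' = ⊥ := by
          rw [← disjoint_iff]
          exact (Submodule.disjoint_span_singleton_of_notMem hmem).symm
        have := Submodule.finrank_sup_add_finrank_inf_eq (Submodule.span ℝ {d}) (sp Δ')
        rw [hinf, finrank_bot, finrank_span_singleton hd0] at this
        omega
      rw [hfr]
      have key : ∀ x, u t x * ∑ p, (wp u (t+1) n p *
          (if ‖(z + y x • d) + ∑ i, y (p i) • Δ' i‖ ≤ 1 then (1:ℝ) else 0)) ≤
          (if |y x - (- φ z)| ≤ Λ then u t x else 0) * B := by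
        intro x
        split_ifs with hx
        · exact mul_le_mul_of_nonneg_left (ih (t+1) Δ' hΔ' _) (hu _ _)
        · rw [zero_mul]
          apply le_of_eq
          rw [Finset.sum_eq_zero, mul_zero]
          intro p _
          rw [if_neg, mul_zero]
          intro hn
          apply hx
          have := h3 _ hn
          simp only [map_add, map_smul, map_sum, h1, h2, smul_eq_mul, mul_zero, mul_one,
            Finset.sum_const_zero, add_zero] at this
          rwa [sub_neg_eq_add, add_comm]
      calc _ ≤ ∑ x, (if |y x - (- φ z)| ≤ Λ then u t x else 0) * B := Finset.sum_le_sum fun x _ => key x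
        _ ≤ (C2 * Real.exp (-a * t)) * B := by
            rw [← Finset.sum_mul]; exact mul_le_mul_of_nonneg_right (hball _ _) hB0
        _ = _ := by
            rw [hB]
            have : Real.exp (-a * ((t+1 : ℕ):ℝ) * fr (sp Δ')) =
              Real.exp (-a * t * fr (sp Δ')) * Real.exp (-a * fr (sp Δ')) := by
              rw [← Real.exp_add]; congr 1; push_cast; ring
            have h' : Real.exp (-a * t * ((fr (sp Δ') + 1 : ℕ) : ℝ)) =
              Real.exp (-a * t * fr (sp Δ')) * Real.exp (-a * t) := by
              rw [← Real.exp_add]; congr 1; push_cast; ring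
            rw [this, h']; ring

end AC
end FKT

open Filter Topology
open scoped Classical
namespace FKT

section GG
variable {X : Type} [NormedAddCommGroup X] [NormedSpace ℝ X] [FiniteDimensional ℝ X]
  {E : Type} [Fintype E]

/-- difference sequences -/
def dl (vec : E → X) {n : ℕ} (s : Fin n → Bool × E) (e' : Fin n → E) : Fin n → X :=
  fun i => if (s i).1 then vec (s i).2 - vec (e' i) else 0

theorem dl_cons (vec : E → X) {n : ℕ} (x : Bool × E) (s : Fin n → Bool × E) (x' : E) (e' : Fin n → E) :
    dl vec (Fin.cons x s : Fin (n+1) → Bool × E) (Fin.cons x' e' : Fin (n+1) → E) =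
    (Fin.cons (if x.1 then vec x.2 - vec x' else 0) (dl vec s e') : Fin (n+1) → X) := by
  funext i
  refine Fin.cases ?_ (fun i => ?_) i
  · simp [dl]
  · simp [dl]

noncomputable def Ff (a : ℝ) (vec : E → X) (m : ℕ → E → ℝ) (t n : ℕ) (s : Fin n → Bool × E)
    (U : Submodule ℝ X) : ℝ :=
  ∑ e' : Fin n → E, wp m t n e' * (if sp (dl vec s e') = U then Zt a n (dl vec s e') else 0)

noncomputable def wB (π : ℕ → ℝ) (m : ℕ → E → ℝ) (c : ℕ) (x : Bool × E) : ℝ :=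
  (if x.1 then π c else 1 - π c) * m c x.2

noncomputable def Gf (a θ : ℝ) (vec : E → X) (π : ℕ → ℝ) (m : ℕ → E → ℝ) (t n : ℕ)
    (U : Submodule ℝ X) : ℝ :=
  ∑ s : Fin n → Bool × E, wp (wB π m) t n s * (Ff a vec m t n s U) ^ θ

noncomputable def Mf (θ : ℝ) (vec : E → X) (π : ℕ → ℝ) (m : ℕ → E → ℝ) (t : ℕ)
    (U : Submodule ℝ X) : ℝ :=
  (1 - π t) + π t * ∑ x, m t x * (∑ x', if vec x - vec x' ∈ U then m t x' else 0) ^ θ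

variable {a θ : ℝ} {vec : E → X} {π : ℕ → ℝ} {m : ℕ → E → ℝ} {𝒰 : Finset (Submodule ℝ X)}

theorem Ff_nonneg (hm : ∀ c x, 0 ≤ m c x) (t n : ℕ) (s : Fin n → Bool × E)
    (U : Submodule ℝ X) : 0 ≤ Ff a vec m t n s U := by
  refine Finset.sum_nonneg fun e' _ => mul_nonneg (wp_nonneg hm _ _ _) ?_
  split_ifs
  · exact Zt_nonneg _ _ _
  · exact le_rfl

theorem wB_nonneg (hm : ∀ c x, 0 ≤ m c x) (h0 : ∀ c, 0 ≤ π c) (h1 : ∀ c, π c ≤ 1) (c : ℕ)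
    (x : Bool × E) : 0 ≤ wB π m c x := by
  refine mul_nonneg ?_ (hm _ _)
  split_ifs
  · exact h0 c
  · linarith [h1 c]

theorem Gf_nonneg (hm : ∀ c x, 0 ≤ m c x) (h0 : ∀ c, 0 ≤ π c) (h1 : ∀ c, π c ≤ 1) (t n : ℕ)
    (U : Submodule ℝ X) : 0 ≤ Gf a θ vec π m t n U :=
  Finset.sum_nonneg fun s _ => mul_nonneg (wp_nonneg (wB_nonneg hm h0 h1) _ _ _)
    (Real.rpow_nonneg (Ff_nonneg hm _ _ _ _) _)

/-- differences used -/
def DD (vec : E → X) : Set X := insert 0 {v | ∃ e e', v = vec e - vec e'}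

theorem DD_finite (vec : E → X) : (DD vec).Finite := by
  refine Set.Finite.insert _ ?_
  have : {v | ∃ e e', v = vec e - vec e'} = Set.range (fun q : E × E => vec q.1 - vec q.2) := by
    ext v; constructor
    · rintro ⟨e, e', rfl⟩; exact ⟨(e, e'), rfl⟩
    · rintro ⟨q, rfl⟩; exact ⟨q.1, q.2, rfl⟩
  rw [this]; exact Set.finite_range _

theorem dl_mem (vec : E → X) {n : ℕ} (s : Fin n → Bool × E) (e' : Fin n → E) (i : Fin n) :
    dl vec s e' i ∈ DD vec := by
  unfold dl
  split_ifs
  · exact Or.inr ⟨_, _, rfl⟩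
  · exact Or.inl rfl

/-- The finite set of relevant subspaces -/
noncomputable def UU (vec : E → X) : Finset (Submodule ℝ X) :=
  (DD_finite vec).toFinset.powerset.image (fun s : Finset X => Submodule.span ℝ (s : Set X))

theorem sp_mem_UU (vec : E → X) {n : ℕ} (s : Fin n → Bool × E) (e' : Fin n → E) :
    sp (dl vec s e') ∈ UU vec := by
  unfold UU
  rw [Finset.mem_image]
  refine ⟨(Set.finite_range (dl vec s e')).toFinset, ?_, ?_⟩
  · rw [Finset.mem_powerset]
    intro v hv
    rw [Set.Finite.mem_toFinset] at hv ⊢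
    obtain ⟨i, rfl⟩ := hv
    exact dl_mem _ _ _ _
  · simp [sp]

theorem Ff_step (hm : ∀ c x, 0 ≤ m c x) (t n : ℕ) (x : Bool × E) (s : Fin n → Bool × E)
    (U : Submodule ℝ X) :
    Ff a vec m t (n+1) (Fin.cons x s : Fin (n+1) → Bool × E) U ≤
    (∑ x', if (if x.1 then vec x.2 - vec x' else 0) ∈ U then m t x' else 0) *
      ∑ U' ∈ (UU vec).filter (· ≤ U), Real.exp (-a * fr U') * Ff a vec m (t+1) n s U' := by
  have e0 : Ff a vec m t (n+1) (Fin.cons x s : Fin (n+1) → Bool × E) U =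
      ∑ x', ∑ e' : Fin n → E, m t x' * (wp m (t+1) n e' *
        (if Submodule.span ℝ {(if x.1 then vec x.2 - vec x' else 0)} ⊔ sp (dl vec s e') = U then
          Real.exp (-a * fr (sp (dl vec s e'))) * Zt a n (dl vec s e') else 0)) := by
    unfold Ff
    rw [sum_cons]
    simp only [wp_cons, dl_cons, sp_cons, Zt_cons, mul_assoc]
  rw [e0, Finset.sum_mul]
  apply Finset.sum_le_sum
  intro x' _
  set d := (if x.1 then vec x.2 - vec x' else 0) with hd
  unfold Ff
  rw [← Finset.mul_sum]
  by_cases hdU : d ∈ U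
  · rw [if_pos hdU]
    apply mul_le_mul_of_nonneg_left _ (hm _ _)
    simp only [Finset.mul_sum]
    rw [Finset.sum_comm]
    apply Finset.sum_le_sum
    intro e' _
    by_cases h : Submodule.span ℝ {d} ⊔ sp (dl vec s e') = U
    · rw [if_pos h]
      have hle : sp (dl vec s e') ≤ U := h ▸ le_sup_right
      have hmem : sp (dl vec s e') ∈ (UU vec).filter (· ≤ U) :=
        Finset.mem_filter.2 ⟨sp_mem_UU _ _ _, hle⟩
      refine le_trans (le_of_eq ?_) (Finset.single_le_sum
        (f := fun U' => Real.exp (-a * fr U') * (wp m (t+1) n e' *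
        (if sp (dl vec s e') = U' then Zt a n (dl vec s e') else 0))) ?_ hmem)
      · simp only [if_true]; ring
      · intro U' _
        refine mul_nonneg (Real.exp_nonneg _) (mul_nonneg (wp_nonneg hm _ _ _) ?_)
        split_ifs
        · exact Zt_nonneg _ _ _
        · exact le_rfl
    · rw [if_neg h, mul_zero]
      refine Finset.sum_nonneg fun U' _ => ?_
      refine mul_nonneg (Real.exp_nonneg _) (mul_nonneg (wp_nonneg hm _ _ _) ?_)
      split_ifs
      · exact Zt_nonneg _ _ _
      · exact le_rfl
  · rw [if_neg hdU, zero_mul]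
    apply le_of_eq
    rw [Finset.sum_eq_zero, mul_zero]
    intro e' _
    rw [if_neg, mul_zero]
    intro h
    exact hdU (h ▸ (le_sup_left : Submodule.span ℝ {d} ≤ _) (Submodule.mem_span_singleton_self d))

theorem Gf_step (hm : ∀ c x, 0 ≤ m c x) (hm1 : ∀ c, ∑ x, m c x = 1)
    (h0 : ∀ c, 0 ≤ π c) (h1 : ∀ c, π c ≤ 1) (hθ : 0 < θ) (hθ1 : θ ≤ 1) (t n : ℕ)
    (U : Submodule ℝ X) :
    Gf a θ vec π m t (n+1) U ≤ Mf θ vec π m t U *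
      ∑ U' ∈ (UU vec).filter (· ≤ U), Real.exp (-a * θ * fr U') * Gf a θ vec π m (t+1) n U' := by
  have hS : ∀ x : Bool × E, 0 ≤ (∑ x', if (if x.1 then vec x.2 - vec x' else 0) ∈ U then m t x' else 0) :=
    fun x => Finset.sum_nonneg fun x' _ => by split_ifs <;> first | exact hm _ _ | exact le_rfl
  have step : ∀ (x : Bool × E) (s : Fin n → Bool × E),
      wp (wB π m) t (n+1) (Fin.cons x s : Fin (n+1) → Bool × E) *
        (Ff a vec m t (n+1) (Fin.cons x s : Fin (n+1) → Bool × E) U) ^ θ ≤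
      (wB π m t x * (∑ x', if (if x.1 then vec x.2 - vec x' else 0) ∈ U then m t x' else 0) ^ θ) *
      (wp (wB π m) (t+1) n s * ∑ U' ∈ (UU vec).filter (· ≤ U), Real.exp (-a * θ * fr U') *
        (Ff a vec m (t+1) n s U') ^ θ) := by
    intro x s
    rw [wp_cons]
    have hb := Ff_step (a := a) (vec := vec) hm t n x s U
    have h2 := Real.rpow_le_rpow (Ff_nonneg hm _ _ _ _) hb hθ.le
    have hT : ∀ U' ∈ (UU vec).filter (· ≤ U), 0 ≤ Real.exp (-a * fr U') * Ff a vec m (t+1) n s U' :=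
      fun U' _ => mul_nonneg (Real.exp_nonneg _) (Ff_nonneg hm _ _ _ _)
    rw [Real.mul_rpow (hS x) (Finset.sum_nonneg hT)] at h2
    have h3 := rpow_sum_le' _ _ hT hθ hθ1
    have h4 : ∀ U', (Real.exp (-a * fr U') * Ff a vec m (t+1) n s U') ^ θ =
        Real.exp (-a * θ * fr U') * (Ff a vec m (t+1) n s U') ^ θ := by
      intro U'
      rw [Real.mul_rpow (Real.exp_nonneg _) (Ff_nonneg hm _ _ _ _), ← Real.exp_mul]
      congr 2; ring
    simp only [h4] at h3
    have w1 := wB_nonneg hm h0 h1 t x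
    have w2 := wp_nonneg (wB_nonneg hm h0 h1) (t+1) n s
    calc _ ≤ wB π m t x * wp (wB π m) (t+1) n s * _ :=
          mul_le_mul_of_nonneg_left (h2.trans (mul_le_mul_of_nonneg_left h3
            (Real.rpow_nonneg (hS x) _))) (mul_nonneg w1 w2)
      _ = _ := by ring
  unfold Gf
  rw [sum_cons]
  calc _ ≤ ∑ x : Bool × E, ∑ s : Fin n → Bool × E,
      (wB π m t x * (∑ x', if (if x.1 then vec x.2 - vec x' else 0) ∈ U then m t x' else 0) ^ θ) *
      (wp (wB π m) (t+1) n s * ∑ U' ∈ (UU vec).filter (· ≤ U), Real.exp (-a * θ * fr U') *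
        (Ff a vec m (t+1) n s U') ^ θ) :=
        Finset.sum_le_sum fun x _ => Finset.sum_le_sum fun s _ => step x s
    _ = _ := by
      rw [← Finset.sum_mul_sum]
      congr 1
      · rw [Fintype.sum_prod_type]
        simp only [Fintype.sum_bool, wB, if_true, Bool.false_eq_true, if_false, Submodule.zero_mem]
        rw [hm1]
        simp only [Real.one_rpow, mul_one, mul_assoc, ← Finset.mul_sum]
        rw [hm1, Mf]; ring
      · simp only [Finset.mul_sum]
        rw [Finset.sum_comm]
        apply Finset.sum_congr rfl; intro U' _
        apply Finset.sum_congr rfl; intro s _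
        ring

theorem Gf_zero_of (hθ : 0 < θ) (V : ℕ → Submodule ℝ X) (hV : ∀ c c', c ≤ c' → V c' ≤ V c)
    (hs : ∀ c x, m c x ≠ 0 → vec x ∈ V c) (t n : ℕ)
    (U : Submodule ℝ X) (hU : ¬ U ≤ V t) : Gf a θ vec π m t n U = 0 := by
  apply Finset.sum_eq_zero
  intro s _
  by_cases hw : wp (wB π m) t n s = 0
  · rw [hw, zero_mul]
  have : Ff a vec m t n s U = 0 := by
    apply Finset.sum_eq_zero
    intro e' _
    by_cases hw' : wp m t n e' = 0
    · rw [hw', zero_mul]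
    rw [if_neg, mul_zero]
    intro h
    apply hU
    rw [← h, sp, Submodule.span_le]
    rintro _ ⟨i, rfl⟩
    unfold dl
    have h1 : m (t + i) (s i).2 ≠ 0 := by
      intro h; apply hw
      exact Finset.prod_eq_zero (Finset.mem_univ i) (by simp [wB, h])
    have h2 : m (t + i) (e' i) ≠ 0 := by
      intro h; apply hw'
      exact Finset.prod_eq_zero (Finset.mem_univ i) h
    split_ifs
    · exact Submodule.sub_mem _ (hV _ _ (Nat.le_add_right _ _) (hs _ _ h1))
        (hV _ _ (Nat.le_add_right _ _) (hs _ _ h2))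
    · exact Submodule.zero_mem _
  rw [this, Real.zero_rpow hθ.ne', mul_zero]

theorem Gf_base_le (hθ : 0 < θ) (t : ℕ) (U : Submodule ℝ X) : Gf a θ vec π m t 0 U ≤ 1 := by
  unfold Gf Ff
  simp only [wp_zero, Finset.univ_unique, Finset.sum_singleton, one_mul, Zt]
  split_ifs
  · simp
  · simp [Real.zero_rpow hθ.ne']

end GG
end FKT

open Filter Topology
open scoped Classical
namespace FKT

section PT
variable {X : Type} [NormedAddCommGroup X] [NormedSpace ℝ X] [FiniteDimensional ℝ X]
  {E : Type} [Fintype E] {ι : Type} [Fintype ι]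

/-- partial drift -/
noncomputable def sj (a θ : ℝ) (μ : ℕ → ι → ℝ) (N : ι → ℕ) (j : ι) (t : ℕ) : ℝ :=
  ∑ c ∈ Finset.Ico t (N j), (μ c j - a * θ)

noncomputable def dv (d N : ι → ℕ) (c : ℕ) : ℝ := ∑ j, if c < N j then (d j : ℝ) else 0

noncomputable def epsf (lam K1 : ℝ) (N : ι → ℕ) (t : ℕ) : ℝ :=
  K1 * ∑ j, if t + 1 < N j then Real.exp (-lam * ((N j : ℝ) - (t + 1))) else 0

theorem potential_step_term {d N : ι → ℕ} {kd : ι → Submodule ℝ X → ℕ}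
    (hkd : ∀ j U, kd j U ≤ d j) (hmono : ∀ j U U', U ≤ U' → kd j U ≤ kd j U')
    (hsum : ∀ U, fr U = ∑ j, kd j U)
    (s : ι → ℝ) (lam C0 : ℝ) (hlam : 0 ≤ lam) (hC0 : 0 ≤ C0) (t : ℕ)
    (hs : ∀ j, t + 1 < N j → lam * ((N j : ℝ) - (t + 1)) - C0 ≤ s j)
    (V U U' : Submodule ℝ X) (hVt : ∀ j, N j ≤ t + 1 → kd j V = 0)
    (hU' : U' ≤ U) (hUV : U' ≤ V) :
    Real.exp (-∑ j, if t + 1 < N j then s j * ((d j : ℝ) - kd j U') else 0) ≤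
    ((if U' = U ⊓ V then 1 else 0) +
      epsf lam (Real.exp (C0 * ∑ j, (d j : ℝ))) N t) *
     Real.exp (-∑ j, if t + 1 < N j then s j * ((d j : ℝ) - kd j U) else 0) := by
  have hkk : ∀ j, kd j U' ≤ kd j U := fun j => hmono j _ _ hU'
  have heps : 0 ≤ epsf lam (Real.exp (C0 * ∑ j, (d j : ℝ))) N t := by
    unfold epsf
    refine mul_nonneg (Real.exp_nonneg _) (Finset.sum_nonneg fun j _ => ?_)
    split_ifs <;> positivity
  have e1 : Real.exp (-∑ j, if t + 1 < N j then s j * ((d j : ℝ) - kd j U') else 0) =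
      Real.exp (-∑ j, if t + 1 < N j then s j * ((kd j U : ℝ) - kd j U') else 0) *
      Real.exp (-∑ j, if t + 1 < N j then s j * ((d j : ℝ) - kd j U) else 0) := by
    rw [← Real.exp_add]
    congr 1
    rw [← neg_add, ← Finset.sum_add_distrib]
    congr 1
    apply Finset.sum_congr rfl
    intro j _
    split_ifs <;> ring
  rw [e1]
  apply mul_le_mul_of_nonneg_right _ (Real.exp_nonneg _)
  by_cases hall : ∀ j, t + 1 < N j → kd j U' = kd j U
  · have hEq : U' = U ⊓ V := by
      apply Submodule.eq_of_le_of_finrank_le (le_inf hU' hUV)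
      change fr (U ⊓ V) ≤ fr U'
      rw [hsum, hsum]
      apply Finset.sum_le_sum
      intro j _
      by_cases hj : t + 1 < N j
      · rw [hall j hj]; exact hmono j _ _ inf_le_left
      · have := hmono j _ _ (inf_le_right : U ⊓ V ≤ V)
        rw [hVt j (not_lt.1 hj)] at this
        omega
    rw [if_pos hEq]
    have : (-∑ j, if t + 1 < N j then s j * ((kd j U : ℝ) - kd j U') else 0) = 0 := by
      rw [neg_eq_zero]
      apply Finset.sum_eq_zero
      intro j _
      split_ifs with h
      · rw [hall j h]; ring
      · rfl
    rw [this, Real.exp_zero]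
    linarith
  · push Not at hall
    obtain ⟨j0, hj0, hne⟩ := hall
    have hlt : kd j0 U' + 1 ≤ kd j0 U := lt_of_le_of_ne (hkk j0) hne
    have hb : ∀ j, (if j = j0 then lam * ((N j : ℝ) - (t + 1)) else 0) - C0 * d j ≤
        (if t + 1 < N j then s j * ((kd j U : ℝ) - kd j U') else 0) := by
      intro j
      have hr0 : (0:ℝ) ≤ (kd j U : ℝ) - kd j U' := by
        have : (kd j U' : ℝ) ≤ kd j U := by exact_mod_cast hkk j
        linarith
      have hr1 : (kd j U : ℝ) - kd j U' ≤ d j := by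
        have : (kd j U : ℝ) ≤ d j := by exact_mod_cast hkd j U
        have : (0:ℝ) ≤ kd j U' := Nat.cast_nonneg _
        linarith
      have hd0 : (0:ℝ) ≤ d j := Nat.cast_nonneg _
      split_ifs with h1 h2 h2
      · subst h1
        have hr2 : (1:ℝ) ≤ (kd j U : ℝ) - kd j U' := by
          have : ((kd j U' + 1 : ℕ) : ℝ) ≤ kd j U := by exact_mod_cast hlt
          push_cast at this; linarith
        have hN : (0:ℝ) ≤ (N j : ℝ) - (t+1) := by
          have : ((t + 1 : ℕ) : ℝ) < N j := by exact_mod_cast h2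
          push_cast at this; linarith
        have := hs j h2
        have hl := mul_nonneg hlam hN
        nlinarith [mul_le_mul_of_nonneg_right this hr0, mul_le_mul_of_nonneg_left hr1 hC0,
          mul_nonneg hl (sub_nonneg.2 hr2)]
      · subst h1; exact absurd hj0 h2
      · have hN : (0:ℝ) ≤ (N j : ℝ) - (t+1) := by
          have : ((t + 1 : ℕ) : ℝ) < N j := by exact_mod_cast h2
          push_cast at this; linarith
        have := hs j h2
        have hl := mul_nonneg hlam hN
        nlinarith [mul_le_mul_of_nonneg_right this hr0, mul_le_mul_of_nonneg_left hr1 hC0,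
          mul_nonneg hl hr0]
      · nlinarith
    have hb2 := Finset.sum_le_sum fun j (_ : j ∈ Finset.univ) => hb j
    rw [Finset.sum_sub_distrib, Finset.sum_ite_eq' , if_pos (Finset.mem_univ _), ← Finset.mul_sum] at hb2
    have h3 : Real.exp (-∑ j, if t + 1 < N j then s j * ((kd j U : ℝ) - kd j U') else 0) ≤
        Real.exp (C0 * ∑ j, (d j : ℝ)) * Real.exp (-lam * ((N j0 : ℝ) - (t + 1))) := by
      rw [← Real.exp_add]
      apply Real.exp_le_exp.2
      linarith
    have h4 : Real.exp (C0 * ∑ j, (d j : ℝ)) * Real.exp (-lam * ((N j0 : ℝ) - (t + 1))) ≤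
        epsf lam (Real.exp (C0 * ∑ j, (d j : ℝ))) N t := by
      unfold epsf
      apply mul_le_mul_of_nonneg_left _ (Real.exp_nonneg _)
      have := Finset.single_le_sum (f := fun j => if t + 1 < N j then
        Real.exp (-lam * ((N j : ℝ) - (t + 1))) else 0) (fun j _ => by
          split_ifs <;> positivity) (Finset.mem_univ j0)
      rwa [if_pos hj0] at this
    split_ifs <;> linarith

variable {a θ lam C0 : ℝ} {vec : E → X} {π : ℕ → ℝ} {m : ℕ → E → ℝ} {μ : ℕ → ι → ℝ}
  {d N : ι → ℕ} {kd : ι → Submodule ℝ X → ℕ}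

theorem sj_succ (j : ι) (t : ℕ) (h : t < N j) :
    sj a θ μ N j t = (μ t j - a * θ) + sj a θ μ N j (t+1) := by
  unfold sj
  rw [Finset.sum_eq_sum_Ico_succ_bot h]

theorem sj_zero (j : ι) (t : ℕ) (h : N j ≤ t) : sj a θ μ N j t = 0 := by
  unfold sj
  rw [Finset.Ico_eq_empty (not_lt.2 h), Finset.sum_empty]

theorem potential (hm : ∀ c x, 0 ≤ m c x) (hm1 : ∀ c, ∑ x, m c x = 1)
    (h0 : ∀ c, 0 ≤ π c) (h1 : ∀ c, π c ≤ 1) (hθ : 0 < θ) (hθ1 : θ ≤ 1)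
    (hkd : ∀ j U, kd j U ≤ d j) (hmono : ∀ j U U', U ≤ U' → kd j U ≤ kd j U')
    (hsum : ∀ U, fr U = ∑ j, kd j U) (hlam : 0 ≤ lam) (hC0 : 0 ≤ C0)
    (hs : ∀ j t, t < N j → lam * ((N j : ℝ) - t) - C0 ≤ sj a θ μ N j t)
    (V : ℕ → Submodule ℝ X) (hV : ∀ c c', c ≤ c' → V c' ≤ V c)
    (hsupp : ∀ c x, m c x ≠ 0 → vec x ∈ V c)
    (hVt : ∀ c j, N j ≤ c → kd j (V c) = 0)
    (hM : ∀ t U, Mf θ vec π m t U ≤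
      Real.exp (-∑ j, if t < N j then μ t j * ((d j : ℝ) - kd j U) else 0)) (n : ℕ) :
    ∀ t, (∀ j, N j ≤ t + n) → ∀ U, 
    Gf a θ vec π m t n U * Real.exp (a * θ * ∑ c ∈ Finset.Ico (t+1) (t+n+1), dv d N c) ≤
    (∏ c ∈ Finset.Ico t (t+n), (1 + (UU vec).card * epsf lam (Real.exp (C0 * ∑ j, (d j : ℝ))) N c)) *
      Real.exp (-∑ j, if t < N j then (sj a θ μ N j t + a * θ) * ((d j : ℝ) - kd j U) else 0) := by
  induction n with
  | zero =>
    intro t hN U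
    have : ∀ j, ¬ t < N j := fun j => not_lt.2 (hN j)
    simp only [this, if_false]
    simpa using Gf_base_le hθ t U
  | succ n ih =>
    intro t hN U
    have ih' := ih (t+1) (by intro j; have := hN j; omega)
    set K1 := Real.exp (C0 * ∑ j, (d j : ℝ)) with hK1
    set P := ∏ c ∈ Finset.Ico (t+1) (t+1+n), (1 + (UU vec).card * epsf lam K1 N c) with hP
    have heps : ∀ c, 0 ≤ epsf lam K1 N c := by
      intro c
      unfold epsf
      refine mul_nonneg (Real.exp_nonneg _) (Finset.sum_nonneg fun j _ => ?_)
      split_ifs <;> positivity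
    have hP0 : 0 ≤ P := Finset.prod_nonneg fun c _ => by have := heps c; positivity
    have hG := Gf_step (a := a) (vec := vec) hm hm1 h0 h1 hθ hθ1 t n U
    have hIco : ∑ c ∈ Finset.Ico (t+1) (t+(n+1)+1), dv d N c =
        dv d N (t+1) + ∑ c ∈ Finset.Ico (t+1+1) (t+1+n+1), dv d N c := by
      rw [Finset.sum_eq_sum_Ico_succ_bot (by omega)]
      congr 2
      congr 1; omega
    have hIcoP : ∏ c ∈ Finset.Ico t (t+(n+1)), (1 + (UU vec).card * epsf lam K1 N c) =
        (1 + (UU vec).card * epsf lam K1 N t) * P := by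
      rw [Finset.prod_eq_prod_Ico_succ_bot (by omega), hP]
      congr 2
      congr 1; omega
    rw [hIco, hIcoP]
    set T := ∑ c ∈ Finset.Ico (t+1+1) (t+1+n+1), dv d N c with hT
    set W := Real.exp (-∑ j, if t + 1 < N j then sj a θ μ N j (t+1) * ((d j : ℝ) - kd j U) else 0) with hW
    -- each term
    have term : ∀ U' ∈ (UU vec).filter (· ≤ U),
        Real.exp (-a * θ * fr U') * Gf a θ vec π m (t+1) n U' * Real.exp (a * θ * (dv d N (t+1) + T)) ≤
        ((if U' = U ⊓ V (t+1) then 1 else 0) + epsf lam K1 N t) * W * P := by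
      intro U' hU'
      have hle := (Finset.mem_filter.1 hU').2
      by_cases hUV : U' ≤ V (t+1)
      · have hd : dv d N (t+1) - fr U' = ∑ j, if t + 1 < N j then ((d j : ℝ) - kd j U') else 0 := by
          rw [hsum, dv, Nat.cast_sum, ← Finset.sum_sub_distrib]
          apply Finset.sum_congr rfl
          intro j _
          split_ifs with h
          · rfl
          · have h1 := hmono j _ _ hUV
            rw [hVt _ j (not_lt.1 h)] at h1
            have : kd j U' = 0 := by omega
            simp [this]
        have h2 := ih' U'
        have hsplit : Real.exp (-a * θ * fr U') * Gf a θ vec π m (t+1) n U' *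
            Real.exp (a * θ * (dv d N (t+1) + T)) =
            Real.exp (a * θ * (dv d N (t+1) - fr U')) * (Gf a θ vec π m (t+1) n U' * Real.exp (a * θ * T)) := by
          have : Real.exp (-a * θ * fr U') * Real.exp (a * θ * (dv d N (t+1) + T)) =
            Real.exp (a * θ * (dv d N (t+1) - fr U')) * Real.exp (a * θ * T) := by
            rw [← Real.exp_add, ← Real.exp_add]; congr 1; ring
          linear_combination Gf a θ vec π m (t+1) n U' * this
        rw [hsplit]
        calc _ ≤ Real.exp (a * θ * (dv d N (t+1) - fr U')) * (P * Real.exp (-∑ j, if t + 1 < N j then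
              (sj a θ μ N j (t+1) + a * θ) * ((d j : ℝ) - kd j U') else 0)) :=
              mul_le_mul_of_nonneg_left h2 (Real.exp_nonneg _)
          _ = Real.exp (-∑ j, if t + 1 < N j then sj a θ μ N j (t+1) * ((d j : ℝ) - kd j U') else 0) * P := by
            rw [hd, mul_left_comm, ← Real.exp_add, mul_comm]
            congr 2
            rw [Finset.mul_sum, ← Finset.sum_neg_distrib, ← Finset.sum_neg_distrib,
              ← Finset.sum_add_distrib]
            apply Finset.sum_congr rfl
            intro j _
            split_ifs <;> ring
          _ ≤ _ := by
            apply mul_le_mul_of_nonneg_right _ hP0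
            exact potential_step_term hkd hmono hsum (fun j => sj a θ μ N j (t+1)) lam C0 hlam hC0 t
              (fun j hj => by have := hs j (t+1) hj; push_cast at this; exact this)
              (V (t+1)) U U' (hVt _) hle hUV
      · rw [Gf_zero_of hθ V hV hsupp _ _ _ hUV, mul_zero, zero_mul]
        refine mul_nonneg (mul_nonneg ?_ (Real.exp_nonneg _)) hP0
        have := heps t
        split_ifs <;> linarith
    have hsumT : ∑ U' ∈ (UU vec).filter (· ≤ U),
        Real.exp (-a * θ * fr U') * Gf a θ vec π m (t+1) n U' * Real.exp (a * θ * (dv d N (t+1) + T)) ≤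
        (1 + (UU vec).card * epsf lam K1 N t) * W * P := by
      refine (Finset.sum_le_sum term).trans ?_
      rw [← Finset.sum_mul, ← Finset.sum_mul]
      apply mul_le_mul_of_nonneg_right _ hP0
      apply mul_le_mul_of_nonneg_right _ (Real.exp_nonneg _)
      rw [Finset.sum_add_distrib, Finset.sum_const, nsmul_eq_mul]
      apply add_le_add
      · rw [Finset.sum_ite_eq']; split_ifs <;> norm_num
      · apply mul_le_mul_of_nonneg_right _ (heps t)
        exact_mod_cast Finset.card_filter_le _ _
    have hMpos : 0 ≤ Mf θ vec π m t U := by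
      unfold Mf
      have : 0 ≤ ∑ x, m t x * (∑ x', if vec x - vec x' ∈ U then m t x' else 0) ^ θ :=
        Finset.sum_nonneg fun x _ => mul_nonneg (hm _ _) (Real.rpow_nonneg
          (Finset.sum_nonneg fun x' _ => by split_ifs <;> first | exact hm _ _ | exact le_rfl) _)
      have := mul_nonneg (h0 t) this
      linarith [h1 t]
    have hWP : 0 ≤ (1 + (UU vec).card * epsf lam K1 N t) * W * P := by
      have := heps t
      have hW0 : 0 ≤ W := Real.exp_nonneg _
      positivity
    calc _ ≤ (Mf θ vec π m t U * ∑ U' ∈ (UU vec).filter (· ≤ U), Real.exp (-a * θ * fr U') *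
            Gf a θ vec π m (t+1) n U') * Real.exp (a * θ * (dv d N (t+1) + T)) :=
          mul_le_mul_of_nonneg_right hG (Real.exp_nonneg _)
      _ = Mf θ vec π m t U * ∑ U' ∈ (UU vec).filter (· ≤ U),
        Real.exp (-a * θ * fr U') * Gf a θ vec π m (t+1) n U' * Real.exp (a * θ * (dv d N (t+1) + T)) := by
          rw [mul_assoc, Finset.sum_mul]
      _ ≤ Real.exp (-∑ j, if t < N j then μ t j * ((d j : ℝ) - kd j U) else 0) *
            ((1 + (UU vec).card * epsf lam K1 N t) * W * P) :=
          (mul_le_mul_of_nonneg_left hsumT hMpos).trans (mul_le_mul_of_nonneg_right (hM t U) hWP)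
      _ = (1 + (UU vec).card * epsf lam K1 N t) * P *
          (Real.exp (-∑ j, if t < N j then μ t j * ((d j : ℝ) - kd j U) else 0) * W) := by ring
      _ = _ := by
          congr 1
          rw [hW, ← Real.exp_add]
          congr 1
          rw [← neg_add, ← Finset.sum_add_distrib]
          congr 1
          apply Finset.sum_congr rfl
          intro j _
          by_cases h1 : t < N j
          · rw [if_pos h1, if_pos h1]
            rw [sj_succ j t h1]
            split_ifs with h2
            · ring
            · rw [sj_zero j (t+1) (not_lt.1 h2)]; ring
          · rw [if_neg h1, if_neg h1, if_neg (by omega)]; ring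

end PT
end FKT

open Filter Topology
open scoped Classical
namespace FKT

theorem geom_aux (r : ℝ) (h0 : 0 ≤ r) (h1 : r < 1) (n N : ℕ) :
    ∑ c ∈ Finset.range n, (if c + 1 < N then r ^ (N - (c+1)) else 0) ≤ (1 - r)⁻¹ := by
  rw [← Finset.sum_filter]
  have hinj : Set.InjOn (fun c => N - (c+1)) ((Finset.range n).filter (fun c => c + 1 < N) : Set ℕ) := by
    intro x hx y hy hxy
    simp only [Finset.coe_filter, Set.mem_setOf_eq] at hx hy
    simp only at hxy
    omega
  rw [← Finset.sum_image (f := fun k => r ^ k) hinj]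
  refine (Summable.sum_le_tsum _ (fun k _ => pow_nonneg h0 k) (summable_geometric_of_lt_one h0 h1)).trans ?_
  rw [tsum_geometric_of_lt_one h0 h1]

section PT
variable {X : Type} [NormedAddCommGroup X] [NormedSpace ℝ X] [FiniteDimensional ℝ X]
  {E : Type} [Fintype E] {ι : Type} [Fintype ι] {J : Type} [Fintype J]

noncomputable def Qf (θ : ℝ) (vec : E → X) (m : ℕ → E → ℝ) (n : ℕ) (o : Fin n → ℝ) : ℝ :=
  ∑ e : Fin n → E, wp m 0 n e * (∑ e' : Fin n → E, wp m 0 n e' *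
    (if ‖∑ i, o i • vec (e i) - ∑ i, o i • vec (e' i)‖ ≤ 1 then 1 else 0)) ^ θ

def piB (π : ℕ → ℝ) (c : ℕ) (b : Bool) : ℝ := if b then π c else 1 - π c

theorem wp_wB (π : ℕ → ℝ) (m : ℕ → E → ℝ) (t n : ℕ) (b : Fin n → Bool) (e : Fin n → E) :
    wp (wB π m) t n (fun i => (b i, e i)) = wp (piB π) t n b * wp m t n e := by
  unfold wp
  rw [← Finset.prod_mul_distrib]
  rfl

theorem sum_pair {n : ℕ} (f : (Fin n → Bool × E) → ℝ) :
    ∑ s, f s = ∑ b : Fin n → Bool, ∑ e : Fin n → E, f (fun i => (b i, e i)) := by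
  rw [← (Equiv.arrowProdEquivProdArrow (Fin n) (fun _ => Bool) (fun _ => E)).symm.sum_comp,
    Fintype.sum_prod_type]
  rfl

noncomputable def collC (S : ℕ) (lam C0 C2 : ℝ) (D R : ℕ) : ℝ :=
  C2 ^ D * (S * (Real.exp (S * (Real.exp (C0 * D) * (R * (1 - Real.exp (-lam))⁻¹))) * Real.exp (C0 * D)))

variable {a θ lam C0 C2 Λ : ℝ} {vec : E → X} {π : ℕ → ℝ} {m : ℕ → E → ℝ} {μ : ℕ → ι → ℝ}
  {d N : ι → ℕ} {kd : ι → Submodule ℝ X → ℕ}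

theorem collision (hm : ∀ c x, 0 ≤ m c x) (hm1 : ∀ c, ∑ x, m c x = 1)
    (h0 : ∀ c, 0 ≤ π c) (h1 : ∀ c, π c ≤ 1) (hθ : 0 < θ) (hθ1 : θ ≤ 1) (ha : 0 ≤ a)
    (hkd : ∀ j U, kd j U ≤ d j) (hmono : ∀ j U U', U ≤ U' → kd j U ≤ kd j U')
    (hsum : ∀ U, fr U = ∑ j, kd j U) (htop : (∑ j, d j) = Module.finrank ℝ X)
    (hlam : 0 < lam) (hC0 : 0 ≤ C0)
    (hs : ∀ j t, t < N j → lam * ((N j : ℝ) - t) - C0 ≤ sj a θ μ N j t)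
    (V : ℕ → Submodule ℝ X) (hV : ∀ c c', c ≤ c' → V c' ≤ V c)
    (hsupp : ∀ c x, m c x ≠ 0 → vec x ∈ V c)
    (hVt : ∀ c j, N j ≤ c → kd j (V c) = 0)
    (hM : ∀ t U, Mf θ vec π m t U ≤
      Real.exp (-∑ j, if t < N j then μ t j * ((d j : ℝ) - kd j U) else 0)) (n : ℕ)
    (hn : ∀ j, N j ≤ n)
    (u : ℕ → J → ℝ) (y : J → ℝ)
    (hu : ∀ c x, 0 ≤ u c x) (hu1 : ∀ c, ∑ x, u c x ≤ 1) (hC : 1 ≤ C2)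
    (hball : ∀ c z, ∑ x, (if |y x - z| ≤ Λ then u c x else 0) ≤ C2 * Real.exp (-a * c))
    (hΛ : FunBd (DD vec) Λ) :
    ∑ b : Fin n → Bool, ∑ p : Fin n → J, wp (piB π) 0 n b * wp u 0 n p *
      Qf θ vec m n (fun i => if b i then y (p i) else 0) ≤
    collC (UU vec).card lam C0 C2 (Module.finrank ℝ X) (Fintype.card ι) *
      Real.exp (-(a * θ * ∑ c ∈ Finset.Ico 1 (n+1), dv d N c)) := by
  have hpi : ∀ c b, 0 ≤ piB π c b := by
    intro c b; unfold piB; split_ifs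
    · exact h0 c
    · linarith [h1 c]
  set DX := Module.finrank ℝ X with hDX
  -- inner AC + Jensen
  have inner : ∀ (b : Fin n → Bool) (e : Fin n → E),
      ∑ p : Fin n → J, wp u 0 n p * (∑ e' : Fin n → E, wp m 0 n e' *
        (if ‖∑ i, (if b i then y (p i) else 0) • vec (e i) -
          ∑ i, (if b i then y (p i) else 0) • vec (e' i)‖ ≤ 1 then 1 else 0)) ^ θ ≤
      C2 ^ DX * ∑ U ∈ UU vec, (Ff a vec m 0 n (fun i => (b i, e i)) U) ^ θ := by
    intro b e
    set s : Fin n → Bool × E := fun i => (b i, e i) with hsdef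
    have hnn : ∀ (p : Fin n → J), 0 ≤ (∑ e' : Fin n → E, wp m 0 n e' *
        (if ‖∑ i, (if b i then y (p i) else 0) • vec (e i) -
          ∑ i, (if b i then y (p i) else 0) • vec (e' i)‖ ≤ 1 then (1:ℝ) else 0)) := fun p =>
      Finset.sum_nonneg fun e' _ => mul_nonneg (wp_nonneg hm _ _ _) (by split_ifs <;> norm_num)
    refine (jensen_rpow _ _ (fun p => wp_nonneg hu 0 n p) (wp_sum_le hu hu1 n 0) hnn hθ hθ1).trans ?_
    have h2 : ∑ p : Fin n → J, wp u 0 n p * (∑ e' : Fin n → E, wp m 0 n e' *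
        (if ‖∑ i, (if b i then y (p i) else 0) • vec (e i) -
          ∑ i, (if b i then y (p i) else 0) • vec (e' i)‖ ≤ 1 then (1:ℝ) else 0)) ≤
        C2 ^ DX * ∑ U ∈ UU vec, Ff a vec m 0 n s U := by
      simp only [Finset.mul_sum]
      rw [Finset.sum_comm]
      have h3 : ∑ U ∈ UU vec, C2 ^ DX * Ff a vec m 0 n s U =
          ∑ e' : Fin n → E, C2 ^ DX * (wp m 0 n e' * Zt a n (dl vec s e')) := by
        simp only [Ff, Finset.mul_sum]
        rw [Finset.sum_comm]
        apply Finset.sum_congr rfl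
        intro e' _
        have : ∀ U : Submodule ℝ X, C2 ^ DX * (wp m 0 n e' * (if sp (dl vec s e') = U then
          Zt a n (dl vec s e') else 0)) = if sp (dl vec s e') = U then
          C2 ^ DX * (wp m 0 n e' * Zt a n (dl vec s e')) else 0 := by
          intro U; split_ifs <;> simp
        simp only [this]
        rw [Finset.sum_ite_eq, if_pos (sp_mem_UU _ _ _)]
      rw [h3]
      apply Finset.sum_le_sum
      intro e' _
      have hac := AC u y a C2 Λ hu hu1 hC hball (DD vec) hΛ n 0 (dl vec s e')
        (fun i => dl_mem _ _ _ i) 0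
      have hz : ∀ p : Fin n → J, (0 : X) + ∑ i, y (p i) • dl vec s e' i =
          ∑ i, (if b i then y (p i) else 0) • vec (e i) -
          ∑ i, (if b i then y (p i) else 0) • vec (e' i) := by
        intro p
        rw [zero_add, ← Finset.sum_sub_distrib]
        apply Finset.sum_congr rfl
        intro i _
        simp only [dl, hsdef]
        split_ifs
        · rw [smul_sub]
        · simp
      simp only [hz] at hac
      have hle : C2 ^ fr (sp (dl vec s e')) * Real.exp (-a * (0:ℕ) * fr (sp (dl vec s e'))) *
          Zt a n (dl vec s e') ≤ C2 ^ DX * Zt a n (dl vec s e') := by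
        have : Real.exp (-a * (0:ℕ) * fr (sp (dl vec s e'))) = 1 := by simp
        rw [this, mul_one]
        exact mul_le_mul_of_nonneg_right (pow_le_pow_right₀ hC (Submodule.finrank_le _)) (Zt_nonneg _ _ _)
      calc _ = wp m 0 n e' * ∑ p : Fin n → J, wp u 0 n p *
          (if ‖∑ i, (if b i then y (p i) else 0) • vec (e i) -
          ∑ i, (if b i then y (p i) else 0) • vec (e' i)‖ ≤ 1 then (1:ℝ) else 0) := by
            rw [Finset.mul_sum]
            apply Finset.sum_congr rfl
            intro p _; ring
        _ ≤ wp m 0 n e' * (C2 ^ DX * Zt a n (dl vec s e')) :=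
            mul_le_mul_of_nonneg_left (hac.trans hle) (wp_nonneg hm _ _ _)
        _ = _ := by ring
    have hF : ∀ U ∈ UU vec, 0 ≤ Ff a vec m 0 n s U := fun U _ => Ff_nonneg hm _ _ _ _
    have hCp : (1:ℝ) ≤ C2 ^ DX := one_le_pow₀ hC
    calc _ ≤ (C2 ^ DX * ∑ U ∈ UU vec, Ff a vec m 0 n s U) ^ θ :=
          Real.rpow_le_rpow (Finset.sum_nonneg fun p _ => mul_nonneg (wp_nonneg hu _ _ _) (hnn p)) h2 hθ.le
      _ = (C2 ^ DX) ^ θ * (∑ U ∈ UU vec, Ff a vec m 0 n s U) ^ θ :=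
          Real.mul_rpow (by positivity) (Finset.sum_nonneg hF)
      _ ≤ C2 ^ DX * ∑ U ∈ UU vec, (Ff a vec m 0 n s U) ^ θ := by
          apply mul_le_mul _ (rpow_sum_le' _ _ hF hθ hθ1) (Real.rpow_nonneg (Finset.sum_nonneg hF) _)
            (by positivity)
          calc (C2 ^ DX) ^ θ ≤ (C2 ^ DX) ^ (1:ℝ) := Real.rpow_le_rpow_of_exponent_le hCp hθ1
            _ = _ := Real.rpow_one _
  have main : ∑ b : Fin n → Bool, ∑ p : Fin n → J, wp (piB π) 0 n b * wp u 0 n p *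
      Qf θ vec m n (fun i => if b i then y (p i) else 0) ≤
      C2 ^ DX * ∑ U ∈ UU vec, Gf a θ vec π m 0 n U := by
    have hG : C2 ^ DX * ∑ U ∈ UU vec, Gf a θ vec π m 0 n U =
        ∑ b : Fin n → Bool, ∑ e : Fin n → E, wp (piB π) 0 n b * wp m 0 n e *
          (C2 ^ DX * ∑ U ∈ UU vec, (Ff a vec m 0 n (fun i => (b i, e i)) U) ^ θ) := by
      simp only [Gf]
      rw [Finset.sum_comm, sum_pair, Finset.mul_sum]
      apply Finset.sum_congr rfl; intro b _
      rw [Finset.mul_sum]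
      apply Finset.sum_congr rfl; intro e _
      simp only [wp_wB]
      rw [← Finset.mul_sum]; ring
    rw [hG]
    apply Finset.sum_le_sum; intro b _
    unfold Qf
    simp only [Finset.mul_sum (s := (Finset.univ : Finset (Fin n → E)))]
    rw [Finset.sum_comm]
    apply Finset.sum_le_sum; intro e _
    calc _ = wp (piB π) 0 n b * wp m 0 n e * ∑ p : Fin n → J, wp u 0 n p *
        (∑ e' : Fin n → E, wp m 0 n e' *
        (if ‖∑ i, (if b i then y (p i) else 0) • vec (e i) -
          ∑ i, (if b i then y (p i) else 0) • vec (e' i)‖ ≤ 1 then 1 else 0)) ^ θ := by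
          rw [Finset.mul_sum]
          apply Finset.sum_congr rfl; intro p _; ring
      _ ≤ _ := mul_le_mul_of_nonneg_left (inner b e) (mul_nonneg (wp_nonneg hpi _ _ _) (wp_nonneg hm _ _ _))
  refine main.trans ?_
  have hDd : (∑ j, (d j : ℝ)) = DX := by rw [← htop]; push_cast; rfl
  have hpot : ∀ U, Gf a θ vec π m 0 n U ≤
      (Real.exp ((UU vec).card * (Real.exp (C0 * DX) * (Fintype.card ι * (1 - Real.exp (-lam))⁻¹))) *
        Real.exp (C0 * DX)) * Real.exp (-(a * θ * ∑ c ∈ Finset.Ico 1 (n+1), dv d N c)) := by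
    intro U
    have := potential (a := a) (μ := μ) hm hm1 h0 h1 hθ hθ1 hkd hmono hsum hlam.le hC0 hs V hV hsupp hVt hM n 0
      (by simpa using hn) U
    simp only [zero_add, hDd] at this
    have hp : ∏ c ∈ Finset.Ico 0 n, (1 + (UU vec).card * epsf lam (Real.exp (C0 * DX)) N c) ≤
        Real.exp ((UU vec).card * (Real.exp (C0 * DX) * (Fintype.card ι * (1 - Real.exp (-lam))⁻¹))) := by
      have heps : ∀ c, 0 ≤ epsf lam (Real.exp (C0 * DX)) N c := by
        intro c
        unfold epsf
        refine mul_nonneg (Real.exp_nonneg _) (Finset.sum_nonneg fun j _ => ?_)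
        split_ifs <;> positivity
      calc _ ≤ ∏ c ∈ Finset.Ico 0 n, Real.exp ((UU vec).card * epsf lam (Real.exp (C0 * DX)) N c) := by
            apply Finset.prod_le_prod
            · intro c _; have := heps c; positivity
            · intro c _; rw [add_comm]; exact Real.add_one_le_exp _
        _ = Real.exp ((UU vec).card * ∑ c ∈ Finset.Ico 0 n, epsf lam (Real.exp (C0 * DX)) N c) := by
            rw [← Real.exp_sum, Finset.mul_sum]
        _ ≤ _ := by
            apply Real.exp_le_exp.2
            apply mul_le_mul_of_nonneg_left _ (Nat.cast_nonneg _)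
            unfold epsf
            rw [← Finset.mul_sum]
            apply mul_le_mul_of_nonneg_left _ (Real.exp_nonneg _)
            rw [Finset.sum_comm]
            have hg : ∀ j : ι, ∑ c ∈ Finset.Ico 0 n, (if c + 1 < N j then
                Real.exp (-lam * ((N j : ℝ) - (c + 1))) else 0) ≤ (1 - Real.exp (-lam))⁻¹ := by
              intro j
              have := geom_aux (Real.exp (-lam)) (Real.exp_nonneg _)
                (by rw [Real.exp_lt_one_iff]; linarith) n (N j)
              rw [Finset.range_eq_Ico] at this
              refine le_trans (le_of_eq ?_) this
              apply Finset.sum_congr rfl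
              intro c _
              split_ifs with h
              · rw [← Real.exp_nat_mul, Nat.cast_sub h.le]
                congr 1; push_cast; ring
              · rfl
            refine (Finset.sum_le_sum fun j _ => hg j).trans ?_
            rw [Finset.sum_const, nsmul_eq_mul, Finset.card_univ]
    have hq : Real.exp (-∑ j, if 0 < N j then (sj a θ μ N j 0 + a * θ) * ((d j : ℝ) - kd j U) else 0) ≤
        Real.exp (C0 * DX) := by
      apply Real.exp_le_exp.2
      rw [← hDd, Finset.mul_sum, neg_le, ← Finset.sum_neg_distrib]
      apply Finset.sum_le_sum
      intro j _
      have hd0 : (0:ℝ) ≤ d j := Nat.cast_nonneg _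
      split_ifs with h
      · have h2 := hs j 0 h
        have h3 : (kd j U : ℝ) ≤ d j := by exact_mod_cast hkd j U
        have h4 : (0:ℝ) ≤ kd j U := Nat.cast_nonneg _
        have h5 : 0 ≤ lam * ((N j : ℝ) - (0:ℕ)) := by
          have : (0:ℝ) ≤ N j := Nat.cast_nonneg _
          simp; positivity
        have h6 := mul_nonneg ha hθ.le
        nlinarith
      · have := mul_nonneg hC0 hd0; linarith
    rw [Real.exp_neg (a * θ * _), ← div_eq_mul_inv _ (Real.exp (a * θ * _)), le_div_iff₀ (Real.exp_pos _)]
    refine this.trans ?_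
    exact mul_le_mul hp hq (Real.exp_nonneg _) (Real.exp_nonneg _)
  unfold collC
  calc _ ≤ C2 ^ DX * ∑ U ∈ UU vec, _ :=
        mul_le_mul_of_nonneg_left (Finset.sum_le_sum fun U _ => hpot U) (by positivity)
    _ = _ := by rw [Finset.sum_const, nsmul_eq_mul]; ring

end PT
end FKT

open Filter Topology
open scoped Classical
namespace FKT

section chain
variable {A B : Type*} [Fintype A] [Fintype B]

lemma ent_chain {st : A → ℝ} {K : A → B → ℝ} (hst : ∀ a, 0 ≤ st a) (hst1 : ∑ a, st a = 1)
    (hK : ∀ a b, 0 ≤ K a b) (hK1 : ∀ a, ∑ b, K a b = 1)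
    {u : A × B → A × B → Prop} (hu : Equivalence u) {j : A → A → Prop} (hj : Equivalence j)
    {r : B → B → Prop} (huj : ∀ x y, u x y → j x.1 y.1)
    (hr : ∀ a b b', u (a,b) (a,b') ↔ r b b') :
    ent st j + ∑ a, st a * ent (K a) r ≤ ent (fun x : A × B => st x.1 * K x.1 x.2) u := by
  set p : A × B → ℝ := fun x => st x.1 * K x.1 x.2 with hp
  have hp0 : ∀ x, 0 ≤ p x := fun x => mul_nonneg (hst _) (hK _ _)
  have hp1 : ∑ x, p x = 1 := by
    rw [Fintype.sum_prod_type]; simp only [hp, ← Finset.mul_sum, hK1, mul_one, hst1]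
  have hv : Equivalence (fun x y : A × B => x.1 = y.1) :=
    ⟨fun _ => rfl, fun h => h.symm, fun h h' => h.trans h'⟩
  have hj' : Equivalence (fun x y : A × B => j x.1 y.1) :=
    ⟨fun _ => hj.refl _, fun h => hj.symm h, fun h h' => hj.trans h h'⟩
  have main := ent_submod hp0 hp1 hu hv (i := fun x y => u x y ∧ x.1 = y.1) (fun x y => Iff.rfl) hj' huj
    (fun x y h => by change j x.1 y.1; rw [show x.1 = y.1 from h]; exact hj.refl _)
  have e1 : ent p (fun x y => j x.1 y.1) = ent st j := by
    unfold ent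
    congr 1
    have : ∀ x : A × B, cp p (fun x y => j x.1 y.1) x = cp st j x.1 := by
      intro x; unfold cp
      rw [Fintype.sum_prod_type]
      refine Finset.sum_congr rfl (fun a _ => ?_)
      split_ifs with h
      · simp only [hp, ← Finset.mul_sum, hK1, mul_one]
      · simp
    simp only [this]
    rw [Fintype.sum_prod_type]
    refine Finset.sum_congr rfl (fun a _ => ?_)
    simp only [hp]
    rw [← Finset.sum_mul, ← Finset.mul_sum, hK1, mul_one]
  have e2 : ent p (fun x y => u x y ∧ x.1 = y.1) = ent p (fun x y => x.1 = y.1) + ∑ a, st a * ent (K a) r := by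
    have c1 : ∀ x : A × B, cp p (fun x y => x.1 = y.1) x = st x.1 := by
      intro x; unfold cp
      rw [Fintype.sum_prod_type]
      rw [Finset.sum_eq_single x.1]
      · simp only [hp, if_true, ← Finset.mul_sum, hK1, mul_one]
      · intro a _ ha; simp [ha.symm]
      · simp
    have c2 : ∀ x : A × B, cp p (fun x y => u x y ∧ x.1 = y.1) x = st x.1 * cp (K x.1) r x.2 := by
      intro x; unfold cp
      rw [Fintype.sum_prod_type]
      rw [Finset.sum_eq_single x.1]
      · rw [Finset.mul_sum]
        refine Finset.sum_congr rfl (fun b _ => ?_)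
        have := hr x.1 x.2 b
        by_cases h : r x.2 b
        · rw [if_pos ⟨this.2 h, rfl⟩, if_pos h]
        · rw [if_neg (fun h' => h (this.1 h'.1)), if_neg h, mul_zero]
      · intro a _ ha; simp [ha.symm]
      · simp
    unfold ent
    simp only [c1, c2]
    have : ∀ x : A × B, p x * Real.log (st x.1 * cp (K x.1) r x.2) = p x * Real.log (st x.1) +
        st x.1 * (K x.1 x.2 * Real.log (cp (K x.1) r x.2)) := by
      intro x
      by_cases h1 : st x.1 = 0
      · simp [hp, h1]
      by_cases h2 : K x.1 x.2 = 0
      · simp [hp, h2]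
      have h3 : cp (K x.1) r x.2 ≠ 0 := by
        have : r x.2 x.2 := (hr x.1 x.2 x.2).1 (hu.refl _)
        have h4 := le_cp (hK x.1) this
        have := lt_of_le_of_ne (hK x.1 x.2) (Ne.symm h2)
        linarith
      rw [Real.log_mul h1 h3]; simp only [hp]; ring
    simp only [this]
    rw [Finset.sum_add_distrib, Fintype.sum_prod_type (f := fun x : A × B => st x.1 * (K x.1 x.2 * Real.log (cp (K x.1) r x.2)))]
    simp only [mul_neg, Finset.sum_neg_distrib, Finset.mul_sum]
    ring
  linarith

/-- concavity of entropy -/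
lemma ent_mix {st : A → ℝ} {K : A → B → ℝ} (hst : ∀ a, 0 ≤ st a) (hst1 : ∑ a, st a = 1)
    (hK : ∀ a b, 0 ≤ K a b) (hK1 : ∀ a, ∑ b, K a b = 1) {r : B → B → Prop} (hr : Equivalence r) :
    ∑ a, st a * ent (K a) r ≤ ent (fun b => ∑ a, st a * K a b) r := by
  have h := ent_chain hst hst1 hK hK1 (u := fun x y => r x.2 y.2)
    ⟨fun _ => hr.refl _, fun h => hr.symm h, fun h h' => hr.trans h h'⟩
    (j := fun _ _ => True) ⟨fun _ => trivial, fun _ => trivial, fun _ _ => trivial⟩ (r := r)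
    (fun _ _ _ => trivial) (fun _ _ _ => Iff.rfl)
  have h0 := ent_nonneg hst hst1 (fun _ _ => True)
  have e : ent (fun x : A × B => st x.1 * K x.1 x.2) (fun x y => r x.2 y.2) =
      ent (fun b => ∑ a, st a * K a b) r := by
    unfold ent
    congr 1
    have c : ∀ x : A × B, cp (fun x : A × B => st x.1 * K x.1 x.2) (fun x y => r x.2 y.2) x =
        cp (fun b => ∑ a, st a * K a b) r x.2 := by
      intro x; unfold cp
      rw [Fintype.sum_prod_type, Finset.sum_comm]
      refine Finset.sum_congr rfl (fun b _ => ?_)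
      split_ifs <;> simp
    simp only [c]
    rw [Fintype.sum_prod_type, Finset.sum_comm]
    refine Finset.sum_congr rfl (fun b _ => ?_)
    rw [Finset.sum_mul]
  linarith
end chain

/-- paths through `n` stages -/
def Pa (D : ℕ) : ℕ → Type
  | 0 => Unit
  | n+1 => Sg (D+n) × Pa D n

noncomputable instance Pa.fin (D : ℕ) : ∀ n, Fintype (Pa D n)
  | 0 => inferInstanceAs (Fintype Unit)
  | n+1 => letI := Pa.fin D n; inferInstanceAs (Fintype (Sg (D+n) × Pa D n))

/-- coordinates -/
def Ix (D : ℕ) : ℕ → Type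
  | 0 => Empty
  | n+1 => Cl (D+n) ⊕ Ix D n

noncomputable instance Ix.fin (D : ℕ) : ∀ n, Fintype (Ix D n)
  | 0 => inferInstanceAs (Fintype Empty)
  | n+1 => letI := Ix.fin D n; inferInstanceAs (Fintype (Cl (D+n) ⊕ Ix D n))

def lev {D : ℕ} : ∀ {n}, Ix D n → ℕ
  | 0, i => 0
  | n+1, Sum.inl q => n
  | n+1, Sum.inr i => lev (n := n) i

lemma lev_lt {D : ℕ} : ∀ {n} (i : Ix D n), lev i < n
  | 0, i => i.elim
  | n+1, Sum.inl q => Nat.lt_succ_self n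
  | n+1, Sum.inr i => (lev_lt i).trans (Nat.lt_succ_self n)

def l0 {D : ℕ} : ∀ {n}, Ix D n → Cl (D+n)
  | 0, i => fun _ => false
  | n+1, Sum.inl q => cns false q
  | n+1, Sum.inr i => cns false (l0 (n := n) i)

def l1 {D : ℕ} : ∀ {n}, Ix D n → Cl (D+n)
  | 0, i => fun _ => false
  | n+1, Sum.inl q => cns true q
  | n+1, Sum.inr i => cns false (l1 (n := n) i)

noncomputable def om {D : ℕ} : ∀ {n}, Pa D n → Cl (D+n) → ℝ
  | 0, _, _ => 0
  | n+1, p, l => (if p.1 (Fin.tail (n := D+n) l) = sgb (l 0) then 1 else 0) + om (n := n) p.2 (Fin.tail (n := D+n) l)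

lemma om_cns {D n : ℕ} (p : Pa D (n+1)) (b : Bool) (q : Cl (D+n)) :
    om p (cns b q : Cl (D+n+1)) = (if p.1 q = sgb b then 1 else 0) + om p.2 q := by
  rw [om]; simp [cns]

noncomputable def vec {D : ℕ} {n : ℕ} (p : Pa D n) (i : Ix D n) : ℝ := om p (l0 i) - om p (l1 i)

lemma vec_inl {D n : ℕ} (p : Pa D (n+1)) (q : Cl (D+n)) :
    vec p (Sum.inl q : Cl (D+n) ⊕ Ix D n) = vecE p.1 q := by
  unfold vec
  change om p (cns false q : Cl (D+n+1)) - om p (cns true q : Cl (D+n+1)) = _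
  rw [om_cns, om_cns]
  unfold sgb vecE
  rcases h : p.1 q with _ | _ | _ <;> simp <;> decide

lemma vec_inr {D n : ℕ} (p : Pa D (n+1)) (i : Ix D n) :
    vec p (Sum.inr i : Cl (D+n) ⊕ Ix D n) = ((if p.1 (l0 i) = sgb false then (1:ℝ) else 0) -
      (if p.1 (l1 i) = sgb false then (1:ℝ) else 0)) + vec p.2 i := by
  unfold vec
  change om p (cns false (l0 i) : Cl (D+n+1)) - om p (cns false (l1 i) : Cl (D+n+1)) = _
  rw [om_cns, om_cns]
  ring

end FKT

open Filter Topology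
open scoped Classical
namespace FKT

noncomputable def stp (ρ : ℝ) (D n b : ℕ) (s : St (D+n+1)) (e : Sg (D+n)) : ℝ :=
  if n ≤ b ∧ b ≤ n + D then nu ρ (D - (b - n)) (D+n) s e else if e = (fun _ => 0) then 1 else 0

noncomputable def ker (ρ : ℝ) (D : ℕ) : ∀ n, ℕ → St (D+n) → Pa D n → ℝ
  | 0, _, _, _ => 1
  | n+1, b, s, p => stp ρ D n b s p.1 * ker ρ D n b (kept (k := D+n) s p.1) p.2

lemma stp_nonneg {ρ : ℝ} (hρ : 0 < ρ) (D n b s e) : 0 ≤ stp ρ D n b s e := by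
  unfold stp; split_ifs
  · exact nu_nonneg hρ _ _ _ _
  · norm_num
  · norm_num

lemma stp_sum {ρ : ℝ} (hρ : 0 < ρ) (D n b s) : ∑ e, stp ρ D n b s e = 1 := by
  unfold stp; split_ifs
  · exact nu_sum hρ _ _ _
  · simp

lemma stp_alw {ρ : ℝ} {D n b : ℕ} {s e} (h : stp ρ D n b s e ≠ 0) : alw s e := by
  unfold stp at h
  split_ifs at h with h1 h2
  · unfold nu at h
    by_contra h3
    rw [if_neg h3] at h; exact h rfl
  · rw [h2]; exact alw_zero s
  · exact absurd rfl h

lemma stp_zero {ρ : ℝ} {D n b : ℕ} {s e} (h : stp ρ D n b s e ≠ 0) (hb : b < n) : e = fun _ => 0 := by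
  unfold stp at h
  rw [if_neg (by omega)] at h
  by_contra h2
  rw [if_neg h2] at h; exact h rfl

lemma ker_nonneg {ρ : ℝ} (hρ : 0 < ρ) (D : ℕ) : ∀ n b s p, 0 ≤ ker ρ D n b s p
  | 0, _, _, _ => zero_le_one
  | n+1, b, s, p => mul_nonneg (stp_nonneg hρ _ _ _ _ _) (ker_nonneg hρ D n _ _ _)

lemma ker_sum {ρ : ℝ} (hρ : 0 < ρ) (D : ℕ) : ∀ n b s, ∑ p, ker ρ D n b s p = 1
  | 0, b, s => by
    change ∑ p : Unit, (1:ℝ) = 1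
    simp
  | n+1, b, s => by
    change ∑ p : Sg (D+n) × Pa D n, stp ρ D n b s p.1 * ker ρ D n b (kept (k := D+n) s p.1) p.2 = 1
    rw [Fintype.sum_prod_type]
    simp only [← Finset.mul_sum, ker_sum hρ D n, mul_one]
    exact stp_sum hρ _ _ _ _

lemma ker_om {ρ : ℝ} {D : ℕ} : ∀ {n b : ℕ} {s : St (D+n)} {p : Pa D n}, ker ρ D n b s p ≠ 0 →
    ∀ l, (om p l = 0 ∨ om p l = 1) ∧ (s l = false → om p l = 0)
  | 0, b, s, p, h, l => ⟨Or.inl rfl, fun _ => rfl⟩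
  | n+1, b, s, p, h, l => by
    rw [ker] at h
    have h1 := left_ne_zero_of_mul h
    have h2 := right_ne_zero_of_mul h
    obtain ⟨β, q, rfl⟩ := cns_surj (k := D+n) l
    have ih := ker_om h2 q
    have ha := (alw_iff _ _).1 (stp_alw h1) β q
    rw [om_cns]
    by_cases he : p.1 q = sgb β
    · rw [if_pos he]
      have hk : kept (k := D+n) s p.1 q = false := by
        unfold kept
        have : p.1 q ≠ 0 := by rw [he]; exact sgb_ne_zero β
        simp [this]
      rw [ih.2 hk]
      exact ⟨Or.inr (by norm_num), fun hs => by rw [ha he] at hs; simp at hs⟩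
    · rw [if_neg he, zero_add]
      refine ⟨ih.1, fun hs => ih.2 ?_⟩
      unfold kept
      cases β <;> simp [hs]

lemma ker_vec {ρ : ℝ} {D : ℕ} : ∀ {n b : ℕ} {s : St (D+n)} {p : Pa D n}, ker ρ D n b s p ≠ 0 →
    ∀ i, b < lev i → vec p i = 0
  | 0, b, s, p, h, i, _ => i.elim
  | n+1, b, s, p, h, i, hi => by
    rw [ker] at h
    have h1 := left_ne_zero_of_mul h
    have h2 := right_ne_zero_of_mul h
    have hb : b < n := lt_of_lt_of_le hi (Nat.lt_succ_iff.1 (lev_lt i))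
    have hz := stp_zero h1 hb
    rcases i with q | i
    · rw [vec_inl, hz]; simp [vecE]
    · rw [vec_inr, hz, ker_vec h2 i hi]; simp

noncomputable def mu (ρ : ℝ) (D R b : ℕ) (p : Pa D R) : ℝ :=
  ∑ s, AL ρ D (b+1-R) (D+R) s * ker ρ D R b s p

lemma mu_nonneg {ρ : ℝ} (hρ : 0 < ρ) (D R b p) : 0 ≤ mu ρ D R b p :=
  Finset.sum_nonneg fun s _ => mul_nonneg (AL_nonneg hρ _ _ _ _) (ker_nonneg hρ _ _ _ _ _)

lemma mu_sum {ρ : ℝ} (hρ : 0 < ρ) (D R b) : ∑ p, mu ρ D R b p = 1 := by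
  unfold mu
  rw [Finset.sum_comm]
  simp only [← Finset.mul_sum, ker_sum hρ, mul_one, AL_sum hρ]

lemma mu_supp {ρ : ℝ} {D R b : ℕ} {p : Pa D R} (h : mu ρ D R b p ≠ 0) : ∃ s, ker ρ D R b s p ≠ 0 := by
  obtain ⟨s, _, hs⟩ := Finset.exists_ne_zero_of_sum_ne_zero h
  exact ⟨s, right_ne_zero_of_mul hs⟩

noncomputable def rin (D n : ℕ) : (Ix D (n+1) → ℝ) →ₗ[ℝ] (Cl (D+n) → ℝ) :=
  LinearMap.funLeft ℝ ℝ (Sum.inl : Cl (D+n) → Cl (D+n) ⊕ Ix D n)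

noncomputable def ext (D n : ℕ) : (Ix D n → ℝ) →ₗ[ℝ] (Ix D (n+1) → ℝ) where
  toFun v := (Sum.elim (fun _ => 0) v : Cl (D+n) ⊕ Ix D n → ℝ)
  map_add' v w := by
    funext i; rcases i with q | i
    · exact (add_zero (0:ℝ)).symm
    · rfl
  map_smul' c v := by
    funext i; rcases i with q | i
    · exact (mul_zero c).symm
    · rfl

noncomputable def kd (D : ℕ) : ∀ n, Submodule ℝ (Ix D n → ℝ) → ℕ → ℕ
  | 0, _, _ => 0
  | n+1, U, j => if j = n then Module.finrank ℝ (U.map (rin D n)) else kd D n (U.comap (ext D n)) j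

lemma kd_mono (D : ℕ) : ∀ n U U' j, U ≤ U' → kd D n U j ≤ kd D n U' j
  | 0, _, _, _, _ => le_rfl
  | n+1, U, U', j, h => by
    unfold kd; split_ifs
    · exact Submodule.finrank_mono (Submodule.map_mono h)
    · exact kd_mono D n _ _ j (Submodule.comap_mono h)

lemma kd_le (D : ℕ) : ∀ n U j, kd D n U j ≤ 2^(D+j)
  | 0, _, _ => Nat.zero_le _
  | n+1, U, j => by
    unfold kd; split_ifs with h
    · refine (Submodule.finrank_le _).trans ?_
      rw [h]; simp
    · exact kd_le D n _ j

lemma kd_zero (D : ℕ) : ∀ n (U : Submodule ℝ (Ix D n → ℝ)) j, (∀ v ∈ U, ∀ i, lev i = j → v i = 0) →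
    kd D n U j = 0
  | 0, _, _, _ => rfl
  | n+1, U, j, h => by
    unfold kd; split_ifs with hj
    · have : U.map (rin D n) = ⊥ := by
        rw [eq_bot_iff]
        rintro _ ⟨v, hv, rfl⟩
        rw [Submodule.mem_bot]
        funext q
        exact h v hv (Sum.inl q : Cl (D+n) ⊕ Ix D n) hj.symm
      rw [this]; simp
    · refine kd_zero D n _ j fun v hv i hi => ?_
      exact h _ hv (Sum.inr i : Cl (D+n) ⊕ Ix D n) hi

lemma kd_sum (D : ℕ) : ∀ n (U : Submodule ℝ (Ix D n → ℝ)),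
    Module.finrank ℝ U = ∑ j ∈ Finset.range n, kd D n U j
  | 0, U => by
    have : IsEmpty (Ix D 0) := inferInstanceAs (IsEmpty Empty)
    simp only [Finset.range_zero, Finset.sum_empty]
    have : Subsingleton (Ix D 0 → ℝ) := inferInstance
    exact Module.finrank_zero_of_subsingleton
  | n+1, U => by
    rw [Finset.sum_range_succ]
    have e1 : ∑ j ∈ Finset.range n, kd D (n+1) U j = ∑ j ∈ Finset.range n, kd D n (U.comap (ext D n)) j := by
      refine Finset.sum_congr rfl (fun j hj => ?_)
      have := Finset.mem_range.1 hj
      rw [kd, if_neg (by omega)]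
    rw [e1, ← kd_sum D n, kd, if_pos rfl]
    have h := LinearMap.finrank_range_add_finrank_ker ((rin D n).domRestrict U)
    have hr : LinearMap.range ((rin D n).domRestrict U) = U.map (rin D n) := by
      rw [LinearMap.range_domRestrict]
    rw [hr] at h
    have hk : Module.finrank ℝ (LinearMap.ker ((rin D n).domRestrict U)) =
        Module.finrank ℝ (U.comap (ext D n)) := by
      have hinj : Function.Injective (ext D n) := by
        intro v w hvw
        funext i
        exact congrFun hvw (Sum.inr i : Cl (D+n) ⊕ Ix D n)
      have e2 : Module.finrank ℝ ((U.comap (ext D n)).map (ext D n)) = Module.finrank ℝ (U.comap (ext D n)) :=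
        (LinearEquiv.finrank_eq (Submodule.equivMapOfInjective _ hinj _)).symm
      have e3 : Module.finrank ℝ ((LinearMap.ker ((rin D n).domRestrict U)).map U.subtype) =
          Module.finrank ℝ (LinearMap.ker ((rin D n).domRestrict U)) :=
        (LinearEquiv.finrank_eq (Submodule.equivMapOfInjective _ (Submodule.injective_subtype U) _)).symm
      rw [← e2, ← e3]
      have : (LinearMap.ker ((rin D n).domRestrict U)).map U.subtype = (U.comap (ext D n)).map (ext D n) := by
        ext v
        constructor
        · rintro ⟨w, hw, rfl⟩
          have hw' : rin D n w.1 = 0 := hw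
          have : ext D n (fun i => w.1 (Sum.inr i : Cl (D+n) ⊕ Ix D n)) = w.1 := by
            funext i
            rcases i with q | i
            · exact (congrFun hw' q).symm
            · rfl
          refine ⟨_, ?_, this⟩
          change ext D n _ ∈ U
          rw [this]; exact w.2
        · rintro ⟨w, hw, rfl⟩
          refine ⟨⟨_, hw⟩, ?_, rfl⟩
          change rin D n (ext D n w) = 0
          rfl
      rw [this]
    omega

lemma card_Ix (D : ℕ) : ∀ n, ∑ j ∈ Finset.range n, 2^(D+j) = Fintype.card (Ix D n)
  | 0 => by
    change _ = Fintype.card Empty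
    simp
  | n+1 => by
    rw [Finset.sum_range_succ, card_Ix D n]
    have : Fintype.card (Ix D (n+1)) = Fintype.card (Cl (D+n) ⊕ Ix D n) := rfl
    rw [this, Fintype.card_sum]
    simp [add_comm]

end FKT

open Filter Topology
open scoped Classical
namespace FKT

lemma ker_chain {ρ : ℝ} (hρ : 0 < ρ) (D n b : ℕ) (s : St (D+n+1)) (U : Submodule ℝ (Ix D (n+1) → ℝ)) :
    ent (stp ρ D n b s) (relV vecE (U.map (rin D n))) + ∑ e, stp ρ D n b s e *
      ent (ker ρ D n b (kept (k := D+n) s e)) (relV vec (U.comap (ext D n))) ≤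
    ent (ker ρ D (n+1) b s) (relV vec U) := by
  refine ent_chain (A := Sg (D+n)) (B := Pa D n) (st := stp ρ D n b s)
    (K := fun e => ker ρ D n b (kept (k := D+n) s e)) (stp_nonneg hρ D n b s) (stp_sum hρ D n b s)
    (fun e p => ker_nonneg hρ _ _ _ _ _) (fun e => ker_sum hρ _ _ _ _)
    (u := relV (X := Sg (D+n) × Pa D n) (fun p => vec (D := D) (n := n+1) p) U)
    (relV_equiv _ _) (j := relV vecE (U.map (rin D n))) (relV_equiv _ _)
    (r := relV vec (U.comap (ext D n))) ?_ ?_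
  · intro x y h
    refine ⟨_, h, ?_⟩
    funext q
    exact congrArg₂ (· - ·) (vec_inl (D := D) (n := n) y q) (vec_inl (D := D) (n := n) x q)
  · intro e p p'
    unfold relV
    rw [Submodule.mem_comap]
    have : vec (D := D) (n := n+1) (e, p') - vec (D := D) (n := n+1) (e, p) = ext D n (vec p' - vec p) := by
      funext i
      rcases i with q | i
      · refine (congrArg₂ (· - ·) (vec_inl (D := D) (n := n) (e,p') q) (vec_inl (D := D) (n := n) (e,p) q)).trans ?_
        exact sub_self _
      · refine (congrArg₂ (· - ·) (vec_inr (D := D) (n := n) (e,p') i) (vec_inr (D := D) (n := n) (e,p) i)).trans ?_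
        exact add_sub_add_left_eq_sub _ _ _
    rw [← this]

lemma ker_ent {ρ : ℝ} (hρ : 0 < ρ) (D b : ℕ) : ∀ n (U : Submodule ℝ (Ix D n → ℝ)),
    ∑ j ∈ Finset.range n, (if j ≤ b ∧ b ≤ j + D then et ρ D (b-j) * ((2:ℝ)^(D+j) - kd D n U j) else 0) ≤
    ∑ s, AL ρ D (b+1-n) (D+n) s * ent (ker ρ D n b s) (relV vec U)
  | 0, U => by
    simp only [Finset.range_zero, Finset.sum_empty]
    exact Finset.sum_nonneg fun s _ => mul_nonneg (AL_nonneg hρ _ _ _ _)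
      (ent_nonneg (ker_nonneg hρ _ _ _ _) (ker_sum hρ _ _ _ _) _)
  | n+1, U => by
    have ih := ker_ent hρ D b n (U.comap (ext D n))
    by_cases hb : n + D < b
    · rw [Finset.sum_eq_zero]
      · exact Finset.sum_nonneg fun s _ => mul_nonneg (AL_nonneg hρ _ _ _ _)
          (ent_nonneg (ker_nonneg hρ _ _ _ _) (ker_sum hρ _ _ _ _) _)
      · intro j hj
        have := Finset.mem_range.1 hj
        rw [if_neg (by omega)]
    push Not at hb
    have e1 : ∑ j ∈ Finset.range (n+1), (if j ≤ b ∧ b ≤ j + D then et ρ D (b-j) * ((2:ℝ)^(D+j) - kd D (n+1) U j) else 0)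
        = (∑ j ∈ Finset.range n, (if j ≤ b ∧ b ≤ j + D then et ρ D (b-j) * ((2:ℝ)^(D+j) - kd D n (U.comap (ext D n)) j) else 0))
        + (if n ≤ b ∧ b ≤ n + D then et ρ D (b-n) * ((2:ℝ)^(D+n) - Module.finrank ℝ (U.map (rin D n))) else 0) := by
      rw [Finset.sum_range_succ]
      congr 1
      · refine Finset.sum_congr rfl (fun j hj => ?_)
        have := Finset.mem_range.1 hj
        rw [show kd D (n+1) U j = kd D n (U.comap (ext D n)) j by rw [kd, if_neg (by omega)]]
      · rw [show kd D (n+1) U n = Module.finrank ℝ (U.map (rin D n)) by rw [kd, if_pos rfl]]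
    rw [e1]
    have hstep : ∑ s, AL ρ D (b+1-(n+1)) (D+(n+1)) s * (ent (stp ρ D n b s) (relV vecE (U.map (rin D n))) + ∑ e, stp ρ D n b s e *
      ent (ker ρ D n b (kept (k := D+n) s e)) (relV vec (U.comap (ext D n)))) ≤
      ∑ s, AL ρ D (b+1-(n+1)) (D+(n+1)) s * ent (ker ρ D (n+1) b s) (relV vec U) :=
      Finset.sum_le_sum fun s _ => mul_le_mul_of_nonneg_left (ker_chain hρ D n b s U) (AL_nonneg hρ _ _ _ _)
    refine le_trans ?_ hstep
    by_cases hn : n ≤ b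
    · rw [if_pos ⟨hn, hb⟩]
      have e2 : b + 1 - (n+1) = b - n := by omega
      have e3 : b + 1 - n = (b - n) + 1 := by omega
      rw [e2]
      rw [e3, AL_step ρ D (b-n) (D+n) (fun s => ent (ker ρ D n b s) (relV vec (U.comap (ext D n))))] at ih
      have hg := gibbs_codim hρ D (b-n) (D+n) (by omega) (by omega) (U.map (rin D n))
      unfold HU at hg
      have e4 : ∀ s : St (D+n+1), stp ρ D n b s = nu ρ (D - (b-n)) (D+n) s := by
        intro s; funext e; unfold stp; rw [if_pos ⟨hn, hb⟩]
      simp only [mul_add, Finset.sum_add_distrib]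
      have a1 : ∑ s : St (D+(n+1)), AL ρ D (b-n) (D+(n+1)) s * ent (stp ρ D n b s) (relV vecE (U.map (rin D n))) =
         ∑ s : St (D+n+1), AL ρ D (b-n) (D+n+1) s * ent (nu ρ (D - (b-n)) (D+n) s) (relV vecE (U.map (rin D n))) :=
        Finset.sum_congr rfl fun s _ => by rw [e4 s]; rfl
      have a2 : ∑ s : St (D+(n+1)), AL ρ D (b-n) (D+(n+1)) s * ∑ e, stp ρ D n b s e *
          ent (ker ρ D n b (kept (k := D+n) s e)) (relV vec (U.comap (ext D n))) =
         ∑ s : St (D+n+1), AL ρ D (b-n) (D+n+1) s * ∑ e, nu ρ (D - (b-n)) (D+n) s e *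
          ent (ker ρ D n b (kept (k := D+n) s e)) (relV vec (U.comap (ext D n))) :=
        Finset.sum_congr rfl fun s _ => by rw [e4 s]; rfl
      rw [a1, a2]
      linarith
    · rw [if_neg (by omega), add_zero]
      have e2 : b + 1 - (n+1) = 0 := by omega
      have e3 : b + 1 - n = 0 := by omega
      rw [e2]
      rw [e3] at ih
      refine ih.trans ?_
      unfold AL
      simp only [ite_mul, one_mul, zero_mul, Finset.sum_ite_eq', Finset.mem_univ, if_true]
      have e4 : ∀ s : St (D+n+1), ∀ e, stp ρ D n b s e = if e = (fun _ => 0) then 1 else 0 := by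
        intro s e; unfold stp; rw [if_neg (by omega)]
      have e5 := ent_nonneg (stp_nonneg hρ D n b (fun _ => true)) (stp_sum hρ D n b _) (relV vecE (U.map (rin D n)))
      have e6 : ∑ e, stp ρ D n b (fun _ => true) e *
          ent (ker ρ D n b (kept (k := D+n) (fun _ => true) e)) (relV vec (U.comap (ext D n))) =
          ent (ker ρ D n b (fun _ => true)) (relV vec (U.comap (ext D n))) := by
        simp only [e4, ite_mul, one_mul, zero_mul, Finset.sum_ite_eq', Finset.mem_univ, if_true]
        have := kept_fl_zero (D+n)
        unfold fl at this
        rw [this]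
      rw [← e6]
      exact le_add_of_nonneg_left e5

lemma mu_ent {ρ : ℝ} (hρ : 0 < ρ) (D R b : ℕ) (U : Submodule ℝ (Ix D R → ℝ)) :
    ∑ j ∈ Finset.range R, (if j ≤ b ∧ b ≤ j + D then et ρ D (b-j) * ((2:ℝ)^(D+j) - kd D R U j) else 0) ≤
    ent (mu ρ D R b) (relV vec U) := by
  refine (ker_ent hρ D b R U).trans ?_
  exact ent_mix (fun s => AL_nonneg hρ _ _ _ s) (AL_sum hρ _ _ _) (fun s p => ker_nonneg hρ _ _ _ _ _)
    (fun s => ker_sum hρ _ _ _ _) (relV_equiv _ _)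

end FKT

open Filter Topology
open scoped Classical
namespace FKT

lemma exp_neg_le_quad {z : ℝ} (hz : 0 ≤ z) : Real.exp (-z) ≤ 1 - z + z^2/2 := by
  have h : MonotoneOn (fun z : ℝ => 1 - z + z^2/2 - Real.exp (-z)) (Set.Ici 0) := by
    apply monotoneOn_of_deriv_nonneg (convex_Ici 0)
    · fun_prop
    · fun_prop
    · intro x hx
      have hd : HasDerivAt (fun z : ℝ => 1 - z + z^2/2 - Real.exp (-z)) (0 - 1 + (2*x^(2-1)*1)/2 - Real.exp (-x) * (-1)) x := by
        refine HasDerivAt.sub (HasDerivAt.add (HasDerivAt.sub (hasDerivAt_const _ _) (hasDerivAt_id _)) ?_) ?_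
        · have := ((hasDerivAt_id x).pow 2).div_const 2
          simpa using this
        · exact (hasDerivAt_neg x).exp
      rw [hd.deriv]
      have := Real.add_one_le_exp (-x)
      norm_num
      linarith
  have := h (Set.mem_Ici.2 le_rfl) (Set.mem_Ici.2 hz) hz
  simp at this
  linarith

lemma Mf_le {E X : Type} [Fintype E] [NormedAddCommGroup X] [NormedSpace ℝ X] [FiniteDimensional ℝ X]
    {θ : ℝ} {vec : E → X} {π : ℕ → ℝ} {m : ℕ → E → ℝ} (t : ℕ) (U : Submodule ℝ X)
    (hm : ∀ x, 0 ≤ m t x) (hm1 : ∑ x, m t x = 1) (h0 : 0 ≤ π t) (hθ : 0 < θ) {L0 : ℝ}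
    (hL : ∀ x, m t x ≠ 0 → Real.exp (-L0) ≤ m t x) :
    Mf θ vec π m t U ≤ Real.exp (-(π t * θ * (1 - θ * L0 / 2) * ent (m t) (relV vec U))) := by
  have hc : ∀ x, (∑ x', if vec x - vec x' ∈ U then m t x' else 0) = cp (m t) (relV vec U) x := by
    intro x; unfold cp relV
    refine Finset.sum_congr rfl fun x' _ => ?_
    have : vec x - vec x' ∈ U ↔ vec x' - vec x ∈ U := by
      rw [← Submodule.neg_mem_iff, neg_sub]
    simp only [this]
  have key : ∑ x, m t x * (cp (m t) (relV vec U) x)^θ ≤ 1 - θ * (1 - θ * L0 / 2) * ent (m t) (relV vec U) := by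
    have : ∀ x, m t x * (cp (m t) (relV vec U) x)^θ ≤ m t x + θ * (1 - θ * L0 / 2) * (m t x * Real.log (cp (m t) (relV vec U) x)) := by
      intro x
      by_cases hx : m t x = 0
      · simp [hx]
      have h1 := hL x hx
      have h2 : m t x ≤ cp (m t) (relV vec U) x := le_cp hm ((relV_equiv _ _).refl x)
      have h3 : 0 < cp (m t) (relV vec U) x := (Real.exp_pos _).trans_le (h1.trans h2)
      have h4 := cp_le_one hm hm1 (relV vec U) x
      set Y := Real.log (cp (m t) (relV vec U) x) with hY
      have hY0 : Y ≤ 0 := Real.log_nonpos h3.le h4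
      have hY1 : -L0 ≤ Y := by
        rw [hY, Real.le_log_iff_exp_le h3]; exact h1.trans h2
      rw [Real.rpow_def_of_pos h3, ← hY]
      have hq := exp_neg_le_quad (z := -(Y*θ)) (by nlinarith)
      rw [neg_neg] at hq
      have : Real.exp (Y*θ) ≤ 1 + θ * (1 - θ*L0/2) * Y := by
        have h6 : Y^2 ≤ L0 * (-Y) := by nlinarith
        have h7 : θ^2 * Y^2 ≤ θ^2 * (L0 * (-Y)) := mul_le_mul_of_nonneg_left h6 (sq_nonneg θ)
        nlinarith
      calc m t x * Real.exp (Y*θ) ≤ m t x * (1 + θ * (1 - θ*L0/2) * Y) := mul_le_mul_of_nonneg_left this (hm x)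
        _ = _ := by ring
    refine (Finset.sum_le_sum fun x _ => this x).trans ?_
    rw [Finset.sum_add_distrib, hm1, ← Finset.mul_sum]
    unfold ent
    apply le_of_eq; ring
  unfold Mf
  simp only [hc]
  have h8 := mul_le_mul_of_nonneg_left key h0
  refine le_trans ?_ (Real.one_sub_le_exp_neg _)
  nlinarith

lemma tail_lemma (g : ℕ → ℝ) {M N : ℕ} {γ : ℝ} (hMN : M ≤ N) (h1 : ∀ c, M ≤ c → c < N → g c = γ)
    (h2 : ∀ c, c < M → g c ≤ 0) (h3 : 0 ≤ ∑ c ∈ Finset.range N, g c) (t : ℕ) (ht : t ≤ N) :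
    0 ≤ ∑ c ∈ Finset.Ico t N, g c := by
  have A : ∀ t, t ≤ M → 0 ≤ ∑ c ∈ Finset.Ico t N, g c := by
    intro t ht
    rw [Finset.sum_Ico_eq_sub _ (ht.trans hMN)]
    have : ∑ c ∈ Finset.range t, g c ≤ 0 := Finset.sum_nonpos fun c hc => h2 c ((Finset.mem_range.1 hc).trans_le ht)
    linarith
  rcases le_total t M with h | h
  · exact A t h
  · have B : ∀ t, M ≤ t → t ≤ N → ∑ c ∈ Finset.Ico t N, g c = ((N - t : ℕ):ℝ) * γ := by
      intro t h ht
      rw [Finset.sum_congr rfl (g := fun _ => γ)]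
      · simp
      · intro c hc
        rw [Finset.mem_Ico] at hc
        exact h1 c (h.trans hc.1) hc.2
    have h4 := A M le_rfl
    rw [B M le_rfl hMN] at h4
    rw [B t h ht]
    rcases Nat.eq_zero_or_pos (N - M) with h5 | h5
    · have : N - t = 0 := by omega
      simp [this]
    · have h6 : (0:ℝ) < ((N-M:ℕ):ℝ) := by exact_mod_cast h5
      have h7 : 0 ≤ γ := by
        by_contra hc; push Not at hc
        nlinarith
      positivity

/-- block index of a cell -/
noncomputable def bb (B : ℕ) (N : ℕ → ℕ) (c : ℕ) : ℕ := ((Finset.Icc 1 B).filter fun b => c < N b).card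

lemma bb_le (B N c) : bb B N c ≤ B := by
  unfold bb
  refine (Finset.card_filter_le _ _).trans ?_
  simp

lemma bb_eq {B : ℕ} {N : ℕ → ℕ} (hN : Antitone N) {c b : ℕ} (hb : b ≤ B) (h1 : b = B ∨ N (b+1) ≤ c)
    (h2 : b = 0 ∨ c < N b) : bb B N c = b := by
  unfold bb
  have : (Finset.Icc 1 B).filter (fun b => c < N b) = Finset.Icc 1 b := by
    ext k
    simp only [Finset.mem_filter, Finset.mem_Icc]
    constructor
    · rintro ⟨⟨h3, h4⟩, h5⟩
      refine ⟨h3, ?_⟩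
      rcases h1 with h1 | h1
      · omega
      · by_contra h6; push Not at h6
        have := hN (show b+1 ≤ k by omega)
        omega
    · rintro ⟨h3, h4⟩
      refine ⟨⟨h3, h4.trans hb⟩, ?_⟩
      rcases h2 with h2 | h2
      · omega
      · exact h2.trans_le (hN h4)
  rw [this]; simp

lemma le_bb_iff {B : ℕ} {N : ℕ → ℕ} (hN : Antitone N) {c b : ℕ} (hb : b ≤ B) (hb1 : 1 ≤ b) :
    b ≤ bb B N c ↔ c < N b := by
  constructor
  · intro h
    by_contra h2; push Not at h2
    have : bb B N c ≤ b - 1 := by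
      unfold bb
      have hs : (Finset.Icc 1 B).filter (fun b => c < N b) ⊆ Finset.Icc 1 (b-1) := by
        intro k
        simp only [Finset.mem_filter, Finset.mem_Icc]
        rintro ⟨⟨h3, h4⟩, h5⟩
        refine ⟨h3, ?_⟩
        by_contra h6
        have := hN (show b ≤ k by omega)
        omega
      refine (Finset.card_le_card hs).trans ?_
      simp
    omega
  · intro h
    unfold bb
    have hs : Finset.Icc 1 b ⊆ (Finset.Icc 1 B).filter (fun b => c < N b) := by
      intro k
      simp only [Finset.mem_filter, Finset.mem_Icc]
      rintro ⟨h3, h4⟩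
      exact ⟨⟨h3, h4.trans hb⟩, h.trans_le (hN h4)⟩
    have := Finset.card_le_card hs
    simpa using this

end FKT

open Filter Topology
open scoped Classical
namespace FKT

noncomputable def zp (D : ℕ) : ∀ n, Pa D n
  | 0 => ()
  | n+1 => ((fun _ => 0 : Sg (D+n)), zp D n)

lemma om_zp (D : ℕ) : ∀ n l, om (zp D n) l = 0
  | 0, l => rfl
  | n+1, l => by
    obtain ⟨b, q, rfl⟩ := cns_surj (k := D+n) l
    rw [om_cns]
    have h1 : om (zp D (n+1)).2 q = 0 := om_zp D n q
    have h2 : ¬ ((zp D (n+1)).1 q = sgb b) := fun h => sgb_ne_zero b h.symm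
    rw [h1, if_neg h2, zero_add]

lemma vec_zp (D n : ℕ) : vec (zp D n) = 0 := by
  funext i; unfold vec; rw [om_zp, om_zp]; simp

noncomputable def mc (ρ : ℝ) (D R : ℕ) (N : ℕ → ℕ) (c : ℕ) (p : Pa D R) : ℝ :=
  if c < N 0 then mu ρ D R (bb (R+D) N c) p else if p = zp D R then 1 else 0

lemma mc_nonneg {ρ : ℝ} (hρ : 0 < ρ) (D R N c p) : 0 ≤ mc ρ D R N c p := by
  unfold mc; split_ifs
  · exact mu_nonneg hρ _ _ _ _
  · norm_num
  · norm_num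

lemma mc_sum {ρ : ℝ} (hρ : 0 < ρ) (D R N c) : ∑ p, mc ρ D R N c p = 1 := by
  unfold mc; split_ifs
  · exact mu_sum hρ _ _ _
  · simp

lemma mc_om {ρ : ℝ} {D R : ℕ} {N : ℕ → ℕ} {c : ℕ} {p : Pa D R} (h : mc ρ D R N c p ≠ 0) (l) :
    om p l = 0 ∨ om p l = 1 := by
  unfold mc at h
  split_ifs at h with h1 h2
  · obtain ⟨s, hs⟩ := mu_supp h
    exact (ker_om hs l).1
  · rw [h2]; exact Or.inl (om_zp _ _ _)
  · exact absurd rfl h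

lemma mc_vec {ρ : ℝ} {D R : ℕ} {N : ℕ → ℕ} (hN : Antitone N) {c : ℕ} {p : Pa D R}
    (h : mc ρ D R N c p ≠ 0) (i : Ix D R) (hi : N (lev i) ≤ c) : vec p i = 0 := by
  unfold mc at h
  split_ifs at h with h1 h2
  · obtain ⟨s, hs⟩ := mu_supp h
    refine ker_vec hs i ?_
    have hl := lev_lt i
    by_contra h3; push Not at h3
    have h4 : 1 ≤ lev i := by
      by_contra h5
      have : lev i = 0 := by omega
      rw [this] at hi; omega
    have := (le_bb_iff hN (show lev i ≤ R + D by omega) h4).1 h3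
    omega
  · rw [h2, vec_zp]; rfl
  · exact absurd rfl h

lemma sum_lev (D : ℕ) (f : ℕ → ℝ) : ∀ n, ∑ i : Ix D n, f (lev i) = ∑ j ∈ Finset.range n, (2:ℝ)^(D+j) * f j
  | 0 => by
    change ∑ i : Empty, _ = _
    simp
  | n+1 => by
    have : ∑ i : Ix D (n+1), f (lev i) = ∑ i : Cl (D+n) ⊕ Ix D n, f (lev (n := n+1) i) := rfl
    rw [this, Fintype.sum_sum_type, Finset.sum_range_succ, ← sum_lev D f n, add_comm]
    congr 1
    change ∑ q : Cl (D+n), f n = _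
    simp

noncomputable def Vs (D R : ℕ) (N : ℕ → ℕ) (c : ℕ) : Submodule ℝ (Ix D R → ℝ) where
  carrier := {v | ∀ i, N (lev i) ≤ c → v i = 0}
  add_mem' := by
    intro v w hv hw i hi
    simp [hv i hi, hw i hi]
  zero_mem' := by intro i hi; rfl
  smul_mem' := by
    intro r v hv i hi
    simp [hv i hi]

noncomputable def muf (ρ : ℝ) (D R : ℕ) (N : ℕ → ℕ) (μ0 : ℝ) (c j : ℕ) : ℝ :=
  μ0 * (if j ≤ bb (R+D) N c ∧ bb (R+D) N c ≤ j + D then et ρ D (bb (R+D) N c - j) else 0)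

lemma muf_nonneg {ρ : ℝ} (hρ : 0 < ρ) (D R N) {μ0 : ℝ} (hμ : 0 ≤ μ0) (c j) : 0 ≤ muf ρ D R N μ0 c j := by
  unfold muf
  refine mul_nonneg hμ ?_
  split_ifs with h
  · exact et_nonneg hρ D _ (by omega)
  · exact le_rfl

lemma muf_block {ρ : ℝ} {D R : ℕ} {N : ℕ → ℕ} (hN : Antitone N) {μ0 : ℝ} {j : ℕ} (hj : j < R) {i c : ℕ} (hi : i ≤ D)
    (h1 : N (j+i+1) ≤ c) (h2 : c < N (j+i)) : muf ρ D R N μ0 c j = μ0 * et ρ D i := by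
  have : bb (R+D) N c = j + i := bb_eq hN (by omega) (Or.inr h1) (Or.inr h2)
  unfold muf
  rw [this, if_pos (by omega), Nat.add_sub_cancel_left]

lemma muf_sum {ρ : ℝ} {D R : ℕ} {N : ℕ → ℕ} (hN : Antitone N) {μ0 : ℝ} {j : ℕ} (hj : j < R) :
    ∀ k, k ≤ D + 1 → ∑ c ∈ Finset.Ico (N (j+k)) (N j), muf ρ D R N μ0 c j =
      μ0 * ∑ i ∈ Finset.range k, et ρ D i * ((N (j+i) : ℝ) - N (j+i+1))
  | 0, _ => by simp
  | k+1, hk => by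
    rw [Finset.sum_range_succ, mul_add, ← muf_sum hN hj k (by omega)]
    rw [← Finset.sum_Ico_consecutive _ (show N (j+(k+1)) ≤ N (j+k) from hN (by omega)) (hN (by omega)), add_comm]
    congr 1
    rw [Finset.sum_congr rfl (g := fun _ => μ0 * et ρ D k)]
    · rw [Finset.sum_const, Nat.card_Ico, nsmul_eq_mul, Nat.cast_sub (hN (by omega))]
      rw [show j + k + 1 = j + (k+1) by ring]; ring
    · intro c hc
      rw [Finset.mem_Ico] at hc
      exact muf_block hN hj (by omega) hc.1 hc.2

theorem trial_collision {ρ : ℝ} (hρ : 0 < ρ) (hρ1 : ρ < 1/3) (D R : ℕ) (N : ℕ → ℕ) (hN : Antitone N)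
    {a θ lam μ0 L0 C2 Λ : ℝ} (ha : 0 ≤ a) (hθ : 0 < θ) (hθ1 : θ ≤ 1) (hlam : 0 < lam) (hμ : 0 ≤ μ0)
    (hμa : μ0 ≤ a * θ)
    (hL : ∀ b, b ≤ R + D → ∀ p, mu ρ D R b p ≠ 0 → Real.exp (-L0) ≤ mu ρ D R b p)
    {π : ℕ → ℝ} (h0 : ∀ c, 0 ≤ π c) (h1 : ∀ c, π c ≤ 1)
    (hπ : ∀ c, N (R+D) ≤ c → μ0 ≤ π c * θ * (1 - θ * L0 / 2)) (hθL : θ * L0 / 2 ≤ 1)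
    (hnum : ∀ j, j < R → (a * θ + lam) * N j ≤
      μ0 * ∑ i ∈ Finset.range (D+1), et ρ D i * ((N (j+i) : ℝ) - N (j+i+1)))
    (n : ℕ) (hn : N 0 ≤ n) {J : Type} [Fintype J] (u : ℕ → J → ℝ) (y : J → ℝ)
    (hu : ∀ c x, 0 ≤ u c x) (hu1 : ∀ c, ∑ x, u c x ≤ 1) (hC : 1 ≤ C2)
    (hball : ∀ c z, ∑ x, (if |y x - z| ≤ Λ then u c x else 0) ≤ C2 * Real.exp (-a * c))
    (hΛ : FunBd (DD (vec : Pa D R → Ix D R → ℝ)) Λ) :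
    ∑ b : Fin n → Bool, ∑ p : Fin n → J, wp (piB π) 0 n b * wp u 0 n p *
      Qf θ vec (mc ρ D R N) n (fun i => if b i then y (p i) else 0) ≤
    collC (UU (vec : Pa D R → Ix D R → ℝ)).card lam 0 C2 (Module.finrank ℝ (Ix D R → ℝ)) R * Real.exp (a * θ * Fintype.card (Ix D R)) *
      Real.exp (-(a * θ * ∑ i : Ix D R, (N (lev i) : ℝ))) := by
  have hmain := collision (X := Ix D R → ℝ) (E := Pa D R) (ι := Fin R) (J := J) (a := a) (θ := θ) (lam := lam)
    (C0 := 0) (C2 := C2) (Λ := Λ) (vec := vec) (π := π) (m := mc ρ D R N)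
    (μ := fun c j => muf ρ D R N μ0 c j) (d := fun j => 2^(D+(j:ℕ))) (N := fun j => N j)
    (kd := fun j U => kd D R U j) (mc_nonneg hρ D R N) (mc_sum hρ D R N) h0 h1 hθ hθ1 ha
    (fun j U => kd_le D R U j) (fun j U U' h => kd_mono D R U U' j h)
    (fun U => by
      unfold fr
      rw [kd_sum D R U, Finset.sum_range]) (by
      rw [Module.finrank_fintype_fun_eq_card, ← card_Ix, Finset.sum_range]) hlam le_rfl ?_
    (Vs D R N) (fun c c' hcc v hv i hi => hv i (hi.trans hcc))
    (fun c x hx i hi => mc_vec hN hx i hi)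
    (fun c j hj => kd_zero D R _ _ fun v hv i hi => hv i (by rw [hi]; exact hj)) ?_ n
    (fun j => (hN (Nat.zero_le _)).trans hn) u y hu hu1 hC hball hΛ
  · refine hmain.trans ?_
    rw [Fintype.card_fin, mul_assoc (collC _ _ _ _ _ _), ← Real.exp_add]
    have hcc : 0 ≤ collC (UU (vec : Pa D R → Ix D R → ℝ)).card lam 0 C2 (Module.finrank ℝ (Ix D R → ℝ)) R := by
      unfold collC
      have : 0 ≤ (1 - Real.exp (-lam))⁻¹ := by
        apply inv_nonneg.2
        have := Real.exp_le_one_iff.2 (show -lam ≤ 0 by linarith)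
        linarith
      positivity
    refine mul_le_mul_of_nonneg_left (Real.exp_le_exp.2 ?_) hcc
    have hdv : ∑ i : Ix D R, (N (lev i) : ℝ) - Fintype.card (Ix D R) ≤
        ∑ c ∈ Finset.Ico 1 (n+1), dv (fun j : Fin R => 2^(D+(j:ℕ))) (fun j : Fin R => N j) c := by
      unfold dv
      rw [Finset.sum_comm]
      rw [sum_lev D (fun j => (N j : ℝ)) R, ← card_Ix, Finset.sum_range, Finset.sum_range]
      push_cast
      rw [← Finset.sum_sub_distrib]
      refine Finset.sum_le_sum fun j _ => ?_
      rw [← Finset.sum_filter, Finset.sum_const, nsmul_eq_mul]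
      have hf : (Finset.Ico 1 (n+1)).filter (fun c => c < N j) = Finset.Ico 1 (N j) := by
        ext c
        simp only [Finset.mem_filter, Finset.mem_Ico]
        have := (hN (Nat.zero_le (j:ℕ))).trans hn
        omega
      rw [hf, Nat.card_Ico]
      have : (N j : ℝ) - 1 ≤ ((N j - 1 : ℕ) : ℝ) := by
        have : N j ≤ (N j - 1) + 1 := by omega
        have : (N j : ℝ) ≤ ((N j - 1 : ℕ) : ℝ) + 1 := by exact_mod_cast this
        linarith
      have h2 : (0:ℝ) < 2^(D+(j:ℕ)) := by positivity
      nlinarith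
    have := mul_le_mul_of_nonneg_left hdv (mul_nonneg ha hθ.le)
    nlinarith
  · intro j t ht
    unfold sj
    have hlog : Real.log 2 ≤ 1 := by
      have := Real.log_two_lt_d9; linarith
    have h := tail_lemma (fun c => muf ρ D R N μ0 c j - (a * θ + lam)) (M := N (j+1)) (N := N j)
      (γ := μ0 * et ρ D 0 - (a*θ+lam)) (hN (Nat.le_succ _)) (fun c hc1 hc2 => by
        rw [muf_block (i := 0) hN j.2 (Nat.zero_le _) hc1 hc2]) (fun c hc => by
        have hbb := (le_bb_iff (B := R+D) hN (show (j:ℕ)+1 ≤ R + D by have := j.2; omega) (by omega)).2 hc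
        have : muf ρ D R N μ0 c j ≤ μ0 * 1 := by
          unfold muf
          refine mul_le_mul_of_nonneg_left ?_ hμ
          split_ifs with h
          · obtain ⟨i, hi⟩ : ∃ i, bb (R+D) N c - j = i + 1 := ⟨bb (R+D) N c - j - 1, by omega⟩
            rw [hi]
            exact (et_le hρ hρ1 D i (by omega)).trans hlog
          · norm_num
        linarith) (by
        rw [Finset.sum_sub_distrib, Finset.sum_const, Finset.card_range, nsmul_eq_mul, sub_nonneg]
        have h4 := hnum j j.2
        rw [← muf_sum hN j.2 (D+1) le_rfl] at h4
        have h5 : ∑ c ∈ Finset.Ico (N (j+(D+1))) (N j), muf ρ D R N μ0 c j ≤ ∑ c ∈ Finset.range (N j), muf ρ D R N μ0 c j := by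
          refine Finset.sum_le_sum_of_subset_of_nonneg ?_ (fun c _ _ => muf_nonneg hρ D R N hμ c j)
          intro c hc
          rw [Finset.mem_Ico] at hc
          exact Finset.mem_range.2 hc.2
        linarith) t ht.le
    have e : ∑ c ∈ Finset.Ico t (N j), (muf ρ D R N μ0 c j - (a * θ + lam)) =
        ∑ c ∈ Finset.Ico t (N j), (muf ρ D R N μ0 c j - a * θ) - lam * ((N j : ℝ) - t) := by
      rw [show lam * ((N j : ℝ) - t) = ∑ c ∈ Finset.Ico t (N j), lam by
        rw [Finset.sum_const, Nat.card_Ico, nsmul_eq_mul, Nat.cast_sub (show t ≤ N j from ht.le)]; ring]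
      rw [← Finset.sum_sub_distrib]
      exact Finset.sum_congr rfl fun c _ => by ring
    rw [e] at h
    linarith
  · intro t U
    by_cases ht : t < N 0
    · have hmt : mc ρ D R N t = mu ρ D R (bb (R+D) N t) := by
        funext p; unfold mc; rw [if_pos ht]
      refine (Mf_le (L0 := L0) t U (mc_nonneg hρ D R N t) (mc_sum hρ D R N t) (h0 t) hθ (fun x hx => by
        rw [hmt] at hx ⊢; exact hL _ (bb_le _ _ _) x hx)).trans ?_
      rw [Real.exp_le_exp, neg_le_neg_iff, hmt]
      have hent := mu_ent hρ D R (bb (R+D) N t) U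
      have hent0 := ent_nonneg (mu_nonneg hρ D R (bb (R+D) N t)) (mu_sum hρ D R _) (relV vec U)
      have hle : ∑ j : Fin R, (if t < N j then muf ρ D R N μ0 t j * (((2^(D+(j:ℕ)) : ℕ) : ℝ) - kd D R U j) else 0) ≤
          μ0 * ∑ j ∈ Finset.range R, (if j ≤ bb (R+D) N t ∧ bb (R+D) N t ≤ j + D then et ρ D (bb (R+D) N t-j) * ((2:ℝ)^(D+j) - kd D R U j) else 0) := by
        rw [Finset.sum_range, Finset.mul_sum]
        refine Finset.sum_le_sum fun j _ => ?_
        have hk : (0:ℝ) ≤ ((2^(D+(j:ℕ)) : ℕ) : ℝ) - kd D R U j := by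
          have := kd_le D R U j
          have : (kd D R U j : ℝ) ≤ ((2^(D+(j:ℕ)) : ℕ) : ℝ) := by exact_mod_cast this
          linarith
        have e2 : μ0 * (if (j:ℕ) ≤ bb (R+D) N t ∧ bb (R+D) N t ≤ j + D then et ρ D (bb (R+D) N t-j) * ((2:ℝ)^(D+(j:ℕ)) - kd D R U j) else 0) =
            muf ρ D R N μ0 t j * (((2^(D+(j:ℕ)) : ℕ) : ℝ) - kd D R U j) := by
          unfold muf
          push_cast
          split_ifs
          · ring
          · ring
        rw [e2]
        split_ifs
        · exact le_rfl
        · exact mul_nonneg (muf_nonneg hρ D R N hμ _ _) hk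
      refine hle.trans ?_
      by_cases hR : N (R+D) ≤ t
      · calc _ ≤ μ0 * ent (mu ρ D R (bb (R+D) N t)) (relV vec U) := mul_le_mul_of_nonneg_left hent hμ
          _ ≤ _ := mul_le_mul_of_nonneg_right (hπ t hR) hent0
      · push Not at hR
        have hb : bb (R+D) N t = R + D := bb_eq hN le_rfl (Or.inl rfl) (Or.inr hR)
        rw [Finset.sum_eq_zero]
        · rw [mul_zero]
          refine mul_nonneg (mul_nonneg (mul_nonneg (h0 t) hθ.le) (by linarith)) hent0
        · intro j hj
          have := Finset.mem_range.1 hj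
          rw [if_neg (by omega)]
    · have hz : ∑ j : Fin R, (if t < N j then muf ρ D R N μ0 t j * (((2^(D+(j:ℕ)) : ℕ) : ℝ) - kd D R U j) else 0) = 0 := by
        refine Finset.sum_eq_zero fun j _ => ?_
        have := hN (Nat.zero_le (j:ℕ))
        rw [if_neg (by omega)]
      rw [hz, neg_zero, Real.exp_zero]
      unfold Mf
      have : ∑ x, mc ρ D R N t x * (∑ x', if vec x - vec x' ∈ U then mc ρ D R N t x' else 0) ^ θ ≤ 1 := by
        calc _ ≤ ∑ x, mc ρ D R N t x * 1 := by
              refine Finset.sum_le_sum fun x _ => mul_le_mul_of_nonneg_left ?_ (mc_nonneg hρ D R N t x)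
              refine Real.rpow_le_one (Finset.sum_nonneg fun x' _ => ?_) ?_ hθ.le
              · split_ifs
                · exact mc_nonneg hρ D R N t x'
                · exact le_rfl
              · rw [← mc_sum hρ D R N t]
                refine Finset.sum_le_sum fun x' _ => ?_
                split_ifs
                · exact le_rfl
                · exact mc_nonneg hρ D R N t x'
          _ = 1 := by simp [mc_sum hρ D R N t]
      nlinarith [h0 t]

end FKT

open Filter Topology
open scoped Classical
namespace FKT

noncomputable def nrm (P : Finset ℕ) : ℝ := ∏ p ∈ P, (1 + 1/(p:ℝ))⁻¹
noncomputable def wt1 (A : Finset ℕ) : ℝ := ∏ p ∈ A, 1/(p:ℝ)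
/-- expectation over a random subset of `P` -/
noncomputable def EP (P : Finset ℕ) (φ : Finset ℕ → ℝ) : ℝ :=
  nrm P * ∑ A ∈ P.powerset, wt1 A * φ A

lemma nrm_pos (P) : 0 < nrm P := Finset.prod_pos fun p _ => by positivity
lemma wt1_nonneg (A) : 0 ≤ wt1 A := Finset.prod_nonneg fun p _ => by positivity

lemma nrm_le_one (P) : nrm P ≤ 1 := Finset.prod_le_one (fun p _ => by positivity) fun p _ => by
  apply inv_le_one_of_one_le₀
  have : 0 ≤ 1/(p:ℝ) := by positivity
  linarith

lemma nrm_union {P Q : Finset ℕ} (h : Disjoint P Q) : nrm (P ∪ Q) = nrm P * nrm Q := Finset.prod_union h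

lemma EP_mono {P : Finset ℕ} {φ ψ : Finset ℕ → ℝ} (h : ∀ A, A ⊆ P → φ A ≤ ψ A) : EP P φ ≤ EP P ψ := by
  unfold EP
  refine mul_le_mul_of_nonneg_left (Finset.sum_le_sum fun A hA => ?_) (nrm_pos P).le
  exact mul_le_mul_of_nonneg_left (h A (Finset.mem_powerset.1 hA)) (wt1_nonneg A)

lemma EP_congr {P : Finset ℕ} {φ ψ : Finset ℕ → ℝ} (h : ∀ A, A ⊆ P → φ A = ψ A) : EP P φ = EP P ψ :=
  le_antisymm (EP_mono fun A hA => (h A hA).le) (EP_mono fun A hA => (h A hA).ge)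

lemma EP_add (P : Finset ℕ) (φ ψ : Finset ℕ → ℝ) : EP P (fun A => φ A + ψ A) = EP P φ + EP P ψ := by
  unfold EP; rw [← mul_add, ← Finset.sum_add_distrib]; simp only [mul_add]

lemma EP_mul_left (P : Finset ℕ) (c : ℝ) (φ : Finset ℕ → ℝ) : EP P (fun A => c * φ A) = c * EP P φ := by
  unfold EP; simp only [Finset.mul_sum]; exact Finset.sum_congr rfl fun A _ => by ring

lemma EP_mul_right (P : Finset ℕ) (c : ℝ) (φ : Finset ℕ → ℝ) : EP P (fun A => φ A * c) = EP P φ * c := by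
  simp only [mul_comm _ c]; exact EP_mul_left P c φ

lemma EP_sub (P : Finset ℕ) (φ ψ : Finset ℕ → ℝ) : EP P (fun A => φ A - ψ A) = EP P φ - EP P ψ := by
  unfold EP; rw [← mul_sub, ← Finset.sum_sub_distrib]; simp only [mul_sub]

lemma EP_sum {ι : Type*} (P : Finset ℕ) (s : Finset ι) (φ : ι → Finset ℕ → ℝ) :
    EP P (fun A => ∑ i ∈ s, φ i A) = ∑ i ∈ s, EP P (φ i) := by
  unfold EP
  rw [← Finset.mul_sum, Finset.sum_comm]
  simp only [Finset.mul_sum]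

lemma EP_empty (φ : Finset ℕ → ℝ) : EP ∅ φ = φ ∅ := by
  simp [EP, nrm, wt1]

lemma EP_insert {p : ℕ} {P : Finset ℕ} (hp : p ∉ P) (φ : Finset ℕ → ℝ) :
    EP (insert p P) φ = EP P (fun A => (1+1/(p:ℝ))⁻¹ * (φ A + 1/(p:ℝ) * φ (insert p A))) := by
  unfold EP
  rw [Finset.sum_powerset_insert hp, nrm, Finset.prod_insert hp, ← Finset.sum_add_distrib, mul_assoc, mul_left_comm,
    Finset.mul_sum]
  change nrm P * _ = _
  congr 1
  refine Finset.sum_congr rfl fun A hA => ?_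
  have : p ∉ A := fun h => hp (Finset.mem_powerset.1 hA h)
  rw [show wt1 (insert p A) = 1/(p:ℝ) * wt1 A from Finset.prod_insert this]
  ring

lemma EP_union {P Q : Finset ℕ} (h : Disjoint P Q) (φ : Finset ℕ → ℝ) :
    EP (P ∪ Q) φ = EP P (fun A => EP Q (fun B => φ (A ∪ B))) := by
  induction Q using Finset.induction_on generalizing φ with
  | empty => simp [EP_empty]
  | insert p Q hp ih =>
    rw [Finset.disjoint_insert_right] at h
    rw [Finset.union_insert, EP_insert (by simp [h.1, hp]), ih h.2]
    refine EP_congr fun A hA => ?_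
    rw [EP_insert hp]
    simp only [Finset.union_insert]

lemma EP_const (P : Finset ℕ) (c : ℝ) : EP P (fun _ => c) = c := by
  induction P using Finset.induction_on with
  | empty => simp [EP_empty]
  | insert p P hp ih =>
    rw [EP_insert hp]
    have : (1+1/(p:ℝ)) ≠ 0 := by positivity
    rw [show (1+1/(p:ℝ))⁻¹ * (c + 1/(p:ℝ) * c) = c by field_simp]
    exact ih

lemma EP_nonneg {P : Finset ℕ} {φ : Finset ℕ → ℝ} (h : ∀ A, A ⊆ P → 0 ≤ φ A) : 0 ≤ EP P φ := by
  rw [← EP_const P 0]; exact EP_mono h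

lemma EP_le_of_subset {P Q : Finset ℕ} (h : P ⊆ Q) {φ : Finset ℕ → ℝ} (hφ : ∀ A B, A ⊆ B → φ A ≤ φ B) :
    EP P φ ≤ EP Q φ := by
  rw [← Finset.union_sdiff_of_subset h, EP_union Finset.disjoint_sdiff]
  refine EP_mono fun A _ => ?_
  rw [← EP_const (Q \ P) (φ A)]
  exact EP_mono fun B _ => hφ _ _ Finset.subset_union_left

lemma EP_biUnion_prod {ι : Type*} (s : Finset ι) (W : ι → Finset ℕ)
    (hW : ∀ i ∈ s, ∀ j ∈ s, i ≠ j → Disjoint (W i) (W j)) (f : ι → Finset ℕ → ℝ) :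
    EP (s.biUnion W) (fun B => ∏ i ∈ s, f i (B ∩ W i)) = ∏ i ∈ s, EP (W i) (f i) := by
  induction s using Finset.induction_on with
  | empty => simp [EP_empty]
  | insert n s hn ih =>
    rw [Finset.biUnion_insert, EP_union, Finset.prod_insert hn, ← ih (fun i hi j hj => hW i (Finset.mem_insert_of_mem hi) j (Finset.mem_insert_of_mem hj)), ← EP_mul_right]
    · refine EP_congr fun A hA => ?_
      rw [← EP_mul_left]
      refine EP_congr fun B hB => ?_
      rw [Finset.prod_insert hn]
      have hd : ∀ i ∈ s, Disjoint (W n) (W i) := fun i hi => hW n (Finset.mem_insert_self _ _) i (Finset.mem_insert_of_mem hi) (fun h => hn (h ▸ hi))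
      have h1 : (A ∪ B) ∩ W n = A := by
        rw [Finset.union_inter_distrib_right, Finset.inter_eq_left.2 hA]
        have : B ∩ W n = ∅ := by
          rw [← Finset.disjoint_iff_inter_eq_empty]
          refine Finset.disjoint_of_subset_left hB ?_
          rw [Finset.disjoint_biUnion_left]
          exact fun i hi => (hd i hi).symm
        rw [this, Finset.union_empty]
      have h2 : ∀ i ∈ s, (A ∪ B) ∩ W i = B ∩ W i := by
        intro i hi
        rw [Finset.union_inter_distrib_right]
        have : A ∩ W i = ∅ := by
          rw [← Finset.disjoint_iff_inter_eq_empty]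
          exact Finset.disjoint_of_subset_left hA (hd i hi)
        rw [this, Finset.empty_union]
      rw [h1]
      congr 1
      exact Finset.prod_congr rfl fun i hi => by rw [h2 i hi]
    · rw [Finset.disjoint_biUnion_right]
      intro i hi
      exact hW n (Finset.mem_insert_self _ _) i (Finset.mem_insert_of_mem hi) (fun h => hn (h ▸ hi))

/-- probability that exactly `p` is picked from `W` -/
noncomputable def gW (W : Finset ℕ) (p : ℕ) : ℝ := nrm W * (1/(p:ℝ))

lemma gW_nonneg (W p) : 0 ≤ gW W p := mul_nonneg (nrm_pos W).le (by positivity)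

lemma EP_ge_singles {ι : Type*} [Fintype ι] [DecidableEq ι] (W : ι → Finset ℕ) (hW : ∀ i j, i ≠ j → Disjoint (W i) (W j))
    (φ : Finset ℕ → ℝ) (hφ : ∀ A, 0 ≤ φ A) :
    ∑ p ∈ Fintype.piFinset W, (∏ i, gW (W i) (p i)) * φ (Finset.univ.image p) ≤ EP (Finset.univ.biUnion W) φ := by
  unfold EP
  have hinj : ∀ p ∈ Fintype.piFinset W, Function.Injective p := by
    intro p hp i j hij
    by_contra h
    rw [Fintype.mem_piFinset] at hp
    exact Finset.disjoint_left.1 (hW i j h) (hp i) (hij ▸ hp j)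
  have hn : nrm (Finset.univ.biUnion W) = ∏ i, nrm (W i) := by
    unfold nrm
    rw [Finset.prod_biUnion]
    intro i _ j _ h; exact hW i j h
  have e : ∀ p ∈ Fintype.piFinset W, (∏ i, gW (W i) (p i)) * φ (Finset.univ.image p) =
      nrm (Finset.univ.biUnion W) * (wt1 (Finset.univ.image p) * φ (Finset.univ.image p)) := by
    intro p hp
    unfold gW wt1
    rw [Finset.prod_mul_distrib, Finset.prod_image (fun i _ j _ h => hinj p hp h), hn]
    ring
  rw [Finset.sum_congr rfl e, ← Finset.mul_sum]
  refine mul_le_mul_of_nonneg_left ?_ (nrm_pos _).le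
  rw [← Finset.sum_image (s := Fintype.piFinset W) (g := fun p : ι → ℕ => Finset.univ.image p) (f := fun A : Finset ℕ => wt1 A * φ A)]
  · refine Finset.sum_le_sum_of_subset_of_nonneg ?_ fun A _ _ => mul_nonneg (wt1_nonneg A) (hφ A)
    intro A hA
    obtain ⟨p, hp, rfl⟩ := Finset.mem_image.1 hA
    rw [Finset.mem_powerset]
    intro q hq
    obtain ⟨i, _, rfl⟩ := Finset.mem_image.1 hq
    exact Finset.mem_biUnion.2 ⟨i, Finset.mem_univ _, Fintype.mem_piFinset.1 hp i⟩
  · intro p hp p' hp' h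
    funext i
    have h1 : p i ∈ Finset.univ.image p' := by
      rw [← show Finset.univ.image p = Finset.univ.image p' from h]; exact Finset.mem_image_of_mem _ (Finset.mem_univ _)
    obtain ⟨j, _, hj⟩ := Finset.mem_image.1 h1
    have hp1 := Fintype.mem_piFinset.1 hp i
    have hp2 := Fintype.mem_piFinset.1 hp' j
    by_cases hij : i = j
    · subst hij; exact hj.symm
    · exact absurd (hj ▸ hp2) (Finset.disjoint_left.1 (hW i j hij) hp1)

/-- value of the unique element -/
noncomputable def o1 (y : ℕ → ℝ) (A : Finset ℕ) : ℝ := if A.card = 1 then ∑ p ∈ A, y p else 0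

lemma EP_o1 (W : Finset ℕ) (y : ℕ → ℝ) (f : ℝ → ℝ) :
    EP W (fun A => f (o1 y A)) = (1 - ∑ p ∈ W, gW W p) * f 0 + ∑ p ∈ W, gW W p * f (y p) := by
  have h1 : ∀ A : Finset ℕ, A ⊆ W → f (o1 y A) = f 0 + ∑ p ∈ W, (if A = {p} then (f (y p) - f 0) else 0) := by
    intro A hA
    unfold o1
    split_ifs with h
    · obtain ⟨q, rfl⟩ := Finset.card_eq_one.1 h
      rw [Finset.sum_singleton, Finset.sum_eq_single q]
      · rw [if_pos rfl]; ring
      · intro p _ hp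
        rw [if_neg]
        intro h2; exact hp (Finset.singleton_injective h2).symm
      · intro h3; exact absurd (hA (Finset.mem_singleton_self q)) h3
    · rw [Finset.sum_eq_zero, add_zero]
      intro p _
      rw [if_neg]; rintro rfl; simp at h
  rw [EP_congr h1, EP_add, EP_const, EP_sum]
  have h2 : ∀ p ∈ W, EP W (fun A => if A = {p} then (f (y p) - f 0) else 0) = gW W p * (f (y p) - f 0) := by
    intro p hp
    unfold EP gW
    rw [Finset.sum_eq_single {p}]
    · simp [wt1, mul_assoc]
    · intro A _ hA; simp [hA]
    · intro h; simp [hp] at h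
  rw [Finset.sum_congr rfl h2]
  simp only [mul_sub, Finset.sum_sub_distrib, ← Finset.sum_mul]
  ring

lemma push {J : Type} [Fintype J] (cell : ℕ → Finset ℕ) (hcell : ∀ i j, i ≠ j → Disjoint (cell i) (cell j))
    (y : ℕ → ℝ) (π : ℕ → ℝ) (u : ℕ → J → ℝ) (yJ : J → ℝ) (M0 : ℕ)
    (h : ∀ c (f : ℝ → ℝ), c < M0 → EP (cell c) (fun A => f (o1 y A)) =
      ∑ b, ∑ p, piB π c b * u c p * f (if b then yJ p else 0)) :
    ∀ n t (F : (Fin n → ℝ) → ℝ), t + n ≤ M0 → EP ((Finset.Ico t (t+n)).biUnion cell) (fun A => F (fun i => o1 y (A ∩ cell (t+i)))) =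
      ∑ b : Fin n → Bool, ∑ p : Fin n → J, wp (piB π) t n b * wp u t n p * F (fun i => if b i then yJ (p i) else 0)
  | 0, t, F => fun hM => by
    simp [EP_empty, wp]
    congr 1
    funext i; exact i.elim0
  | n+1, t, F => fun hM => by
    have e0 : (Finset.Ico t (t+(n+1))).biUnion cell = cell t ∪ (Finset.Ico (t+1) (t+1+n)).biUnion cell := by
      rw [← Finset.biUnion_insert]
      congr 1
      ext c; simp only [Finset.mem_insert, Finset.mem_Ico]; omega
    have hd : Disjoint (cell t) ((Finset.Ico (t+1) (t+1+n)).biUnion cell) := by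
      rw [Finset.disjoint_biUnion_right]
      intro i hi
      rw [Finset.mem_Ico] at hi
      exact hcell _ _ (by omega)
    rw [e0, EP_union hd]
    have e1 : ∀ A, A ⊆ cell t → EP ((Finset.Ico (t+1) (t+1+n)).biUnion cell)
        (fun B => F (fun i => o1 y ((A ∪ B) ∩ cell (t+i)))) =
        ∑ b : Fin n → Bool, ∑ p : Fin n → J, wp (piB π) (t+1) n b * wp u (t+1) n p *
          F (Fin.cons (o1 y A) (fun i => if b i then yJ (p i) else 0)) := by
      intro A hA
      rw [← push cell hcell y π u yJ M0 h n (t+1) (fun v => F (Fin.cons (o1 y A) v)) (by omega)]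
      refine EP_congr fun B hB => ?_
      congr 1
      funext i
      refine Fin.cases ?_ (fun i => ?_) i
      · rw [Fin.cons_zero, Fin.val_zero, add_zero]
        congr 1
        rw [Finset.union_inter_distrib_right, Finset.inter_eq_left.2 hA]
        have : B ∩ cell t = ∅ := by
          rw [← Finset.disjoint_iff_inter_eq_empty]
          exact (Finset.disjoint_of_subset_right hB hd).symm
        rw [this, Finset.union_empty]
      · rw [Fin.cons_succ, Fin.val_succ, show t + ((i:ℕ)+1) = t + 1 + i by ring]
        congr 1
        rw [Finset.union_inter_distrib_right]
        have : A ∩ cell (t+1+i) = ∅ := by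
          rw [← Finset.disjoint_iff_inter_eq_empty]
          exact Finset.disjoint_of_subset_left hA (hcell _ _ (by omega))
        rw [this, Finset.empty_union]
    rw [EP_congr e1]
    rw [h t (fun v => ∑ b : Fin n → Bool, ∑ p : Fin n → J, wp (piB π) (t+1) n b * wp u (t+1) n p *
          F (Fin.cons v (fun i => if b i then yJ (p i) else 0))) (by omega)]
    rw [sum_cons]
    refine Finset.sum_congr rfl fun β _ => ?_
    have e2 : ∀ b : Fin n → Bool, ∑ p : Fin (n+1) → J, wp (piB π) t (n+1) (Fin.cons β b) * wp u t (n+1) p *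
        F (fun i => if (Fin.cons β b : Fin (n+1) → Bool) i then yJ (p i) else 0) =
        ∑ x : J, ∑ p : Fin n → J, piB π t β * u t x * (wp (piB π) (t+1) n b * wp u (t+1) n p *
          F (Fin.cons (if β then yJ x else 0) (fun i => if b i then yJ (p i) else 0))) := by
      intro b
      rw [sum_cons]
      refine Finset.sum_congr rfl fun x _ => Finset.sum_congr rfl fun p _ => ?_
      rw [wp_cons, wp_cons]
      have : (fun i => if (Fin.cons β b : Fin (n+1) → Bool) i = true then yJ ((Fin.cons x p : Fin (n+1) → J) i) else 0) =
          (Fin.cons (if β then yJ x else 0) (fun i => if b i then yJ (p i) else 0) : Fin (n+1) → ℝ) := by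
        funext i
        refine Fin.cases ?_ (fun i => ?_) i
        · simp
        · simp
      rw [this]; ring
    simp only [e2]
    rw [Finset.sum_comm]
    refine Finset.sum_congr rfl fun x _ => ?_
    simp only [Finset.mul_sum]

end FKT

open Filter Topology
open scoped Classical
namespace FKT

/-- weight -/
noncomputable def cpr (n : ℕ) : ℝ := if n.Prime then Real.log n / n else 0

lemma log_fact (N : ℕ) : Real.log (N.factorial) = ∑ p ∈ (Finset.range (N+1)).filter Nat.Prime, (padicValNat p N.factorial : ℝ) * Real.log p := by
  have h := Nat.factorization_prod_pow_eq_self (Nat.factorial_ne_zero N)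
  conv_lhs => rw [← h]
  rw [Finsupp.prod_of_support_subset _ (s := (Finset.range (N+1)).filter Nat.Prime)]
  · push_cast
    rw [Real.log_prod]
    · refine Finset.sum_congr rfl fun p hp => ?_
      rw [Real.log_pow, Nat.factorization_def _ (Finset.mem_filter.1 hp).2]
    · intro p hp
      have := (Finset.mem_filter.1 hp).2.pos
      positivity
  · intro p hp
    rw [Nat.support_factorization, Nat.mem_primeFactors] at hp
    rw [Finset.mem_filter, Finset.mem_range]
    exact ⟨Nat.lt_succ_of_le ((Nat.Prime.dvd_factorial hp.1).1 hp.2.1), hp.1⟩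
  · simp

lemma padic_lower {p N : ℕ} (hp : p.Prime) : (N:ℝ)/p - 1 ≤ padicValNat p N.factorial := by
  have h : N / p ≤ padicValNat p N.factorial := by
    haveI := Fact.mk hp
    rw [← padicValNat_dvd_iff_le (Nat.factorial_ne_zero N)]
    have h1 : (p * (N/p)).factorial ∣ N.factorial := Nat.factorial_dvd_factorial (Nat.mul_div_le N p)
    refine dvd_trans ?_ h1
    rw [padicValNat_dvd_iff_le (Nat.factorial_ne_zero _), padicValNat_factorial_mul]
    omega
  have h2 : (N:ℝ)/p < (N/p : ℕ) + 1 := by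
    rw [div_lt_iff₀ (by exact_mod_cast hp.pos)]
    have := Nat.lt_div_mul_add hp.pos (a := N)
    have h3 : N < (N/p+1)*p := by linarith
    exact_mod_cast h3
  have : ((N/p : ℕ):ℝ) ≤ padicValNat p N.factorial := by exact_mod_cast h
  linarith

lemma padic_upper {p N : ℕ} (hp : p.Prime) : (padicValNat p N.factorial : ℝ) ≤ N/((p:ℝ)-1) := by
  haveI := Fact.mk hp
  have h := sub_one_mul_padicValNat_factorial (p := p) N
  have h1 : (p-1) * padicValNat p N.factorial ≤ N := by rw [h]; omega
  have h2 : (2:ℝ) ≤ p := by exact_mod_cast hp.two_le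
  rw [le_div_iff₀ (by linarith)]
  have h3 : (((p-1) * padicValNat p N.factorial : ℕ):ℝ) ≤ N := by exact_mod_cast h1
  rw [Nat.cast_mul, Nat.cast_sub hp.one_le] at h3
  push_cast at h3
  linarith

lemma sum_cpr (N : ℕ) : ∑ k ∈ Finset.range N, cpr k = ∑ p ∈ (Finset.range N).filter Nat.Prime, Real.log p / p := by
  unfold cpr; rw [Finset.sum_filter]

lemma mertens_up (N : ℕ) (hN : 1 ≤ N) : ∑ k ∈ Finset.range (N+1), cpr k ≤ Real.log N + Real.log 4 := by
  have hN' : (0:ℝ) < N := by exact_mod_cast hN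
  have h1 : ∑ p ∈ (Finset.range (N+1)).filter Nat.Prime, ((N:ℝ)/p-1) * Real.log p ≤ Real.log (N.factorial) := by
    rw [log_fact]
    refine Finset.sum_le_sum fun p hp => mul_le_mul_of_nonneg_right (padic_lower (Finset.mem_filter.1 hp).2) (Real.log_natCast_nonneg p)
  have h2 : Real.log (N.factorial) ≤ N * Real.log N := by
    rw [← Real.log_pow]
    apply Real.log_le_log (by exact_mod_cast Nat.factorial_pos N)
    exact_mod_cast Nat.factorial_le_pow N
  have h3 : ∑ p ∈ (Finset.range (N+1)).filter Nat.Prime, Real.log p ≤ Real.log 4 * N := by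
    have := Chebyshev.theta_le_log4_mul_x (x := N) hN'.le
    refine le_trans (le_of_eq ?_) this
    rw [Chebyshev.theta_eq_sum_Icc, Nat.floor_natCast]
    refine Finset.sum_congr ?_ fun _ _ => rfl
    ext p; simp [Nat.lt_succ_iff]
  have h4 : ∑ p ∈ (Finset.range (N+1)).filter Nat.Prime, ((N:ℝ)/p-1) * Real.log p = N * ∑ k ∈ Finset.range (N+1), cpr k - ∑ p ∈ (Finset.range (N+1)).filter Nat.Prime, Real.log p := by
    rw [sum_cpr, Finset.mul_sum, ← Finset.sum_sub_distrib]
    refine Finset.sum_congr rfl fun p _ => by ring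
  have h5 : N * ∑ k ∈ Finset.range (N+1), cpr k ≤ N * (Real.log N + Real.log 4) := by nlinarith
  exact le_of_mul_le_mul_left h5 hN'

lemma small_sum (N : ℕ) : ∑ p ∈ (Finset.range N).filter Nat.Prime, (Real.log p/((p:ℝ)-1) - Real.log p/p) ≤ 8 := by
  have h0 : ∀ n : ℕ, 2 ≤ n → Real.log n/((n:ℝ)-1) - Real.log n/n ≤ 8 * (1/Real.sqrt ((n:ℝ)-1) - 1/Real.sqrt n) := by
    intro n hn
    obtain ⟨m, rfl⟩ : ∃ m, n = m+1 := ⟨n-1, by omega⟩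
    have hm : (1:ℝ) ≤ m := by exact_mod_cast (by omega : 1 ≤ m)
    push_cast
    rw [add_sub_cancel_right]
    set s := Real.sqrt m with hs
    set t := Real.sqrt ((m:ℝ)+1) with ht
    have hs1 : 1 ≤ s := Real.one_le_sqrt.2 hm
    have hst : s ≤ t := Real.sqrt_le_sqrt (by linarith)
    have hs2 : s^2 = m := Real.sq_sqrt (by linarith)
    have ht2 : t^2 = m+1 := Real.sq_sqrt (by linarith)
    have ht2s : t ≤ 2*s := by nlinarith
    have hlog : Real.log ((m:ℝ)+1) ≤ 2*t := by
      rw [← ht2, Real.log_pow]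
      have := Real.log_le_sub_one_of_pos (show 0 < t by linarith)
      push_cast; linarith
    have e1 : Real.log ((m:ℝ)+1)/m - Real.log ((m:ℝ)+1)/(m+1) = Real.log ((m:ℝ)+1) / (s^2*t^2) := by
      rw [hs2, ht2]; field_simp; ring
    have e2 : 1/s - 1/t = 1/(s*t*(s+t)) := by
      have : t - s = 1/(s+t) := by
        rw [eq_div_iff (by linarith)]; nlinarith
      have h3 : 1/s-1/t = (t-s)/(s*t) := by
        have : s ≠ 0 := by linarith
        have : t ≠ 0 := by linarith
        field_simp
      rw [h3, this]; field_simp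
    rw [e1, e2]
    have hs0 : 0 < s := by linarith
    have ht0 : 0 < t := by linarith
    rw [mul_one_div, div_le_div_iff₀ (by positivity) (by positivity)]
    have h6 : s + t ≤ 4 * s := by linarith
    calc Real.log ((m:ℝ)+1) * (s*t*(s+t)) ≤ 2*t*(s*t*(4*s)) := by
          apply mul_le_mul hlog _ (by positivity) (by positivity)
          exact mul_le_mul_of_nonneg_left (by linarith) (by positivity)
      _ = 8 * (s^2*t^2) := by ring
  have h1 : ∀ N : ℕ, ∑ p ∈ (Finset.range N).filter Nat.Prime, (Real.log p/((p:ℝ)-1) - Real.log p/p) ≤ ∑ n ∈ Finset.Ico 2 (N+2), 8 * (1/Real.sqrt ((n:ℝ)-1) - 1/Real.sqrt n) := by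
    intro N
    have hnn : ∀ n ∈ Finset.Ico 2 (N+2), 0 ≤ 8 * (1/Real.sqrt ((n:ℝ)-1) - 1/Real.sqrt n) := by
      intro n hn
      refine le_trans ?_ (h0 n (Finset.mem_Ico.1 hn).1)
      have : (2:ℝ) ≤ n := by exact_mod_cast (Finset.mem_Ico.1 hn).1
      rw [sub_nonneg]
      exact div_le_div_of_nonneg_left (Real.log_natCast_nonneg n) (by linarith) (by linarith)
    refine le_trans (Finset.sum_le_sum fun p hp => h0 p (Finset.mem_filter.1 hp).2.two_le) ?_
    refine Finset.sum_le_sum_of_subset_of_nonneg ?_ fun n hn _ => hnn n hn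
    intro p hp
    rw [Finset.mem_filter, Finset.mem_range] at hp
    rw [Finset.mem_Ico]; exact ⟨hp.2.two_le, by omega⟩
  refine (h1 N).trans ?_
  have h2 : ∀ N : ℕ, ∑ n ∈ Finset.Ico 2 (N+2), 8 * (1/Real.sqrt ((n:ℝ)-1) - 1/Real.sqrt n) = 8 * (1 - 1/Real.sqrt ((N:ℝ)+1)) := by
    intro N
    induction N with
    | zero => simp
    | succ N ih =>
      rw [Finset.sum_Ico_succ_top (by omega), ih]
      push_cast
      rw [show (N:ℝ)+2-1 = N+1 by ring, show (N:ℝ)+1+1 = N+2 by ring]; ring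
  rw [h2]
  have : 0 ≤ 1/Real.sqrt ((N:ℝ)+1) := by positivity
  linarith

lemma mertens_low (N : ℕ) (hN : 1 ≤ N) : Real.log N - 9 ≤ ∑ k ∈ Finset.range (N+1), cpr k := by
  have hN' : (0:ℝ) < N := by exact_mod_cast hN
  have h1 : Real.log (N.factorial) ≤ N * ∑ p ∈ (Finset.range (N+1)).filter Nat.Prime, Real.log p/((p:ℝ)-1) := by
    rw [log_fact, Finset.mul_sum]
    refine Finset.sum_le_sum fun p hp => ?_
    refine (mul_le_mul_of_nonneg_right (padic_upper (Finset.mem_filter.1 hp).2) (Real.log_natCast_nonneg p)).trans (le_of_eq (by ring))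
  have h2 : N * Real.log N - N ≤ Real.log (N.factorial) := by
    have := Stirling.le_log_factorial_stirling (n := N) (by omega)
    have h3 : 0 ≤ Real.log N := Real.log_natCast_nonneg N
    have h4 : 0 ≤ Real.log (2*Real.pi) := Real.log_nonneg (by linarith [Real.pi_gt_three])
    linarith
  have h3 := small_sum (N+1)
  rw [Finset.sum_sub_distrib, ← sum_cpr] at h3
  have h4 : N * (Real.log N - 1) ≤ N * (8 + ∑ k ∈ Finset.range (N+1), cpr k) := by
    refine le_trans (by linarith) (h1.trans (mul_le_mul_of_nonneg_left (by linarith) hN'.le))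
  have := le_of_mul_le_mul_left h4 hN'
  linarith

lemma mertens1 (N : ℕ) (hN : 1 ≤ N) : |∑ k ∈ Finset.range N, cpr k - Real.log N| ≤ 11 := by
  obtain ⟨m, rfl⟩ : ∃ m, N = m+1 := ⟨N-1, by omega⟩
  rcases Nat.eq_zero_or_pos m with rfl | hm
  · simp [cpr]
  have h1 := mertens_up m hm
  have h2 := mertens_low m hm
  have hm' : (1:ℝ) ≤ m := by exact_mod_cast hm
  have h3 : Real.log m ≤ Real.log ((m:ℝ)+1) := Real.log_le_log (by linarith) (by linarith)
  have h4 : Real.log ((m:ℝ)+1) ≤ Real.log m + Real.log 2 := by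
    rw [← Real.log_mul (by linarith) (by norm_num)]
    exact Real.log_le_log (by linarith) (by linarith)
  have h5 : Real.log 2 ≤ 1 := by linarith [Real.log_two_lt_d9]
  have h6 : Real.log 4 = 2 * Real.log 2 := by
    rw [show (4:ℝ) = 2^2 by norm_num, Real.log_pow]; norm_num
  push_cast
  rw [abs_le]; constructor <;> linarith

lemma abel_ineq (d f : ℕ → ℝ) (a : ℕ) (C : ℝ) (hf : ∀ k, a ≤ k → f (k+1) ≤ f k) (hf0 : ∀ k, a ≤ k → 0 ≤ f k)
    (hd : ∀ m, a ≤ m → |∑ k ∈ Finset.Ico a m, d k| ≤ C) (m : ℕ) (hm : a ≤ m) :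
    |∑ k ∈ Finset.Ico a m, d k * f k| ≤ C * f a := by
  have key : ∀ m, a ≤ m → |∑ k ∈ Finset.Ico a m, d k * f k - (∑ k ∈ Finset.Ico a m, d k) * f m| ≤ C * (f a - f m) := by
    intro m hm
    induction m, hm using Nat.le_induction with
    | base => simp
    | succ m hm ih =>
      rw [Finset.sum_Ico_succ_top hm, Finset.sum_Ico_succ_top hm]
      have h1 := hd (m+1) (by omega)
      rw [Finset.sum_Ico_succ_top hm] at h1
      set S := ∑ k ∈ Finset.Ico a m, d k
      set T := ∑ k ∈ Finset.Ico a m, d k * f k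
      have : T + d m * f m - (S + d m) * f (m+1) = (T - S * f m) + (S + d m) * (f m - f (m+1)) := by ring
      rw [this]
      refine (abs_add_le _ _).trans ?_
      rw [abs_mul, abs_of_nonneg (sub_nonneg.2 (hf m hm))]
      have := mul_le_mul_of_nonneg_right h1 (sub_nonneg.2 (hf m hm))
      linarith
  have h1 := key m hm
  have h2 : |(∑ k ∈ Finset.Ico a m, d k) * f m| ≤ C * f m := by
    rw [abs_mul, abs_of_nonneg (hf0 m hm)]
    exact mul_le_mul_of_nonneg_right (hd m hm) (hf0 m hm)
  have h3 := abs_add_le (∑ k ∈ Finset.Ico a m, d k * f k - (∑ k ∈ Finset.Ico a m, d k) * f m) ((∑ k ∈ Finset.Ico a m, d k) * f m)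
  rw [sub_add_cancel] at h3
  linarith

lemma mertens_nat (a b : ℕ) (ha : 2 ≤ a) (hab : a ≤ b) :
    |∑ p ∈ (Finset.Ico a b).filter Nat.Prime, 1/(p:ℝ) - (Real.log (Real.log b) - Real.log (Real.log a))| ≤ 23 / Real.log a := by
  have hlog : ∀ k, a ≤ k → 0 < Real.log k := fun k hk => Real.log_pos (by exact_mod_cast (by omega : 1 < k))
  have hlogm : ∀ k : ℕ, a ≤ k → Real.log k ≤ Real.log ((k+1 : ℕ):ℝ) := fun k hk => Real.log_le_log (by exact_mod_cast (by omega : 0 < k)) (by push_cast; linarith)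
  set d : ℕ → ℝ := fun k => cpr k - (Real.log ((k+1:ℕ):ℝ) - Real.log k) with hd
  set f : ℕ → ℝ := fun k => 1/Real.log k with hf
  have tel : ∀ m, a ≤ m → ∑ k ∈ Finset.Ico a m, (Real.log ((k+1:ℕ):ℝ) - Real.log k) = Real.log m - Real.log a := by
    intro m hm
    exact Finset.sum_Ico_sub (fun k : ℕ => Real.log (k:ℝ)) hm
  have h1 := abel_ineq d f a 22 (fun k hk => one_div_le_one_div_of_le (hlog k hk) (hlogm k hk)) (fun k hk => by have := hlog k hk; positivity)
    (by
      intro m hm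
      rw [hd, Finset.sum_sub_distrib, tel m hm, Finset.sum_Ico_eq_sub _ hm]
      have e1 := abs_le.1 (mertens1 m (by omega))
      have e2 := abs_le.1 (mertens1 a (by omega))
      rw [abs_le]; constructor <;> linarith [e1.1, e1.2, e2.1, e2.2]) b hab
  have h2 : ∑ p ∈ (Finset.Ico a b).filter Nat.Prime, 1/(p:ℝ) = ∑ k ∈ Finset.Ico a b, cpr k * f k := by
    rw [Finset.sum_filter]
    refine Finset.sum_congr rfl fun k hk => ?_
    have := hlog k (Finset.mem_Ico.1 hk).1
    rw [cpr, hf]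
    split_ifs
    · field_simp
    · simp
  have h3 : ∀ m, a ≤ m → Real.log (Real.log m) - Real.log (Real.log a) ≤ ∑ k ∈ Finset.Ico a m, (Real.log ((k+1:ℕ):ℝ) - Real.log k) * f k ∧
     ∑ k ∈ Finset.Ico a m, (Real.log ((k+1:ℕ):ℝ) - Real.log k) * f k ≤ Real.log (Real.log m) - Real.log (Real.log a) + (f a - f m) := by
    intro m hm
    induction m, hm using Nat.le_induction with
    | base => simp
    | succ m hm ih =>
      rw [Finset.sum_Ico_succ_top hm]
      have p1 := hlog m hm
      have p2 := hlog (m+1) (by omega)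
      have p3 := hlogm m hm
      set A := Real.log (m:ℝ)
      set B := Real.log ((m+1:ℕ):ℝ)
      have fA : f m = 1/A := rfl
      have fB : f (m+1) = 1/B := rfl
      rw [fB]; rw [fA] at ih ⊢
      have q1 : Real.log B - Real.log A ≤ (B - A) * (1/A) := by
        rw [← Real.log_div p2.ne' p1.ne']
        refine (Real.log_le_sub_one_of_pos (by positivity)).trans (le_of_eq ?_)
        field_simp
      have q2 : (B-A)*(1/B) ≤ Real.log B - Real.log A := by
        have := Real.log_le_sub_one_of_pos (show 0 < A/B by positivity)
        rw [Real.log_div p1.ne' p2.ne'] at this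
        have e : (B-A)*(1/B) = 1 - A/B := by field_simp
        rw [e]; linarith
      have q3 : (B-A) ≤ 1 := by
        have : B ≤ A + Real.log 2 := by
          change Real.log ((m+1:ℕ):ℝ) ≤ Real.log (m:ℝ) + _
          have hm1 : (1:ℝ) ≤ m := by exact_mod_cast (by omega : 1 ≤ m)
          rw [← Real.log_mul (by linarith) (by norm_num)]
          exact Real.log_le_log (by positivity) (by push_cast; linarith)
        linarith [Real.log_two_lt_d9]
      have q4 : 0 ≤ 1/A - 1/B := sub_nonneg.2 (one_div_le_one_div_of_le p1 p3)
      have q5 : (B-A)*(1/A-1/B) ≤ 1/A - 1/B := by nlinarith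
      constructor
      · linarith [ih.1]
      · linarith [ih.2]
  have h4 : ∑ k ∈ Finset.Ico a b, d k * f k = ∑ k ∈ Finset.Ico a b, cpr k * f k - ∑ k ∈ Finset.Ico a b, (Real.log ((k+1:ℕ):ℝ) - Real.log k) * f k := by
    rw [← Finset.sum_sub_distrib]; refine Finset.sum_congr rfl fun k _ => by rw [hd]; ring
  rw [h2]
  rw [h4] at h1
  have h5 := h3 b hab
  have h6 : 0 ≤ f b := by have := hlog b hab; positivity
  have h7 : f a = 1/Real.log a := rfl
  have h8 := abs_le.1 h1
  rw [show 23/Real.log a = 22 * f a + f a by rw [h7]; ring]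
  rw [abs_le]; constructor <;> linarith [h8.1, h8.2, h5.1, h5.2]

/-- primes with `u ≤ log p < v` -/
noncomputable def PrI (u v : ℝ) : Finset ℕ := (Finset.Ico ⌈Real.exp u⌉₊ ⌈Real.exp v⌉₊).filter Nat.Prime

lemma mem_PrI {u v : ℝ} {p : ℕ} : p ∈ PrI u v ↔ p.Prime ∧ u ≤ Real.log p ∧ Real.log p < v := by
  unfold PrI
  rw [Finset.mem_filter, Finset.mem_Ico, Nat.ceil_le, Nat.lt_ceil]
  constructor
  · rintro ⟨⟨h1, h2⟩, h3⟩
    have : (0:ℝ) < p := by exact_mod_cast h3.pos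
    exact ⟨h3, (Real.le_log_iff_exp_le this).2 h1, (Real.log_lt_iff_lt_exp this).2 h2⟩
  · rintro ⟨h3, h1, h2⟩
    have : (0:ℝ) < p := by exact_mod_cast h3.pos
    exact ⟨⟨(Real.le_log_iff_exp_le this).1 h1, (Real.log_lt_iff_lt_exp this).1 h2⟩, h3⟩

lemma ceil_log {u : ℝ} (hu : 1 ≤ u) : u ≤ Real.log ⌈Real.exp u⌉₊ ∧ Real.log ⌈Real.exp u⌉₊ ≤ u + 1 ∧ Real.log (Real.log ⌈Real.exp u⌉₊) ≤ Real.log u + 1/u := by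
  have h0 := Real.exp_pos u
  have h1 := Nat.le_ceil (Real.exp u)
  have h2 := Nat.ceil_lt_add_one h0.le
  have h3 : u ≤ Real.log ⌈Real.exp u⌉₊ := (Real.le_log_iff_exp_le (h0.trans_le h1)).2 h1
  have h5 : Real.log ⌈Real.exp u⌉₊ ≤ u + 1 := by
    rw [Real.log_le_iff_le_exp (h0.trans_le h1), Real.exp_add]
    have := Real.add_one_le_exp (1:ℝ)
    have := Real.add_one_le_exp u
    nlinarith
  refine ⟨h3, h5, ?_⟩
  have h6 : Real.log (Real.log ⌈Real.exp u⌉₊) ≤ Real.log (u * (1+1/u)) := by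
    apply Real.log_le_log (by linarith)
    rw [mul_add, mul_one_div_cancel (by linarith)]; linarith
  rw [Real.log_mul (by linarith) (by positivity)] at h6
  have := Real.log_le_sub_one_of_pos (show 0 < 1+1/u by positivity)
  linarith

lemma mertens2 {u v : ℝ} (hu : 1 ≤ u) (huv : u ≤ v) : |∑ p ∈ PrI u v, 1/(p:ℝ) - Real.log (v/u)| ≤ 25/u := by
  have h1 := ceil_log hu
  have h2 := ceil_log (hu.trans huv)
  have ha : 2 ≤ ⌈Real.exp u⌉₊ := by
    have : (1:ℝ) < ⌈Real.exp u⌉₊ := lt_of_lt_of_le (by have := Real.add_one_le_exp u; linarith) (Nat.le_ceil _)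
    exact_mod_cast this
  have h3 := mertens_nat _ _ ha (Nat.ceil_mono (Real.exp_le_exp.2 huv))
  have h4 : 23 / Real.log ⌈Real.exp u⌉₊ ≤ 23/u := div_le_div_of_nonneg_left (by norm_num) (by linarith) h1.1
  have h5 : Real.log u ≤ Real.log (Real.log ⌈Real.exp u⌉₊) := Real.log_le_log (by linarith) h1.1
  have h6 : Real.log v ≤ Real.log (Real.log ⌈Real.exp v⌉₊) := Real.log_le_log (by linarith) h2.1
  have h7 : 1/v ≤ 1/u := one_div_le_one_div_of_le (by linarith) huv
  rw [Real.log_div (by linarith) (by linarith)]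
  unfold PrI
  have h8 := abs_le.1 (h3.trans h4)
  rw [show 25/u = 23/u + 1/u + 1/u by ring]
  have : 0 ≤ 1/u := by positivity
  rw [abs_le]; constructor <;> linarith [h8.1, h8.2, h1.2, h2.2]

lemma mertens1_PrI {v : ℝ} (hv : 1 ≤ v) : ∑ p ∈ PrI 0 v, Real.log p/(p:ℝ) ≤ 13*v := by
  have h1 := ceil_log hv
  have h2 : ∑ p ∈ PrI 0 v, Real.log p/(p:ℝ) ≤ ∑ k ∈ Finset.range ⌈Real.exp v⌉₊, cpr k := by
    rw [sum_cpr]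
    refine Finset.sum_le_sum_of_subset_of_nonneg ?_ fun p _ _ => div_nonneg (Real.log_natCast_nonneg p) (by positivity)
    intro p hp
    unfold PrI at hp
    rw [Finset.mem_filter, Finset.mem_Ico] at hp
    exact Finset.mem_filter.2 ⟨Finset.mem_range.2 hp.1.2, hp.2⟩
  have h3 := mertens1 ⌈Real.exp v⌉₊ (Nat.one_le_ceil_iff.2 (Real.exp_pos v))
  have := (abs_le.1 h3).2
  linarith [h1.2.1]

end FKT

open Filter Topology
open scoped Classical
namespace FKT

/-- on which side `l` passes node `i` -/
def psd {D : ℕ} : ∀ {n}, Cl (D+n) → Ix D n → Option Bool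
  | 0, _, i => none
  | n+1, l, Sum.inl q => if Fin.tail l = q then some (l 0) else none
  | n+1, l, Sum.inr i => psd (n := n) (Fin.tail l : Cl (D+n)) i

lemma psd_inl {D n : ℕ} (b : Bool) (q q' : Cl (D+n)) :
    psd (n := n+1) (cns b q) (Sum.inl q' : Cl (D+n) ⊕ Ix D n) = if q = q' then some b else none := by
  change (if Fin.tail (cns b q) = q' then some ((cns b q) 0) else none) = _
  simp [cns]

lemma psd_inr {D n : ℕ} (b : Bool) (q : Cl (D+n)) (i : Ix D n) :
    psd (n := n+1) (cns b q) (Sum.inr i : Cl (D+n) ⊕ Ix D n) = psd (n := n) q i := by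
  change psd (n := n) (Fin.tail (cns b q) : Cl (D+n)) i = _
  simp [cns]

/-- sum over `Ix D (n+1)` -/
lemma sum_Ix {D n : ℕ} (f : Ix D (n+1) → ℝ) :
    ∑ i, f i = ∑ q : Cl (D+n), f (Sum.inl q : Cl (D+n) ⊕ Ix D n) + ∑ i : Ix D n, f (Sum.inr i : Cl (D+n) ⊕ Ix D n) :=
  Fintype.sum_sum_type (f := (f : Cl (D+n) ⊕ Ix D n → ℝ))

noncomputable def pvv (o : Option Bool) (A B : ℝ) : ℝ := if o = some false then A else if o = some true then B else 0

/-- sum of pivots -/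
noncomputable def pv {D n : ℕ} (PP QQ : Ix D n → ℝ) (l : Cl (D+n)) : ℝ := ∑ i, pvv (psd l i) (PP i) (QQ i)

lemma pv_cns {D n : ℕ} (PP QQ : Ix D (n+1) → ℝ) (b : Bool) (q : Cl (D+n)) :
    pv PP QQ (cns b q) = (if b then QQ (Sum.inl q : Cl (D+n) ⊕ Ix D n) else PP (Sum.inl q : Cl (D+n) ⊕ Ix D n)) +
      pv (n := n) (fun i => PP (Sum.inr i : Cl (D+n) ⊕ Ix D n)) (fun i => QQ (Sum.inr i : Cl (D+n) ⊕ Ix D n)) q := by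
  unfold pv
  rw [sum_Ix]
  simp only [psd_inl, psd_inr]
  congr 1
  rw [Finset.sum_eq_single q]
  · cases b <;> simp [pvv]
  · intro q' _ h
    rw [if_neg (Ne.symm h)]; simp [pvv]
  · simp

noncomputable def gg {D : ℕ} : ∀ {n}, (Ix D n → ℝ) → Ix D n → ℝ
  | 0, _, i => 0
  | n+1, PP, Sum.inl q => PP (Sum.inl q : Cl (D+n) ⊕ Ix D n)
  | n+1, PP, Sum.inr i => PP (Sum.inl (l0 (n := n) i) : Cl (D+n) ⊕ Ix D n) - PP (Sum.inl (l1 (n := n) i) : Cl (D+n) ⊕ Ix D n)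
      + gg (n := n) (fun i => PP (Sum.inr i : Cl (D+n) ⊕ Ix D n)) i

lemma pv_diff {D : ℕ} : ∀ {n} (PP QQ : Ix D n → ℝ) (i : Ix D n), pv PP QQ (l0 i) - pv PP QQ (l1 i) = gg PP i - QQ i
  | 0, _, _, i => i.elim
  | n+1, PP, QQ, Sum.inl q => by
    change pv PP QQ (cns false q) - pv PP QQ (cns true q) = PP (Sum.inl q : Cl (D+n) ⊕ Ix D n) - QQ (Sum.inl q : Cl (D+n) ⊕ Ix D n)
    rw [pv_cns, pv_cns]; simp
  | n+1, PP, QQ, Sum.inr i => by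
    change pv PP QQ (cns false (l0 (n := n) i)) - pv PP QQ (cns false (l1 (n := n) i)) = PP (Sum.inl (l0 (n := n) i) : Cl (D+n) ⊕ Ix D n) - PP (Sum.inl (l1 (n := n) i) : Cl (D+n) ⊕ Ix D n)
      + gg (n := n) (fun i => PP (Sum.inr i : Cl (D+n) ⊕ Ix D n)) i - QQ (Sum.inr i : Cl (D+n) ⊕ Ix D n)
    rw [pv_cns, pv_cns]
    have := pv_diff (n := n) (fun i => PP (Sum.inr i : Cl (D+n) ⊕ Ix D n)) (fun i => QQ (Sum.inr i : Cl (D+n) ⊕ Ix D n)) i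
    simp only [Bool.false_eq_true, if_false]
    linarith

/-- `gg` is a small perturbation -/
lemma gg_near {D : ℕ} : ∀ {n} (PP : Ix D n → ℝ) (i : Ix D n) (M : ℝ), 0 ≤ M → (∀ i', lev i < lev i' → |PP i'| ≤ M) →
    |gg PP i - PP i| ≤ 2 * n * M
  | 0, _, i, _, _, _ => i.elim
  | n+1, PP, Sum.inl q, M, hM, h => by
    change |PP (Sum.inl q : Cl (D+n) ⊕ Ix D n) - PP (Sum.inl q : Cl (D+n) ⊕ Ix D n)| ≤ _
    rw [sub_self, abs_zero]; positivity
  | n+1, PP, Sum.inr i, M, hM, h => by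
    have h1 := h (Sum.inl (l0 (n := n) i) : Cl (D+n) ⊕ Ix D n) (lev_lt (n := n) i)
    have h2 := h (Sum.inl (l1 (n := n) i) : Cl (D+n) ⊕ Ix D n) (lev_lt (n := n) i)
    have h3 := gg_near (n := n) (fun i => PP (Sum.inr i : Cl (D+n) ⊕ Ix D n)) i M hM (fun i' hi' => h (Sum.inr i' : Cl (D+n) ⊕ Ix D n) hi')
    change |(PP (Sum.inl (l0 (n := n) i) : Cl (D+n) ⊕ Ix D n) - PP (Sum.inl (l1 (n := n) i) : Cl (D+n) ⊕ Ix D n)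
      + gg (n := n) (fun i => PP (Sum.inr i : Cl (D+n) ⊕ Ix D n)) i) - PP (Sum.inr i : Cl (D+n) ⊕ Ix D n)| ≤ _
    rw [abs_le] at *
    push_cast
    constructor <;> linarith [h1.1, h1.2, h2.1, h2.2, h3.1, h3.2]

def emb (D : ℕ) : ∀ n, Cl n → Cl (D+n)
  | 0, _ => fun _ => false
  | n+1, l => cns (l 0) (emb D n (Fin.tail l))

lemma emb_cns (D n : ℕ) (b : Bool) (q : Cl n) : emb D (n+1) (cns b q) = cns b (emb D n q) := by
  change cns ((cns b q) 0) (emb D n (Fin.tail (cns b q))) = _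
  simp [cns]

lemma emb_inj (D : ℕ) : ∀ n (l l' : Cl n), (∀ i, psd (emb D n l) i = psd (emb D n l') i) → l = l'
  | 0, l, l', _ => by funext i; exact i.elim0
  | n+1, l, l', h => by
    obtain ⟨b, q, rfl⟩ := cns_surj l
    obtain ⟨b', q', rfl⟩ := cns_surj l'
    rw [emb_cns, emb_cns] at h
    have hq : q = q' := emb_inj D n q q' fun i => by
      have := h (Sum.inr i : Cl (D+n) ⊕ Ix D n)
      rwa [psd_inr, psd_inr] at this
    subst hq
    have := h (Sum.inl (emb D n q) : Cl (D+n) ⊕ Ix D n)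
    rw [psd_inl, psd_inl, if_pos rfl, if_pos rfl] at this
    rw [Option.some.inj this]

lemma spread {D : ℕ} : ∀ n (X : Cl (D+n) → ℝ) (d : ℝ), (0 ≤ d) → (∀ i : Ix D n, |X (l0 i) - X (l1 i)| ≤ d) →
    ∀ l, |X (emb D n l) - X (emb D n fun _ => false)| ≤ n * d
  | 0, X, d, hd, h, l => by
    have : l = fun _ => false := by funext i; exact i.elim0
    subst this; simp
  | n+1, X, d, hd, h, l => by
    obtain ⟨b, q, rfl⟩ := cns_surj l
    have e0 : (fun _ => false : Cl (n+1)) = cns false (fun _ => false) := by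
      funext i; refine Fin.cases ?_ (fun i => ?_) i <;> simp [cns]
    rw [e0, emb_cns, emb_cns]
    have h1 := spread n (fun l => X (cns false l)) d hd (fun i => h (Sum.inr i : Cl (D+n) ⊕ Ix D n)) q
    have h2 : |X (cns b (emb D n q)) - X (cns false (emb D n q))| ≤ d := by
      cases b
      · simpa using hd
      · rw [abs_sub_comm]; exact h (Sum.inl (emb D n q) : Cl (D+n) ⊕ Ix D n)
    rw [abs_le] at *
    push_cast
    constructor <;> linarith [h1.1, h1.2, h2.1, h2.2]

/-- `A` contains at least `z` subsets whose log-sums lie in an interval of length `h` -/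
def Clus (h z : ℝ) (A : Finset ℕ) : Prop :=
  ∃ F : Finset (Finset ℕ), z ≤ F.card ∧ (∀ B ∈ F, B ⊆ A) ∧
    ∃ v : ℝ, ∀ B ∈ F, v ≤ ∑ p ∈ B, Real.log p ∧ ∑ p ∈ B, Real.log p ≤ v + h

lemma Clus_mono {h z : ℝ} {A A' : Finset ℕ} (hA : A ⊆ A') (hc : Clus h z A) : Clus h z A' := by
  obtain ⟨F, h1, h2, h3⟩ := hc
  exact ⟨F, h1, fun B hB => (h2 B hB).trans hA, h3⟩

section struct
variable {D R : ℕ}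

def sel (l : Cl (D+R)) (x : Ix D R × Fin 3) : Prop :=
  (psd l x.1 = some false ∧ x.2 ≠ 2) ∨ (psd l x.1 = some true ∧ x.2 = 2)

/-- the main part of the set attached to `l` -/
noncomputable def BMc (cell : ℕ → Finset ℕ) (A : Finset ℕ) {n : ℕ} (e : Fin n → Pa D R) (l : Cl (D+R)) (c : Fin n) : Finset ℕ :=
  if (A ∩ cell c).card = 1 ∧ om (e c) l = 1 then A ∩ cell c else ∅

noncomputable def BM (cell : ℕ → Finset ℕ) (A : Finset ℕ) {n : ℕ} (e : Fin n → Pa D R) (l : Cl (D+R)) : Finset ℕ :=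
  Finset.univ.biUnion (BMc cell A e l)

noncomputable def BV (pvt : Ix D R × Fin 3 → ℕ) (l : Cl (D+R)) : Finset ℕ := (Finset.univ.filter (sel l)).image pvt

lemma BM_sum (cell : ℕ → Finset ℕ) (hcell : ∀ i j, i ≠ j → Disjoint (cell i) (cell j)) (A : Finset ℕ) {n : ℕ}
    (e : Fin n → Pa D R) (he : ∀ c l, om (e c) l = 0 ∨ om (e c) l = 1) (l : Cl (D+R)) (y : ℕ → ℝ) :
    ∑ p ∈ BM cell A e l, y p = ∑ c : Fin n, o1 y (A ∩ cell c) * om (e c) l := by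
  unfold BM
  have hs : ∀ c, BMc cell A e l c ⊆ cell c := by
    intro c; unfold BMc; split_ifs
    · exact Finset.inter_subset_right
    · exact Finset.empty_subset _
  rw [Finset.sum_biUnion]
  · refine Finset.sum_congr rfl fun c _ => ?_
    unfold BMc o1
    rcases he c l with h | h
    · simp [h]
    · simp only [h, and_true, mul_one]
      split_ifs <;> simp
  · intro c _ c' _ hcc
    exact Finset.disjoint_of_subset_left (hs c) (Finset.disjoint_of_subset_right (hs c') (hcell _ _ (fun h => hcc (Fin.ext h))))

lemma BV_sum (pvt : Ix D R × Fin 3 → ℕ) (hinj : Function.Injective pvt) (l : Cl (D+R)) (y : ℕ → ℝ) :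
    ∑ p ∈ BV pvt l, y p = pv (fun i => y (pvt (i,0)) + y (pvt (i,1))) (fun i => y (pvt (i,2))) l := by
  unfold BV
  rw [Finset.sum_image (fun a _ b _ h => hinj h), Finset.sum_filter, Fintype.sum_prod_type]
  unfold pv
  refine Finset.sum_congr rfl fun i _ => ?_
  rw [Fin.sum_univ_three]
  unfold sel pvv
  rcases psd l i with _ | _ | _ <;> simp

lemma struct (h : ℝ) (hh : 0 < h) (cell : ℕ → Finset ℕ) (hcell : ∀ i j, i ≠ j → Disjoint (cell i) (cell j)) (A : Finset ℕ) {n : ℕ}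
    (e : Fin n → Pa D R) (he : ∀ c l, om (e c) l = 0 ∨ om (e c) l = 1)
    (pvt : Ix D R × Fin 3 → ℕ) (hinj : Function.Injective pvt) (hA : ∀ x, pvt x ∈ A) (hc : ∀ x c, pvt x ∉ cell c)
    (hit : ∀ i, |∑ c : Fin n, o1 (fun p => Real.log p / h) (A ∩ cell c) * vec (e c) i +
      gg (fun i => Real.log (pvt (i,0)) / h + Real.log (pvt (i,1)) / h) i - Real.log (pvt (i,2)) / h| ≤ 1) :
    Clus (2 * R * h) (2^R) A := by
  set y : ℕ → ℝ := fun p => Real.log p / h with hy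
  set X : Cl (D+R) → ℝ := fun l => ∑ c : Fin n, o1 y (A ∩ cell c) * om (e c) l + pv (fun i => y (pvt (i,0)) + y (pvt (i,1))) (fun i => y (pvt (i,2))) l with hX
  set Bs : Cl (D+R) → Finset ℕ := fun l => BM cell A e l ∪ BV pvt l with hB
  have hBMc : ∀ l x, pvt x ∉ BM cell A e l := by
    intro l x hx
    obtain ⟨c, _, h1⟩ := Finset.mem_biUnion.1 hx
    unfold BMc at h1
    split_ifs at h1
    · exact hc x c (Finset.mem_inter.1 h1).2
    · simp at h1
  have hsum : ∀ l, ∑ p ∈ Bs l, Real.log p = h * X l := by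
    intro l
    have h1 : ∑ p ∈ Bs l, y p = X l := by
      rw [hB]
      simp only []
      rw [Finset.sum_union, BM_sum cell hcell A e he, BV_sum pvt hinj]
      rw [Finset.disjoint_right]
      intro p hp
      obtain ⟨x, _, rfl⟩ := Finset.mem_image.1 hp
      exact hBMc l x
    rw [← h1, Finset.mul_sum]
    refine Finset.sum_congr rfl fun p _ => ?_
    rw [hy]; field_simp
  have hmem : ∀ l x, pvt x ∈ Bs l ↔ sel l x := by
    intro l x
    rw [hB]
    simp only [Finset.mem_union, hBMc l x, false_or, BV, Finset.mem_image, Finset.mem_filter, Finset.mem_univ, true_and]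
    constructor
    · rintro ⟨x', h1, h2⟩; exact hinj h2 ▸ h1
    · intro h1; exact ⟨x, h1, rfl⟩
  have hBinj : Function.Injective fun l : Cl R => Bs (emb D R l) := by
    intro l l' hll
    apply emb_inj D R
    intro i
    have h0 : sel (emb D R l) (i,0) ↔ sel (emb D R l') (i,0) := by
      rw [← hmem, ← hmem, show Bs (emb D R l) = Bs (emb D R l') from hll]
    have h2 : sel (emb D R l) (i,2) ↔ sel (emb D R l') (i,2) := by
      rw [← hmem, ← hmem, show Bs (emb D R l) = Bs (emb D R l') from hll]
    unfold sel at h0 h2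
    revert h0 h2
    generalize psd (emb D R l) i = o
    generalize psd (emb D R l') i = o'
    rcases o with _ | _ | _ <;> rcases o' with _ | _ | _ <;> simp
  have hd : ∀ i, |X (l0 i) - X (l1 i)| ≤ 1 := by
    intro i
    refine le_trans (le_of_eq ?_) (hit i)
    congr 1
    have h1 := pv_diff (fun i => y (pvt (i,0)) + y (pvt (i,1))) (fun i => y (pvt (i,2))) i
    have h2 : ∑ c : Fin n, o1 y (A ∩ cell c) * vec (e c) i = ∑ c : Fin n, o1 y (A ∩ cell c) * om (e c) (l0 i) - ∑ c : Fin n, o1 y (A ∩ cell c) * om (e c) (l1 i) := by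
      rw [← Finset.sum_sub_distrib]
      refine Finset.sum_congr rfl fun c _ => ?_
      unfold vec; ring
    simp only [hX]
    rw [h2]
    linarith
  have hsp := spread R X 1 zero_le_one hd
  refine ⟨Finset.univ.image fun l : Cl R => Bs (emb D R l), ?_, ?_, h * (X (emb D R fun _ => false) - R), ?_⟩
  · rw [Finset.card_image_of_injective _ hBinj]
    simp [Cl]
  · intro B hB'
    obtain ⟨l, _, rfl⟩ := Finset.mem_image.1 hB'
    intro p hp
    rcases Finset.mem_union.1 hp with hp | hp
    · obtain ⟨c, _, h1⟩ := Finset.mem_biUnion.1 hp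
      unfold BMc at h1
      split_ifs at h1
      · exact (Finset.mem_inter.1 h1).1
      · simp at h1
    · obtain ⟨x, _, rfl⟩ := Finset.mem_image.1 hp
      exact hA x
  · intro B hB'
    obtain ⟨l, _, rfl⟩ := Finset.mem_image.1 hB'
    rw [hsum]
    have := abs_le.1 (hsp l)
    constructor
    · apply mul_le_mul_of_nonneg_left _ hh.le; linarith [this.1]
    · rw [show h * (X (emb D R fun _ => false) - R) + 2 * R * h = h * (X (emb D R fun _ => false) + R) by ring]
      apply mul_le_mul_of_nonneg_left _ hh.le; linarith [this.2]
end struct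

end FKT

open Filter Topology
open scoped Classical
namespace FKT

section Z
variable {ι : Type} [Fintype ι] {E : Type} [Fintype E]

noncomputable def Tv (vec : E → ι → ℝ) {n : ℕ} (o : Fin n → ℝ) (e : Fin n → E) : ι → ℝ := ∑ i, o i • vec (e i)
noncomputable def Zf (vec : E → ι → ℝ) {n : ℕ} (o : Fin n → ℝ) (e : Fin n → E) : ι → ℤ := fun j => ⌊Tv vec o e j⌋
noncomputable def Zs (vec : E → ι → ℝ) (m : ℕ → E → ℝ) {n : ℕ} (o : Fin n → ℝ) : Finset (ι → ℤ) :=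
  (Finset.univ.filter fun e : Fin n → E => wp m 0 n e ≠ 0).image (Zf vec o)

lemma Zs_card (vec : E → ι → ℝ) (m : ℕ → E → ℝ) (hm : ∀ c e, 0 ≤ m c e) (hm1 : ∀ c, ∑ e, m c e = 1) {n : ℕ} (o : Fin n → ℝ)
    {θ : ℝ} (hθ : 0 < θ) : 1 ≤ ((Zs vec m o).card : ℝ)^θ * Qf θ vec m n o := by
  set Z := Zs vec m o
  set w := wp m 0 n
  have hw : ∀ e, 0 ≤ w e := fun e => wp_nonneg hm 0 n e
  have hw1 : ∑ e, w e = 1 := wp_sum hm1 n 0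
  set W : (ι → ℤ) → ℝ := fun z => ∑ e, if Zf vec o e = z then w e else 0 with hW
  have hW0 : ∀ z, 0 ≤ W z := fun z => Finset.sum_nonneg fun e _ => by split_ifs; exacts [hw e, le_rfl]
  have hin : ∀ e, w e ≠ 0 → Zf vec o e ∈ Z := fun e he => Finset.mem_image_of_mem _ (Finset.mem_filter.2 ⟨Finset.mem_univ _, he⟩)
  have hex : ∀ g : (ι → ℤ) → ℝ, ∑ z ∈ Z, W z * g z = ∑ e, w e * g (Zf vec o e) := by
    intro g
    simp only [hW, Finset.sum_mul]
    rw [Finset.sum_comm]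
    refine Finset.sum_congr rfl fun e _ => ?_
    by_cases he : w e = 0
    · simp [he]
    · rw [Finset.sum_eq_single (Zf vec o e)]
      · simp
      · intro z _ hz; rw [if_neg (Ne.symm hz), zero_mul]
      · intro h; exact absurd (hin e he) h
  have h1 : ∑ z ∈ Z, W z = 1 := by
    have := hex (fun _ => 1)
    simpa [hw1] using this
  have h2 := Real.rpow_sum_le_const_mul_sum_rpow_of_nonneg Z (f := W) (p := 1+θ) (by linarith) (fun z _ => hW0 z)
  rw [h1, Real.one_rpow, add_sub_cancel_left] at h2
  refine h2.trans (mul_le_mul_of_nonneg_left ?_ (by positivity))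
  have h3 : ∑ z ∈ Z, W z ^ (1+θ) = ∑ e, w e * W (Zf vec o e) ^ θ := by
    rw [← hex (fun z => W z ^ θ)]
    refine Finset.sum_congr rfl fun z _ => ?_
    rw [Real.rpow_add_of_nonneg (hW0 z) zero_le_one hθ.le, Real.rpow_one]
  rw [h3]
  unfold Qf
  refine Finset.sum_le_sum fun e _ => mul_le_mul_of_nonneg_left ?_ (hw e)
  refine Real.rpow_le_rpow (hW0 _) (Finset.sum_le_sum fun e' _ => ?_) hθ.le
  split_ifs with h4 h5 h5
  · simp [w]
  · exfalso; apply h5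
    rw [pi_norm_le_iff_of_nonneg zero_le_one]
    intro j
    have h6 : Int.floor (Tv vec o e' j) = Int.floor (Tv vec o e j) := congrFun h4 j
    have h7 := Int.abs_sub_lt_one_of_floor_eq_floor h6
    rw [Real.norm_eq_abs]
    change |Tv vec o e j - Tv vec o e' j| ≤ 1
    rw [abs_sub_comm]
    exact h7.le
  · exact mul_nonneg (hw e') (by norm_num)
  · simp
end Z

section hit
variable {ι : Type} [Fintype ι]

lemma hit_inner (WQ : ι → Finset ℕ) (hWQ : ∀ i j, i ≠ j → Disjoint (WQ i) (WQ j))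
    (Z : Finset (ι → ℤ)) (g : ι → ℝ) (y : ℕ → ℝ) (cQ : ι → ℝ) (hcQ0 : ∀ i, 0 ≤ cQ i)
    (hcQ : ∀ z ∈ Z, ∀ i, cQ i ≤ ∑ q ∈ (WQ i).filter (fun q => g i + z i ≤ y q ∧ y q < g i + z i + 1), gW (WQ i) q)
    (φ : Finset ℕ → ℝ) (hφ0 : ∀ A, 0 ≤ φ A)
    (hφ : ∀ Q ∈ Fintype.piFinset WQ, ∀ z ∈ Z, (∀ i, g i + z i ≤ y (Q i) ∧ y (Q i) < g i + z i + 1) → 1 ≤ φ (Finset.univ.image Q)) :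
    Z.card * ∏ i, cQ i ≤ EP (Finset.univ.biUnion WQ) φ := by
  refine le_trans ?_ (EP_ge_singles WQ hWQ φ hφ0)
  have h1 : ∀ Q ∈ Fintype.piFinset WQ, (∏ i, gW (WQ i) (Q i)) * ∑ z ∈ Z, (if ∀ i, g i + z i ≤ y (Q i) ∧ y (Q i) < g i + z i + 1 then (1:ℝ) else 0)
      ≤ (∏ i, gW (WQ i) (Q i)) * φ (Finset.univ.image Q) := by
    intro Q hQ
    refine mul_le_mul_of_nonneg_left ?_ (Finset.prod_nonneg fun i _ => gW_nonneg _ _)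
    rw [← Finset.sum_filter, Finset.sum_const, nsmul_eq_mul, mul_one]
    have hc : (Z.filter fun z => ∀ i, g i + z i ≤ y (Q i) ∧ y (Q i) < g i + z i + 1).card ≤ 1 := by
      rw [Finset.card_le_one]
      intro z hz z' hz'
      funext i
      have a1 := (Finset.mem_filter.1 hz).2 i
      have a2 := (Finset.mem_filter.1 hz').2 i
      have b1 : (z i : ℝ) < z' i + 1 := by linarith [a1.1, a2.2]
      have b2 : (z' i : ℝ) < z i + 1 := by linarith [a1.2, a2.1]
      have b3 : z i < z' i + 1 := by exact_mod_cast b1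
      have b4 : z' i < z i + 1 := by exact_mod_cast b2
      omega
    rcases Finset.eq_empty_or_nonempty (Z.filter fun z => ∀ i, g i + z i ≤ y (Q i) ∧ y (Q i) < g i + z i + 1) with h | ⟨z, hz⟩
    · rw [h]; simpa using hφ0 _
    · have := hφ Q hQ z (Finset.mem_filter.1 hz).1 (Finset.mem_filter.1 hz).2
      refine le_trans ?_ this
      exact_mod_cast hc
  refine le_trans ?_ (Finset.sum_le_sum h1)
  simp only [Finset.mul_sum]
  rw [Finset.sum_comm, ← nsmul_eq_mul]
  refine Finset.card_nsmul_le_sum _ _ _ fun z hz => ?_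
  refine (Finset.prod_le_prod (fun i _ => hcQ0 i) fun i _ => hcQ z hz i).trans ?_
  rw [Finset.prod_univ_sum]
  simp only [mul_ite, mul_one, mul_zero]
  rw [← Finset.sum_filter]
  refine le_of_eq (Finset.sum_congr ?_ fun _ _ => rfl)
  ext Q
  simp only [Fintype.mem_piFinset, Finset.mem_filter]
  constructor
  · intro h; exact ⟨fun i => (h i).1, fun i => (h i).2⟩
  · rintro ⟨h1, h2⟩ i; exact ⟨h1 i, h2 i⟩

lemma hit_prob (WP : ι × Bool → Finset ℕ) (WQ : ι → Finset ℕ) (hWP : ∀ i j, i ≠ j → Disjoint (WP i) (WP j))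
    (hWQ : ∀ i j, i ≠ j → Disjoint (WQ i) (WQ j)) (hPQ : ∀ x i, Disjoint (WP x) (WQ i))
    (Z : Finset (ι → ℤ)) (g : (ι × Bool → ℕ) → ι → ℝ) (y : ℕ → ℝ) (cP : ℝ) (hcP0 : 0 ≤ cP) (cQ : ι → ℝ) (hcQ0 : ∀ i, 0 ≤ cQ i)
    (hcP : ∀ x, cP ≤ ∑ p ∈ WP x, gW (WP x) p)
    (hcQ : ∀ P ∈ Fintype.piFinset WP, ∀ z ∈ Z, ∀ i, cQ i ≤ ∑ q ∈ (WQ i).filter (fun q => g P i + z i ≤ y q ∧ y q < g P i + z i + 1), gW (WQ i) q)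
    (φ : Finset ℕ → ℝ) (hφ0 : ∀ A, 0 ≤ φ A)
    (hφ : ∀ P ∈ Fintype.piFinset WP, ∀ Q ∈ Fintype.piFinset WQ, ∀ z ∈ Z, (∀ i, g P i + z i ≤ y (Q i) ∧ y (Q i) < g P i + z i + 1) →
      1 ≤ φ (Finset.univ.image P ∪ Finset.univ.image Q)) :
    cP ^ (Fintype.card (ι × Bool)) * (Z.card * ∏ i, cQ i) ≤ EP (Finset.univ.biUnion WP ∪ Finset.univ.biUnion WQ) φ := by
  rw [EP_union]
  · refine le_trans ?_ (EP_ge_singles WP hWP (fun A => EP (Finset.univ.biUnion WQ) fun B => φ (A ∪ B)) fun A => EP_nonneg fun B _ => hφ0 _)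
    have h1 : ∀ P ∈ Fintype.piFinset WP, (∏ i, gW (WP i) (P i)) * (Z.card * ∏ i, cQ i) ≤
        (∏ i, gW (WP i) (P i)) * EP (Finset.univ.biUnion WQ) (fun B => φ (Finset.univ.image P ∪ B)) := by
      intro P hP
      refine mul_le_mul_of_nonneg_left ?_ (Finset.prod_nonneg fun i _ => gW_nonneg _ _)
      exact hit_inner WQ hWQ Z (g P) y cQ hcQ0 (hcQ P hP) (fun B => φ (Finset.univ.image P ∪ B)) (fun _ => hφ0 _) (hφ P hP)
    refine le_trans ?_ (Finset.sum_le_sum h1)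
    rw [← Finset.sum_mul]
    refine mul_le_mul_of_nonneg_right ?_ (mul_nonneg (by positivity) (Finset.prod_nonneg fun i _ => hcQ0 i))
    rw [← Finset.prod_univ_sum, ← Finset.card_univ, ← Finset.prod_const]
    exact Finset.prod_le_prod (fun _ _ => hcP0) fun x _ => hcP x
  · rw [Finset.disjoint_biUnion_left]
    intro x _
    rw [Finset.disjoint_biUnion_right]
    intro i _
    exact hPQ x i
end hit

end FKT

open Filter Topology
open scoped Classical
namespace FKT

/-- indicator -/
noncomputable def ind (p : Prop) : ℝ := if p then 1 else 0

lemma ind_nonneg (p) : 0 ≤ ind p := by unfold ind; split_ifs <;> norm_num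
lemma ind_le_one (p) : ind p ≤ 1 := by unfold ind; split_ifs <;> norm_num
lemma ind_mono {p q : Prop} (h : p → q) : ind p ≤ ind q := by
  unfold ind; split_ifs with a b b <;> first | exact absurd (h a) b | norm_num
lemma ind_of {p : Prop} (h : p) : ind p = 1 := if_pos h
lemma ind_of_not {p : Prop} (h : ¬ p) : ind p = 0 := if_neg h

/-- Combining independent trials. -/
lemma combine (Main : Finset ℕ) (T : ℕ) (hT : 0 < T) (Piv : ℕ → Finset ℕ)
    (hP : ∀ i < T, ∀ j < T, i ≠ j → Disjoint (Piv i) (Piv j)) (hM : ∀ i < T, Disjoint Main (Piv i))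
    (C : Finset ℕ → Prop) (hC : ∀ A B, A ⊆ B → C A → C B) (good : ℕ → Finset ℕ → Prop) (c1 q : ℝ) (hc1 : 0 ≤ c1)
    (hgood : ∀ n < T, ∀ A ⊆ Main, good n A → c1 ≤ EP (Piv n) (fun B => ind (C (A ∪ B))))
    (hbad : ∀ n < T, EP Main (fun A => ind (¬ good n A)) ≤ q) :
    1 - Real.exp (-(c1*T/2)) - 2*q ≤ EP (Main ∪ (Finset.range T).biUnion Piv) (fun A => ind (C A)) := by
  have hTr : (0:ℝ) < T := by exact_mod_cast hT
  have hdis : Disjoint Main ((Finset.range T).biUnion Piv) := by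
    rw [Finset.disjoint_biUnion_right]; intro i hi; exact hM i (Finset.mem_range.1 hi)
  have key : EP (Main ∪ (Finset.range T).biUnion Piv) (fun A => 1 - ind (C A)) ≤ Real.exp (-(c1*T/2)) + 2*q := by
    rw [EP_union hdis]
    have hA : ∀ A ⊆ Main, EP ((Finset.range T).biUnion Piv) (fun B => 1 - ind (C (A ∪ B))) ≤
        Real.exp (-(c1*T/2)) + 2/T * ∑ n ∈ Finset.range T, ind (¬ good n A) := by
      intro A hA
      have h1 : EP ((Finset.range T).biUnion Piv) (fun B => 1 - ind (C (A ∪ B))) ≤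
          EP ((Finset.range T).biUnion Piv) (fun B => ∏ i ∈ Finset.range T, (fun i B => 1 - ind (C (A ∪ B))) i (B ∩ Piv i)) := by
        refine EP_mono fun B _ => ?_
        by_cases h : ∃ i ∈ Finset.range T, C (A ∪ (B ∩ Piv i))
        · obtain ⟨i, hi, h2⟩ := h
          rw [ind_of (hC _ _ (Finset.union_subset_union_right Finset.inter_subset_left) h2), sub_self]
          exact Finset.prod_nonneg fun i _ => by have := ind_le_one (C (A ∪ (B ∩ Piv i))); simpa using this
        · rw [Finset.prod_eq_one]
          · have := ind_nonneg (C (A ∪ B)); linarith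
          · intro i hi
            have : ¬ C (A ∪ (B ∩ Piv i)) := fun h' => h ⟨i, hi, h'⟩
            simp [ind_of_not this]
      refine h1.trans ?_
      rw [EP_biUnion_prod (Finset.range T) Piv (fun i hi j hj => hP i (Finset.mem_range.1 hi) j (Finset.mem_range.1 hj))
        (fun i B => 1 - ind (C (A ∪ B)))]
      have h2 : ∀ i ∈ Finset.range T, EP (Piv i) (fun B => 1 - ind (C (A ∪ B))) ≤ Real.exp (-(c1 * (1 - ind (¬ good i A)))) := by
        intro i hi
        rw [EP_sub, EP_const]
        by_cases hg : good i A
        · have := hgood i (Finset.mem_range.1 hi) A hA hg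
          rw [ind_of_not (not_not.2 hg)]
          have h3 := Real.add_one_le_exp (-(c1 * (1 - 0)))
          linarith
        · rw [ind_of hg]; simp
          exact EP_nonneg fun _ _ => ind_nonneg _
      refine (Finset.prod_le_prod (fun i _ => ?_) h2).trans ?_
      · exact EP_nonneg fun B _ => by have := ind_le_one (C (A ∪ B)); linarith
      rw [← Real.exp_sum]
      set s := ∑ n ∈ Finset.range T, ind (¬ good n A) with hs
      have hs0 : 0 ≤ s := Finset.sum_nonneg fun _ _ => ind_nonneg _
      have h3 : ∑ i ∈ Finset.range T, -(c1 * (1 - ind (¬ good i A))) = -(c1 * (T - s)) := by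
        rw [Finset.sum_neg_distrib, ← Finset.mul_sum, Finset.sum_sub_distrib]; simp [hs]
      rw [h3]
      by_cases h4 : s ≤ T/2
      · have : Real.exp (-(c1*(T-s))) ≤ Real.exp (-(c1*T/2)) := Real.exp_le_exp.2 (by nlinarith)
        have : 0 ≤ 2/T*s := by positivity
        linarith
      · push Not at h4
        have h5 : 1 ≤ 2/T*s := by
          rw [div_mul_eq_mul_div, le_div_iff₀ hTr]; linarith
        have h6 : Real.exp (-(c1 * (T - s))) ≤ 1 := by
          rw [Real.exp_le_one_iff]
          have : s ≤ T := by
            calc s ≤ ∑ n ∈ Finset.range T, (1:ℝ) := Finset.sum_le_sum fun _ _ => ind_le_one _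
              _ = T := by simp
          nlinarith
        have := Real.exp_pos (-(c1*T/2))
        linarith
    refine (EP_mono hA).trans ?_
    rw [EP_add, EP_const, EP_mul_left, EP_sum]
    have : ∑ n ∈ Finset.range T, EP Main (fun A => ind (¬ good n A)) ≤ ∑ n ∈ Finset.range T, q :=
      Finset.sum_le_sum fun n hn => hbad n (Finset.mem_range.1 hn)
    rw [Finset.sum_const, Finset.card_range, nsmul_eq_mul] at this
    have h7 : 2/(T:ℝ) * ∑ n ∈ Finset.range T, EP Main (fun A => ind (¬ good n A)) ≤ 2/T*(T*q) :=
      mul_le_mul_of_nonneg_left this (by positivity)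
    have h8 : 2/(T:ℝ)*(T*q) = 2*q := by field_simp
    linarith
  rw [EP_sub, EP_const] at key
  linarith

lemma nrm_ge (W : Finset ℕ) : Real.exp (-∑ p ∈ W, 1/(p:ℝ)) ≤ nrm W := by
  unfold nrm
  rw [← Finset.sum_neg_distrib, Real.exp_sum]
  refine Finset.prod_le_prod (fun _ _ => (Real.exp_pos _).le) fun p _ => ?_
  rw [Real.exp_neg]
  have h0 : 0 ≤ 1/(p:ℝ) := by positivity
  refine inv_anti₀ (by positivity) ?_
  have := Real.add_one_le_exp (1/(p:ℝ)); linarith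

lemma gW_sum (W : Finset ℕ) (s : Finset ℕ) : ∑ p ∈ s, gW W p = nrm W * ∑ p ∈ s, 1/(p:ℝ) := by
  unfold gW; rw [Finset.mul_sum]

lemma gW_sum_le_one (W : Finset ℕ) : ∑ p ∈ W, gW W p ≤ 1 := by
  have h := EP_o1 W (fun _ => 1) (fun t => 1 - t)
  simp at h
  have h2 : 0 ≤ EP W (fun A => 1 - o1 (fun _ => 1) A) := EP_nonneg fun A _ => by
    unfold o1; split_ifs with h
    · simp [h]
    · norm_num
  linarith

lemma gW_sum_le (W : Finset ℕ) (s : Finset ℕ) : ∑ p ∈ s, gW W p ≤ ∑ p ∈ s, 1/(p:ℝ) := by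
  rw [gW_sum]
  have : 0 ≤ ∑ p ∈ s, 1/(p:ℝ) := Finset.sum_nonneg fun _ _ => by positivity
  nlinarith [nrm_le_one W]

lemma PrI_disjoint {u v u' v' : ℝ} (h : v ≤ u') : Disjoint (PrI u v) (PrI u' v') := by
  rw [Finset.disjoint_left]; intro p h1 h2
  have a := (mem_PrI.1 h1).2.2; have b := (mem_PrI.1 h2).2.1; linarith

lemma PrI_subset {u v u' v' : ℝ} (h : u' ≤ u) (h2 : v ≤ v') : PrI u v ⊆ PrI u' v' := by
  intro p hp; rw [mem_PrI] at *; exact ⟨hp.1, by linarith, by linarith⟩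

/-- short interval mass -/
lemma short_mass {h t : ℝ} (hh : 100 ≤ h) (ht : 1 ≤ t) : 1/(4*t) ≤ ∑ p ∈ PrI (h*t) (h*(t+1)), 1/(p:ℝ) := by
  have h1 := mertens2 (u := h*t) (v := h*(t+1)) (by nlinarith) (by nlinarith)
  have h2 : h*(t+1)/(h*t) = 1 + 1/t := by field_simp
  rw [h2] at h1
  have h3 : 1/(2*t) ≤ Real.log (1+1/t) := by
    have := Real.one_sub_inv_le_log_of_pos (x := 1+1/t) (by positivity)
    refine le_trans ?_ this
    have : (1+1/t)⁻¹ = t/(t+1) := by field_simp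
    rw [this]
    rw [div_le_iff₀ (by positivity)]
    have : (1 - t/(t+1)) * (2*t) = 2*t/(t+1) := by field_simp; ring
    rw [this, le_div_iff₀ (by positivity)]; linarith
  have h4 : 25/(h*t) ≤ 1/(4*t) := by
    rw [div_le_div_iff₀ (by positivity) (by positivity)]; nlinarith
  have h5 : 1/(2*t) = 1/(4*t) + 1/(4*t) := by field_simp; norm_num
  have := (abs_le.1 h1).1
  linarith

lemma ball_mass {h t b : ℝ} (hh : 100 ≤ h) (ht : 1 ≤ t) (hb : 0 ≤ b) : ∑ p ∈ PrI (h*t) (h*(t+b)), 1/(p:ℝ) ≤ (b+1)/t := by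
  have h1 := mertens2 (u := h*t) (v := h*(t+b)) (by nlinarith) (by nlinarith)
  have h2 : h*(t+b)/(h*t) = 1 + b/t := by field_simp
  rw [h2] at h1
  have h3 : Real.log (1+b/t) ≤ b/t := by
    have := Real.log_le_sub_one_of_pos (x := 1+b/t) (by positivity); linarith
  have h4 : 25/(h*t) ≤ 1/t := by
    rw [div_le_div_iff₀ (by positivity) (by positivity)]; nlinarith
  have := (abs_le.1 h1).2
  rw [add_div]; linarith

lemma win_mass {h u v : ℝ} (hh : 100 ≤ h) (hu : 1 ≤ u) (huv : u ≤ v) :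
    |∑ p ∈ PrI (h*u) (h*v), 1/(p:ℝ) - Real.log (v/u)| ≤ 25/h := by
  have h1 := mertens2 (u := h*u) (v := h*v) (by nlinarith) (by nlinarith)
  have h2 : h*v/(h*u) = v/u := by field_simp
  rw [h2] at h1
  refine h1.trans ?_
  rw [div_le_div_iff₀ (by positivity) (by positivity)]; nlinarith
end FKT

open Filter Topology
open scoped Classical
namespace FKT

noncomputable def ac (h a a' : ℝ) (c : ℕ) : Finset ℕ := PrI (h * Real.exp (a*c)) (h * Real.exp (a*c+a'))
noncomputable def mcell (h a a' : ℝ) (c0 : ℕ) (c : ℕ) : Finset ℕ := if c0 ≤ c then ac h a a' c else ∅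
noncomputable def pi0 (h a a' : ℝ) (c : ℕ) : ℝ := ∑ p ∈ ac h a a' c, gW (ac h a a' c) p
noncomputable def piM (h a a' : ℝ) (c0 : ℕ) (c : ℕ) : ℝ := if c0 ≤ c then pi0 h a a' c else 0
noncomputable def SS (h a a' : ℝ) (n : ℕ) : Finset ℕ := (Finset.range n).biUnion (ac h a a')
noncomputable def uM (h a a' : ℝ) (n : ℕ) (c : ℕ) (x : {p // p ∈ SS h a a' n}) : ℝ :=
  if x.1 ∈ ac h a a' c then gW (ac h a a' c) x.1 / pi0 h a a' c else 0

section
variable {h a a' : ℝ} (hh : 100 ≤ h) (ha' : 0 < a') (haa : a' < a)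
include hh ha' haa

lemma ac_disj {i j : ℕ} (hij : i ≠ j) : Disjoint (ac h a a' i) (ac h a a' j) := by
  wlog hlt : i < j generalizing i j
  · exact (this hij.symm (by omega)).symm
  apply PrI_disjoint
  have : ((i:ℝ)+1) ≤ j := by exact_mod_cast hlt
  have h2 : a*i+a' ≤ a*j := by nlinarith
  exact mul_le_mul_of_nonneg_left (Real.exp_le_exp.2 h2) (by linarith)

lemma mcell_disj (c0 : ℕ) (i j : ℕ) (hij : i ≠ j) : Disjoint (mcell h a a' c0 i) (mcell h a a' c0 j) := by
  unfold mcell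
  split_ifs <;> first | exact ac_disj hh ha' haa hij | simp

lemma ac_mass (c : ℕ) : |∑ p ∈ ac h a a' c, 1/(p:ℝ) - a'| ≤ 25/h := by
  have ha : 0 < a := ha'.trans haa
  have h1 := win_mass (h := h) (u := Real.exp (a*c)) (v := Real.exp (a*c+a')) hh
    (Real.one_le_exp (by positivity)) (Real.exp_le_exp.2 (by linarith))
  rw [← Real.exp_sub, Real.log_exp] at h1
  simpa [ac] using h1

lemma pi0_ge (c : ℕ) (hb : 0 ≤ a' - 25/h) : (a' - 25/h) * (1 - (a' + 25/h)) ≤ pi0 h a a' c := by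
  have h1 := ac_mass hh ha' haa c
  rw [abs_le] at h1
  unfold pi0
  rw [gW_sum]
  have h2 := nrm_ge (ac h a a' c)
  have h3 := Real.add_one_le_exp (-∑ p ∈ ac h a a' c, 1/(p:ℝ))
  have h4 : 1 - (a' + 25/h) ≤ nrm (ac h a a' c) := by linarith
  rw [mul_comm]
  exact mul_le_mul h4 (by linarith) hb (nrm_pos _).le

lemma uM_nonneg (n c x) : 0 ≤ uM h a a' n c x := by
  unfold uM; split_ifs
  · exact div_nonneg (gW_nonneg _ _) (Finset.sum_nonneg fun _ _ => gW_nonneg _ _)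
  · exact le_rfl

lemma uM_sum' (n c : ℕ) (f : ℕ → ℝ) : ∑ x, uM h a a' n c x * f x.1 =
    (∑ p ∈ (ac h a a' c).filter (· ∈ SS h a a' n), gW (ac h a a' c) p * f p) / pi0 h a a' c := by
  have h1 : ∑ x : {p // p ∈ SS h a a' n}, uM h a a' n c x * f x.1 =
     ∑ p ∈ SS h a a' n, (if p ∈ ac h a a' c then gW (ac h a a' c) p / pi0 h a a' c else 0) * f p := by
    rw [Finset.univ_eq_attach]
    exact Finset.sum_attach (SS h a a' n) (fun p => (if p ∈ ac h a a' c then gW (ac h a a' c) p / pi0 h a a' c else 0) * f p)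
  rw [h1, Finset.sum_div]
  simp only [ite_mul, zero_mul]
  rw [← Finset.sum_filter]
  refine Finset.sum_congr ?_ fun p _ => by ring
  ext p; simp [and_comm]

lemma uM_sum_le (n c : ℕ) : ∑ x, uM h a a' n c x ≤ 1 := by
  have h1 := uM_sum' hh ha' haa n c (fun _ => 1)
  simp only [mul_one] at h1
  rw [h1]
  apply div_le_one_of_le₀
  · exact Finset.sum_le_sum_of_subset_of_nonneg (Finset.filter_subset _ _) fun _ _ _ => gW_nonneg _ _
  · exact Finset.sum_nonneg fun _ _ => gW_nonneg _ _

lemma uM_ball {n : ℕ} {πm Λ : ℝ} (hπm : 0 < πm) (hπ : ∀ c, πm ≤ pi0 h a a' c) (hΛ : 0 ≤ Λ) (c : ℕ) (z : ℝ) :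
    ∑ x : {p // p ∈ SS h a a' n}, (if |Real.log x.1 / h - z| ≤ Λ then uM h a a' n c x else 0) ≤ ((2*Λ+2)/πm) * Real.exp (-a*c) := by
  have ha : 0 < a := ha'.trans haa
  have h1 := uM_sum' hh ha' haa n c (fun p => if |Real.log p / h - z| ≤ Λ then 1 else 0)
  have h2 : ∑ x : {p // p ∈ SS h a a' n}, (if |Real.log x.1 / h - z| ≤ Λ then uM h a a' n c x else 0) =
     ∑ x : {p // p ∈ SS h a a' n}, uM h a a' n c x * (if |Real.log x.1 / h - z| ≤ Λ then 1 else 0) := by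
    simp
  rw [h2, h1]
  set s := max (Real.exp (a*c)) (z-Λ) with hs
  have hs1 : 1 ≤ s := le_trans (Real.one_le_exp (by positivity)) (le_max_left _ _)
  have h3 : ∑ p ∈ (ac h a a' c).filter (· ∈ SS h a a' n), gW (ac h a a' c) p * (if |Real.log p / h - z| ≤ Λ then 1 else 0)
      ≤ ∑ p ∈ PrI (h*s) (h*(s+(2*Λ+1))), 1/(p:ℝ) := by
    refine le_trans ?_ (gW_sum_le (ac h a a' c) _)
    simp only [mul_ite, mul_one, mul_zero]
    rw [← Finset.sum_filter]
    refine Finset.sum_le_sum_of_subset_of_nonneg ?_ fun _ _ _ => gW_nonneg _ _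
    intro p hp
    simp only [Finset.mem_filter] at hp
    obtain ⟨⟨hp1, -⟩, hp2⟩ := hp
    have hp3 := mem_PrI.1 hp1
    have hh0 : 0 < h := by linarith
    rw [abs_le] at hp2
    have e1 : Real.exp (a*c) ≤ Real.log p / h := by rw [le_div_iff₀ hh0]; linarith [hp3.2.1]
    have e2 : s ≤ Real.log p / h := max_le e1 (by linarith)
    have e3 : Real.log p / h < s + (2*Λ+1) := by
      have := le_max_right (Real.exp (a*c)) (z-Λ); linarith
    rw [le_div_iff₀ hh0] at e2
    rw [div_lt_iff₀ hh0] at e3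
    rw [mem_PrI]
    exact ⟨hp3.1, by linarith, by linarith⟩
  have h4 := ball_mass hh hs1 (b := 2*Λ+1) (by linarith)
  have h5 : (2*Λ+1+1)/s ≤ (2*Λ+2) * Real.exp (-a*c) := by
    rw [div_eq_mul_inv, show -a*c = -(a*c) by ring, Real.exp_neg]
    have : s⁻¹ ≤ (Real.exp (a*c))⁻¹ := inv_anti₀ (Real.exp_pos _) (le_max_left _ _)
    have h6 : 2*Λ+1+1 = 2*Λ+2 := by ring
    rw [h6]
    exact mul_le_mul_of_nonneg_left this (by linarith)
  have h7 := h3.trans (h4.trans h5)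
  calc _ ≤ ((2*Λ+2) * Real.exp (-a*c)) / pi0 h a a' c := div_le_div_of_nonneg_right h7 (hπm.le.trans (hπ c))
    _ ≤ ((2*Λ+2) * Real.exp (-a*c)) / πm := div_le_div_of_nonneg_left (by positivity) hπm (hπ c)
    _ = _ := by ring

lemma cell_law {n : ℕ} (c0 : ℕ) (hπ : ∀ c, 0 < pi0 h a a' c) (c : ℕ) (f : ℝ → ℝ) (hc : c < n) :
    EP (mcell h a a' c0 c) (fun A => f (o1 (fun p => Real.log p / h) A)) =
      ∑ b, ∑ p : {p // p ∈ SS h a a' n}, piB (piM h a a' c0) c b * uM h a a' n c p * f (if b then Real.log p.1 / h else 0) := by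
  have hsub : (ac h a a' c).filter (· ∈ SS h a a' n) = ac h a a' c := by
    rw [Finset.filter_eq_self]
    intro p hp
    exact Finset.mem_biUnion.2 ⟨c, Finset.mem_range.2 hc, hp⟩
  have hs1 : ∑ x, uM h a a' n c x = 1 := by
    have h1 := uM_sum' hh ha' haa n c (fun _ => 1)
    simp only [mul_one] at h1
    rw [h1, hsub]; exact div_self (hπ c).ne'
  have hs2 : ∑ x : {p // p ∈ SS h a a' n}, uM h a a' n c x * f (Real.log x.1 / h) =
      (∑ p ∈ ac h a a' c, gW (ac h a a' c) p * f (Real.log p / h)) / pi0 h a a' c := by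
    rw [uM_sum' hh ha' haa n c (fun p => f (Real.log p / h)), hsub]
  rw [Fintype.sum_bool]
  simp only [piB, if_true, mul_assoc, ← Finset.mul_sum]
  simp only [Bool.false_eq_true, if_false]
  rw [← Finset.sum_mul, hs1, hs2]
  unfold mcell piM
  split_ifs with h1
  · rw [EP_o1]
    have := (hπ c).ne'
    change (1 - pi0 h a a' c) * _ + _ = _
    field_simp
    ring
  · rw [EP_empty]; simp [o1]

theorem trial_bad {ρ : ℝ} (hρ : 0 < ρ) (hρ1 : ρ < 1/3) (D R : ℕ) (N : ℕ → ℕ) (hN : Antitone N) (c0 n : ℕ)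
    {θ lam μ0 L0 Λ πm K : ℝ} (hθ : 0 < θ) (hθ1 : θ ≤ 1) (hlam : 0 < lam) (hμ : 0 ≤ μ0)
    (hμa : μ0 ≤ a * θ)
    (hL : ∀ b, b ≤ R + D → ∀ p, mu ρ D R b p ≠ 0 → Real.exp (-L0) ≤ mu ρ D R b p)
    (hπm : 0 < πm) (hπm1 : πm ≤ 1) (hπ0 : ∀ c, πm ≤ pi0 h a a' c) (hc0 : c0 ≤ N (R+D))
    (hπ : μ0 ≤ πm * θ * (1 - θ * L0 / 2)) (hθL : θ * L0 / 2 ≤ 1)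
    (hnum : ∀ j, j < R → (a * θ + lam) * N j ≤
      μ0 * ∑ i ∈ Finset.range (D+1), et ρ D i * ((N (j+i) : ℝ) - N (j+i+1)))
    (hn : N 0 ≤ n) (hΛ0 : 0 ≤ Λ)
    (hΛ : FunBd (DD (vec : Pa D R → Ix D R → ℝ)) Λ) (hK : 0 < K) :
    EP ((Finset.range n).biUnion (mcell h a a' c0)) (fun A => ind (¬ (Qf θ vec (mc ρ D R N) n
        (fun i : Fin n => o1 (fun p => Real.log p / h) (A ∩ mcell h a a' c0 i)) ≤
        K * Real.exp (-(a * θ * ∑ i : Ix D R, (N (lev i) : ℝ)))))) ≤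
    collC (UU (vec : Pa D R → Ix D R → ℝ)).card lam 0 ((2*Λ+2)/πm) (Module.finrank ℝ (Ix D R → ℝ)) R
      * Real.exp (a * θ * Fintype.card (Ix D R)) / K := by
  have ha : 0 < a := ha'.trans haa
  set E := Real.exp (-(a * θ * ∑ i : Ix D R, (N (lev i) : ℝ))) with hE
  have hE0 : 0 < E := Real.exp_pos _
  have hcoll := trial_collision hρ hρ1 D R N hN (a := a) (θ := θ) (lam := lam) (μ0 := μ0) (L0 := L0) (C2 := (2*Λ+2)/πm) (Λ := Λ) ha.le hθ hθ1 hlam hμ hμa hL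
    (π := piM h a a' c0) (fun c => by unfold piM; split_ifs; exacts [hπm.le.trans (hπ0 c), le_rfl])
    (fun c => by unfold piM; split_ifs; exacts [gW_sum_le_one _, zero_le_one])
    (fun c hc => by
      unfold piM; rw [if_pos (hc0.trans hc)]
      refine hπ.trans ?_
      have h1 := hπ0 c
      have h2 : 0 ≤ 1 - θ*L0/2 := by linarith
      gcongr)
    hθL hnum n hn (J := {p // p ∈ SS h a a' n}) (uM h a a' n) (fun p => Real.log p.1 / h)
    (uM_nonneg hh ha' haa n) (uM_sum_le hh ha' haa n) (by rw [le_div_iff₀ hπm]; linarith)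
    (fun c z => uM_ball hh ha' haa hπm hπ0 hΛ0 c z) hΛ
  have hpush := push (mcell h a a' c0) (mcell_disj hh ha' haa c0) (fun p => Real.log p / h) (piM h a a' c0) (uM h a a' n)
    (fun p => Real.log p.1 / h) n (fun c f hc => cell_law hh ha' haa c0 (fun c => hπm.trans_le (hπ0 c)) c f hc) n 0
    (Qf θ vec (mc ρ D R N) n) (by omega)
  simp only [Nat.zero_add, ← Finset.range_eq_Ico] at hpush
  rw [← hpush] at hcoll
  have hQ0 : ∀ o, 0 ≤ Qf θ vec (mc ρ D R N) n o := by
    intro o; unfold Qf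
    refine Finset.sum_nonneg fun e _ => mul_nonneg (wp_nonneg (mc_nonneg hρ D R N) 0 n e) (Real.rpow_nonneg (Finset.sum_nonneg fun e' _ => mul_nonneg (wp_nonneg (mc_nonneg hρ D R N) 0 n e') ?_) _)
    split_ifs <;> norm_num
  refine le_trans (b := EP ((Finset.range n).biUnion (mcell h a a' c0)) (fun A => (Qf θ vec (mc ρ D R N) n
        (fun i : Fin n => o1 (fun p => Real.log p / h) (A ∩ mcell h a a' c0 i))) * (1/(K*E)))) ?_ ?_
  · refine EP_mono fun A _ => ?_
    rw [mul_one_div, le_div_iff₀ (by positivity)]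
    unfold ind
    split_ifs with h1
    · rw [zero_mul]; exact hQ0 _
    · push Not at h1; linarith
  · rw [EP_mul_right, mul_one_div, div_le_div_iff₀ (by positivity) hK]
    nlinarith [hcoll]
end
end FKT

open Filter Topology
open scoped Classical
namespace FKT

/-- pivot part of a cell -/
noncomputable def pp (h a a' : ℝ) (c : ℕ) : Finset ℕ := PrI (h * Real.exp (a*c+a')) (h * Real.exp (a*(c+1)))

noncomputable def plo (τ : ℝ) : Fin 3 → ℝ := ![1+0.4*τ, 1+0.55*τ, 2]
noncomputable def phi (τ : ℝ) : Fin 3 → ℝ := ![1+0.45*τ, 1+0.6*τ, 2+2*τ]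
noncomputable def W3 {ι : Type} (h a a' : ℝ) (cc : ι → ℕ) (x : ι × Fin 3) : Finset ℕ :=
  PrI (h * (Real.exp (a*cc x.1+a') * plo (Real.exp (a-a')-1) x.2)) (h * (Real.exp (a*cc x.1+a') * phi (Real.exp (a-a')-1) x.2))

section
variable {h a a' : ℝ} (hh : 100 ≤ h) (ha' : 0 < a') (haa : a' < a)
include hh ha' haa

lemma pp_disj {i j : ℕ} (hij : i ≠ j) : Disjoint (pp h a a' i) (pp h a a' j) := by
  wlog hlt : i < j generalizing i j
  · exact (this hij.symm (by omega)).symm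
  apply PrI_disjoint
  have : ((i:ℝ)+1) ≤ j := by exact_mod_cast hlt
  have h2 : a*(i+1) ≤ a*j+a' := by nlinarith
  exact mul_le_mul_of_nonneg_left (Real.exp_le_exp.2 h2) (by linarith)

lemma pp_ac (i j : ℕ) : Disjoint (pp h a a' i) (ac h a a' j) := by
  by_cases hlt : i < j
  · apply PrI_disjoint
    have : ((i:ℝ)+1) ≤ j := by exact_mod_cast hlt
    have h2 : a*(i+1) ≤ a*j := by nlinarith
    exact mul_le_mul_of_nonneg_left (Real.exp_le_exp.2 h2) (by linarith)
  · refine (PrI_disjoint ?_).symm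
    have : (j:ℝ) ≤ i := by exact_mod_cast not_lt.1 hlt
    have h2 : a*j+a' ≤ a*i+a' := by nlinarith
    exact mul_le_mul_of_nonneg_left (Real.exp_le_exp.2 h2) (by linarith)

lemma pp_mcell (i c0 j : ℕ) : Disjoint (pp h a a' i) (mcell h a a' c0 j) := by
  unfold mcell; split_ifs
  · exact pp_ac hh ha' haa i j
  · simp

lemma W3_sub {ι : Type} {M : ℕ} (hM : a*M = Real.log 2) (cc : ι → ℕ) (x : ι × Fin 3) :
    W3 h a a' cc x ⊆ pp h a a' (if x.2 = 2 then cc x.1 + M else cc x.1) := by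
  set τ := Real.exp (a-a')-1 with hτ
  have hτ0 : 0 < τ := by have := Real.add_one_lt_exp (x := a-a') (by linarith); linarith
  have hV : ∀ c : ℕ, Real.exp (a*(c+1)) = Real.exp (a*c+a') * (1+τ) := by
    intro c; rw [hτ, add_sub_cancel, ← Real.exp_add]; ring_nf
  have hM2 : ∀ c : ℕ, Real.exp (a*(c+M:ℕ)+a') = 2 * Real.exp (a*c+a') := by
    intro c
    rw [show a*(c+M:ℕ)+a' = Real.log 2 + (a*c+a') by push_cast; rw [← hM]; ring, Real.exp_add, Real.exp_log (by norm_num)]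
  obtain ⟨i, k⟩ := x
  have hV0 := Real.exp_pos (a*cc i+a')
  have hh0 : 0 < h := by linarith
  unfold W3 pp
  rw [hV]
  fin_cases k
  · simp [plo, phi, ← hτ]
    apply PrI_subset <;> apply mul_le_mul_of_nonneg_left _ hh0.le <;> nlinarith
  · simp [plo, phi, ← hτ]
    apply PrI_subset <;> apply mul_le_mul_of_nonneg_left _ hh0.le <;> nlinarith
  · simp [plo, phi, ← hτ]
    have := hM2 (cc i)
    push_cast at this
    rw [this]
    apply PrI_subset <;> apply mul_le_mul_of_nonneg_left _ hh0.le <;> nlinarith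

lemma W3_disj {ι : Type} {M : ℕ} (hM : a*M = Real.log 2) (cc : ι → ℕ) (hcc : Function.Injective cc) (hcM : ∀ i j, cc i + M ≠ cc j)
    (x x' : ι × Fin 3) (hx : x ≠ x') : Disjoint (W3 h a a' cc x) (W3 h a a' cc x') := by
  by_cases hc : (if x.2 = 2 then cc x.1 + M else cc x.1) = (if x'.2 = 2 then cc x'.1 + M else cc x'.1)
  · obtain ⟨i, k⟩ := x
    obtain ⟨i', k'⟩ := x'
    have hτ0 : 0 < Real.exp (a-a')-1 := by have := Real.add_one_lt_exp (x := a-a') (by linarith); linarith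
    have hh0 : 0 < h := by linarith
    have key : ∀ i, Disjoint (W3 h a a' cc (i,0)) (W3 h a a' cc (i,1)) := by
      intro i
      apply PrI_disjoint
      have hV0 := Real.exp_pos (a*cc i+a')
      simp [plo, phi]
      exact mul_le_mul_of_nonneg_left (mul_le_mul_of_nonneg_left (by linarith) hV0.le) hh0.le
    simp only at hc
    split_ifs at hc with h1 h2 h2
    · exfalso; apply hx; rw [h1, h2, hcc (Nat.add_right_cancel hc)]
    · exact absurd hc (hcM _ _)
    · exact absurd hc.symm (hcM _ _)
    · have hi := hcc hc
      subst hi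
      fin_cases k <;> fin_cases k' <;> simp at h1 h2 hx
      · exact key i
      · exact (key i).symm
  · exact Disjoint.mono (W3_sub hh ha' haa hM cc x) (W3_sub hh ha' haa hM cc x') (pp_disj hh ha' haa hc)

lemma o1_bd (A : Finset ℕ) (c0 c : ℕ) : |o1 (fun p => Real.log p / h) (A ∩ mcell h a a' c0 c)| ≤ Real.exp (a*(c+1)) := by
  unfold o1
  split_ifs with h1
  · obtain ⟨p, hp⟩ := Finset.card_eq_one.1 h1
    rw [hp, Finset.sum_singleton]
    have hpm : p ∈ mcell h a a' c0 c := (Finset.mem_inter.1 (hp ▸ Finset.mem_singleton_self p : p ∈ A ∩ mcell h a a' c0 c)).2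
    unfold mcell at hpm
    split_ifs at hpm
    · have h3 := mem_PrI.1 hpm
      have hh0 : 0 < h := by linarith
      have h4 : 0 ≤ Real.log p / h := div_nonneg (Real.log_natCast_nonneg p) hh0.le
      rw [abs_of_nonneg h4, div_le_iff₀ hh0]
      refine h3.2.2.le.trans ?_
      rw [mul_comm]
      exact mul_le_mul_of_nonneg_right (Real.exp_le_exp.2 (by linarith)) hh0.le
    · simp at hpm
  · simp; exact (Real.exp_pos _).le

lemma Tv_bd {D R n : ℕ} (N : ℕ → ℕ) (hN : Antitone N) {ρ : ℝ} (o : Fin n → ℝ) (ho : ∀ c, |o c| ≤ Real.exp (a*((c:ℕ)+1)))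
    (e : Fin n → Pa D R) (he : ∀ c : Fin n, mc ρ D R N c (e c) ≠ 0) (i : Ix D R) :
    |Tv vec o e i| ≤ Real.exp a / (Real.exp a - 1) * Real.exp (a*N (lev i)) := by
  have ha : 0 < a := ha'.trans haa
  have hea : 0 < Real.exp a - 1 := by have := Real.add_one_lt_exp ha.ne'; linarith
  have h1 : Tv vec o e i = ∑ c : Fin n, o c * vec (e c) i := by
    unfold Tv; simp [Finset.sum_apply]
  rw [h1]
  refine (Finset.abs_sum_le_sum_abs _ _).trans ?_
  have h2 : ∀ c : Fin n, |o c * vec (e c) i| ≤ if (c:ℕ) < N (lev i) then Real.exp (a*((c:ℕ)+1)) else 0 := by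
    intro c
    split_ifs with hc
    · rw [abs_mul]
      have h3 : |vec (e c) i| ≤ 1 := by
        have h4 := mc_om (he c) (l0 i)
        have h5 := mc_om (he c) (l1 i)
        unfold vec
        rcases h4 with h4 | h4 <;> rcases h5 with h5 | h5 <;> rw [h4, h5] <;> norm_num
      calc _ ≤ Real.exp (a*((c:ℕ)+1)) * 1 := mul_le_mul (ho c) h3 (abs_nonneg _) (Real.exp_pos _).le
        _ = _ := mul_one _
    · rw [mc_vec hN (he c) i (not_lt.1 hc)]; simp
  refine (Finset.sum_le_sum fun c _ => h2 c).trans ?_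
  rw [Finset.sum_fin_eq_sum_range]
  have h3 : ∑ c ∈ Finset.range n, (if h : c < n then (if c < N (lev i) then Real.exp (a*((c:ℕ)+1)) else 0) else 0) ≤
      ∑ c ∈ Finset.range (N (lev i)), Real.exp (a*((c:ℕ)+1)) := by
    calc _ = ∑ c ∈ Finset.range n, (if c < N (lev i) then Real.exp (a*((c:ℕ)+1)) else 0) := by
          refine Finset.sum_congr rfl fun c hc => ?_
          rw [dif_pos (Finset.mem_range.1 hc)]
      _ ≤ _ := by
          rw [← Finset.sum_filter]
          refine Finset.sum_le_sum_of_subset_of_nonneg ?_ fun _ _ _ => (Real.exp_pos _).le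
          intro c hc; exact Finset.mem_range.2 (Finset.mem_filter.1 hc).2
  refine h3.trans ?_
  have h4 : ∀ c : ℕ, Real.exp (a*((c:ℕ)+1)) = Real.exp a * Real.exp a ^ c := by
    intro c; rw [← Real.exp_nat_mul, ← Real.exp_add]; ring_nf
  simp only [h4]
  rw [← Finset.mul_sum, geom_sum_eq (by linarith), ← Real.exp_nat_mul, mul_div_assoc', div_mul_eq_mul_div]
  apply div_le_div_of_nonneg_right _ hea.le
  apply mul_le_mul_of_nonneg_left _ (Real.exp_pos _).le
  rw [mul_comm]; linarith
end
end FKT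

open Filter Topology
open scoped Classical
namespace FKT
section
variable {h a a' : ℝ} (hh : 100 ≤ h) (ha' : 0 < a') (haa : a' < a)
include hh ha' haa

lemma W3_nrm {ι : Type} {M : ℕ} (hM0 : 0 < M) (hM : a*M = Real.log 2) (cc : ι → ℕ) (x : ι × Fin 3) :
    Real.exp (-1) ≤ nrm (W3 h a a' cc x) := by
  refine le_trans ?_ (nrm_ge _)
  apply Real.exp_le_exp.2
  rw [neg_le_neg_iff]
  have ha : 0 < a := ha'.trans haa
  refine le_trans (Finset.sum_le_sum_of_subset_of_nonneg (W3_sub hh ha' haa hM cc x) fun _ _ _ => by positivity) ?_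
  set c := (if x.2 = 2 then cc x.1 + M else cc x.1)
  have h1 := win_mass (h := h) (u := Real.exp (a*c+a')) (v := Real.exp (a*(c+1))) hh
    (Real.one_le_exp (by positivity)) (Real.exp_le_exp.2 (by linarith))
  rw [← Real.exp_sub, Real.log_exp] at h1
  have h2 := (abs_le.1 h1).2
  have h3 : 25/h ≤ 1/4 := by rw [div_le_div_iff₀ (by linarith) (by norm_num)]; linarith
  have h4 : a ≤ Real.log 2 := by
    rw [← hM]; have : (1:ℝ) ≤ M := by exact_mod_cast hM0
    nlinarith
  have := Real.log_two_lt_d9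
  unfold pp
  linarith

set_option maxHeartbeats 1000000 in
theorem trial_hit {ρ : ℝ} (hρ : 0 < ρ) (D R : ℕ) (N : ℕ → ℕ) (hN : Antitone N) (c0 n : ℕ)
    {θ K : ℝ} (hθ : 0 < θ) (hK : 0 < K) {M : ℕ} (hM0 : 0 < M) (hM : a*M = Real.log 2) {τ : ℝ} (hτ : τ = Real.exp (a-a')-1)
    (hhτ : 2000/τ ≤ h)
    (w0 w1 : ℕ) (hw1 : Real.exp a / (Real.exp a - 1) ≤ 0.2*τ*Real.exp (a*w0)) (hw2 : 4*R*Real.exp a ≤ 0.1*τ*Real.exp (a*w0))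
    (hw3 : 1 ≤ 0.1*τ*Real.exp (a*w0))
    (cc : Ix D R → ℕ) (hcc : Function.Injective cc) (hcM : ∀ i j, cc i + M ≠ cc j)
    (hc1 : ∀ i, N (lev i) + w0 ≤ cc i) (hc2 : ∀ i, cc i ≤ N (lev i) + w1) (hc3 : ∀ i i', lev i < lev i' → cc i' + w0 ≤ cc i)
    (A : Finset ℕ) (hA : A ⊆ (Finset.range n).biUnion (mcell h a a' c0))
    (hQ : Qf θ vec (mc ρ D R N) n (fun i : Fin n => o1 (fun p => Real.log p / h) (A ∩ mcell h a a' c0 i)) ≤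
        K * Real.exp (-(a * θ * ∑ i : Ix D R, (N (lev i) : ℝ)))) :
    (Real.exp (-1) * (τ/80)) ^ (Fintype.card (Ix D R × Bool)) *
      (K ^ (-(1/θ)) * (Real.exp (-1) / 16 * Real.exp (-(a*w1+a')))^(Fintype.card (Ix D R))) ≤
    EP (Finset.univ.biUnion (W3 h a a' cc)) (fun B => ind (Clus (2*R*h) (2^R) (A ∪ B))) := by
  have ha : 0 < a := ha'.trans haa
  have hh0 : 0 < h := by linarith
  have hτ0 : 0 < τ := by have := Real.add_one_lt_exp (x := a-a') (by linarith); linarith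
  have hτ1 : τ ≤ 1 := by
    have h4 : a ≤ Real.log 2 := by
      rw [← hM]; have : (1:ℝ) ≤ M := by exact_mod_cast hM0
      nlinarith
    have : Real.exp (a-a') ≤ Real.exp (Real.log 2) := Real.exp_le_exp.2 (by linarith)
    rw [Real.exp_log (by norm_num)] at this; linarith
  set y : ℕ → ℝ := fun p => Real.log p / h with hy
  set o : Fin n → ℝ := fun i => o1 y (A ∩ mcell h a a' c0 i) with ho
  set E := Real.exp (-(a * θ * ∑ i : Ix D R, (N (lev i) : ℝ))) with hE
  set V : Ix D R → ℝ := fun i => Real.exp (a*cc i+a') with hV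
  have hV0 : ∀ i, 0 < V i := fun i => Real.exp_pos _
  set WP : Ix D R × Bool → Finset ℕ := fun x => W3 h a a' cc (x.1, if x.2 then 1 else 0) with hWP
  set WQ : Ix D R → Finset ℕ := fun i => W3 h a a' cc (i, 2) with hWQ
  have hd := W3_disj hh ha' haa hM cc hcc hcM
  have hUn : Finset.univ.biUnion (W3 h a a' cc) = Finset.univ.biUnion WP ∪ Finset.univ.biUnion WQ := by
    ext p
    simp only [Finset.mem_biUnion, Finset.mem_union, Finset.mem_univ, true_and]
    constructor
    · rintro ⟨⟨i, k⟩, hp⟩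
      fin_cases k
      · exact Or.inl ⟨(i, false), by simpa [hWP] using hp⟩
      · exact Or.inl ⟨(i, true), by simpa [hWP] using hp⟩
      · exact Or.inr ⟨i, hp⟩
    · rintro (⟨x, hp⟩ | ⟨i, hp⟩)
      · exact ⟨_, hp⟩
      · exact ⟨_, hp⟩
  set m := mc ρ D R N with hm
  set Z := Zs vec m o with hZ
  have hZc := Zs_card vec m (mc_nonneg hρ D R N) (mc_sum hρ D R N) o hθ
  set g : (Ix D R × Bool → ℕ) → Ix D R → ℝ := fun P i => gg (fun i => y (P (i,false)) + y (P (i,true))) i with hg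
  have ho1 : ∀ c : Fin n, |o c| ≤ Real.exp (a*((c:ℕ)+1)) := fun c => o1_bd hh ha' haa A c0 c
  have hw0V : ∀ i, Real.exp (a*N (lev i)) * Real.exp (a*w0) ≤ V i := by
    intro i; rw [← Real.exp_add]; apply Real.exp_le_exp.2
    have : (N (lev i) : ℝ) + w0 ≤ cc i := by exact_mod_cast hc1 i
    nlinarith
  have hV1 : ∀ i, Real.exp (a*w0) ≤ V i := fun i => le_trans (by
    have : 1 ≤ Real.exp (a*N (lev i)) := Real.one_le_exp (by positivity)
    nlinarith [Real.exp_pos (a*w0)]) (hw0V i)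
  -- elements of Z
  have hZe : ∀ z ∈ Z, ∃ e : Fin n → Pa D R, (∀ c : Fin n, m c (e c) ≠ 0) ∧ ∀ i, z i = ⌊Tv vec o e i⌋ := by
    intro z hz
    obtain ⟨e, he, rfl⟩ := Finset.mem_image.1 hz
    have he2 := (Finset.mem_filter.1 he).2
    refine ⟨e, fun c => ?_, fun i => rfl⟩
    unfold wp at he2
    rw [Finset.prod_ne_zero_iff] at he2
    simpa using he2 c (Finset.mem_univ _)
  have hTb : ∀ e : Fin n → Pa D R, (∀ c : Fin n, m c (e c) ≠ 0) → ∀ i, |Tv vec o e i| ≤ 0.2*τ*V i := by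
    intro e he i
    refine (Tv_bd hh ha' haa N hN o ho1 e he i).trans ?_
    calc _ ≤ 0.2*τ*Real.exp (a*w0) * Real.exp (a*N (lev i)) := mul_le_mul_of_nonneg_right hw1 (Real.exp_pos _).le
      _ = 0.2*τ*(Real.exp (a*N (lev i)) * Real.exp (a*w0)) := by ring
      _ ≤ _ := mul_le_mul_of_nonneg_left (hw0V i) (by positivity)
  -- bounds on pivots
  have hPb : ∀ P ∈ Fintype.piFinset WP, ∀ i, V i * (2+0.95*τ) ≤ y (P (i,false)) + y (P (i,true)) ∧
      y (P (i,false)) + y (P (i,true)) ≤ V i * (2+1.05*τ) := by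
    intro P hP i
    have h1 := mem_PrI.1 (Fintype.mem_piFinset.1 hP (i,false))
    have h2 := mem_PrI.1 (Fintype.mem_piFinset.1 hP (i,true))
    simp [plo, phi, ← hτ] at h1 h2
    simp only [hy]
    have e1 := h1.2; have e2 := h2.2
    rw [← add_div, le_div_iff₀ hh0, div_le_iff₀ hh0]
    simp only [hV]
    constructor <;> linarith [e1.1, e1.2, e2.1, e2.2]
  have hgb : ∀ P ∈ Fintype.piFinset WP, ∀ i, |g P i - (y (P (i,false)) + y (P (i,true)))| ≤ 0.2*τ*V i := by
    intro P hP i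
    refine (gg_near (fun i => y (P (i,false)) + y (P (i,true))) i (4 * Real.exp a * V i * Real.exp (-(a*w0))) (by positivity) ?_).trans ?_
    · intro i' hi'
      have h1 := hPb P hP i'
      rw [abs_of_nonneg (le_trans (by have := hV0 i'; positivity) h1.1)]
      refine h1.2.trans ?_
      have h2 : V i' ≤ V i * Real.exp (-(a*w0)) := by
        rw [← Real.exp_add]; apply Real.exp_le_exp.2
        have : (cc i' : ℝ) + w0 ≤ cc i := by exact_mod_cast hc3 i i' hi'
        nlinarith
      have h3 : 1 ≤ Real.exp a := Real.one_le_exp ha.le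
      have h4 : V i' * (2+1.05*τ) ≤ V i' * 4 := mul_le_mul_of_nonneg_left (by linarith) (hV0 i').le
      have h5 : V i' * 4 ≤ (V i * Real.exp (-(a*w0)))*4 := by linarith
      have h6 : 0 < V i * Real.exp (-(a*w0)) := mul_pos (hV0 i) (Real.exp_pos _)
      nlinarith
    · have h1 : (Real.exp (a*w0)) * Real.exp (-(a*w0)) = 1 := by rw [← Real.exp_add]; simp
      have h2 : 0 < V i * Real.exp (-(a*w0)) := mul_pos (hV0 i) (Real.exp_pos _)
      calc 2*(R:ℝ)*(4 * Real.exp a * V i * Real.exp (-(a*w0))) = 2 * ((4*R*Real.exp a) * (V i * Real.exp (-(a*w0)))) := by ring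
        _ ≤ 2*((0.1*τ*Real.exp (a*w0)) * (V i * Real.exp (-(a*w0)))) := by
            have := mul_le_mul_of_nonneg_right hw2 h2.le; linarith
        _ = 0.2*τ*V i*(Real.exp (a*w0) * Real.exp (-(a*w0))) := by ring
        _ = _ := by rw [h1, mul_one]
  have htar : ∀ P ∈ Fintype.piFinset WP, ∀ z ∈ Z, ∀ i, V i * 2 ≤ g P i + z i ∧ g P i + z i + 1 ≤ V i * (2+2*τ) := by
    intro P hP z hz i
    obtain ⟨e, he, hez⟩ := hZe z hz
    have h1 := abs_le.1 (hTb e he i)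
    have h2 := hPb P hP i
    have h3 := abs_le.1 (hgb P hP i)
    have h4 := Int.floor_le (Tv vec o e i)
    have h5 := Int.lt_floor_add_one (Tv vec o e i)
    rw [hez i]
    have h6 : 1 ≤ 0.1*τ*V i := hw3.trans (mul_le_mul_of_nonneg_left (hV1 i) (by positivity))
    have h7 := mul_pos hτ0 (hV0 i)
    constructor <;> nlinarith [h1.1, h1.2, h2.1, h2.2, h3.1, h3.2]
  have hhit := hit_prob WP WQ (fun x x' hx => hd _ _ (by
      obtain ⟨i, b⟩ := x; obtain ⟨i', b'⟩ := x'
      intro h1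
      simp only [Prod.mk.injEq] at h1
      apply hx
      rw [Prod.mk.injEq]
      refine ⟨h1.1, ?_⟩
      cases b <;> cases b' <;> simp at h1 ⊢)) (fun i j hij => hd _ _ (by simpa using hij))
    (fun x i => hd _ _ (by
      intro h1; simp only [Prod.mk.injEq] at h1
      have := h1.2
      split_ifs at this <;> simp at this)) Z g y (Real.exp (-1) * (τ/80)) (by positivity)
    (fun i => Real.exp (-1)/16 / V i) (fun i => by have := hV0 i; positivity) ?_ ?_
    (fun B => ind (Clus (2*R*h) (2^R) (A ∪ B))) (fun _ => ind_nonneg _) ?_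
  · rw [hUn]
    refine le_trans ?_ hhit
    apply mul_le_mul_of_nonneg_left _ (by positivity)
    have hQ0 : 0 < Qf θ vec m n o := by
      by_contra hneg
      push Not at hneg
      have : (Z.card:ℝ)^θ * Qf θ vec m n o ≤ 0 := mul_nonpos_of_nonneg_of_nonpos (by positivity) hneg
      linarith
    have hE0 : 0 < E := Real.exp_pos _
    have h1 : (K*E)⁻¹ ≤ (Z.card:ℝ)^θ := by
      rw [inv_le_iff_one_le_mul₀ (by positivity)]
      exact hZc.trans (mul_le_mul_of_nonneg_left hQ (by positivity))
    have h2 : ((K*E)⁻¹)^(1/θ) ≤ Z.card := by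
      have := Real.rpow_le_rpow (by positivity) h1 (z := 1/θ) (by positivity)
      rwa [← Real.rpow_mul (by positivity), mul_one_div_cancel hθ.ne', Real.rpow_one] at this
    have h3 : ((K*E)⁻¹)^(1/θ) = K^(-(1/θ)) * Real.exp (a * ∑ i : Ix D R, (N (lev i) : ℝ)) := by
      rw [mul_inv, Real.mul_rpow (by positivity) (by positivity), Real.inv_rpow hK.le, ← Real.rpow_neg hK.le, hE, ← Real.exp_neg, ← Real.exp_mul]
      congr 2; field_simp
    have h4 : (Real.exp (-1) / 16 * Real.exp (-(a*w1+a')))^(Fintype.card (Ix D R)) * Real.exp (-(a * ∑ i : Ix D R, (N (lev i) : ℝ)))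
        ≤ ∏ i : Ix D R, Real.exp (-1)/16 / V i := by
      have h5 : Real.exp (-(a * ∑ i : Ix D R, (N (lev i) : ℝ))) = ∏ i : Ix D R, Real.exp (-(a * N (lev i))) := by
        rw [← Real.exp_sum, Finset.mul_sum, Finset.sum_neg_distrib]
      rw [h5, ← Finset.card_univ, ← Finset.prod_const, ← Finset.prod_mul_distrib]
      refine Finset.prod_le_prod (fun i _ => by positivity) fun i _ => ?_
      rw [div_eq_mul_inv _ (V i), hV]
      simp only
      rw [← Real.exp_neg, mul_assoc, ← Real.exp_add]
      apply mul_le_mul_of_nonneg_left _ (by positivity)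
      apply Real.exp_le_exp.2
      have : (cc i : ℝ) ≤ N (lev i) + w1 := by exact_mod_cast hc2 i
      nlinarith
    calc _ = (K^(-(1/θ)) * Real.exp (a * ∑ i : Ix D R, (N (lev i) : ℝ))) * ((Real.exp (-1) / 16 * Real.exp (-(a*w1+a')))^(Fintype.card (Ix D R)) * Real.exp (-(a * ∑ i : Ix D R, (N (lev i) : ℝ)))) := by
          have : Real.exp (a * ∑ i : Ix D R, (N (lev i) : ℝ)) * Real.exp (-(a * ∑ i : Ix D R, (N (lev i) : ℝ))) = 1 := by
            rw [← Real.exp_add]; simp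
          linear_combination (-(K^(-(1/θ)) * (Real.exp (-1) / 16 * Real.exp (-(a*w1+a')))^(Fintype.card (Ix D R)))) * this
      _ ≤ Z.card * ∏ i : Ix D R, Real.exp (-1)/16 / V i := by
          rw [← h3]
          exact mul_le_mul h2 h4 (by positivity) (by positivity)
  · intro x
    rw [gW_sum]
    refine mul_le_mul (W3_nrm hh ha' haa hM0 hM cc _) ?_ (by positivity) (nrm_pos _).le
    obtain ⟨i, b⟩ := x
    have h25 : 25/h ≤ τ/80 := by
      rw [div_le_iff₀ hτ0] at hhτ
      rw [div_le_div_iff₀ hh0 (by norm_num)]; linarith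
    have hVge : 1 ≤ V i := Real.one_le_exp (by positivity)
    have gen : ∀ s t : ℝ, 0 < s → s ≤ 1 → 0.05*τ ≤ t - s*τ → t ≤ τ → τ/80 ≤ ∑ p ∈ PrI (h*(V i*(1+s*τ))) (h*(V i*(1+t))), 1/(p:ℝ) := by
      intro s t hs hs1 hst ht
      have hsτ : 0 < s*τ := mul_pos hs hτ0
      have h1 := win_mass (h := h) (u := V i*(1+s*τ)) (v := V i*(1+t)) hh (by nlinarith) (by nlinarith)
      have h2 : V i*(1+t)/(V i*(1+s*τ)) = (1+t)/(1+s*τ) := by have := hV0 i; field_simp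
      rw [h2] at h1
      have h3 : τ/40 ≤ Real.log ((1+t)/(1+s*τ)) := by
        refine le_trans ?_ (Real.one_sub_inv_le_log_of_pos (div_pos (by linarith) (by linarith)))
        rw [inv_div, le_sub_iff_add_le, ← le_sub_iff_add_le', div_le_iff₀ (by linarith)]
        nlinarith
      have := (abs_le.1 h1).1
      linarith
    cases b
    · have := gen 0.4 (0.45*τ) (by norm_num) (by norm_num) (by linarith) (by linarith)
      simpa [hWP, W3, plo, phi, ← hτ] using this
    · have := gen 0.55 (0.6*τ) (by norm_num) (by norm_num) (by linarith) (by linarith)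
      simpa [hWP, W3, plo, phi, ← hτ] using this
  · intro P hP z hz i
    have ht := htar P hP z hz i
    set t := g P i + z i with htt
    have hVge : 1 ≤ V i := Real.one_le_exp (by positivity)
    have h1 := short_mass hh (t := t) (by linarith)
    rw [gW_sum, div_div]
    have h2 : (WQ i).filter (fun q => t ≤ y q ∧ y q < t + 1) = PrI (h*t) (h*(t+1)) := by
      ext q
      simp only [Finset.mem_filter, hWQ, W3, mem_PrI, hy, le_div_iff₀ hh0, div_lt_iff₀ hh0]
      simp only [plo, phi, ← hτ]
      simp
      constructor
      · rintro ⟨⟨hq, -⟩, h3, h4⟩; exact ⟨hq, by linarith, by linarith⟩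
      · rintro ⟨hq, h3, h4⟩
        refine ⟨⟨hq, ?_, ?_⟩, by linarith, by linarith⟩
        · refine le_trans ?_ h3; exact mul_le_mul_of_nonneg_left ht.1 hh0.le
        · refine lt_of_lt_of_le h4 ?_; exact mul_le_mul_of_nonneg_left ht.2 hh0.le
    rw [h2]
    have h3 : 1/(16*V i) ≤ 1/(4*t) := one_div_le_one_div_of_le (by linarith) (by nlinarith [hV0 i])
    calc Real.exp (-1)/(16*V i) = Real.exp (-1) * (1/(16*V i)) := by ring
      _ ≤ _ := mul_le_mul (W3_nrm hh ha' haa hM0 hM cc _) (h3.trans h1) (by positivity) (nrm_pos _).le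
  · intro P hP Q hQm z hz hPQ
    refine le_of_eq (ind_of ?_).symm
    obtain ⟨e, he, hez⟩ := hZe z hz
    set B := Finset.univ.image P ∪ Finset.univ.image Q with hB
    set pvt : Ix D R × Fin 3 → ℕ := fun x => if x.2 = 2 then Q x.1 else P (x.1, decide (x.2 = 1)) with hpvt
    have hpW : ∀ x, pvt x ∈ W3 h a a' cc x := by
      rintro ⟨i, k⟩
      fin_cases k
      · simpa [hpvt, hWP] using Fintype.mem_piFinset.1 hP (i,false)
      · simpa [hpvt, hWP] using Fintype.mem_piFinset.1 hP (i,true)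
      · simpa [hpvt] using Fintype.mem_piFinset.1 hQm i
    have hpc : ∀ x c, pvt x ∉ mcell h a a' c0 c := by
      intro x c
      exact Finset.disjoint_left.1 (pp_mcell hh ha' haa _ c0 c) (W3_sub hh ha' haa hM cc x (hpW x))
    have hBp : ∀ p ∈ B, ∃ x, p = pvt x := by
      intro p hp
      rcases Finset.mem_union.1 hp with hp | hp
      · obtain ⟨⟨i, b⟩, -, rfl⟩ := Finset.mem_image.1 hp
        cases b
        · exact ⟨(i,0), by simp [hpvt]⟩
        · exact ⟨(i,1), by simp [hpvt]⟩
      · obtain ⟨i, -, rfl⟩ := Finset.mem_image.1 hp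
        exact ⟨(i,2), by simp [hpvt]⟩
    have hAB : ∀ c, (A ∪ B) ∩ mcell h a a' c0 c = A ∩ mcell h a a' c0 c := by
      intro c; ext p
      simp only [Finset.mem_inter, Finset.mem_union]
      constructor
      · rintro ⟨hp | hp, hpc'⟩
        · exact ⟨hp, hpc'⟩
        · obtain ⟨x, rfl⟩ := hBp p hp; exact absurd hpc' (hpc x c)
      · rintro ⟨h1, h2⟩; exact ⟨Or.inl h1, h2⟩
    refine struct h hh0 (mcell h a a' c0) (mcell_disj hh ha' haa c0) (A ∪ B) e (fun c l => mc_om (he c) l) pvt ?_ ?_ hpc ?_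
    · intro x x' hxx
      by_contra hne
      exact Finset.disjoint_left.1 (hd x x' hne) (hpW x) (hxx ▸ hpW x')
    · rintro ⟨i, k⟩
      refine Finset.mem_union_right _ ?_
      fin_cases k
      · exact Finset.mem_union_left _ (Finset.mem_image.2 ⟨(i,false), Finset.mem_univ _, by simp [hpvt]⟩)
      · exact Finset.mem_union_left _ (Finset.mem_image.2 ⟨(i,true), Finset.mem_univ _, by simp [hpvt]⟩)
      · exact Finset.mem_union_right _ (Finset.mem_image.2 ⟨i, Finset.mem_univ _, by simp [hpvt]⟩)
    · intro i
      simp only [hAB]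
      have h1 : ∑ c : Fin n, o1 (fun p => Real.log p / h) (A ∩ mcell h a a' c0 c) * vec (e c) i = Tv vec o e i := by
        unfold Tv; simp [Finset.sum_apply, ho, hy]
      rw [h1]
      have h2 : (fun i => Real.log (pvt (i,0)) / h + Real.log (pvt (i,1)) / h) = fun i => y (P (i,false)) + y (P (i,true)) := by
        funext i; simp [hpvt, hy]
      rw [h2]
      have h3 : Real.log (pvt (i,2)) / h = y (Q i) := by simp [hpvt, hy]
      rw [h3]
      have h4 := hPQ i
      rw [hez i] at h4
      have h5 := Int.floor_le (Tv vec o e i)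
      have h6 := Int.lt_floor_add_one (Tv vec o e i)
      change |Tv vec o e i + g P i - y (Q i)| ≤ 1
      rw [abs_le]
      constructor <;> linarith [h4.1, h4.2]
end
end FKT

open Filter Topology
open scoped Classical
namespace FKT

/-- index of a coordinate -/
noncomputable def mix {D R : ℕ} (i : Ix D R) : ℕ := (Fintype.equivFin (Ix D R) i : ℕ)
lemma mix_lt {D R : ℕ} (i : Ix D R) : mix i < Fintype.card (Ix D R) := (Fintype.equivFin (Ix D R) i).2
lemma mix_inj {D R : ℕ} {i i' : Ix D R} (h : mix i = mix i') : i = i' :=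
  (Fintype.equivFin (Ix D R)).injective (Fin.ext h)

noncomputable def Nn (N : ℕ → ℕ) (u n b : ℕ) : ℕ := N b + n*u
noncomputable def ccn {D R : ℕ} (N : ℕ → ℕ) (u w0 M n : ℕ) (i : Ix D R) : ℕ := Nn N u n (lev i) + w0 + 2*M*mix i

lemma idx_inj {D R : ℕ} (N : ℕ → ℕ) (u w0 M T : ℕ) (hM0 : 0 < M) (hu : u = w0 + 2*M*Fintype.card (Ix D R))
    (hgap : ∀ j j', j < j' → j' < R → N j' + (T+2)*u ≤ N j) {n n' : ℕ} (hn : n < T) (hn' : n' < T) (i i' : Ix D R)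
    {s s' : ℕ} (hs : s = 0 ∨ s = M) (hs' : s' = 0 ∨ s' = M)
    (h : ccn N u w0 M n i + s = ccn N u w0 M n' i' + s') : n = n' ∧ i = i' ∧ s = s' := by
  unfold ccn Nn at h
  have hb : ∀ (i : Ix D R) (s : ℕ), (s = 0 ∨ s = M) → w0 + 2*M*mix i + s < w0 + 2*M*Fintype.card (Ix D R) := by
    intro i s hs
    have h1 : mix i + 1 ≤ Fintype.card (Ix D R) := mix_lt i
    have h2 := Nat.mul_le_mul_left (2*M) h1
    have h3 : 2*M*(mix i+1) = 2*M*mix i + 2*M := by ring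
    rcases hs with rfl | rfl <;> omega
  have b1 := hb i s hs
  have b2 := hb i' s' hs'
  rw [← hu] at b1 b2
  have hTu : (T+2)*u = T*u + 2*u := by ring
  have m1 : (n+1)*u ≤ T*u := Nat.mul_le_mul_right u hn
  have m2 : (n'+1)*u ≤ T*u := Nat.mul_le_mul_right u hn'
  have e1 : (n+1)*u = n*u+u := by ring
  have e2 : (n'+1)*u = n'*u+u := by ring
  have hlev : lev i = lev i' := by
    rcases lt_trichotomy (lev i) (lev i') with hl | hl | hl
    · have := hgap _ _ hl (lev_lt i'); omega
    · exact hl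
    · have := hgap _ _ hl (lev_lt i); omega
  rw [hlev] at h
  have hnn : n = n' := by
    rcases lt_trichotomy n n' with hl | hl | hl
    · have := Nat.mul_le_mul_right u hl
      have e3 : (n+1)*u = n*u+u := by ring
      simp only [Nat.succ_eq_add_one] at this
      omega
    · exact hl
    · have := Nat.mul_le_mul_right u hl
      have e3 : (n'+1)*u = n'*u+u := by ring
      simp only [Nat.succ_eq_add_one] at this
      omega
  subst hnn
  have h5 : 2*M*mix i + s = 2*M*mix i' + s' := by omega
  have hm : mix i = mix i' := by
    rcases lt_trichotomy (mix i) (mix i') with hl | hl | hl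
    · have := Nat.mul_le_mul_left (2*M) hl
      have e3 : 2*M*(mix i+1) = 2*M*mix i + 2*M := by ring
      simp only [Nat.succ_eq_add_one] at this
      omega
    · exact hl
    · have := Nat.mul_le_mul_left (2*M) hl
      have e3 : 2*M*(mix i'+1) = 2*M*mix i' + 2*M := by ring
      simp only [Nat.succ_eq_add_one] at this
      omega
  refine ⟨rfl, mix_inj hm, ?_⟩
  rw [hm] at h5; omega

section
variable {h a a' : ℝ} (hh : 100 ≤ h) (ha' : 0 < a') (haa : a' < a)
include hh ha' haa

theorem cluster_core {ρ : ℝ} (hρ : 0 < ρ) (hρ1 : ρ < 1/3) (D R : ℕ) (N : ℕ → ℕ) (hN : Antitone N)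
    {θ lam μ0 L0 Λ πm K : ℝ} (hθ : 0 < θ) (hθ1 : θ ≤ 1) (hlam : 0 < lam) (hμ : 0 ≤ μ0)
    (hμa : μ0 ≤ a * θ)
    (hL : ∀ b, b ≤ R + D → ∀ p, mu ρ D R b p ≠ 0 → Real.exp (-L0) ≤ mu ρ D R b p)
    (hπm : 0 < πm) (hπm1 : πm ≤ 1) (hπ0 : ∀ c, πm ≤ pi0 h a a' c)
    (hπ : μ0 ≤ πm * θ * (1 - θ * L0 / 2)) (hθL : θ * L0 / 2 ≤ 1)
    (hΛ0 : 0 ≤ Λ) (hΛ : FunBd (DD (vec : Pa D R → Ix D R → ℝ)) Λ) (hK : 0 < K)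
    {M : ℕ} (hM0 : 0 < M) (hM : a*M = Real.log 2) {τ : ℝ} (hτ : τ = Real.exp (a-a')-1) (hhτ : 2000/τ ≤ h)
    (w0 : ℕ) (hw1 : Real.exp a / (Real.exp a - 1) ≤ 0.2*τ*Real.exp (a*w0)) (hw2 : 4*R*Real.exp a ≤ 0.1*τ*Real.exp (a*w0))
    (hw3 : 1 ≤ 0.1*τ*Real.exp (a*w0)) (u T : ℕ) (hu : u = w0 + 2*M*Fintype.card (Ix D R)) (hT : 0 < T)
    (hgap : ∀ j j', j < j' → j' < R → N j' + (T+2)*u ≤ N j)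
    (hnum : ∀ n < T, ∀ j, j < R → (a * θ + lam) * ((N j : ℝ) + n*u) ≤
      μ0 * ∑ i ∈ Finset.range (D+1), et ρ D i * ((N (j+i) : ℝ) - N (j+i+1))) :
    1 - Real.exp (-(((Real.exp (-1) * (τ/80)) ^ (Fintype.card (Ix D R × Bool)) *
      (K ^ (-(1/θ)) * (Real.exp (-1) / 16 * Real.exp (-(a*u+a')))^(Fintype.card (Ix D R))))*T/2))
      - 2*(collC (UU (vec : Pa D R → Ix D R → ℝ)).card lam 0 ((2*Λ+2)/πm) (Module.finrank ℝ (Ix D R → ℝ)) R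
      * Real.exp (a * θ * Fintype.card (Ix D R)) / K) ≤
    EP (PrI (h*Real.exp (a*N (R+D))) (h*Real.exp (a*(N 0+(T+2)*u:ℕ)))) (fun A => ind (Clus (2*R*h) (2^R) A)) := by
  have ha : 0 < a := ha'.trans haa
  have hh0 : 0 < h := by linarith
  have hτ0 : 0 < τ := by have := Real.add_one_lt_exp (x := a-a') (by linarith); linarith
  set nt := N 0 + T*u with hnt
  set Main := (Finset.range nt).biUnion (mcell h a a' (N (R+D))) with hMain
  set Piv : ℕ → Finset ℕ := fun n => Finset.univ.biUnion (W3 h a a' (ccn (D := D) (R := R) N u w0 M n)) with hPiv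
  have hNn : ∀ n, Antitone (Nn N u n) := fun n b b' hbb => by unfold Nn; have := hN hbb; omega
  have hmem : ∀ n, ∀ p ∈ Piv n, ∃ i : Ix D R, ∃ s, (s = 0 ∨ s = M) ∧ p ∈ pp h a a' (ccn N u w0 M n i + s) := by
    intro n p hp
    obtain ⟨x, -, hx⟩ := Finset.mem_biUnion.1 hp
    have := W3_sub hh ha' haa hM _ x hx
    split_ifs at this
    · exact ⟨x.1, M, Or.inr rfl, this⟩
    · exact ⟨x.1, 0, Or.inl rfl, this⟩
  have hinj := fun {n n' : ℕ} (hn : n < T) (hn' : n' < T) (i i' : Ix D R) {s s' : ℕ} => idx_inj (s := s) (s' := s') N u w0 M T hM0 hu hgap hn hn' i i'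
  have hcomb := combine Main T hT Piv (by
      intro n hn n' hn' hne
      rw [Finset.disjoint_left]
      intro p hp hp'
      obtain ⟨i, s, hs, h1⟩ := hmem n p hp
      obtain ⟨i', s', hs', h1'⟩ := hmem n' p hp'
      by_cases hc : ccn N u w0 M n i + s = ccn N u w0 M n' i' + s'
      · exact hne (hinj hn hn' i i' hs hs' hc).1
      · exact Finset.disjoint_left.1 (pp_disj hh ha' haa hc) h1 h1') (by
      intro n hn
      rw [Finset.disjoint_left]
      intro p hp hp'
      obtain ⟨i, s, hs, h1⟩ := hmem n p hp'
      obtain ⟨c, -, h2⟩ := Finset.mem_biUnion.1 hp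
      exact Finset.disjoint_left.1 (pp_mcell hh ha' haa _ _ c) h1 h2)
    (Clus (2*R*h) (2^R)) (fun A B hAB => Clus_mono hAB)
    (fun n A => Qf θ vec (mc ρ D R (Nn N u n)) nt (fun i : Fin nt => o1 (fun p => Real.log p / h) (A ∩ mcell h a a' (N (R+D)) i)) ≤
        K * Real.exp (-(a * θ * ∑ i : Ix D R, (Nn N u n (lev i) : ℝ))))
    ((Real.exp (-1) * (τ/80)) ^ (Fintype.card (Ix D R × Bool)) *
      (K ^ (-(1/θ)) * (Real.exp (-1) / 16 * Real.exp (-(a*u+a')))^(Fintype.card (Ix D R))))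
    (collC (UU (vec : Pa D R → Ix D R → ℝ)).card lam 0 ((2*Λ+2)/πm) (Module.finrank ℝ (Ix D R → ℝ)) R
      * Real.exp (a * θ * Fintype.card (Ix D R)) / K) (by positivity) ?_ ?_
  · refine hcomb.trans ?_
    apply EP_le_of_subset
    · intro p hp
      rcases Finset.mem_union.1 hp with hp | hp
      · obtain ⟨c, hc, h2⟩ := Finset.mem_biUnion.1 hp
        rw [Finset.mem_range] at hc
        unfold mcell at h2
        split_ifs at h2 with h3
        · refine PrI_subset ?_ ?_ h2
          · apply mul_le_mul_of_nonneg_left _ hh0.le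
            apply Real.exp_le_exp.2
            have : ((N (R+D):ℕ):ℝ) ≤ c := by exact_mod_cast h3
            nlinarith
          · apply mul_le_mul_of_nonneg_left _ hh0.le
            apply Real.exp_le_exp.2
            have : ((c:ℝ)+1) ≤ ((N 0+(T+2)*u:ℕ):ℝ) := by
              have : c + 1 ≤ N 0 + (T+2)*u := by
                have e : (T+2)*u = T*u+2*u := by ring
                omega
              exact_mod_cast this
            nlinarith
        · simp at h2
      · obtain ⟨n, hn, h2⟩ := Finset.mem_biUnion.1 hp
        rw [Finset.mem_range] at hn
        obtain ⟨i, s, hs, h1⟩ := hmem n p h2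
        have hle1 : N (R+D) ≤ ccn N u w0 M n i + s := by
          unfold ccn Nn
          have := hN (show lev i ≤ R + D by have := lev_lt i; omega)
          omega
        have hle2 : ccn N u w0 M n i + s + 1 ≤ N 0 + (T+2)*u := by
          unfold ccn Nn
          have := hN (Nat.zero_le (lev i))
          have e : (T+2)*u = T*u+2*u := by ring
          have m1 : (n+1)*u ≤ T*u := Nat.mul_le_mul_right u hn
          have e1 : (n+1)*u = n*u+u := by ring
          have h2 := Nat.mul_le_mul_left (2*M) (mix_lt i)
          have h3 : 2*M*(mix i+1) = 2*M*mix i + 2*M := by ring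
          simp only [Nat.succ_eq_add_one] at h2
          have : s ≤ M := by rcases hs with rfl | rfl <;> omega
          omega
        refine PrI_subset ?_ ?_ h1
        · apply mul_le_mul_of_nonneg_left _ hh0.le
          apply Real.exp_le_exp.2
          have : ((N (R+D):ℕ):ℝ) ≤ ((ccn N u w0 M n i + s : ℕ):ℝ) := by exact_mod_cast hle1
          nlinarith
        · apply mul_le_mul_of_nonneg_left _ hh0.le
          apply Real.exp_le_exp.2
          have : (((ccn N u w0 M n i + s : ℕ):ℝ)+1) ≤ ((N 0+(T+2)*u:ℕ):ℝ) := by exact_mod_cast hle2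
          nlinarith
    · intro A B hAB
      exact ind_mono (Clus_mono hAB)
  · intro n hn A hA hg
    refine trial_hit hh ha' haa hρ D R (Nn N u n) (hNn n) (N (R+D)) nt hθ hK hM0 hM hτ hhτ w0 u hw1 hw2 hw3
      (ccn N u w0 M n) ?_ ?_ ?_ ?_ ?_ A hA hg
    · intro i i' hii
      exact (hinj hn hn i i' (s := 0) (s' := 0) (Or.inl rfl) (Or.inl rfl) (by simpa using hii)).2.1
    · intro i j hij
      have := (hinj hn hn i j (s := M) (s' := 0) (Or.inr rfl) (Or.inl rfl) (by simpa using hij)).2.2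
      omega
    · intro i; unfold ccn; omega
    · intro i; unfold ccn
      have h2 := Nat.mul_le_mul_left (2*M) (mix_lt i).le
      omega
    · intro i i' hii
      unfold ccn Nn
      have := hgap _ _ hii (lev_lt i')
      have h2 := Nat.mul_le_mul_left (2*M) (mix_lt i').le
      have e : (T+2)*u = T*u+2*u := by ring
      omega
  · intro n hn
    refine trial_bad hh ha' haa hρ hρ1 D R (Nn N u n) (hNn n) (N (R+D)) nt hθ hθ1 hlam hμ hμa hL hπm hπm1 hπ0 ?_ hπ hθL ?_ ?_ hΛ0 hΛ hK
    · unfold Nn; omega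
    · intro j hj
      have := hnum n hn j hj
      unfold Nn
      push_cast
      simpa using this
    · unfold Nn
      have := Nat.mul_le_mul_right u hn.le
      omega
end
end FKT

open Filter Topology
open scoped Classical
namespace FKT

lemma exists_L0 {ρ : ℝ} (hρ : 0 < ρ) (D R : ℕ) : ∃ L0 : ℝ, 0 ≤ L0 ∧
    ∀ b, b ≤ R + D → ∀ p, mu ρ D R b p ≠ 0 → Real.exp (-L0) ≤ mu ρ D R b p := by
  refine ⟨∑ b ∈ Finset.range (R+D+1), ∑ p, |Real.log (mu ρ D R b p)|, by positivity, ?_⟩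
  intro b hb p hp
  have h0 : 0 < mu ρ D R b p := lt_of_le_of_ne (mu_nonneg hρ D R b p) (Ne.symm hp)
  rw [← Real.le_log_iff_exp_le h0]
  have h1 : |Real.log (mu ρ D R b p)| ≤ ∑ p, |Real.log (mu ρ D R b p)| :=
    Finset.single_le_sum (f := fun p => |Real.log (mu ρ D R b p)|) (fun _ _ => abs_nonneg _) (Finset.mem_univ p)
  have h2 : ∑ p, |Real.log (mu ρ D R b p)| ≤ ∑ b ∈ Finset.range (R+D+1), ∑ p, |Real.log (mu ρ D R b p)| :=
    Finset.single_le_sum (f := fun b => ∑ p, |Real.log (mu ρ D R b p)|) (fun _ _ => by positivity) (Finset.mem_range.2 (by omega))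
  have := neg_abs_le (Real.log (mu ρ D R b p))
  linarith

lemma exists_w0 {a : ℝ} (ha : 0 < a) (B : ℝ) : ∃ w0 : ℕ, B ≤ Real.exp (a*w0) := by
  obtain ⟨n, hn⟩ := exists_nat_ge (B/a)
  refine ⟨n, ?_⟩
  rw [div_le_iff₀ ha] at hn
  have := Real.add_one_le_exp (a*n)
  linarith

lemma clus_aux1 {a ζ t : ℝ} (ha : 0 < a) (hζ0 : 0 < ζ) (hζ1 : ζ ≤ 1/4) (haζ : a ≤ ζ/16) (ht : t ≤ a*ζ/16) (ht0 : 0 ≤ t) :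
    0 ≤ a*(1-ζ/4) - t ∧ a*(1-ζ/2) ≤ (a*(1-ζ/4) - t)*(1-(a*(1-ζ/4)+t)) := by
  have e : a*ζ ≤ a*(1/4) := mul_le_mul_of_nonneg_left hζ1 ha.le
  have e0 : 0 < a*ζ := mul_pos ha hζ0
  have h1 : 0 ≤ a*(1-ζ/4) - t := by linarith
  refine ⟨h1, ?_⟩
  have h2 : a*(1-5*ζ/16) ≤ a*(1-ζ/4) - t := by linarith
  have h3 : 1-ζ/8 ≤ 1 - (a*(1-ζ/4)+t) := by linarith
  have h4 := mul_le_mul h2 h3 (by linarith) h1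
  refine le_trans ?_ h4
  have : 0 ≤ a*ζ*ζ := by positivity
  linarith

lemma clus_aux2 {a ζ θ L0 : ℝ} (ha : 0 < a) (hζ0 : 0 < ζ) (hζ1 : ζ ≤ 1/4) (hθ : 0 < θ) (hθL : θ*L0/2 ≤ ζ/4) :
    θ*a*(1-ζ) ≤ a*(1-ζ/2)*θ*(1-θ*L0/2) := by
  have h0 : (1-ζ/2)*(1-ζ/4) ≤ (1-ζ/2)*(1-θ*L0/2) := mul_le_mul_of_nonneg_left (by linarith) (by linarith)
  have h1 : (1-ζ) ≤ (1-ζ/2)*(1-θ*L0/2) := by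
    have := mul_pos hζ0 hζ0
    linarith
  have := mul_le_mul_of_nonneg_left h1 (mul_pos hθ ha).le
  linarith

set_option maxHeartbeats 3000000 in
theorem cluster {ρ : ℝ} (hρ : 0 < ρ) (hρ1 : ρ < 1/3) {x δ : ℝ} (hx0 : 0 < x) (hx1 : x < 1) (D : ℕ) (hδ : 0 < δ)
    (hnum : 1 + δ ≤ (1 - x) * ∑ i ∈ Finset.range (D+1), x^i * et ρ D i) (R : ℕ) {ε1 : ℝ} (hε1 : 0 < ε1) :
    ∃ h0 K0 : ℝ, ∀ h, h0 ≤ h → ∀ K, K0 ≤ K →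
      1 - ε1 ≤ EP (PrI (h*Real.exp (x^(R+D+1)*K)) (h*Real.exp K)) (fun A => ind (Clus (2*R*h) (2^R) A)) := by
  wlog hδ1 : δ ≤ 1 generalizing δ
  · exact this one_pos (by linarith) le_rfl
  obtain ⟨L0, hL0, hL⟩ := exists_L0 hρ D R
  obtain ⟨Λ, hΛ0, hΛ⟩ := exists_funBd (DD (vec : Pa D R → Ix D R → ℝ)) (DD_finite _)
  set ζ := δ/4 with hζ
  have hζ0 : 0 < ζ := by positivity
  have hζ1 : ζ ≤ 1/4 := by rw [hζ]; linarith
  have hl2 : 0 < Real.log 2 := Real.log_pos (by norm_num)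
  have hl2' := Real.log_two_lt_d9
  obtain ⟨M, hM1⟩ := exists_nat_ge (16/ζ)
  have hMr : (0:ℝ) < M := lt_of_lt_of_le (by positivity) hM1
  have hM0 : 0 < M := by exact_mod_cast hMr
  set a := Real.log 2 / M with ha_def
  have ha : 0 < a := by positivity
  have hM : a*M = Real.log 2 := by rw [ha_def]; field_simp
  have haζ : a ≤ ζ/16 := by
    rw [ha_def, div_le_iff₀ hMr]
    rw [div_le_iff₀ hζ0] at hM1
    linarith
  set a' := a*(1-ζ/4) with ha'_def
  have ha' : 0 < a' := mul_pos ha (by linarith)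
  have haa : a' < a := by rw [ha'_def]; nlinarith
  set τ := Real.exp (a-a') - 1 with hτ
  have hτ0 : 0 < τ := by have := Real.add_one_lt_exp (x := a-a') (by linarith); linarith
  set θ := min 1 (ζ/(2*(L0+1))) with hθd
  have hθ : 0 < θ := lt_min one_pos (by positivity)
  have hθ1 : θ ≤ 1 := min_le_left _ _
  have hθL : θ*L0/2 ≤ ζ/4 := by
    have h1 : θ ≤ ζ/(2*(L0+1)) := min_le_right _ _
    rw [le_div_iff₀ (by positivity)] at h1
    nlinarith
  set μ0 := θ*a*(1-ζ) with hμ0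
  set lam := a*θ*δ/4 with hlam
  set πm := a*(1-ζ/2) with hπm
  have hπm0 : 0 < πm := mul_pos ha (by linarith)
  set C1 := collC (UU (vec : Pa D R → Ix D R → ℝ)).card lam 0 ((2*Λ+2)/πm) (Module.finrank ℝ (Ix D R → ℝ)) R
      * Real.exp (a * θ * Fintype.card (Ix D R)) with hC1
  set K1 := (4*|C1|+1)/ε1 with hK1
  have hK10 : 0 < K1 := by positivity
  obtain ⟨w0, hw0⟩ := exists_w0 ha (max (Real.exp a / (Real.exp a - 1) / (0.2*τ)) (max (4*R*Real.exp a/(0.1*τ)) (1/(0.1*τ))))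
  have hw1 : Real.exp a / (Real.exp a - 1) ≤ 0.2*τ*Real.exp (a*w0) := by
    have := (le_max_left _ _).trans hw0
    rwa [div_le_iff₀ (by positivity), mul_comm] at this
  have hw2 : 4*R*Real.exp a ≤ 0.1*τ*Real.exp (a*w0) := by
    have := ((le_max_left _ _).trans (le_max_right _ _)).trans hw0
    rw [div_le_iff₀ (by positivity)] at this
    linarith
  have hw3 : 1 ≤ 0.1*τ*Real.exp (a*w0) := by
    have := ((le_max_right _ _).trans (le_max_right _ _)).trans hw0
    rwa [div_le_iff₀ (by positivity), mul_comm] at this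
  set u := w0 + 2*M*Fintype.card (Ix D R) with hu
  set c1 := (Real.exp (-1) * (τ/80)) ^ (Fintype.card (Ix D R × Bool)) *
      (K1 ^ (-(1/θ)) * (Real.exp (-1) / 16 * Real.exp (-(a*u+a')))^(Fintype.card (Ix D R))) with hc1
  have hc10 : 0 < c1 := by positivity
  obtain ⟨T0, hT0⟩ := exists_nat_ge (2*(2/ε1)/c1)
  set T := T0+1 with hT
  have hTr : 2*(2/ε1)/c1 ≤ T := by rw [hT]; push_cast; linarith
  have hexpT : Real.exp (-(c1*T/2)) ≤ ε1/2 := by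
    rw [div_le_iff₀ hc10] at hTr
    have h1 := Real.add_one_le_exp (c1*T/2)
    rw [Real.exp_neg, inv_le_comm₀ (Real.exp_pos _) (by positivity), inv_div]
    linarith
  set S := ∑ i ∈ Finset.range (D+1), et ρ D i with hS
  have hS0 : 0 ≤ S := Finset.sum_nonneg fun i hi => et_nonneg hρ D i (by have := Finset.mem_range.1 hi; omega)
  set G : ℝ := (T+2)*u with hG
  have hG0 : 0 ≤ G := by positivity
  -- threshold for κ
  set κ0 := (G+1)/(x^(R+D)*(1-x)) + (2*(1+T*u)+S)*(4/δ)/x^R with hκ0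
  have hx1' : 0 < 1-x := by linarith
  refine ⟨max 100 (max (2000/τ) (400/(a*ζ))), max (κ0*a/x) (a*(1+G)/(1-x)), ?_⟩
  intro h hh K hK
  have hh100 : 100 ≤ h := (le_max_left _ _).trans hh
  have hhτ : 2000/τ ≤ h := ((le_max_left _ _).trans (le_max_right _ _)).trans hh
  have hha : 25/h ≤ a*ζ/16 := by
    have := ((le_max_right _ _).trans (le_max_right _ _)).trans hh
    rw [div_le_iff₀ (by positivity)] at this
    rw [div_le_div_iff₀ (by linarith) (by norm_num)]
    linarith
  set κ := x*K/a with hκ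
  have hκκ : κ0 ≤ κ := by
    have := (le_max_left _ _).trans hK
    rw [div_le_iff₀ hx0] at this
    rw [hκ, le_div_iff₀ ha]; linarith
  have hK2 : a*(1+G) ≤ (1-x)*K := by
    have := (le_max_right _ _).trans hK
    rw [div_le_iff₀ hx1'] at this; linarith
  have hκ1 : G+1 ≤ κ*(x^(R+D)*(1-x)) := by
    rw [← div_le_iff₀ (by positivity)]
    refine le_trans ?_ hκκ
    rw [hκ0]
    have : 0 ≤ (2*(1+T*u)+S)*(4/δ)/x^R := by positivity
    linarith
  have hκ2 : 2*(1+T*u)+S ≤ δ/4*(κ*x^R) := by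
    have h1 : (2*(1+T*u)+S)*(4/δ)/x^R ≤ κ := by
      refine le_trans ?_ hκκ
      rw [hκ0]
      have : 0 ≤ (G+1)/(x^(R+D)*(1-x)) := by positivity
      linarith
    rw [div_le_iff₀ (by positivity)] at h1
    have h2 : δ/4*((2*(1+T*u)+S)*(4/δ)) = 2*(1+T*u)+S := by field_simp
    rw [← h2]
    exact mul_le_mul_of_nonneg_left h1 (by positivity)
  have hκpos : 0 < κ := by
    by_contra hneg
    push Not at hneg
    have : κ*(x^(R+D)*(1-x)) ≤ 0 := mul_nonpos_of_nonpos_of_nonneg hneg (by positivity)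
    linarith
  set N : ℕ → ℕ := fun b => ⌈κ*x^b⌉₊ with hNdef
  have hxp : ∀ {b b' : ℕ}, b ≤ b' → x^b' ≤ x^b := fun hb => pow_le_pow_of_le_one hx0.le hx1.le hb
  have hN : Antitone N := fun b b' hb => Nat.ceil_mono (mul_le_mul_of_nonneg_left (hxp hb) hκpos.le)
  have hNl : ∀ b, κ*x^b ≤ N b := fun b => Nat.le_ceil _
  have hNu : ∀ b, (N b:ℝ) ≤ κ*x^b + 1 := fun b => (Nat.ceil_lt_add_one (by positivity)).le
  have q1 : 0 ≤ μ0 := by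
    rw [hμ0]; exact mul_nonneg (mul_nonneg hθ.le ha.le) (by linarith)
  have q2 : μ0 ≤ a*θ := by
    rw [hμ0, mul_comm θ a]; exact mul_le_of_le_one_right (mul_nonneg ha.le hθ.le) (by linarith)
  have q3 : πm ≤ 1 := by
    rw [hπm]; exact mul_le_one₀ (by linarith) (by linarith) (by linarith)
  have q4 : ∀ c, πm ≤ pi0 h a a' c := by
    intro c
    obtain ⟨h1, h4⟩ := clus_aux1 ha hζ0 hζ1 haζ hha (by positivity : 0 ≤ 25/h)
    refine le_trans ?_ (pi0_ge hh100 ha' haa c h1)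
    exact h4
  have q5 : μ0 ≤ πm*θ*(1-θ*L0/2) := clus_aux2 ha hζ0 hζ1 hθ hθL
  have hcore := cluster_core hh100 ha' haa hρ hρ1 D R N hN (θ := θ) (lam := lam) (μ0 := μ0) (L0 := L0) (Λ := Λ) (πm := πm) (K := K1)
    hθ hθ1 (by positivity) q1 q2 hL hπm0 q3 q4 q5 (by linarith) hΛ0 hΛ hK10 hM0 hM hτ hhτ w0 hw1 hw2 hw3 u T hu (by omega) ?_ ?_
  · rw [← hC1] at hcore
    have h1 : 2*(C1/K1) ≤ ε1/2 := by
      have e1 : C1/K1 ≤ |C1|/K1 := div_le_div_of_nonneg_right (le_abs_self _) hK10.le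
      have e2 : |C1|/K1 ≤ ε1/4 := by
        rw [div_le_iff₀ hK10, hK1]
        have : ε1/4*((4*|C1|+1)/ε1) = |C1|+1/4 := by field_simp
        linarith
      linarith
    refine le_trans (by linarith) (hcore.trans ?_)
    apply EP_le_of_subset
    · have hh0 : 0 ≤ h := by linarith
      apply PrI_subset
      · apply mul_le_mul_of_nonneg_left _ hh0
        apply Real.exp_le_exp.2
        have h2 := mul_le_mul_of_nonneg_left (hNl (R+D)) ha.le
        refine le_trans (le_of_eq ?_) h2
        rw [hκ]; field_simp; ring
      · apply mul_le_mul_of_nonneg_left _ hh0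
        apply Real.exp_le_exp.2
        have h2 := hNu 0
        have h3 : a*κ = x*K := by rw [hκ]; field_simp
        push_cast
        rw [← hG]
        have h4 := mul_le_mul_of_nonneg_left h2 ha.le
        rw [pow_zero] at h4
        linarith only [h4, h3, hK2]
    · intro A B hAB
      exact ind_mono (Clus_mono hAB)
  · intro j j' hjj hj'
    have h1 : κ*x^j' ≤ κ*x^j*x := by
      have : x^j' ≤ x^j*x := by rw [← pow_succ]; exact hxp hjj
      calc _ ≤ κ*(x^j*x) := mul_le_mul_of_nonneg_left this hκpos.le
        _ = _ := by ring
    have h2 : κ*(x^(R+D)*(1-x)) ≤ κ*(x^j*(1-x)) :=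
      mul_le_mul_of_nonneg_left (mul_le_mul_of_nonneg_right (hxp (by omega)) hx1'.le) hκpos.le
    have h3 : (N j':ℝ) + (T+2)*u ≤ N j := by
      have g1 := hNu j'
      have g2 := hNl j
      rw [← hG]
      linarith only [g1, g2, h1, h2, hκ1]
    exact_mod_cast h3
  · intro n hn j hj
    have hd : ∀ i, κ*x^j*(1-x)*x^i - 1 ≤ (N (j+i):ℝ) - N (j+i+1) := by
      intro i
      have h1 := hNl (j+i); have h2 := hNu (j+i+1)
      have : κ*x^j*(1-x)*x^i = κ*x^(j+i) - κ*x^(j+i+1) := by ring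
      linarith
    have h1 : κ*x^j*(1+δ) - S ≤ ∑ i ∈ Finset.range (D+1), et ρ D i * ((N (j+i) : ℝ) - N (j+i+1)) := by
      calc κ*x^j*(1+δ) - S ≤ κ*x^j*((1 - x) * ∑ i ∈ Finset.range (D+1), x^i * et ρ D i) - S := by
            have := mul_le_mul_of_nonneg_left hnum (show 0 ≤ κ*x^j by positivity); linarith
        _ = ∑ i ∈ Finset.range (D+1), et ρ D i * (κ*x^j*(1-x)*x^i - 1) := by
            rw [hS, ← mul_assoc, Finset.mul_sum, ← Finset.sum_sub_distrib]
            refine Finset.sum_congr rfl fun i _ => by ring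
        _ ≤ _ := Finset.sum_le_sum fun i hi => mul_le_mul_of_nonneg_left (hd i) (et_nonneg hρ D i (by have := Finset.mem_range.1 hi; omega))
    have h1ζ : 0 ≤ 1-ζ := by linarith
    refine le_trans ?_ (mul_le_mul_of_nonneg_left h1 (show 0 ≤ μ0 by rw [hμ0]; positivity))
    have hnT : (n:ℝ)*u ≤ T*u := by
      have : (n:ℝ) ≤ T := by exact_mod_cast hn.le
      gcongr
    have h2 : (N j:ℝ) + n*u ≤ κ*x^j + (1+T*u) := by have := hNu j; linarith
    have h3 : κ*x^R ≤ κ*x^j := mul_le_mul_of_nonneg_left (hxp hj.le) hκpos.le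
    set X := κ*x^j with hX
    have hX0 : 0 < X := by positivity
    have e1 : a*θ+lam = θ*a*(1+δ/4) := by rw [hlam]; ring
    rw [e1, hμ0, mul_assoc (θ*a), mul_assoc (θ*a)]
    apply mul_le_mul_of_nonneg_left _ (by positivity)
    have e2 : (1+δ/4)*((N j:ℝ) + n*u) ≤ (1+δ/4)*(X + (1+T*u)) := mul_le_mul_of_nonneg_left h2 (by positivity)
    refine e2.trans ?_
    have e3 : (1-ζ)*(1+δ) ≥ 1+δ/2 := by
      rw [hζ]
      have := mul_nonneg hδ.le (sub_nonneg.2 hδ1)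
      linarith only [this]
    have e4 : (1+δ/2)*X ≤ (1-ζ)*(1+δ)*X := mul_le_mul_of_nonneg_right e3 hX0.le
    have e5 : 2*(1+T*u)+S ≤ δ/4*X := hκ2.trans (mul_le_mul_of_nonneg_left h3 (by positivity))
    have e6 : (1+δ/4)*(1+T*u) ≤ 2*(1+(T:ℝ)*u) := mul_le_mul_of_nonneg_right (by linarith) (by positivity)
    have e7 : (1-ζ)*S ≤ S := by
      have := mul_nonneg hζ0.le hS0
      linarith only [this]
    linarith only [e4, e5, e6, e7]
end FKT

open Filter Topology
open scoped Classical
namespace FKT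

lemma Clus_mul {w w' : ℝ} {z z' : ℝ} (hz : 0 ≤ z) (hz' : 0 ≤ z') {A A' : Finset ℕ} (hd : Disjoint A A') (h1 : Clus w z A) (h2 : Clus w' z' A') :
    Clus (w+w') (z*z') (A ∪ A') := by
  obtain ⟨F, hF, hFA, v, hv⟩ := h1
  obtain ⟨F', hF', hFA', v', hv'⟩ := h2
  refine ⟨(F ×ˢ F').image (fun q => q.1 ∪ q.2), ?_, ?_, v+v', ?_⟩
  · rw [Finset.card_image_of_injOn, Finset.card_product]
    · push_cast; exact mul_le_mul hF hF' hz' (by positivity)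
    · rintro ⟨B, C⟩ hB ⟨B', C'⟩ hB' he
      simp only [Finset.coe_product, Set.mem_prod, Finset.mem_coe] at hB hB'
      simp only at he
      have k : ∀ B C, B ⊆ A → C ⊆ A' → (B ∪ C) ∩ A = B ∧ (B ∪ C) ∩ A' = C := by
        intro B C hB hC
        rw [Finset.disjoint_left] at hd
        constructor
        · ext t; simp only [Finset.mem_inter, Finset.mem_union]
          constructor
          · rintro ⟨h | h, h'⟩
            · exact h
            · exact absurd (hC h) (hd h')
          · intro h; exact ⟨Or.inl h, hB h⟩
        · ext t; simp only [Finset.mem_inter, Finset.mem_union]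
          constructor
          · rintro ⟨h | h, h'⟩
            · exact absurd h' (hd (hB h))
            · exact h
          · intro h; exact ⟨Or.inr h, hC h⟩
      have e1 := k B C (hFA _ hB.1) (hFA' _ hB.2)
      have e2 := k B' C' (hFA _ hB'.1) (hFA' _ hB'.2)
      rw [he] at e1
      exact Prod.ext (e1.1.symm.trans e2.1) (e1.2.symm.trans e2.2)
  · intro B hB
    obtain ⟨q, hq, rfl⟩ := Finset.mem_image.1 hB
    rw [Finset.mem_product] at hq
    exact Finset.union_subset_union (hFA _ hq.1) (hFA' _ hq.2)
  · intro B hB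
    obtain ⟨q, hq, rfl⟩ := Finset.mem_image.1 hB
    rw [Finset.mem_product] at hq
    rw [Finset.sum_union (Finset.disjoint_of_subset_left (hFA _ hq.1) (Finset.disjoint_of_subset_right (hFA' _ hq.2) hd))]
    have a1 := hv _ hq.1
    have a2 := hv' _ hq.2
    constructor <;> linarith [a1.1, a1.2, a2.1, a2.2]

lemma Clus_pigeon {h : ℝ} (hh : 0 < h) {W : ℕ} {z : ℝ} (hW : 0 < W) {A : Finset ℕ} (hc : Clus (W*h) z A) : Clus h (z/W) A := by
  obtain ⟨F, hF, hFA, v, hv⟩ := hc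
  set f : Finset ℕ → ℕ := fun B => min (W-1) ⌊(∑ p ∈ B, Real.log p - v)/h⌋₊ with hf
  have hmaps : ∀ B ∈ F, f B ∈ Finset.range W := by
    intro B hB
    rw [Finset.mem_range]
    have : f B ≤ W-1 := min_le_left _ _
    omega
  obtain ⟨i, hi, hcard⟩ := Finset.exists_le_card_fiber_of_nsmul_le_card_of_maps_to (M := ℝ) (b := z/W) hmaps
    (by simpa using hW.ne') (by
      have : (0:ℝ) < W := by exact_mod_cast hW
      rw [Finset.card_range, nsmul_eq_mul, mul_div_cancel₀ _ this.ne']; exact hF)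
  refine ⟨_, hcard, fun B hB => hFA B (Finset.mem_filter.1 hB).1, v + i*h, ?_⟩
  intro B hB
  obtain ⟨hB, hBi⟩ := Finset.mem_filter.1 hB
  have hvB := hv B hB
  set s := ∑ p ∈ B, Real.log p
  have hs0 : 0 ≤ (s-v)/h := div_nonneg (by linarith [hvB.1]) hh.le
  have e1 : (⌊(s-v)/h⌋₊:ℝ) ≤ (s-v)/h := Nat.floor_le hs0
  have e2 : (s-v)/h < ⌊(s-v)/h⌋₊ + 1 := Nat.lt_floor_add_one _
  rw [le_div_iff₀ hh] at e1
  rw [div_lt_iff₀ hh] at e2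
  have hi1 : i ≤ ⌊(s-v)/h⌋₊ := by rw [← hBi]; exact min_le_right _ _
  have hi1' : (i:ℝ) ≤ ⌊(s-v)/h⌋₊ := by exact_mod_cast hi1
  constructor
  · have := mul_le_mul_of_nonneg_right hi1' hh.le
    linarith
  · rcases le_total (W-1) ⌊(s-v)/h⌋₊ with hc | hc
    · have : i = W-1 := by rw [← hBi]; exact min_eq_left hc
      have : (i:ℝ)+1 = W := by
        have : i+1 = W := by omega
        exact_mod_cast this
      have h2 : (i:ℝ)*h + h = W*h := by rw [← this]; ring
      linarith [hvB.2]
    · have : i = ⌊(s-v)/h⌋₊ := by rw [← hBi]; exact min_eq_right hc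
      rw [← this] at e2
      linarith

lemma Clus_le {h z z' : ℝ} (hz : z' ≤ z) {A : Finset ℕ} (hc : Clus h z A) : Clus h z' A := by
  obtain ⟨F, hF, r⟩ := hc
  exact ⟨F, hz.trans hF, r⟩

lemma PrI_split {u w v : ℝ} (h1 : u ≤ w) (h2 : w ≤ v) : PrI u v = PrI u w ∪ PrI w v := by
  ext p
  simp only [Finset.mem_union, mem_PrI]
  constructor
  · rintro ⟨hp, a, b⟩
    rcases lt_or_ge (Real.log p) w with h | h
    · exact Or.inl ⟨hp, a, h⟩
    · exact Or.inr ⟨hp, h, b⟩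
  · rintro (⟨hp, a, b⟩ | ⟨hp, a, b⟩)
    · exact ⟨hp, a, lt_of_lt_of_le b h2⟩
    · exact ⟨hp, h1.trans a, b⟩

lemma chain {h β K0 ε1 : ℝ} (hh : 0 ≤ h) (hβ0 : 0 < β) (hβ1 : β ≤ 1) (hε : ε1 ≤ 1) {w z : ℝ} (hz : 0 ≤ z)
    (hK0 : 0 ≤ K0)
    (H : ∀ K, K0 ≤ K → 1 - ε1 ≤ EP (PrI (h*Real.exp (β*K)) (h*Real.exp K)) (fun A => ind (Clus w z A))) (L : ℝ) (J : ℕ)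
    (hJ : ∀ k < J, K0 ≤ β^k*L) (hL : 0 ≤ L) :
    (1-ε1)^J ≤ EP (PrI (h*Real.exp (β^J*L)) (h*Real.exp L)) (fun A => ind (Clus (J*w) (z^J) A)) := by
  induction J with
  | zero =>
    have : ∀ A : Finset ℕ, A ⊆ PrI (h*Real.exp (β^0*L)) (h*Real.exp L) → (1:ℝ) ≤ ind (Clus ((0:ℕ)*w) (z^0) A) := by
      intro A _
      rw [ind_of]
      refine ⟨{∅}, by simp, by simp, 0, ?_⟩
      simp
    have h2 := EP_mono this
    rw [EP_const] at h2
    simpa using h2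
  | succ J ih =>
    have ih := ih (fun k hk => hJ k (by omega))
    have h1 := H _ (hJ J (by omega))
    have hle : β*(β^J*L) ≤ β^J*L := mul_le_of_le_one_left (by positivity) hβ1
    have hle2 : β^J*L ≤ L := mul_le_of_le_one_left hL (pow_le_one₀ hβ0.le hβ1)
    have e : β^(J+1)*L = β*(β^J*L) := by ring
    rw [e]
    rw [PrI_split (w := h*Real.exp (β^J*L)) (by gcongr) (by gcongr), EP_union (PrI_disjoint le_rfl)]
    have hb0 : 0 ≤ 1-ε1 := by linarith
    calc (1-ε1)^(J+1) = (1-ε1)^J*(1-ε1) := pow_succ _ _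
      _ ≤ EP (PrI (h*Real.exp (β^J*L)) (h*Real.exp L)) (fun A => ind (Clus (J*w) (z^J) A)) *
          EP (PrI (h*Real.exp (β*(β^J*L))) (h*Real.exp (β^J*L))) (fun A => ind (Clus w z A)) :=
          mul_le_mul ih h1 hb0 (le_trans (by positivity) ih)
      _ = EP (PrI (h*Real.exp (β*(β^J*L))) (h*Real.exp (β^J*L))) (fun A =>
          EP (PrI (h*Real.exp (β^J*L)) (h*Real.exp L)) (fun B => ind (Clus w z A) * ind (Clus (J*w) (z^J) B))) := by
          rw [← EP_mul_left]
          refine EP_congr fun A _ => ?_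
          rw [EP_mul_left, mul_comm]
      _ ≤ _ := by
          refine EP_mono fun A hA => EP_mono fun B hB => ?_
          by_cases c1 : Clus w z A
          · by_cases c2 : Clus (J*w) (z^J) B
            · rw [ind_of c1, ind_of c2, ind_of]
              · norm_num
              have := Clus_mul hz (by positivity : 0 ≤ z^J) (Finset.disjoint_of_subset_left hA (Finset.disjoint_of_subset_right hB (PrI_disjoint le_rfl))) c1 c2
              convert this using 1
              · push_cast; ring
              · ring
            · rw [ind_of_not c2, mul_zero]; exact ind_nonneg _
          · rw [ind_of_not c1, zero_mul]; exact ind_nonneg _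
end FKT

open Filter Topology
open scoped Classical
namespace FKT

lemma exp_neg_le_half {t : ℝ} (h0 : 0 ≤ t) (h1 : t ≤ 1) : Real.exp (-t) ≤ 1 - t/2 := by
  have h := Real.add_one_le_exp t
  rw [Real.exp_neg, inv_le_comm₀ (Real.exp_pos _) (by linarith)]
  refine le_trans ?_ h
  rw [inv_le_comm₀ (by linarith) (by linarith), inv_le_iff_one_le_mul₀ (by linarith)]
  nlinarith

set_option maxHeartbeats 2000000 in
theorem manyclus (ρ : ℝ) (hρ0 : 0 < ρ) (hρ1 : ρ < 1/3)
    (a : ℕ → ℝ) (ha1 : a 1 = 2) (ha2 : a 2 = 2 + (2:ℝ) ^ ρ)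
    (harec : ∀ j : ℕ, 3 ≤ j → a j = a (j-1) ^ 2 + a (j-1) ^ ρ - a (j-2) ^ (2*ρ))
    (hlim : Filter.Tendsto (fun j : ℕ => (2:ℝ) ^ ((j:ℝ) - 2) / Real.log (a j))
      Filter.atTop (nhds (1 - ρ/2)))
    (ε : ℝ) (hε : 0 < ε) :
    ∃ c : ℝ, 0 < c ∧ ∃ h0 L0 : ℝ, ∀ h, h0 ≤ h → ∀ L, L0 ≤ L →
      c * L ^ (-ε) ≤ EP (PrI h (h*Real.exp L)) (fun A => ind (Clus h (c * L ^ (Real.log 2 / Real.log (2/ρ) - ε)) A)) := by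
  set l := Real.log (2/ρ) with hl
  have hl2 : 0 < Real.log 2 := Real.log_pos (by norm_num)
  have hl2l : Real.log 2 ≤ l := Real.log_le_log (by norm_num) (by rw [le_div_iff₀ hρ0]; linarith)
  have hl0 : 0 < l := by linarith
  set η := Real.log 2 / l with hη
  have hη0 : 0 < η := by positivity
  have hη1 : η ≤ 1 := (div_le_one hl0).2 hl2l
  have hηl : η*l = Real.log 2 := by rw [hη]; field_simp
  set κ := min (1/2) (ε/3) with hκ
  have hκ0 : 0 < κ := lt_min (by norm_num) (by positivity)
  have hκ1 : κ ≤ 1/2 := min_le_left _ _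
  have hκ2 : κ ≤ ε/3 := min_le_right _ _
  set x := Real.exp (-(l*(1+κ))) with hx
  have hx0 : 0 < x := Real.exp_pos _
  have hxρ : x < ρ/2 := by
    have : ρ/2 = Real.exp (-l) := by
      rw [Real.exp_neg, hl, Real.exp_log (by positivity), inv_div]
    rw [this, hx, Real.exp_lt_exp]
    have := mul_pos hl0 hκ0
    linarith
  obtain ⟨D, δ, hδ, hnum⟩ := numeric ρ hρ0 hρ1 a ha1 ha2 harec hlim x hx0 hxρ
  obtain ⟨R, hR⟩ := exists_nat_ge ((D+1)/κ)
  rw [div_le_iff₀ hκ0] at hR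
  have hR0 : (0:ℝ) < R := by
    have : (0:ℝ) < R*κ := lt_of_lt_of_le (by positivity) hR
    exact pos_of_mul_pos_left this hκ0.le
  have hRn : 0 < R := by exact_mod_cast hR0
  set b : ℝ := (R+D+1)*(l*(1+κ)) with hb
  have hb0 : 0 < b := by positivity
  have hβ : x^(R+D+1) = Real.exp (-b) := by
    rw [hx, ← Real.exp_nat_mul, hb]; congr 1; push_cast; ring
  set ε1 := min (1/2) (ε*b/2) with hε1
  have hε10 : 0 < ε1 := lt_min (by norm_num) (by positivity)
  have hε11 : ε1 ≤ 1/2 := min_le_left _ _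
  have hε12 : ε1 ≤ ε*b/2 := min_le_right _ _
  obtain ⟨h0, K0, hcl⟩ := cluster hρ0 hρ1 hx0 (by linarith) D hδ hnum R hε10
  set K := max K0 1 with hK
  have hK1 : 1 ≤ K := le_max_right _ _
  have hlK : 0 ≤ Real.log K := Real.log_nonneg hK1
  set E := (1-κ)*Real.log 2*R/b with hE
  have hE0 : 0 ≤ E := by
    have : 0 ≤ 1-κ := by linarith
    positivity
  have hEη : η-ε ≤ E := by
    have e1 : η*(1-κ)^2*b ≤ Real.log 2*R := by
      have g1 : η*b = (R+D+1)*(1+κ)*Real.log 2 := by rw [← hηl, hb]; ring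
      have g2 : (1-κ)*((R:ℝ)+D+1) ≤ R := by
        have : 0 ≤ κ*((D:ℝ)+1) := by positivity
        linarith
      have g3 : (1-κ)*(1+κ) ≤ 1 := by nlinarith
      calc η*(1-κ)^2*b = ((1-κ)*(1+κ))*(((1-κ)*((R:ℝ)+D+1))*Real.log 2) := by
            linear_combination (1-κ)^2*g1
        _ ≤ 1*((R:ℝ)*Real.log 2) := by
            apply mul_le_mul g3 (mul_le_mul_of_nonneg_right g2 hl2.le) _ (by norm_num)
            have : 0 ≤ 1-κ := by linarith
            positivity
        _ = _ := by ring
    have e2 : η*(1-κ)^3 ≤ E := by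
      rw [hE, le_div_iff₀ hb0]
      have := mul_le_mul_of_nonneg_left e1 (show 0 ≤ 1-κ by linarith)
      linarith
    have e3 : 1-3*κ ≤ (1-κ)^3 := by
      have : (1-κ)^3 = 1-3*κ+κ^2*(3-κ) := by ring
      have : 0 ≤ κ^2*(3-κ) := mul_nonneg (by positivity) (by linarith)
      linarith
    have e4 := mul_le_mul_of_nonneg_left e3 hη0.le
    have e5 : η*κ ≤ 1*κ := mul_le_mul_of_nonneg_right hη1 hκ0.le
    linarith
  set c1 := κ*Real.log 2/2*Real.exp (-(E*Real.log K) - Real.log 2*R) with hc1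
  have hc10 : 0 < c1 := by positivity
  refine ⟨min 1 c1, lt_min one_pos hc10, max h0 1, K*Real.exp b, ?_⟩
  intro h hh L hL
  have hh1 : 1 ≤ h := (le_max_right _ _).trans hh
  have hh0 : h0 ≤ h := (le_max_left _ _).trans hh
  have hL1 : 1 ≤ L := le_trans (by have := Real.one_le_exp hb0.le; nlinarith) hL
  have hL0 : 0 < L := by linarith
  have hlL : 0 ≤ Real.log L := Real.log_nonneg hL1
  set t := (Real.log L - Real.log K)/b with ht
  have hbt : b*t = Real.log L - Real.log K := by rw [ht]; field_simp
  have ht1 : 1 ≤ t := by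
    rw [ht, le_div_iff₀ hb0]
    have := Real.log_le_log (by positivity) hL
    rw [Real.log_mul (by positivity) (Real.exp_ne_zero _), Real.log_exp] at this
    linarith
  set J := ⌊t⌋₊ with hJ
  have hJ1 : (J:ℝ) ≤ t := Nat.floor_le (by linarith)
  have hJ2 : t < J+1 := Nat.lt_floor_add_one _
  have hJ0 : 0 < J := Nat.floor_pos.2 ht1
  have hJr : (0:ℝ) < J := by exact_mod_cast hJ0
  have hchain := chain (h := h) (β := x^(R+D+1)) (K0 := K) (ε1 := ε1) (w := 2*R*h) (z := 2^R) (by linarith) (by positivity)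
    (pow_le_one₀ hx0.le (by linarith)) (by linarith) (by positivity) (by linarith)
    (fun K' hK' => hcl h hh0 K' ((le_max_left _ _).trans hK')) L J (by
      intro k hk
      have hk' : (k:ℝ) ≤ J := by exact_mod_cast hk.le
      rw [hβ, ← Real.exp_nat_mul, ← Real.exp_log (show 0 < K by linarith)]
      nth_rw 1 [← Real.exp_log hL0]
      rw [← Real.exp_add, Real.exp_le_exp]
      have := mul_le_mul_of_nonneg_left (hk'.trans hJ1) hb0.le
      linarith) hL0.le
  have hp : min 1 c1 * L^(-ε) ≤ (1-ε1)^J := by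
    have q1 : min 1 c1 * L^(-ε) ≤ 1*L^(-ε) := mul_le_mul_of_nonneg_right (min_le_left _ _) (by positivity)
    refine q1.trans ?_
    have q2 : Real.exp (-(2*ε1)) ≤ 1-ε1 := by
      have := exp_neg_le_half (t := 2*ε1) (by linarith) (by linarith)
      linarith
    calc 1*L^(-ε) = Real.exp (-(ε*Real.log L)) := by rw [one_mul, Real.rpow_def_of_pos hL0]; congr 1; ring
      _ ≤ Real.exp (J*(-(2*ε1))) := by
          apply Real.exp_le_exp.2
          have r1 : J*(2*ε1) ≤ J*(ε*b) := mul_le_mul_of_nonneg_left (by linarith) hJr.le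
          have r2 : ε*b*J ≤ ε*b*t := mul_le_mul_of_nonneg_left hJ1 (by positivity)
          have r3 : ε*b*t = ε*Real.log L - ε*Real.log K := by rw [mul_assoc, hbt]; ring
          have r4 : 0 ≤ ε*Real.log K := by positivity
          linarith
      _ = Real.exp (-(2*ε1))^J := by rw [← Real.exp_nat_mul]
      _ ≤ _ := pow_le_pow_left₀ (Real.exp_pos _).le q2 J
  refine hp.trans (hchain.trans ?_)
  have hz : min 1 c1 * L^(η-ε) ≤ ((2:ℝ)^R)^J/((2*R*J:ℕ):ℝ) := by
    have q1 : min 1 c1 * L^(η-ε) ≤ c1*L^E := 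
      mul_le_mul (min_le_right _ _) (Real.rpow_le_rpow_of_exponent_le hL1 hEη) (by positivity) hc10.le
    refine q1.trans ?_
    have hn0 : (0:ℝ) < R*J := by positivity
    rw [le_div_iff₀ (by push_cast; positivity)]
    have q2 : ((2:ℝ)^R)^J = Real.exp (Real.log 2*(R*J)) := by
      rw [← pow_mul, ← Real.rpow_natCast, Real.rpow_def_of_pos (by norm_num)]; push_cast; rfl
    have q3 : κ*Real.log 2*(R*J) ≤ Real.exp (κ*Real.log 2*(R*J)) := by
      have := Real.add_one_le_exp (κ*Real.log 2*(R*J)); linarith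
    have q4 : Real.exp (-(E*Real.log K) - Real.log 2*R) * L^E ≤ Real.exp ((1-κ)*Real.log 2*(R*J)) := by
      rw [Real.rpow_def_of_pos hL0, ← Real.exp_add]
      apply Real.exp_le_exp.2
      have r0 : 0 ≤ (1-κ)*Real.log 2*R := by
        have : 0 ≤ 1-κ := by linarith
        positivity
      have r1 := mul_le_mul_of_nonneg_left hJ2.le r0
      have r2 : (1-κ)*Real.log 2*R*t = E*(Real.log L - Real.log K) := by rw [hE, ht]; ring
      have r3 : 0 ≤ κ*(Real.log 2*R) := by positivity
      linarith
    calc c1*L^E*((2*R*J:ℕ):ℝ) = (κ*Real.log 2*(R*J))*(Real.exp (-(E*Real.log K) - Real.log 2*R) * L^E) := by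
          rw [hc1]; push_cast; ring
      _ ≤ Real.exp (κ*Real.log 2*(R*J))*Real.exp ((1-κ)*Real.log 2*(R*J)) :=
          mul_le_mul q3 q4 (by positivity) (Real.exp_pos _).le
      _ = _ := by rw [q2, ← Real.exp_add]; congr 1; ring
  refine le_trans (EP_mono (ψ := fun A => ind (Clus h (min 1 c1 * L^(η-ε)) A)) fun A _ => ind_mono fun hc => ?_) (EP_le_of_subset ?_ ?_)
  · refine Clus_le hz (Clus_pigeon (by linarith) (by positivity) ?_)
    have e : ((2*R*J:ℕ):ℝ)*h = J*(2*R*h) := by push_cast; ring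
    rw [e]; exact hc
  · apply PrI_subset _ le_rfl
    have := Real.one_le_exp (show 0 ≤ (x^(R+D+1))^J*L by positivity)
    nlinarith
  · intro A B hAB
    exact ind_mono (Clus_mono hAB)
end FKT

open Filter Topology
open scoped Classical
namespace FKT

lemma EP_prod (P : Finset ℕ) (g : ℕ → ℝ) :
    EP P (fun A => ∏ p ∈ A, g p) = ∏ p ∈ P, (1+1/(p:ℝ))⁻¹ * (1 + g p/p) := by
  induction P using Finset.induction_on with
  | empty => simp [EP_empty]
  | insert q P hq ih =>
    rw [EP_insert hq, Finset.prod_insert hq, ← ih, ← EP_mul_left]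
    refine EP_congr fun A hA => ?_
    rw [Finset.prod_insert (fun h => hq (hA h))]
    ring

lemma EP_prod_le (P : Finset ℕ) (g : ℕ → ℝ) (hg : ∀ p, 1 ≤ g p) (hP : ∀ p ∈ P, 0 < p) :
    EP P (fun A => ∏ p ∈ A, g p) ≤ Real.exp (∑ p ∈ P, (g p - 1)/p) := by
  rw [EP_prod, Real.exp_sum]
  refine Finset.prod_le_prod (fun p _ => ?_) fun p hp => ?_
  · have := hg p; positivity
  · have h0 : (0:ℝ) < p := by exact_mod_cast hP p hp
    refine le_trans ?_ (Real.add_one_le_exp _)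
    rw [inv_mul_le_iff₀ (by positivity)]
    have h1 := hg p
    have : (1+1/(p:ℝ))*((g p - 1)/p+1) = 1 + g p/p + (g p - 1)/p*(1/p) := by field_simp; ring
    rw [this]
    have : 0 ≤ (g p - 1)/p*(1/(p:ℝ)) := mul_nonneg (div_nonneg (by linarith) h0.le) (by positivity)
    linarith

lemma sum_inv_sq (P : Finset ℕ) (hP : ∀ p ∈ P, 2 ≤ p) : ∑ p ∈ P, 1/(p:ℝ)^2 ≤ 1 := by
  obtain ⟨n, hn⟩ : ∃ n, ∀ p ∈ P, p < n := ⟨P.sup id + 1, fun p hp => Nat.lt_succ_of_le (Finset.le_sup (f := id) hp)⟩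
  have key : ∀ n : ℕ, ∑ p ∈ Finset.range n, 1/((p:ℝ)+2)^2 ≤ 1 - 1/((n:ℝ)+1) := by
    intro n
    induction n with
    | zero => simp
    | succ n ih =>
      rw [Finset.sum_range_succ]
      have : 1/((n:ℝ)+2)^2 ≤ 1/((n:ℝ)+1) - 1/((n:ℝ)+1+1) := by
        rw [div_sub_div _ _ (by positivity) (by positivity), div_le_div_iff₀ (by positivity) (by positivity)]
        nlinarith
      push_cast
      linarith
  have h1 : ∑ p ∈ P, 1/(p:ℝ)^2 ≤ ∑ p ∈ (Finset.range n).image (fun p : ℕ => (p+2 : ℕ)), 1/(p:ℝ)^2 := by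
    apply Finset.sum_le_sum_of_subset_of_nonneg
    · intro p hp
      rw [Finset.mem_image]
      have := hn p hp; have := hP p hp
      exact ⟨p-2, Finset.mem_range.2 (by omega), by omega⟩
    · intros; positivity
  rw [Finset.sum_image (by intro a _ b _ h; simpa using h)] at h1
  push_cast at h1
  have h2 := key n
  have : 0 ≤ 1/((n:ℝ)+1) := by positivity
  linarith

lemma EP_pow2_ge (P : Finset ℕ) (hP : ∀ p ∈ P, 2 ≤ p) :
    Real.exp (∑ p ∈ P, 1/(p:ℝ) - 2) ≤ EP P (fun A => ∏ p ∈ A, (2:ℝ)) := by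
  rw [EP_prod P (fun _ => 2)]
  have h1 := sum_inv_sq P hP
  refine le_trans (b := Real.exp (∑ p ∈ P, (1/(p:ℝ) - 2*(1/(p:ℝ)^2)))) ?_ ?_
  · rw [Finset.sum_sub_distrib, ← Finset.mul_sum]
    apply Real.exp_le_exp.2; linarith
  rw [Real.exp_sum]
  refine Finset.prod_le_prod (fun p _ => (Real.exp_pos _).le) fun p hp => ?_
  have h2 : (2:ℝ) ≤ p := by exact_mod_cast hP p hp
  have h0 : (0:ℝ) < p := by linarith
  have e1 : (1+1/(p:ℝ))⁻¹ * (1+2/p) = 1 + 1/(p+1) := by field_simp; ring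
  rw [e1]
  have h3 : Real.exp (-(1/(p:ℝ) - 2*(1/(p:ℝ)^2))) ≥ 1 - (1/(p:ℝ) - 2*(1/(p:ℝ)^2)) := by
    have := Real.add_one_le_exp (-(1/(p:ℝ) - 2*(1/(p:ℝ)^2))); linarith
  have h4 : (1 - (1/(p:ℝ) - 2*(1/(p:ℝ)^2))) * (1+1/((p:ℝ)+1)) ≥ 1 := by
    have : (1 - (1/(p:ℝ) - 2*(1/(p:ℝ)^2))) * (1+1/((p:ℝ)+1)) - 1 = 4/(p^2*(p+1)) := by field_simp; ring
    have : 0 ≤ 4/((p:ℝ)^2*(p+1)) := by positivity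
    linarith
  have h5 : 1 ≤ Real.exp (-(1/(p:ℝ) - 2*(1/(p:ℝ)^2))) * (1+1/((p:ℝ)+1)) :=
    h4.le.trans (mul_le_mul_of_nonneg_right h3 (by positivity))
  rw [Real.exp_neg, inv_mul_eq_div, le_div_iff₀ (Real.exp_pos _)] at h5
  linarith

lemma EP_sumlog (P : Finset ℕ) (f : ℕ → ℝ) (hf : ∀ p, 0 ≤ f p) :
    EP P (fun A => (∏ p ∈ A, (2:ℝ)) * ∑ p ∈ A, f p) ≤ EP P (fun A => ∏ p ∈ A, (2:ℝ)) * (2*∑ p ∈ P, f p/p) := by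
  induction P using Finset.induction_on with
  | empty => simp [EP_empty]
  | insert q P hq ih =>
    rw [EP_insert hq, EP_insert hq]
    set X := EP P (fun A => (∏ p ∈ A, (2:ℝ)) * ∑ p ∈ A, f p) with hX
    set Y := EP P (fun A => ∏ p ∈ A, (2:ℝ)) with hY
    have hY0 : 0 ≤ Y := EP_nonneg fun A _ => by positivity
    have e1 : EP P (fun A => (1+1/(q:ℝ))⁻¹ * ((∏ p ∈ A, (2:ℝ)) * ∑ p ∈ A, f p + 1/(q:ℝ) *
        ((∏ p ∈ insert q A, (2:ℝ)) * ∑ p ∈ insert q A, f p))) = (1+1/(q:ℝ))⁻¹*((1+2/q)*X + 2*f q/q*Y) := by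
      rw [hX, hY, ← EP_mul_left P (1+2/(q:ℝ)), ← EP_mul_left P (2*f q/q), ← EP_add, ← EP_mul_left P (1+1/(q:ℝ))⁻¹]
      refine EP_congr fun A hA => ?_
      have hqA : q ∉ A := fun h => hq (hA h)
      rw [Finset.prod_insert hqA, Finset.sum_insert hqA]
      ring
    have e2 : EP P (fun A => (1+1/(q:ℝ))⁻¹ * ((∏ p ∈ A, (2:ℝ)) + 1/(q:ℝ) * (∏ p ∈ insert q A, (2:ℝ))))
        = (1+1/(q:ℝ))⁻¹*((1+2/q)*Y) := by
      rw [hY, ← EP_mul_left P (1+2/(q:ℝ)), ← EP_mul_left P (1+1/(q:ℝ))⁻¹]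
      refine EP_congr fun A hA => ?_
      have hqA : q ∉ A := fun h => hq (hA h)
      rw [Finset.prod_insert hqA]
      ring
    rw [e1, e2, Finset.sum_insert hq, mul_assoc]
    apply mul_le_mul_of_nonneg_left _ (by positivity)
    have h1 : (1+2/(q:ℝ))*X ≤ (1+2/(q:ℝ))*(Y*(2*∑ p ∈ P, f p/p)) := mul_le_mul_of_nonneg_left ih (by positivity)
    have h2 : 0 ≤ 2/(q:ℝ)*(Y*(2*(f q/q))) := by have := hf q; positivity
    have h3 : 2*f q/q*Y = 2*(f q/q)*Y := by ring
    rw [h3]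
    linarith

/-- the abstract second-moment-free maximal argument -/
lemma fkt_abs (P I : Finset ℕ) (M U : ℕ → Finset ℕ → ℝ) (hM : ∀ j A, 0 < M j A) (hU1 : ∀ j A, U j A ≤ 1)
    (Y : Finset ℕ → ℝ) (hY0 : ∀ A, 0 ≤ Y A) (hY : ∀ j ∈ I, ∀ A, A ⊆ P → M j A * U j A ≤ Y A) {q s k : ℝ} (hk : 0 < k)
    (hq : ∀ j ∈ I, q ≤ EP P (fun A => M j A * U j A))
    (hs : ∀ j ∈ I, ∑ i ∈ I, EP P (fun A => Real.sqrt (M i A * M j A)) ≤ s) :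
    I.card * (q - s/k) ≤ k^2 * EP P Y := by
  have hpt : ∀ A, A ⊆ P → ∑ j ∈ I, (M j A * U j A - 1/k * ∑ i ∈ I, Real.sqrt (M i A * M j A)) ≤ k^2*Y A := by
    intro A hA
    rcases I.eq_empty_or_nonempty with rfl | hI
    · simp; have := hY0 A; positivity
    set S := ∑ i ∈ I, M i A with hS
    have hS0 : 0 < S := Finset.sum_pos (fun i _ => hM i A) hI
    have : ∀ j ∈ I, M j A * U j A - 1/k * ∑ i ∈ I, Real.sqrt (M i A * M j A) ≤ Y A * (k^2*M j A/S) := by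
      intro j hj
      have hs0 : 0 ≤ 1/k * ∑ i ∈ I, Real.sqrt (M i A * M j A) := by positivity
      have hMj := hM j A
      have hYA := hY0 A
      rcases le_or_gt S (k^2*M j A) with h | h
      · have h1 : 1 ≤ k^2*M j A/S := (one_le_div hS0).2 h
        have h2 := hY j hj A hA
        have h3 := mul_le_mul_of_nonneg_left h1 hYA
        linarith
      · have h1 : M j A * U j A ≤ M j A := mul_le_of_le_one_right hMj.le (hU1 j A)
        have h2 : k * M j A ≤ Real.sqrt (S * M j A) := by
          apply Real.le_sqrt_of_sq_le
          have := mul_le_mul_of_nonneg_right h.le hMj.le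
          linarith
        have h3 : Real.sqrt (S * M j A) ≤ ∑ i ∈ I, Real.sqrt (M i A * M j A) := by
          apply Real.sqrt_le_iff.2
          refine ⟨by positivity, ?_⟩
          calc S * M j A = ∑ i ∈ I, Real.sqrt (M i A * M j A)^2 := by
                rw [hS, Finset.sum_mul]
                refine Finset.sum_congr rfl fun i _ => ?_
                rw [Real.sq_sqrt (mul_pos (hM i A) hMj).le]
            _ ≤ _ := Finset.sum_sq_le_sq_sum_of_nonneg fun i _ => Real.sqrt_nonneg _
        have h4 : M j A ≤ 1/k * ∑ i ∈ I, Real.sqrt (M i A * M j A) := by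
          rw [one_div, le_inv_mul_iff₀ hk]; linarith
        have h5 : 0 ≤ Y A * (k^2*M j A/S) := by positivity
        linarith
    refine (Finset.sum_le_sum this).trans (le_of_eq ?_)
    rw [← Finset.mul_sum, ← Finset.sum_div, ← Finset.mul_sum, ← hS]
    field_simp
  have h1 := EP_mono hpt
  rw [EP_mul_left, EP_sum] at h1
  refine le_trans ?_ h1
  rw [← nsmul_eq_mul]
  apply Finset.card_nsmul_le_sum
  intro j hj
  rw [EP_sub, EP_mul_left, EP_sum]
  have h2 := hq j hj
  have h3 := hs j hj
  have h4 : 1/k * ∑ i ∈ I, EP P (fun A => Real.sqrt (M i A * M j A)) ≤ s/k := by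
    rw [div_mul_eq_mul_div, one_mul]; gcongr
  linarith
end FKT

open Filter Topology
open scoped Classical
namespace FKT

lemma Clus_wide {w w' z : ℝ} (hw : w ≤ w') {A : Finset ℕ} (hc : Clus w z A) : Clus w' z A := by
  obtain ⟨F, h1, h2, v, h3⟩ := hc
  exact ⟨F, h1, h2, v, fun B hB => ⟨(h3 B hB).1, (h3 B hB).2.trans (by linarith)⟩⟩

lemma Delta_ge {A : Finset ℕ} (hA : ∀ p ∈ A, p.Prime) {z : ℝ} (hc : Clus (1/2) z A) : z ≤ Delta (∏ p ∈ A, p) := by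
  obtain ⟨F, h1, h2, v, h3⟩ := hc
  refine h1.trans ?_
  unfold Delta DeltaV
  norm_cast
  have hmem : ∀ d : ℝ, (d ∈ (do let a ← (∏ p ∈ A, p).divisors; pure (a:ℝ) : Finset ℝ)) ↔ ∃ a ∈ (∏ p ∈ A, p).divisors, (a:ℝ) = d := by
    intro d
    simp [Finset.bind_def, Finset.mem_sup, eq_comm]
  set DD' : Finset ℝ := (do let a ← (∏ p ∈ A, p).divisors; pure (a:ℝ) : Finset ℝ) with hDD
  have hb : BddAbove (Set.range fun u : ℝ => (DD'.filter fun d => Real.exp u < d ∧ d ≤ Real.exp (u + 1)).card) :=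
    ⟨DD'.card, by rintro _ ⟨u, rfl⟩; exact Finset.card_filter_le _ _⟩
  refine le_trans ?_ (le_ciSup hb (v-1/4))
  have hinj : Set.InjOn (fun B : Finset ℕ => ((∏ p ∈ B, p : ℕ):ℝ)) F := by
    intro B hB C hC he
    have e1 := Nat.primeFactors_prod (fun p hp => hA p (h2 B hB hp))
    have e2 := Nat.primeFactors_prod (fun p hp => hA p (h2 C hC hp))
    have he : ∏ p ∈ B, p = ∏ p ∈ C, p := Nat.cast_injective (R := ℝ) he
    rw [← e1, ← e2, he]
  rw [← Finset.card_image_of_injOn hinj]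
  apply Finset.card_le_card
  intro d hd
  obtain ⟨B, hB, rfl⟩ := Finset.mem_image.1 hd
  have hBA := h2 B hB
  have hpos : ∀ p ∈ A, p ≠ 0 := fun p hp => (hA p hp).ne_zero
  rw [Finset.mem_filter, hmem]
  have hd0 : (0:ℝ) < ((∏ p ∈ B, p : ℕ):ℝ) := by
    have : 0 < ∏ p ∈ B, p := Finset.prod_pos fun p hp => (hA p (hBA hp)).pos
    exact_mod_cast this
  have hlog : Real.log ((∏ p ∈ B, p : ℕ):ℝ) = ∑ p ∈ B, Real.log p := by
    push_cast
    rw [Real.log_prod]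
    intro p hp
    exact_mod_cast hpos p (hBA hp)
  refine ⟨⟨_, Nat.mem_divisors.2 ⟨Finset.prod_dvd_prod_of_subset _ _ _ hBA, Finset.prod_ne_zero_iff.2 hpos⟩, rfl⟩, ?_, ?_⟩
  · rw [← Real.lt_log_iff_exp_lt hd0, hlog]
    have := (h3 B hB).1; linarith
  · rw [← Real.log_le_iff_le_exp hd0, hlog]
    have := (h3 B hB).2; linarith

lemma Delta_ge' {A : Finset ℕ} (hA : ∀ p ∈ A, p.Prime) {z w : ℝ} (hz : 0 ≤ z) (hw : 1 ≤ w) (hc : Clus w z A) :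
    z/(3*w) ≤ Delta (∏ p ∈ A, p) := by
  have h1 : 2*w ≤ ⌈2*w⌉₊ := Nat.le_ceil _
  have h2 : (⌈2*w⌉₊:ℝ) < 2*w+1 := Nat.ceil_lt_add_one (by linarith)
  have h0 : 0 < ⌈2*w⌉₊ := Nat.ceil_pos.2 (by linarith)
  refine le_trans ?_ (Delta_ge hA (Clus_pigeon (by norm_num) h0 (Clus_wide (w := w) (by linarith) hc)))
  apply div_le_div_of_nonneg_left hz (by linarith) (by linarith)

lemma sum_PrI0 {v : ℝ} (hv : 1 ≤ v) : ∑ p ∈ PrI 0 v, 1/(p:ℝ) ≤ Real.log v + 26 := by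
  rw [PrI_split zero_le_one hv, Finset.sum_union (PrI_disjoint le_rfl)]
  have h1 : ∑ p ∈ PrI 0 1, 1/(p:ℝ) ≤ ∑ p ∈ {2}, 1/((p:ℕ):ℝ) := by
    apply Finset.sum_le_sum_of_subset_of_nonneg
    · intro p hp
      obtain ⟨hp, _, h⟩ := mem_PrI.1 hp
      have h0 : (0:ℝ) < p := by exact_mod_cast hp.pos
      rw [Real.log_lt_iff_lt_exp h0] at h
      have h3 : (p:ℝ) < 3 := by have := Real.exp_one_lt_d9; linarith
      have h4 : p < 3 := by exact_mod_cast h3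
      have := hp.two_le
      rw [Finset.mem_singleton]; omega
    · intros; positivity
  rw [Finset.sum_singleton] at h1
  have h2 := (abs_le.1 (mertens2 le_rfl hv)).2
  rw [div_one] at h2
  norm_num at h1 h2
  have h3 : ∀ x, 1/(x:ℝ) = x⁻¹ := fun x => one_div x
  simp only [h3]
  linarith

noncomputable def gj (j : ℕ) (p : ℕ) : ℝ := if Real.log p < Real.exp j then 2 else 1
noncomputable def Mj (j : ℕ) (A : Finset ℕ) : ℝ := Real.exp (-j) * ∏ p ∈ A, gj j p
noncomputable def Uj (z : ℝ) (j : ℕ) (A : Finset ℕ) : ℝ :=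
  ind (∑ p ∈ A.filter (fun p : ℕ => Real.log p < Real.exp j), Real.log p ≤ 52*Real.exp j) *
    ind (Clus (Real.exp j) z (A.filter (fun p : ℕ => Real.exp j ≤ Real.log p)))

lemma gj_ge (j p) : 1 ≤ gj j p := by unfold gj; split_ifs <;> norm_num
lemma Mj_pos (j A) : 0 < Mj j A := mul_pos (Real.exp_pos _) (Finset.prod_pos fun p _ => by have := gj_ge j p; linarith)
lemma Mj_eq (j : ℕ) (A : Finset ℕ) : Mj j A = Real.exp (-j) * ∏ p ∈ A.filter (fun p : ℕ => Real.log p < Real.exp j), 2 := by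
  unfold Mj gj; rw [Finset.prod_filter]
lemma Uj_le (z j A) : Uj z j A ≤ 1 := mul_le_one₀ (ind_le_one _) (ind_nonneg _) (ind_le_one _)

lemma MU_le {z V : ℝ} (hz : 0 < z) (j : ℕ) {A : Finset ℕ} (hA : A ⊆ PrI 0 V) :
    Mj j A * Uj z j A ≤ 159/z * (Delta (∏ p ∈ A, p) : ℝ) := by
  have hR : 0 ≤ 159/z * (Delta (∏ p ∈ A, p) : ℝ) := by positivity
  unfold Uj
  set A1 := A.filter (fun p : ℕ => Real.log p < Real.exp j) with hA1
  set A2 := A.filter (fun p : ℕ => Real.exp j ≤ Real.log p) with hA2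
  by_cases c1 : ∑ p ∈ A1, Real.log p ≤ 52*Real.exp j
  swap
  · rw [ind_of_not c1]; simpa using hR
  by_cases c2 : Clus (Real.exp j) z A2
  swap
  · rw [ind_of_not c2]; simpa using hR
  rw [ind_of c1, ind_of c2, Mj_eq, mul_one, mul_one, ← hA1]
  have hl : ∀ p ∈ A, 0 ≤ Real.log (p:ℝ) := fun p hp => (mem_PrI.1 (hA hp)).2.1
  have k1 : Clus (52*Real.exp j) (∏ p ∈ A1, (2:ℝ)) A1 := by
    refine ⟨A1.powerset, ?_, fun B hB => Finset.mem_powerset.1 hB, 0, fun B hB => ?_⟩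
    · rw [Finset.prod_const, Finset.card_powerset]; push_cast; exact le_rfl
    · have hB := Finset.mem_powerset.1 hB
      have hf : ∀ p ∈ A1, 0 ≤ Real.log (p:ℝ) := fun p hp => hl p (Finset.mem_filter.1 hp).1
      refine ⟨Finset.sum_nonneg fun p hp => hf p (hB hp), ?_⟩
      have := Finset.sum_le_sum_of_subset_of_nonneg (f := fun p : ℕ => Real.log (p:ℝ)) hB (fun p hp _ => hf p hp)
      linarith
  have hd : Disjoint A1 A2 := by
    rw [Finset.disjoint_left]
    intro p h1 h2
    have := (Finset.mem_filter.1 h1).2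
    have := (Finset.mem_filter.1 h2).2
    linarith
  have hu : A1 ∪ A2 = A := by
    ext p; simp only [hA1, hA2, Finset.mem_union, Finset.mem_filter]
    constructor
    · rintro (h | h) <;> exact h.1
    · intro h
      rcases lt_or_ge (Real.log p) (Real.exp j) with h' | h'
      · exact Or.inl ⟨h, h'⟩
      · exact Or.inr ⟨h, h'⟩
  have k2 := Clus_mul (by positivity) hz.le hd k1 c2
  rw [hu] at k2
  have he : 1 ≤ Real.exp j := Real.one_le_exp (by positivity)
  have k3 := Delta_ge' (fun p hp => (mem_PrI.1 (hA hp)).1) (by positivity) (by linarith) k2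
  have e0 := Real.exp_pos j
  rw [div_le_iff₀ (by positivity)] at k3
  rw [Real.exp_neg, inv_mul_le_iff₀ e0, div_mul_eq_mul_div, mul_div_assoc', le_div_iff₀ hz]
  linarith

lemma EMU_ge {z V p : ℝ} (j : ℕ) (hV : Real.exp j ≤ V) (hp : 0 ≤ p)
    (hcl : p ≤ EP (PrI (Real.exp j) V) (fun A => ind (Clus (Real.exp j) z A))) :
    p * Real.exp (-27) / 2 ≤ EP (PrI 0 V) (fun A => Mj j A * Uj z j A) := by
  have e0 := Real.exp_pos j
  have he : 1 ≤ Real.exp j := Real.one_le_exp (by positivity)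
  rw [PrI_split e0.le hV, EP_union (PrI_disjoint le_rfl)]
  set X := EP (PrI 0 (Real.exp j)) (fun A => ∏ p ∈ A, (2:ℝ)) with hX
  have hX1 : Real.exp (j-27) ≤ X := by
    refine le_trans (Real.exp_le_exp.2 ?_) (EP_pow2_ge _ (fun p hp => (mem_PrI.1 hp).1.two_le))
    have h1 := (abs_le.1 (mertens2 le_rfl he)).1
    rw [div_one, div_one, Real.log_exp] at h1
    have h2 : ∑ p ∈ PrI 1 (Real.exp j), 1/(p:ℝ) ≤ ∑ p ∈ PrI 0 (Real.exp j), 1/(p:ℝ) :=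
      Finset.sum_le_sum_of_subset_of_nonneg (PrI_subset zero_le_one le_rfl) (by intros; positivity)
    linarith
  have hX0 : 0 ≤ X := (Real.exp_pos _).le.trans hX1
  have hT : X/2 ≤ EP (PrI 0 (Real.exp j)) (fun A => (∏ p ∈ A, (2:ℝ)) * ind (∑ p ∈ A, Real.log p ≤ 52*Real.exp j)) := by
    have h1 := EP_sumlog (PrI 0 (Real.exp j)) (fun p => Real.log (p:ℝ)) (fun p => Real.log_natCast_nonneg p)
    rw [← hX] at h1
    have h2 := mertens1_PrI he
    have h3 : X*(2*∑ p ∈ PrI 0 (Real.exp j), Real.log p/p) ≤ X*(2*(13*Real.exp j)) := by gcongr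
    have h4 : EP (PrI 0 (Real.exp j)) (fun A => (∏ p ∈ A, (2:ℝ)) - 1/(52*Real.exp j)*((∏ p ∈ A, (2:ℝ)) * ∑ p ∈ A, Real.log p)) ≤
        EP (PrI 0 (Real.exp j)) (fun A => (∏ p ∈ A, (2:ℝ)) * ind (∑ p ∈ A, Real.log p ≤ 52*Real.exp j)) := by
      refine EP_mono fun A _ => ?_
      have hg : 0 < ∏ p ∈ A, (2:ℝ) := by positivity
      have hs : 0 ≤ ∑ p ∈ A, Real.log (p:ℝ) := Finset.sum_nonneg fun p _ => Real.log_natCast_nonneg p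
      by_cases c : ∑ p ∈ A, Real.log (p:ℝ) ≤ 52*Real.exp j
      · rw [ind_of c]
        have : 0 ≤ 1/(52*Real.exp j)*((∏ p ∈ A, (2:ℝ)) * ∑ p ∈ A, Real.log p) := by positivity
        linarith
      · rw [ind_of_not c]
        push Not at c
        have : 1 ≤ 1/(52*Real.exp j) * ∑ p ∈ A, Real.log (p:ℝ) := by
          rw [one_div, le_inv_mul_iff₀ (by positivity)]; linarith
        have := mul_le_mul_of_nonneg_left this hg.le
        linarith
    rw [EP_sub, EP_mul_left, ← hX] at h4
    have h5 : 1/(52*Real.exp j)*EP (PrI 0 (Real.exp j)) (fun A => (∏ p ∈ A, (2:ℝ)) * ∑ p ∈ A, Real.log p) ≤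
        1/(52*Real.exp j)*(X*(2*(13*Real.exp j))) := mul_le_mul_of_nonneg_left (h1.trans h3) (by positivity)
    have h6 : 1/(52*Real.exp j)*(X*(2*(13*Real.exp j))) = X/2 := by field_simp; ring
    linarith
  have e1 : EP (PrI 0 (Real.exp j)) (fun A => EP (PrI (Real.exp j) V) (fun B => Mj j (A ∪ B) * Uj z j (A ∪ B))) =
      Real.exp (-j) * (EP (PrI 0 (Real.exp j)) (fun A => (∏ p ∈ A, (2:ℝ)) * ind (∑ p ∈ A, Real.log p ≤ 52*Real.exp j)) *
       EP (PrI (Real.exp j) V) (fun A => ind (Clus (Real.exp j) z A))) := by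
    rw [← EP_mul_right, ← EP_mul_left]
    refine EP_congr fun A hA => ?_
    rw [← EP_mul_left, ← EP_mul_left]
    refine EP_congr fun B hB => ?_
    have f1 : (A ∪ B).filter (fun p : ℕ => Real.log p < Real.exp j) = A := by
      ext p; simp only [Finset.mem_filter, Finset.mem_union]
      constructor
      · rintro ⟨h | h, h'⟩
        · exact h
        · have := (mem_PrI.1 (hB h)).2.1; linarith
      · intro h; exact ⟨Or.inl h, (mem_PrI.1 (hA h)).2.2⟩
    have f2 : (A ∪ B).filter (fun p : ℕ => Real.exp j ≤ Real.log p) = B := by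
      ext p; simp only [Finset.mem_filter, Finset.mem_union]
      constructor
      · rintro ⟨h | h, h'⟩
        · have := (mem_PrI.1 (hA h)).2.2; linarith
        · exact h
      · intro h; exact ⟨Or.inr h, (mem_PrI.1 (hB h)).2.1⟩
    unfold Uj
    rw [Mj_eq, f1, f2]
    ring
  rw [e1]
  have h7 : X/2*p ≤ EP (PrI 0 (Real.exp j)) (fun A => (∏ p ∈ A, (2:ℝ)) * ind (∑ p ∈ A, Real.log p ≤ 52*Real.exp j)) *
       EP (PrI (Real.exp j) V) (fun A => ind (Clus (Real.exp j) z A)) := mul_le_mul hT hcl hp (le_trans (by positivity) hT)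
  refine le_trans ?_ (mul_le_mul_of_nonneg_left h7 (Real.exp_pos _).le)
  have h8 : Real.exp (-27) ≤ Real.exp (-j)*X := by
    refine le_trans (le_of_eq ?_) (mul_le_mul_of_nonneg_left hX1 (Real.exp_pos _).le)
    rw [← Real.exp_add]; congr 1; ring
  have := mul_le_mul_of_nonneg_right h8 hp
  linarith
end FKT

open Filter Topology
open scoped Classical
namespace FKT

lemma sqrt_prod_aux (A : Finset ℕ) (f : ℕ → ℝ) (hf : ∀ p, 0 ≤ f p) :
    Real.sqrt (∏ p ∈ A, f p) = ∏ p ∈ A, Real.sqrt (f p) := by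
  induction A using Finset.induction_on with
  | empty => simp
  | insert q A hq ih => rw [Finset.prod_insert hq, Finset.prod_insert hq, Real.sqrt_mul (hf q), ih]

lemma sqrtMM_eq (i j : ℕ) (A : Finset ℕ) :
    Real.sqrt (Mj i A * Mj j A) = Real.exp (-((i:ℝ)+j)/2) * ∏ p ∈ A, Real.sqrt (gj i p * gj j p) := by
  have h0 : ∀ p, 0 ≤ gj i p * gj j p := fun p => by have := gj_ge i p; have := gj_ge j p; positivity
  rw [← sqrt_prod_aux A (fun p => gj i p * gj j p) h0, Finset.prod_mul_distrib]
  unfold Mj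
  have e : Real.exp (-(i:ℝ)) * (∏ p ∈ A, gj i p) * (Real.exp (-(j:ℝ)) * ∏ p ∈ A, gj j p) =
      Real.exp (-((i:ℝ)+j)/2)^2 * ((∏ p ∈ A, gj i p) * ∏ p ∈ A, gj j p) := by
    have : Real.exp (-((i:ℝ)+j)/2)^2 = Real.exp (-(i:ℝ)) * Real.exp (-(j:ℝ)) := by
      rw [← Real.exp_nat_mul, ← Real.exp_add]; congr 1; push_cast; ring
    rw [this]; ring
  rw [e, Real.sqrt_mul (by positivity), Real.sqrt_sq (Real.exp_pos _).le]

lemma sqrtMM_le {V : ℝ} (i j : ℕ) (hij : i ≤ j) (hV : Real.exp j ≤ V) :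
    EP (PrI 0 V) (fun A => Real.sqrt (Mj i A * Mj j A)) ≤ Real.exp 40 * Real.exp (-0.08)^(j-i) := by
  have hijr : (i:ℝ) ≤ j := by exact_mod_cast hij
  have h1 : EP (PrI 0 V) (fun A => Real.sqrt (Mj i A * Mj j A)) = Real.exp (-((i:ℝ)+j)/2) *
      EP (PrI 0 V) (fun A => ∏ p ∈ A, Real.sqrt (gj i p * gj j p)) := by
    rw [← EP_mul_left]
    exact EP_congr fun A _ => sqrtMM_eq i j A
  have h2 := EP_prod_le (PrI 0 V) (fun p => Real.sqrt (gj i p * gj j p)) (fun p => by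
    apply Real.le_sqrt_of_sq_le
    have := gj_ge i p; have := gj_ge j p; nlinarith) (fun p hp => (mem_PrI.1 hp).1.pos)
  have hei := Real.exp_pos i
  have hee : Real.exp i ≤ Real.exp j := Real.exp_le_exp.2 hijr
  have he1 : 1 ≤ Real.exp i := Real.one_le_exp (by positivity)
  have h3 : ∑ p ∈ PrI 0 V, (Real.sqrt (gj i p * gj j p) - 1)/(p:ℝ) ≤
      ∑ p ∈ PrI 0 (Real.exp i), 1/(p:ℝ) + 0.42 * ∑ p ∈ PrI (Real.exp i) (Real.exp j), 1/(p:ℝ) := by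
    rw [PrI_split (hei.le.trans hee) hV, Finset.sum_union (PrI_disjoint le_rfl),
      PrI_split hei.le hee, Finset.sum_union (PrI_disjoint le_rfl), Finset.mul_sum]
    have a1 : ∑ p ∈ PrI 0 (Real.exp i), (Real.sqrt (gj i p * gj j p) - 1)/(p:ℝ) ≤ ∑ p ∈ PrI 0 (Real.exp i), 1/(p:ℝ) := by
      refine Finset.sum_le_sum fun p hp => ?_
      have hp := (mem_PrI.1 hp).2.2
      have e1 : gj i p = 2 := if_pos hp
      have e2 : gj j p = 2 := if_pos (by linarith)
      rw [e1, e2, Real.sqrt_mul_self (by norm_num)]; norm_num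
    have a2 : ∑ p ∈ PrI (Real.exp i) (Real.exp j), (Real.sqrt (gj i p * gj j p) - 1)/(p:ℝ) ≤
        ∑ p ∈ PrI (Real.exp i) (Real.exp j), 0.42*(1/(p:ℝ)) := by
      refine Finset.sum_le_sum fun p hp => ?_
      have hp := (mem_PrI.1 hp).2
      have e1 : gj i p = 1 := if_neg (by linarith)
      have e2 : gj j p = 2 := if_pos hp.2
      rw [e1, e2, one_mul, mul_one_div]
      have : Real.sqrt 2 ≤ 1.42 := Real.sqrt_le_iff.2 ⟨by norm_num, by norm_num⟩
      apply div_le_div_of_nonneg_right _ (by positivity)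
      linarith
    have a3 : ∑ p ∈ PrI (Real.exp j) V, (Real.sqrt (gj i p * gj j p) - 1)/(p:ℝ) = 0 := by
      refine Finset.sum_eq_zero fun p hp => ?_
      have hp := (mem_PrI.1 hp).2.1
      have e1 : gj i p = 1 := if_neg (by linarith)
      have e2 : gj j p = 1 := if_neg (by linarith)
      rw [e1, e2]; simp
    linarith
  have h4 := sum_PrI0 he1
  rw [Real.log_exp] at h4
  have h5 := (abs_le.1 (mertens2 he1 hee)).2
  rw [← Real.exp_sub, Real.log_exp] at h5
  have h6 : 25/Real.exp i ≤ 25 := div_le_self (by norm_num) he1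
  have h7 : ∑ p ∈ PrI 0 V, (Real.sqrt (gj i p * gj j p) - 1)/(p:ℝ) ≤ i + 26 + 0.42*(j-i+25) := by linarith
  rw [h1]
  calc Real.exp (-((i:ℝ)+j)/2) * EP (PrI 0 V) (fun A => ∏ p ∈ A, Real.sqrt (gj i p * gj j p))
      ≤ Real.exp (-((i:ℝ)+j)/2) * Real.exp (i + 26 + 0.42*(j-i+25)) :=
        mul_le_mul_of_nonneg_left (h2.trans (Real.exp_le_exp.2 h7)) (Real.exp_pos _).le
    _ ≤ _ := by
        rw [← Real.exp_nat_mul, ← Real.exp_add, ← Real.exp_add]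
        apply Real.exp_le_exp.2
        push_cast [hij]
        linarith

lemma geo_half {r : ℝ} (h0 : 0 ≤ r) (h1 : r < 1) (I : Finset ℕ) (f : ℕ → ℕ) (hf : Set.InjOn f I) :
    ∑ i ∈ I, r^(f i) ≤ 1/(1-r) := by
  have := (summable_geometric_of_lt_one h0 h1).sum_le_tsum (I.image f) (fun _ _ => by positivity)
  rw [tsum_geometric_of_lt_one h0 h1, Finset.sum_image hf] at this
  rw [one_div]; exact this

lemma sumMM_le {V : ℝ} (I : Finset ℕ) (hI : ∀ i ∈ I, Real.exp i ≤ V) (j : ℕ) (hj : j ∈ I) :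
    ∑ i ∈ I, EP (PrI 0 V) (fun A => Real.sqrt (Mj i A * Mj j A)) ≤ 2*Real.exp 40/(1-Real.exp (-0.08)) := by
  set r := Real.exp (-0.08) with hr
  have hr0 : 0 ≤ r := (Real.exp_pos _).le
  have hr1 : r < 1 := by rw [hr, Real.exp_lt_one_iff]; norm_num
  rw [← Finset.sum_filter_add_sum_filter_not I (fun i => i ≤ j)]
  have a1 : ∑ i ∈ I.filter (fun i => i ≤ j), EP (PrI 0 V) (fun A => Real.sqrt (Mj i A * Mj j A)) ≤ Real.exp 40*(1/(1-r)) := by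
    refine le_trans (Finset.sum_le_sum (g := fun i => Real.exp 40 * r^(j-i)) fun i hi => ?_) ?_
    · exact sqrtMM_le i j (Finset.mem_filter.1 hi).2 (hI j hj)
    · rw [← Finset.mul_sum]
      apply mul_le_mul_of_nonneg_left _ (Real.exp_pos _).le
      apply geo_half hr0 hr1 _ (fun i => j-i)
      intro a ha b hb hab
      have := (Finset.mem_filter.1 (Finset.mem_coe.1 ha)).2
      have := (Finset.mem_filter.1 (Finset.mem_coe.1 hb)).2
      simp only at hab
      omega
  have a2 : ∑ i ∈ I.filter (fun i => ¬ i ≤ j), EP (PrI 0 V) (fun A => Real.sqrt (Mj i A * Mj j A)) ≤ Real.exp 40*(1/(1-r)) := by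
    refine le_trans (Finset.sum_le_sum (g := fun i => Real.exp 40 * r^(i-j)) fun i hi => ?_) ?_
    · have hi' := Finset.mem_filter.1 hi
      have := sqrtMM_le j i (by omega) (hI i hi'.1)
      refine le_trans (le_of_eq ?_) this
      exact EP_congr fun A _ => by rw [mul_comm]
    · rw [← Finset.mul_sum]
      apply mul_le_mul_of_nonneg_left _ (Real.exp_pos _).le
      apply geo_half hr0 hr1 _ (fun i => i-j)
      intro a ha b hb hab
      have := (Finset.mem_filter.1 (Finset.mem_coe.1 ha)).2
      have := (Finset.mem_filter.1 (Finset.mem_coe.1 hb)).2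
      simp only at hab
      omega
  have : 2*Real.exp 40/(1-r) = Real.exp 40*(1/(1-r)) + Real.exp 40*(1/(1-r)) := by ring
  rw [this]; linarith

theorem fkt : ∃ c : ℝ, 0 < c ∧ ∀ (V z p : ℝ) (I : Finset ℕ), 0 < z → 0 < p →
    (∀ j ∈ I, Real.exp j ≤ V ∧ p ≤ EP (PrI (Real.exp j) V) (fun A => ind (Clus (Real.exp j) z A))) →
    c * (z * p^3 * I.card) ≤ EP (PrI 0 V) (fun A => (Delta (∏ q ∈ A, q) : ℝ)) := by
  set s := 2*Real.exp 40/(1-Real.exp (-0.08)) with hs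
  have hs0 : 0 < s := by
    have : Real.exp (-0.08) < 1 := by rw [Real.exp_lt_one_iff]; norm_num
    apply div_pos (by positivity); linarith
  set m := Real.exp (-27) with hm
  have hm0 : 0 < m := Real.exp_pos _
  refine ⟨m^3/(64*159*s^2), by positivity, ?_⟩
  intro V z p I hz hp hI
  have key := fkt_abs (PrI 0 V) I Mj (Uj z) Mj_pos (fun j A => Uj_le z j A)
    (fun A => 159/z * (Delta (∏ p ∈ A, p) : ℝ)) (fun A => by positivity) (fun j hj A hA => MU_le hz j hA)
    (q := p*m/2) (s := s) (k := 4*s/(p*m)) (by positivity)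
    (fun j hj => EMU_ge j (hI j hj).1 hp.le (hI j hj).2)
    (fun j hj => sumMM_le I (fun i hi => (hI i hi).1) j hj)
  rw [EP_mul_left] at key
  set E := EP (PrI 0 V) (fun A => (Delta (∏ q ∈ A, q) : ℝ)) with hE
  have e1 : p*m/2 - s/(4*s/(p*m)) = p*m/4 := by field_simp; norm_num
  have e2 : (4*s/(p*m))^2*(159/z*E) = E * (16*159*s^2/(p^2*m^2*z)) := by field_simp; ring
  rw [e1, e2] at key
  have h3 := mul_le_mul_of_nonneg_right key (show 0 ≤ p^2*m^2*z/(16*159*s^2) by positivity)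
  have e3 : E * (16*159*s^2/(p^2*m^2*z)) * (p^2*m^2*z/(16*159*s^2)) = E := by field_simp
  rw [e3] at h3
  refine le_trans (le_of_eq ?_) h3
  field_simp
  ring
end FKT

open Filter Topology
open scoped Classical
namespace FKT

lemma EP_link {x : ℝ} (hx : 1 < x) :
    primeProd 1 x * ∑ᶠ n ∈ Sset 1 x, (Delta n : ℝ) / n = EP (PrI 0 (Real.log x)) (fun A => (Delta (∏ q ∈ A, q) : ℝ)) := by
  have hP : ∀ p : ℕ, p ∈ PrI 0 (Real.log x) ↔ p.Prime ∧ (p:ℝ) < x := by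
    intro p
    rw [mem_PrI]
    constructor
    · rintro ⟨hp, _, h⟩
      exact ⟨hp, (Real.log_lt_log_iff (by exact_mod_cast hp.pos) (by linarith)).1 h⟩
    · rintro ⟨hp, h⟩
      exact ⟨hp, Real.log_natCast_nonneg p, Real.log_lt_log (by exact_mod_cast hp.pos) h⟩
  have h1 : primeProd 1 x = nrm (PrI 0 (Real.log x)) := by
    unfold primeProd nrm
    have : {p : ℕ | p.Prime ∧ (1:ℝ) ≤ (p : ℝ) ∧ (p : ℝ) < x} = ↑(PrI 0 (Real.log x)) := by
      ext p
      rw [Finset.mem_coe, hP]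
      constructor
      · rintro ⟨a, b, c⟩; exact ⟨a, c⟩
      · rintro ⟨a, c⟩; exact ⟨a, by exact_mod_cast a.one_lt.le, c⟩
    rw [this, finprod_mem_coe_finset]
  have hpr : ∀ A ∈ (PrI 0 (Real.log x)).powerset, ∀ p ∈ A, p.Prime := fun A hA p hp =>
    ((hP p).1 (Finset.mem_powerset.1 hA hp)).1
  have h2 : Sset 1 x = ↑((PrI 0 (Real.log x)).powerset.image (fun A => ∏ q ∈ A, q)) := by
    ext n
    rw [Finset.mem_coe, Finset.mem_image]
    constructor
    · rintro ⟨hn, hsq, hp⟩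
      refine ⟨n.primeFactors, ?_, Nat.prod_primeFactors_of_squarefree hsq⟩
      rw [Finset.mem_powerset]
      intro p hpn
      exact (hP p).2 ⟨Nat.prime_of_mem_primeFactors hpn, (hp p hpn).2⟩
    · rintro ⟨A, hA, rfl⟩
      have hA' := hpr A hA
      refine ⟨Finset.prod_pos fun p hp => (hA' p hp).pos, ?_, ?_⟩
      · exact Finset.squarefree_prod_of_pairwise_isCoprime
          (fun p hp q hq hpq => Nat.coprime_iff_isRelPrime.1 ((Nat.coprime_primes (hA' p hp) (hA' q hq)).2 hpq))
          (fun p hp => (hA' p hp).prime.squarefree)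
      · intro p hp
        rw [Nat.primeFactors_prod hA'] at hp
        have := (hP p).1 (Finset.mem_powerset.1 hA hp)
        exact ⟨by exact_mod_cast this.1.one_lt.le, this.2⟩
  have h3 : ∑ᶠ n ∈ Sset 1 x, (Delta n : ℝ) / n = ∑ A ∈ (PrI 0 (Real.log x)).powerset, wt1 A * (Delta (∏ q ∈ A, q) : ℝ) := by
    rw [h2, finsum_mem_coe_finset, Finset.sum_image]
    · refine Finset.sum_congr rfl fun A hA => ?_
      unfold wt1
      push_cast
      rw [Finset.prod_div_distrib, Finset.prod_const_one]
      ring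
    · intro A hA B hB he
      have e1 := Nat.primeFactors_prod (hpr A hA)
      have e2 := Nat.primeFactors_prod (hpr B hB)
      simp only at he
      rw [← e1, ← e2, he]
  rw [h1, h3]; rfl

theorem final (ρ : ℝ) (hρ0 : 0 < ρ) (hρ1 : ρ < 1/3)
    (a : ℕ → ℝ) (ha1 : a 1 = 2) (ha2 : a 2 = 2 + (2:ℝ) ^ ρ)
    (harec : ∀ j : ℕ, 3 ≤ j → a j = a (j-1) ^ 2 + a (j-1) ^ ρ - a (j-2) ^ (2*ρ))
    (hlim : Filter.Tendsto (fun j : ℕ => (2:ℝ) ^ ((j:ℝ) - 2) / Real.log (a j))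
      Filter.atTop (nhds (1 - ρ/2)))
    (ε : ℝ) (hε : 0 < ε) :
    ∃ c : ℝ, 0 < c ∧ ∃ x₀ : ℝ, ∀ x : ℝ, x₀ ≤ x →
      c * LLog2 x ^ (1 + Real.log 2 / Real.log (2/ρ) - ε)
        ≤ primeProd 1 x * ∑ᶠ n ∈ Sset 1 x, (Delta n : ℝ) / n := by
  obtain ⟨c, hc, h0, L0, hcl⟩ := manyclus ρ hρ0 hρ1 a ha1 ha2 harec hlim (ε/4) (by positivity)
  obtain ⟨cF, hcF, hF⟩ := fkt
  set η := Real.log 2 / Real.log (2/ρ) with hη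
  obtain ⟨j0, hj0⟩ := exists_nat_ge h0
  set e := 1+η-ε with he
  set L1 := max (max 1 (2*L0)) (4*(1+j0)) with hL1
  refine ⟨cF*(c^4/2)/2^e, by positivity, Real.exp (Real.exp L1), ?_⟩
  intro x hx
  have hL11 : 1 ≤ L1 := (le_max_left _ _).trans (le_max_left _ _)
  have hx0 : 0 < x := (Real.exp_pos _).trans_le hx
  have hV : Real.exp L1 ≤ Real.log x := by rwa [Real.le_log_iff_exp_le hx0]
  have hV0 : 0 < Real.log x := (Real.exp_pos _).trans_le hV
  have hLL : L1 ≤ Real.log (Real.log x) := by rwa [Real.le_log_iff_exp_le hV0]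
  have hx1 : 1 < x := by
    by_contra h
    push Not at h
    have := Real.log_nonpos hx0.le h
    linarith
  have hV1 : 1 ≤ Real.log x := le_trans (Real.one_le_exp (by linarith)) hV
  rw [EP_link hx1]
  have hLd : LLog2 x = Real.log (Real.log x) := by
    unfold LLog2 LLog
    rw [max_eq_right hV1, max_eq_right (by linarith)]
  rw [hLd]
  set L := Real.log (Real.log x) with hL
  set V := Real.log x with hVd
  have hLe : Real.exp L = V := Real.exp_log hV0
  have hL1' : 1 ≤ L := hL11.trans hLL
  have hL2 : L0 ≤ L/2 := by
    have : 2*L0 ≤ L := ((le_max_right _ _).trans (le_max_left _ _)).trans hLL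
    linarith
  have hL4 : 4*(1+(j0:ℝ)) ≤ L := (le_max_right _ _).trans hLL
  set X := L/2 with hX
  have hX0 : 0 < X := by positivity
  set I := Finset.Ico j0 ⌊X⌋₊ with hI
  have hcard : X/2 ≤ I.card := by
    rw [hI, Nat.card_Ico]
    have h1 : X < ⌊X⌋₊ + 1 := Nat.lt_floor_add_one _
    have h2 : j0 ≤ ⌊X⌋₊ := by
      rw [Nat.le_floor_iff hX0.le, hX]; linarith
    rw [Nat.cast_sub h2]
    linarith
  have key := hF V (c*X^(η-ε/4)) (c*X^(-(ε/4))) I (by positivity) (by positivity) (by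
    intro j hj
    obtain ⟨hj1, hj2⟩ := Finset.mem_Ico.1 hj
    have hjX : (j:ℝ) ≤ X := by
      rw [← Nat.le_floor_iff hX0.le]; exact hj2.le
    have hjj : (j0:ℝ) ≤ j := by exact_mod_cast hj1
    have hjV : Real.exp j * Real.exp X ≤ V := by
      rw [← Real.exp_add, ← hLe]
      apply Real.exp_le_exp.2
      linarith
    have hX1 : 1 ≤ Real.exp X := Real.one_le_exp hX0.le
    refine ⟨le_trans (by nlinarith [Real.exp_pos j]) hjV, ?_⟩
    have h1 := hcl (Real.exp j) (by have := Real.add_one_le_exp (j:ℝ); linarith) X hL2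
    refine h1.trans (EP_le_of_subset (PrI_subset le_rfl hjV) ?_)
    intro A B hAB
    exact ind_mono (Clus_mono hAB))
  refine le_trans ?_ key
  have e1 : cF*(c^4/2)/2^e*L^e = cF*(c^4/2*X^e) := by
    rw [hX, Real.div_rpow (by linarith) (by norm_num)]; ring
  rw [e1]
  apply mul_le_mul_of_nonneg_left _ hcF.le
  have e2 : X^e = X^(η-ε/4)*(X^(-(ε/4)))^3*X := by
    rw [← Real.rpow_natCast (X^(-(ε/4))) 3, ← Real.rpow_mul hX0.le, ← Real.rpow_add hX0]
    nth_rw 3 [← Real.rpow_one X]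
    rw [← Real.rpow_add hX0]
    congr 1; push_cast; ring
  rw [e2]
  have h5 := mul_le_mul_of_nonneg_left hcard (show 0 ≤ c*X^(η-ε/4)*(c*X^(-(ε/4)))^3 by positivity)
  refine le_trans (le_of_eq ?_) h5
  ring
end FKT

theorem statement1 (ρ : ℝ) (hρ0 : 0 < ρ) (hρ1 : ρ < 1/3)
    (a : ℕ → ℝ) (ha1 : a 1 = 2) (ha2 : a 2 = 2 + (2:ℝ) ^ ρ)
    (harec : ∀ j : ℕ, 3 ≤ j → a j = a (j-1) ^ 2 + a (j-1) ^ ρ - a (j-2) ^ (2*ρ))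
    (hlim : Filter.Tendsto (fun j : ℕ => (2:ℝ) ^ ((j:ℝ) - 2) / Real.log (a j))
      Filter.atTop (nhds (1 - ρ/2)))
    (ε : ℝ) (hε : 0 < ε) :
    ∃ c : ℝ, 0 < c ∧ ∃ x₀ : ℝ, ∀ x : ℝ, x₀ ≤ x →
      c * LLog2 x ^ (1 + Real.log 2 / Real.log (2/ρ) - ε)
        ≤ primeProd 1 x * ∑ᶠ n ∈ Sset 1 x, (Delta n : ℝ) / n := by
  exact FKT.final ρ hρ0 hρ1 a ha1 ha2 harec hlim ε hε
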